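/- Let Q ≥ 2 and let Z be an Ahlfors Q-regular metric space homeomorphic to the 2-sphere S². If Z is Q-Loewner, then Q = 2 and Z is quasisymmetrically homeomorphic to the standard sphere S². -/

import Mathlib

open MeasureTheory
open scoped ENNReal

/-- A continuum: a compact connected set with more than one point. -/
def IsContinuum {Z : Type*} [MetricSpace Z] (E : Set Z) : Prop :=
  IsCompact E ∧ IsConnected E ∧ E.Nontrivial

/-- The distance between two subsets of a metric space. -/
noncomputable def setDist {Z : Type*} [MetricSpace Z] (E F : Set Z) : ℝ :=
  sInf (Set.image2 dist E F)

/-- The relative distance `Δ(E,F) = dist(E,F)/min(diam E, diam F)`. -/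
noncomputable def relDelta {Z : Type*} [MetricSpace Z] (E F : Set Z) : ℝ :=
  setDist E F / min (Metric.diam E) (Metric.diam F)

/-- `μ` is Ahlfors `Q`-regular with constant `C`. -/
def AhlforsRegular {Z : Type*} [MetricSpace Z] [MeasurableSpace Z]
    (μ : Measure Z) (Q C : ℝ) : Prop :=
  ∀ (a : Z) (R : ℝ), 0 < R → R ≤ Metric.diam (Set.univ : Set Z) →
    ENNReal.ofReal (C⁻¹ * R ^ Q) ≤ μ (Metric.ball a R) ∧
      μ (Metric.ball a R) ≤ ENNReal.ofReal (C * R ^ Q)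

/-- A rectifiable curve in arclength parametrization: a `1`-Lipschitz map on `[0,L]`. -/
structure Curve (Z : Type*) [MetricSpace Z] where
  L : ℝ
  toFun : ℝ → Z
  L_nonneg : 0 ≤ L
  lip : LipschitzOnWith 1 toFun (Set.Icc 0 L)

/-- The line integral `∫_γ ρ ds` of a density along a curve. -/
noncomputable def Curve.lineIntegral {Z : Type*} [MetricSpace Z]
    (c : Curve Z) (ρ : Z → ℝ≥0∞) : ℝ≥0∞ :=
  ∫⁻ t in Set.Icc (0:ℝ) c.L, ρ (c.toFun t)

/-- The `Q`-modulus of a family of curves: `inf ∫ ρ^Q dμ` over Borel densities `ρ`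
with `∫_γ ρ ds ≥ 1` for every curve of the family. -/
noncomputable def ModFam {Z : Type*} [MetricSpace Z] [MeasurableSpace Z]
    (μ : Measure Z) (Q : ℝ) (Γ : Set (Curve Z)) : ℝ≥0∞ :=
  ⨅ (ρ : Z → ℝ≥0∞) (_ : Measurable ρ) (_ : ∀ c ∈ Γ, 1 ≤ c.lineIntegral ρ),
    ∫⁻ z, ρ z ^ Q ∂μ

/-- The family of curves joining `E` to `F`. -/
def curvesJoining {Z : Type*} [MetricSpace Z] (E F : Set Z) : Set (Curve Z) :=
  {c | c.toFun 0 ∈ E ∧ c.toFun c.L ∈ F}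

/-- The image family `f(Γ)`: the curves that are (monotone) reparametrizations of `f ∘ γ`
for `γ ∈ Γ`. -/
def imageFam {X Y : Type*} [MetricSpace X] [MetricSpace Y]
    (f : X → Y) (Γ : Set (Curve X)) : Set (Curve Y) :=
  {c' | ∃ c ∈ Γ, ∃ φ : ℝ → ℝ, MonotoneOn φ (Set.Icc 0 c.L) ∧ φ 0 = 0 ∧ φ c.L = c'.L ∧
    ∀ t ∈ Set.Icc 0 c.L, c'.toFun (φ t) = f (c.toFun t)}

/-- `Z` (with measure `μ`) is `Q`-Loewner with function `Ψ`: `Z` is rectifiably connected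
and `Mod_Q(E,F) ≥ Ψ(Δ(E,F))` for all disjoint continua `E, F`. -/
def IsLoewnerWith {Z : Type*} [MetricSpace Z] [MeasurableSpace Z]
    (μ : Measure Z) (Q : ℝ) (Ψ : ℝ → ℝ) : Prop :=
  (∀ x y : Z, ∃ c : Curve Z, c.toFun 0 = x ∧ c.toFun c.L = y) ∧
  ∀ E F : Set Z, IsContinuum E → IsContinuum F → Disjoint E F →
    ENNReal.ofReal (Ψ (relDelta E F)) ≤ ModFam μ Q (curvesJoining E F)

/-- `Z` is `λ`-LLC. -/
def IsLLC (Z : Type*) [MetricSpace Z] (lam : ℝ) : Prop :=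
  (∀ (a : Z) (r : ℝ), ∀ x ∈ Metric.ball a r, ∀ y ∈ Metric.ball a r,
      ∃ E : Set Z, IsContinuum E ∧ E ⊆ Metric.ball a (lam * r) ∧ x ∈ E ∧ y ∈ E) ∧
  (∀ (a : Z) (r : ℝ), ∀ x ∉ Metric.ball a r, ∀ y ∉ Metric.ball a r,
      ∃ E : Set Z, IsContinuum E ∧ E ⊆ (Metric.ball a (r / lam))ᶜ ∧ x ∈ E ∧ y ∈ E)

/-- The cross-ratio of four points in a metric space. -/
noncomputable def crossRatio {Z : Type*} [MetricSpace Z] (z1 z2 z3 z4 : Z) : ℝ :=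
  (dist z1 z3 * dist z2 z4) / (dist z1 z4 * dist z2 z3)

/-- A control function: a homeomorphism `η : [0,∞) → [0,∞)` with `η(0) = 0`. -/
def ControlFunction (η : ℝ → ℝ) : Prop :=
  η 0 = 0 ∧ StrictMonoOn η (Set.Ici 0) ∧ ContinuousOn η (Set.Ici 0) ∧
    Set.SurjOn η (Set.Ici 0) (Set.Ici 0)

/-- `f` is `η`-quasi-Möbius. -/
def IsQuasiMobiusWith {X Y : Type*} [MetricSpace X] [MetricSpace Y]
    (η : ℝ → ℝ) (f : X → Y) : Prop :=
  Function.Injective f ∧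
  ∀ x1 x2 x3 x4 : X, x1 ≠ x2 → x1 ≠ x3 → x1 ≠ x4 → x2 ≠ x3 → x2 ≠ x4 → x3 ≠ x4 →
    crossRatio (f x1) (f x2) (f x3) (f x4) ≤ η (crossRatio x1 x2 x3 x4)

/-- `f` is `η`-quasisymmetric. -/
def IsQuasisymmetricWith {X Y : Type*} [MetricSpace X] [MetricSpace Y]
    (η : ℝ → ℝ) (f : X → Y) : Prop :=
  Function.Injective f ∧
  ∀ x1 x2 x3 : X, x1 ≠ x2 → x1 ≠ x3 → x2 ≠ x3 →
    dist (f x1) (f x2) / dist (f x1) (f x3) ≤ η (dist x1 x2 / dist x1 x3)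

set_option linter.unusedSectionVars false

/-- Standing assumptions: a compact space with upper and lower `Q`-regular measure which is
`Q`-Loewner. -/
structure LoewnerSpace {Z : Type*} [MetricSpace Z] [MeasurableSpace Z] (μ : Measure Z)
    (Q C : ℝ) (Ψ : ℝ → ℝ) : Prop where
  two_le : 2 ≤ Q
  one_le : 1 ≤ C
  compact : CompactSpace Z
  upper : ∀ (a : Z) (R : ℝ), 0 < R → μ (Metric.ball a R) ≤ ENNReal.ofReal (C * R ^ Q)
  lower : ∀ (a : Z) (R : ℝ), 0 < R → R ≤ Metric.diam (Set.univ : Set Z) →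
    ENNReal.ofReal (C⁻¹ * R ^ Q) ≤ μ (Metric.ball a R)
  pos : ∀ t > (0:ℝ), 0 < Ψ t
  anti : AntitoneOn Ψ (Set.Ioi 0)
  loewner : IsLoewnerWith μ Q Ψ

section CurveLemmas

variable {Z : Type*} [MetricSpace Z]

lemma setLIntegral_Ioc_succ (f : ℝ → ℝ≥0∞) (a b c : ℝ) (hab : a ≤ b) (hbc : b ≤ c) :
    (∫⁻ t in Set.Ioc a b, f t) + ∫⁻ t in Set.Ioc b c, f t = ∫⁻ t in Set.Ioc a c, f t := by
  rw [← Set.Ioc_union_Ioc_eq_Ioc hab hbc]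
  rw [lintegral_union measurableSet_Ioc]
  rw [Set.disjoint_left]
  intro x hx hx'
  exact absurd hx.2 (not_le.2 hx'.1)

lemma curve_step {γ : ℝ → Z} {a h ε : ℝ} (hε : 0 < ε) (hh : ε / 2 ≤ h) (hh2 : h ≤ ε)
    (hγ : LipschitzOnWith 1 γ (Set.Icc a (a + h))) {ω : Z → ℝ} {g : Z → ℝ≥0∞}
    (hosc : ∀ z z', dist z z' ≤ ε → ENNReal.ofReal |ω z - ω z'| ≤ ENNReal.ofReal ε * g z) :
    ENNReal.ofReal |ω (γ a) - ω (γ (a + h))| ≤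
      4 * ∫⁻ t in Set.Ioc a (a + h), g (γ t) := by
  have h0 : 0 < h := by linarith
  set D := |ω (γ a) - ω (γ (a + h))| with hD
  have key : ∀ t ∈ Set.Ioc a (a + h), ENNReal.ofReal (D / (2 * ε)) ≤ g (γ t) := by
    intro t ht
    have ht' : t ∈ Set.Icc a (a + h) := ⟨ht.1.le, ht.2⟩
    have hd1 : dist (γ t) (γ a) ≤ ε := by
      have := hγ.dist_le_mul t ht' a ⟨le_rfl, by linarith⟩
      rw [Real.dist_eq, abs_of_nonneg (by linarith [ht.1])] at this
      simp at this
      linarith [ht.2]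
    have hd2 : dist (γ t) (γ (a + h)) ≤ ε := by
      have := hγ.dist_le_mul t ht' (a + h) ⟨by linarith, le_rfl⟩
      rw [Real.dist_eq, abs_of_nonpos (by linarith [ht.2])] at this
      simp at this
      linarith [ht.1]
    have h1 := hosc _ _ hd1
    have h2 := hosc _ _ hd2
    have h3 : ENNReal.ofReal D ≤ ENNReal.ofReal (2 * ε) * g (γ t) := by
      calc ENNReal.ofReal D ≤ ENNReal.ofReal (|ω (γ t) - ω (γ a)| + |ω (γ t) - ω (γ (a + h))|) := by
            apply ENNReal.ofReal_le_ofReal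
            rw [hD, abs_sub_comm (ω (γ t)) (ω (γ a))]
            exact abs_sub_le _ _ _
        _ ≤ ENNReal.ofReal ε * g (γ t) + ENNReal.ofReal ε * g (γ t) := by
            rw [ENNReal.ofReal_add (abs_nonneg _) (abs_nonneg _)]
            gcongr
        _ = _ := by
            rw [← two_mul, ← mul_assoc, ENNReal.ofReal_mul (by norm_num)]
            simp
    rw [ENNReal.ofReal_div_of_pos (by linarith)]
    exact ENNReal.div_le_of_le_mul' h3
  have hint := setLIntegral_mono' (μ := volume) measurableSet_Ioc key
  rw [setLIntegral_const, Real.volume_Ioc] at hint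
  calc ENNReal.ofReal D ≤ 4 * (ENNReal.ofReal (D / (2 * ε)) * ENNReal.ofReal (a + h - a)) := by
        rw [← ENNReal.ofReal_mul (by positivity)]
        have : (4 : ℝ≥0∞) = ENNReal.ofReal 4 := by simp
        rw [this, ← ENNReal.ofReal_mul (by norm_num)]
        apply ENNReal.ofReal_le_ofReal
        have hD0 : 0 ≤ D := abs_nonneg _
        have : 4 * (D / (2 * ε) * (a + h - a)) = D * (2 * h / ε) := by field_simp; ring
        rw [this]
        have : 1 ≤ 2 * h / ε := by rw [le_div_iff₀ hε]; linarith
        nlinarith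
    _ ≤ _ := by gcongr

lemma curve_steps {γ : ℝ → Z} {a h ε : ℝ} (hε : 0 < ε) (hh : ε / 2 ≤ h) (hh2 : h ≤ ε)
    (m : ℕ)
    (hγ : LipschitzOnWith 1 γ (Set.Icc a (a + m * h))) {ω : Z → ℝ} {g : Z → ℝ≥0∞}
    (hosc : ∀ z z', dist z z' ≤ ε → ENNReal.ofReal |ω z - ω z'| ≤ ENNReal.ofReal ε * g z) :
    ENNReal.ofReal |ω (γ a) - ω (γ (a + m * h))| ≤
      4 * ∫⁻ t in Set.Ioc a (a + m * h), g (γ t) := by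
  have h0 : 0 < h := by linarith
  induction m with
  | zero => simp
  | succ m ih =>
    have e : a + (m + 1 : ℕ) * h = (a + m * h) + h := by push_cast; ring
    have hm : 0 ≤ m * h := by positivity
    rw [e] at hγ ⊢
    have ih' := ih (hγ.mono (Set.Icc_subset_Icc le_rfl (by linarith)))
    have st := curve_step hε hh hh2 (hγ.mono (Set.Icc_subset_Icc (by linarith) le_rfl)) hosc
    rw [← setLIntegral_Ioc_succ _ a (a + m * h) _ (by linarith) (by linarith), mul_add]
    refine le_trans ?_ (add_le_add ih' st)
    rw [← ENNReal.ofReal_add (abs_nonneg _) (abs_nonneg _)]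
    exact ENNReal.ofReal_le_ofReal (abs_sub_le _ _ _)

/-- Along a curve, a function changes by at most a multiple of the integral of a coarse upper
gradient. -/
lemma curve_osc {γ : ℝ → Z} {p q ε : ℝ} (hε : 0 < ε) (hpq : ε ≤ q - p)
    (hγ : LipschitzOnWith 1 γ (Set.Icc p q)) {ω : Z → ℝ} {g : Z → ℝ≥0∞}
    (hosc : ∀ z z', dist z z' ≤ ε → ENNReal.ofReal |ω z - ω z'| ≤ ENNReal.ofReal ε * g z) :
    ENNReal.ofReal |ω (γ p) - ω (γ q)| ≤ 4 * ∫⁻ t in Set.Icc p q, g (γ t) := by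
  set m : ℕ := ⌈(q - p) / ε⌉₊ with hm
  have h1 : (q - p) / ε ≤ m := Nat.le_ceil _
  have h1' : 1 ≤ (q - p) / ε := by rw [le_div_iff₀ hε]; linarith
  have h2 : (m : ℝ) < (q - p) / ε + 1 := Nat.ceil_lt_add_one (by linarith)
  have hm0 : (0 : ℝ) < m := by linarith
  have e : p + m * ((q - p) / m) = q := by field_simp; ring
  have h3 : ε / 2 ≤ (q - p) / m := by
    rw [le_div_iff₀ hm0]
    have : (m : ℝ) ≤ 2 * ((q - p) / ε) := by linarith
    calc ε / 2 * m ≤ ε / 2 * (2 * ((q - p) / ε)) := by gcongr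
      _ = q - p := by field_simp
  have h4 : (q - p) / m ≤ ε := by
    rw [div_le_iff₀ hm0]
    rw [div_le_iff₀ hε] at h1
    linarith
  have := curve_steps hε h3 h4 m (by rw [e]; exact hγ) hosc
  rw [e] at this
  refine this.trans ?_
  gcongr
  exact Set.Ioc_subset_Icc_self

/-- `g` is a coarse upper gradient at scale `ε` of a function which is `0` on `E`
and `1` on `F`. -/
structure CoarseAdm (ω : Z → ℝ) (g : Z → ℝ≥0∞) (ε : ℝ) (E F : Set Z) : Prop where
  osc : ∀ z z', dist z z' ≤ 4 * ε → ENNReal.ofReal |ω z - ω z'| ≤ ENNReal.ofReal ε * g z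
  left : ∀ z ∈ E, ∀ z', dist z z' ≤ 4 * ε → ENNReal.ofReal (ω z) ≤ ENNReal.ofReal ε * g z'
  right : ∀ z ∈ F, ∀ z', dist z z' ≤ 4 * ε →
    ENNReal.ofReal (1 - ω z) ≤ ENNReal.ofReal ε * g z'

lemma const_le_setLIntegral {f : ℝ → ℝ≥0∞} {a b ε : ℝ} {c : ℝ≥0∞} (hε : 0 < ε)
    (hab : ε ≤ b - a) (h : ∀ t ∈ Set.Icc a b, c ≤ ENNReal.ofReal ε * f t) :
    c ≤ ∫⁻ t in Set.Icc a b, f t := by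
  have h1 : ∀ t ∈ Set.Icc a b, c / ENNReal.ofReal ε ≤ f t := fun t ht =>
    ENNReal.div_le_of_le_mul' (h t ht)
  have hint := setLIntegral_mono' (μ := volume) measurableSet_Icc h1
  rw [setLIntegral_const, Real.volume_Icc] at hint
  refine le_trans ?_ hint
  calc c = c / ENNReal.ofReal ε * ENNReal.ofReal ε := by
        rw [ENNReal.div_mul_cancel] <;> simp [hε]
    _ ≤ _ := by gcongr

lemma CoarseAdm.one_le {ω : Z → ℝ} {g : Z → ℝ≥0∞} {ε : ℝ} {E F : Set Z}
    (h : CoarseAdm ω g ε E F) (hε : 0 < ε) {γ : ℝ → Z} {p q : ℝ} (hpq : ε ≤ q - p)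
    (hγ : LipschitzOnWith 1 γ (Set.Icc p q)) (hp : γ p ∈ E) (hq : γ q ∈ F) :
    1 ≤ 6 * ∫⁻ t in Set.Icc p q, g (γ t) := by
  have h1 := curve_osc hε hpq hγ (ω := ω) (g := g) (fun z z' hz => h.osc z z' (by linarith))
  have h2 : ENNReal.ofReal (ω (γ p)) ≤ ∫⁻ t in Set.Icc p q, g (γ t) := by
    refine le_trans ?_ (lintegral_mono_set (Set.Icc_subset_Icc le_rfl (show p + ε ≤ q by linarith)))
    apply const_le_setLIntegral hε (by linarith)
    intro t ht
    apply h.left _ hp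
    have := hγ.dist_le_mul p ⟨le_rfl, by linarith⟩ t ⟨ht.1, by linarith [ht.2]⟩
    rw [Real.dist_eq, abs_of_nonpos (by linarith [ht.1])] at this
    simp at this
    linarith [ht.2]
  have h3 : ENNReal.ofReal (1 - ω (γ q)) ≤ ∫⁻ t in Set.Icc p q, g (γ t) := by
    refine le_trans ?_ (lintegral_mono_set (Set.Icc_subset_Icc (show p ≤ q - ε by linarith) le_rfl))
    apply const_le_setLIntegral hε (by linarith)
    intro t ht
    apply h.right _ hq
    have := hγ.dist_le_mul q ⟨by linarith, le_rfl⟩ t ⟨by linarith [ht.1], ht.2⟩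
    rw [Real.dist_eq, abs_of_nonneg (by linarith [ht.2])] at this
    simp at this
    linarith [ht.1]
  set I := ∫⁻ t in Set.Icc p q, g (γ t)
  calc (1 : ℝ≥0∞) = ENNReal.ofReal 1 := by simp
    _ ≤ ENNReal.ofReal (ω (γ p) + |ω (γ p) - ω (γ q)| + (1 - ω (γ q))) := by
        apply ENNReal.ofReal_le_ofReal
        linarith [neg_abs_le (ω (γ p) - ω (γ q))]
    _ ≤ ENNReal.ofReal (ω (γ p)) + ENNReal.ofReal |ω (γ p) - ω (γ q)|
        + ENNReal.ofReal (1 - ω (γ q)) :=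
        ENNReal.ofReal_add_le.trans (add_le_add_left ENNReal.ofReal_add_le _)
    _ ≤ I + 4 * I + I := by gcongr
    _ = 6 * I := by ring

end CurveLemmas

section Capacity

variable {Z : Type*} [MetricSpace Z] [MeasurableSpace Z] [BorelSpace Z]

lemma log_clip_sub_le {ρ R d d' : ℝ} (hρ : 0 < ρ) (hR : ρ ≤ R) (hd : |d - d'| ≤ ρ / 2) :
    |Real.log (min (max d ρ) R) - Real.log (min (max d' ρ) R)| ≤
      ρ / 2 * (if d < 2 * R then 2 / max d ρ else 0) := by
  rw [abs_le] at hd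
  split_ifs with h
  · have hm : 0 < max d ρ := lt_max_of_lt_right hρ
    set a := min (max d ρ) R
    set b := min (max d' ρ) R
    have ha : max d ρ / 2 ≤ a := by
      apply le_min
      · linarith
      · rcases max_cases d ρ with h' | h' <;> linarith
    have hb : max d ρ / 2 ≤ b := by
      apply le_min
      · rcases max_cases d ρ with h' | h'
        · have := le_max_left d' ρ; linarith
        · have := le_max_right d' ρ; linarith
      · rcases max_cases d ρ with h' | h' <;> linarith
    have hab : |a - b| ≤ ρ / 2 := by
      calc |a - b| ≤ |max d ρ - max d' ρ| := by
            have := abs_min_sub_min_le_max (max d ρ) R (max d' ρ) R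
            simpa using this
        _ ≤ |d - d'| := by
            have := abs_max_sub_max_le_max d ρ d' ρ
            simpa using this
        _ ≤ _ := abs_le.2 hd
    have ha0 : 0 < a := by linarith
    have hb0 : 0 < b := by linarith
    have key : ∀ x y : ℝ, max d ρ / 2 ≤ x → max d ρ / 2 ≤ y → |x - y| ≤ ρ / 2 →
        Real.log x - Real.log y ≤ ρ / 2 * (2 / max d ρ) := by
      intro x y hx hy hxy
      have hx0 : 0 < x := by linarith
      have hy0 : 0 < y := by linarith
      rw [← Real.log_div hx0.ne' hy0.ne']
      refine (Real.log_le_sub_one_of_pos (by positivity)).trans ?_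
      have : x / y - 1 = (x - y) / y := by field_simp
      rw [this, div_le_iff₀ hy0]
      calc x - y ≤ ρ / 2 := (le_abs_self _).trans hxy
        _ = ρ / 2 * (2 / max d ρ) * (max d ρ / 2) := by field_simp
        _ ≤ _ := by gcongr
    rw [abs_le]
    constructor
    · have := key b a hb ha (by rwa [abs_sub_comm]); linarith
    · exact key a b ha hb hab
  · have h1 : R ≤ max d ρ := le_max_of_le_left (by linarith)
    have h2 : R ≤ max d' ρ := le_max_of_le_left (by linarith)
    rw [min_eq_right h1, min_eq_right h2]
    simp

/-- The density `2 / max (d(·, z), ρ)` on the ball of radius `2R`. -/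
noncomputable def logDensity (z : Z) (ρ R : ℝ) (w : Z) : ℝ≥0∞ :=
  (Metric.ball z (2 * R)).indicator (fun w => ENNReal.ofReal (2 / max (dist w z) ρ)) w

lemma measurable_logDensity (z : Z) {ρ R : ℝ} (hρ : 0 < ρ) : Measurable (logDensity z ρ R) := by
  apply Measurable.indicator _ Metric.isOpen_ball.measurableSet
  apply ENNReal.measurable_ofReal.comp
  apply Continuous.measurable
  apply Continuous.div continuous_const (by fun_prop)
  intro w
  exact (lt_max_of_lt_right hρ).ne'

lemma logDensity_curve {z : Z} {ρ : ℝ} (hρ : 0 < ρ) {n : ℕ} (hn : 1 ≤ n) {γ : ℝ → Z} {p q : ℝ}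
    (hpq : p ≤ q) (hγ : LipschitzOnWith 1 γ (Set.Icc p q))
    (h : (dist (γ p) z ≤ ρ ∧ 2 ^ n * ρ ≤ dist (γ q) z) ∨
      (dist (γ q) z ≤ ρ ∧ 2 ^ n * ρ ≤ dist (γ p) z)) :
    ENNReal.ofReal (n * Real.log 2) ≤
      4 * ∫⁻ t in Set.Icc p q, logDensity z ρ (2 ^ n * ρ) (γ t) := by
  have h2 : (2 : ℝ) ≤ 2 ^ n := by
    calc (2 : ℝ) = 2 ^ 1 := by norm_num
      _ ≤ 2 ^ n := pow_le_pow_right₀ (by norm_num) hn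
  have hR : ρ ≤ 2 ^ n * ρ := by nlinarith
  have hlen : ρ / 2 ≤ q - p := by
    have h1 := hγ.dist_le_mul p ⟨le_rfl, hpq⟩ q ⟨hpq, le_rfl⟩
    rw [Real.dist_eq, abs_of_nonpos (by linarith)] at h1
    simp at h1
    have h3 := dist_triangle (γ p) (γ q) z
    have h4 := dist_triangle (γ q) (γ p) z
    rw [dist_comm (γ q) (γ p)] at h4
    rcases h with h | h <;> nlinarith
  have := curve_osc (ε := ρ / 2) (by linarith) hlen hγ
    (ω := fun w => Real.log (min (max (dist w z) ρ) (2 ^ n * ρ)))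
    (g := logDensity z ρ (2 ^ n * ρ)) (by
      intro w w' hw
      have := log_clip_sub_le hρ hR (d := dist w z) (d' := dist w' z)
        ((abs_dist_sub_le w w' z).trans hw)
      refine (ENNReal.ofReal_le_ofReal this).trans ?_
      rw [ENNReal.ofReal_mul (by linarith)]
      gcongr
      unfold logDensity
      split_ifs with h
      · rw [Set.indicator_of_mem (by simpa using h)]
      · simp)
  refine le_trans (ENNReal.ofReal_le_ofReal ?_) this
  have e1 : ∀ d, d ≤ ρ → min (max d ρ) (2 ^ n * ρ) = ρ := by
    intro d hd; rw [max_eq_right hd, min_eq_left hR]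
  have e2 : ∀ d, 2 ^ n * ρ ≤ d → min (max d ρ) (2 ^ n * ρ) = 2 ^ n * ρ := by
    intro d hd; rw [min_eq_right (le_max_of_le_left hd)]
  have e3 : Real.log (2 ^ n * ρ) = n * Real.log 2 + Real.log ρ := by
    rw [Real.log_mul (by positivity) hρ.ne', Real.log_pow]
  rcases h with ⟨ha, hb⟩ | ⟨ha, hb⟩
  · simp only [e1 _ ha, e2 _ hb, e3]
    rw [abs_sub_comm]
    exact le_trans (by linarith) (le_abs_self _)
  · simp only [e1 _ ha, e2 _ hb, e3]
    exact le_trans (by linarith) (le_abs_self _)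

variable {μ : Measure Z} {Q C : ℝ} {Ψ : ℝ → ℝ}

lemma LoewnerSpace.lintegral_logDensity (hZ : LoewnerSpace μ Q C Ψ) (z : Z) {ρ : ℝ} (hρ : 0 < ρ)
    (n : ℕ) :
    ∫⁻ w, logDensity z ρ (2 ^ n * ρ) w ^ Q ∂μ ≤ ENNReal.ofReal ((n + 1) * (C * 4 ^ Q)) := by
  have hQ := hZ.two_le
  have hC := hZ.one_le
  have key : ∀ w, logDensity z ρ (2 ^ n * ρ) w ^ Q ≤ ∑ k ∈ Finset.range (n + 1),
      (Metric.ball z (2 ^ (k + 1) * ρ)).indicator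
        (fun _ => ENNReal.ofReal ((2 / (2 ^ k * ρ)) ^ Q)) w := by
    intro w
    by_cases hw : w ∈ Metric.ball z (2 * (2 ^ n * ρ))
    · unfold logDensity
      rw [Set.indicator_of_mem hw]
      have h1 : 1 ≤ max (dist w z) ρ / ρ := by
        rw [le_div_iff₀ hρ]; simp
      obtain ⟨k, hk1, hk2⟩ := exists_nat_pow_near h1 (by norm_num : (1:ℝ) < 2)
      rw [le_div_iff₀ hρ] at hk1
      rw [div_lt_iff₀ hρ] at hk2
      have hkn : k < n + 1 := by
        by_contra hcon
        have h3 : (2 : ℝ) ^ (n + 1) ≤ 2 ^ k := pow_le_pow_right₀ (by norm_num) (by omega)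
        have h4 : (2:ℝ) ^ (n + 1) * ρ ≤ max (dist w z) ρ := le_trans (by gcongr) hk1
        rw [Metric.mem_ball] at hw
        have h5 : (1:ℝ) ≤ 2 ^ n := one_le_pow₀ (by norm_num)
        rw [pow_succ] at h4
        rcases max_cases (dist w z) ρ with h' | h' <;> nlinarith
      refine le_trans ?_ (Finset.single_le_sum (f := fun k =>
        (Metric.ball z (2 ^ (k + 1) * ρ)).indicator
        (fun _ => ENNReal.ofReal ((2 / (2 ^ k * ρ)) ^ Q)) w) (fun _ _ => bot_le)
        (Finset.mem_range.2 hkn))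
      have hmem : w ∈ Metric.ball z (2 ^ (k + 1) * ρ) :=
        lt_of_le_of_lt (le_max_left _ _) hk2
      simp only [Set.indicator_of_mem hmem]
      rw [ENNReal.ofReal_rpow_of_nonneg (by positivity) (by linarith)]
      apply ENNReal.ofReal_le_ofReal
      gcongr
    · unfold logDensity
      rw [Set.indicator_of_notMem hw, ENNReal.zero_rpow_of_pos (by linarith)]
      exact bot_le
  refine (lintegral_mono key).trans ?_
  rw [lintegral_finsetSum _ (fun k _ => measurable_const.indicator
    Metric.isOpen_ball.measurableSet)]
  calc _ ≤ ∑ k ∈ Finset.range (n + 1), ENNReal.ofReal (C * 4 ^ Q) := by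
        apply Finset.sum_le_sum
        intro k _
        rw [lintegral_indicator Metric.isOpen_ball.measurableSet, setLIntegral_const]
        refine (mul_le_mul_right (hZ.upper z (2 ^ (k + 1) * ρ) (by positivity)) _).trans ?_
        rw [← ENNReal.ofReal_mul (by positivity)]
        apply ENNReal.ofReal_le_ofReal
        rw [mul_left_comm, ← Real.mul_rpow (by positivity) (by positivity)]
        apply le_of_eq
        congr 2
        field_simp
        ring
    _ = _ := by
        rw [Finset.sum_const, Finset.card_range, nsmul_eq_mul,
          ENNReal.ofReal_mul (p := (n : ℝ) + 1) (by positivity),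
          show (n:ℝ) + 1 = ((n + 1 : ℕ) : ℝ) by push_cast; ring, ENNReal.ofReal_natCast]

/-- Curves crossing a thick annulus have small modulus. -/
lemma LoewnerSpace.cap (hZ : LoewnerSpace μ Q C Ψ) {δ : ℝ} (hδ : 0 < δ) :
    ∃ n : ℕ, 1 ≤ n ∧ ∀ (z : Z) (ρ : ℝ), 0 < ρ → ∃ g : Z → ℝ≥0∞, Measurable g ∧
      ∫⁻ w, g w ^ Q ∂μ ≤ ENNReal.ofReal δ ∧
      ∀ (γ : ℝ → Z) (p q : ℝ), p ≤ q → LipschitzOnWith 1 γ (Set.Icc p q) →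
        ((dist (γ p) z ≤ ρ ∧ 2 ^ n * ρ ≤ dist (γ q) z) ∨
          (dist (γ q) z ≤ ρ ∧ 2 ^ n * ρ ≤ dist (γ p) z)) →
        1 ≤ ∫⁻ t in Set.Icc p q, g (γ t) := by
  have hQ := hZ.two_le
  have hC := hZ.one_le
  have hl : 0 < Real.log 2 := Real.log_pos (by norm_num)
  set K := (4 / Real.log 2) ^ 2 * (2 * (C * 4 ^ Q)) with hK
  have hK0 : 0 < K := by positivity
  obtain ⟨n, hn⟩ := exists_nat_ge (max (4 / Real.log 2) (K / δ) + 1)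
  have hn1 : (1 : ℝ) ≤ n := by
    have : 0 < 4 / Real.log 2 := by positivity
    have := le_max_left (4 / Real.log 2) (K / δ)
    linarith
  refine ⟨n, by exact_mod_cast hn1, fun z ρ hρ => ?_⟩
  set c := 4 / (n * Real.log 2) with hc
  have hc0 : 0 < c := by positivity
  have hc1 : c ≤ 1 := by
    rw [hc, div_le_one (by positivity)]
    have := le_max_left (4 / Real.log 2) (K / δ)
    have h3 : 4 / Real.log 2 ≤ n := by linarith
    rwa [div_le_iff₀ hl] at h3
  refine ⟨fun w => ENNReal.ofReal c * logDensity z ρ (2 ^ n * ρ) w,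
    (measurable_logDensity z hρ).const_mul _, ?_, ?_⟩
  · simp_rw [ENNReal.mul_rpow_of_nonneg _ _ (by linarith : 0 ≤ Q)]
    rw [lintegral_const_mul _ ((measurable_logDensity z hρ).pow_const _)]
    refine (mul_le_mul_right (hZ.lintegral_logDensity z hρ n) _).trans ?_
    rw [ENNReal.ofReal_rpow_of_pos hc0, ← ENNReal.ofReal_mul (by positivity)]
    apply ENNReal.ofReal_le_ofReal
    have h1 : c ^ Q ≤ c ^ 2 := by
      rw [← Real.rpow_two]
      exact Real.rpow_le_rpow_of_exponent_ge hc0 hc1 hQ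
    calc c ^ Q * ((n + 1) * (C * 4 ^ Q)) ≤ c ^ 2 * ((n + n) * (C * 4 ^ Q)) := by gcongr
      _ = K / n := by rw [hc, hK]; field_simp; norm_num
      _ ≤ δ := by
        rw [div_le_iff₀ (by linarith)]
        have := le_max_right (4 / Real.log 2) (K / δ)
        have h3 : K / δ ≤ n := by linarith
        rw [div_le_iff₀ hδ] at h3
        linarith
  · intro γ p q hpq hγ h
    have := logDensity_curve hρ (by exact_mod_cast hn1) hpq hγ h
    rw [lintegral_const_mul' _ _ ENNReal.ofReal_ne_top]
    calc (1 : ℝ≥0∞) = ENNReal.ofReal (c / 4) * ENNReal.ofReal (n * Real.log 2) := by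
          rw [← ENNReal.ofReal_mul (by positivity), hc]
          rw [← ENNReal.ofReal_one]; congr 1; field_simp
      _ ≤ ENNReal.ofReal (c / 4) * (4 * ∫⁻ t in Set.Icc p q, logDensity z ρ (2 ^ n * ρ) (γ t)) := by
          gcongr
      _ = _ := by
          rw [← mul_assoc]
          congr 1
          rw [show (4 : ℝ≥0∞) = ENNReal.ofReal 4 by simp, ← ENNReal.ofReal_mul (by positivity)]
          congr 1; ring

end Capacity

/-- A continuum joining `{f ≤ a}` to `{b ≤ f}` contains a subcontinuum of `{a ≤ f ≤ b}` meeting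
both boundary levels. -/
lemma exists_subcontinuum {Z : Type*} [MetricSpace Z] {E : Set Z} (hE : IsCompact E)
    (hE' : IsPreconnected E) {f : Z → ℝ} (hf : Continuous f) {a b : ℝ} (hab : a < b)
    (ha : ∃ u ∈ E, f u ≤ a) (hb : ∃ v ∈ E, b ≤ f v) :
    ∃ E' ⊆ E, IsCompact E' ∧ IsConnected E' ∧ (∀ z ∈ E', a ≤ f z ∧ f z ≤ b) ∧
      (∃ u ∈ E', f u = a) ∧ ∃ v ∈ E', f v = b := by
  set K : Set Z := E ∩ {z | a ≤ f z ∧ f z ≤ b} with hKdef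
  have hcl : IsClosed {z | a ≤ f z ∧ f z ≤ b} :=
    (isClosed_le continuous_const hf).inter (isClosed_le hf continuous_const)
  have hK : IsCompact K := hE.inter_right hcl
  have : CompactSpace K := isCompact_iff_compactSpace.1 hK
  set A : Set K := {k | f k ≤ a}
  set B : Set K := {k | b ≤ f k}
  have hA : IsClosed A := isClosed_le (hf.comp continuous_subtype_val) continuous_const
  have hB : IsClosed B := isClosed_le continuous_const (hf.comp continuous_subtype_val)
  set A' := ConnectedComponents.mk '' A
  set B' := ConnectedComponents.mk '' B
  have hA' : IsClosed A' := (hA.isCompact.image ConnectedComponents.continuous_coe).isClosed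
  have hB' : IsClosed B' := (hB.isCompact.image ConnectedComponents.continuous_coe).isClosed
  by_cases hne : A' ⊆ B'ᶜ
  · exfalso
    obtain ⟨P, hP, hAP, hPB⟩ := exists_clopen_of_closed_subset_open hA' hB'.isOpen_compl hne
    set U : Set K := ConnectedComponents.mk ⁻¹' P
    have hU : IsClopen U := hP.preimage ConnectedComponents.continuous_coe
    have hAU : ∀ k : K, f k ≤ a → k ∈ U := fun k hk => hAP ⟨k, hk, rfl⟩
    have hBU : ∀ k : K, b ≤ f k → k ∉ U := fun k hk hkU => hPB hkU ⟨k, hk, rfl⟩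
    have c1 : IsClosed (Subtype.val '' U ∪ E ∩ {z | f z ≤ a}) :=
      ((hU.1.isCompact.image continuous_subtype_val).union
        (hE.inter_right (isClosed_le hf continuous_const))).isClosed
    have c2 : IsClosed (Subtype.val '' Uᶜ ∪ E ∩ {z | b ≤ f z}) :=
      ((hU.compl.1.isCompact.image continuous_subtype_val).union
        (hE.inter_right (isClosed_le continuous_const hf))).isClosed
    obtain ⟨u, hu, hua⟩ := ha
    obtain ⟨v, hv, hvb⟩ := hb
    obtain ⟨w, hwE, hw1, hw2⟩ := isPreconnected_closed_iff.1 hE' _ _ c1 c2 (by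
        intro z hz
        by_cases h1 : f z ≤ a
        · exact Or.inl (Or.inr ⟨hz, h1⟩)
        by_cases h2 : b ≤ f z
        · exact Or.inr (Or.inr ⟨hz, h2⟩)
        push Not at h1 h2
        by_cases h3 : (⟨z, hz, h1.le, h2.le⟩ : K) ∈ U
        · exact Or.inl (Or.inl ⟨_, h3, rfl⟩)
        · exact Or.inr (Or.inl ⟨_, h3, rfl⟩))
      ⟨u, hu, Or.inr ⟨hu, hua⟩⟩ ⟨v, hv, Or.inr ⟨hv, hvb⟩⟩
    rcases hw1 with ⟨k, hk, rfl⟩ | ⟨_, h1⟩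
    · rcases hw2 with ⟨k', hk', hkk⟩ | ⟨_, h2⟩
      · rw [Subtype.ext hkk] at hk'
        exact hk' hk
      · exact hBU k h2 hk
    · rcases hw2 with ⟨k', hk', rfl⟩ | ⟨_, h2⟩
      · exact hk' (hAU k' h1)
      · exact absurd (le_trans h2 h1) (not_le.2 hab)
  · obtain ⟨_, ⟨k, hk, rfl⟩, hk'⟩ := Set.not_subset.1 hne
    rw [Set.notMem_compl_iff] at hk'
    obtain ⟨k', hk'B, hkk⟩ := hk'
    rw [ConnectedComponents.coe_eq_coe'] at hkk
    refine ⟨Subtype.val '' connectedComponent k, ?_, ?_, ?_, ?_, ?_, ?_⟩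
    · rintro _ ⟨x, _, rfl⟩; exact x.2.1
    · exact isClosed_connectedComponent.isCompact.image continuous_subtype_val
    · exact isConnected_connectedComponent.image _ continuous_subtype_val.continuousOn
    · rintro _ ⟨x, _, rfl⟩; exact x.2.2
    · exact ⟨k, ⟨k, mem_connectedComponent, rfl⟩, le_antisymm hk k.2.2.1⟩
    · exact ⟨k', ⟨k', hkk, rfl⟩, le_antisymm k'.2.2.2 hk'B⟩

section Loewner

variable {Z : Type*} [MetricSpace Z] [MeasurableSpace Z] [BorelSpace Z]
variable {μ : Measure Z} {Q C : ℝ} {Ψ : ℝ → ℝ}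

lemma LoewnerSpace.le_lintegral (hZ : LoewnerSpace μ Q C Ψ) {E F : Set Z} (hE : IsCompact E)
    (hE' : IsConnected E) (hF : IsCompact F) (hF' : IsConnected F) (hEF : Disjoint E F)
    {d D : ℝ} (hd : 0 < d) (hdE : d ≤ Metric.diam E) (hdF : d ≤ Metric.diam F)
    {x y : Z} (hx : x ∈ E) (hy : y ∈ F) (hxy : dist x y ≤ D) {g : Z → ℝ≥0∞}
    (hg : Measurable g)
    (hadm : ∀ c ∈ curvesJoining E F, 1 ≤ c.lineIntegral g) :
    ENNReal.ofReal (Ψ (D / d)) ≤ ∫⁻ z, g z ^ Q ∂μ := by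
  have nt : ∀ S : Set Z, d ≤ Metric.diam S → S.Nontrivial := by
    intro S hS
    by_contra h
    rw [Set.not_nontrivial_iff] at h
    rw [Metric.diam_subsingleton h] at hS
    linarith
  have hbdd : BddBelow (Set.image2 dist E F) := ⟨0, by rintro _ ⟨_, _, _, _, rfl⟩; exact dist_nonneg⟩
  have h1 : setDist E F ≤ D := (csInf_le hbdd ⟨x, hx, y, hy, rfl⟩).trans hxy
  have h2 : 0 < setDist E F := by
    have hc : IsCompact (Set.image2 dist E F) := by
      rw [← Set.image_uncurry_prod]
      exact (hE.prod hF).image continuous_dist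
    obtain ⟨u, hu, v, hv, huv⟩ := hc.sInf_mem ⟨_, x, hx, y, hy, rfl⟩
    unfold setDist
    rw [← huv]
    exact dist_pos.2 (fun h => Set.disjoint_left.1 hEF hu (h ▸ hv))
  have h3 : relDelta E F ≤ D / d := by
    unfold relDelta
    gcongr
    · linarith
    · exact le_min hdE hdF
  have h4 : 0 < relDelta E F := by
    unfold relDelta
    exact div_pos h2 (lt_min (by linarith) (by linarith))
  calc ENNReal.ofReal (Ψ (D / d)) ≤ ENNReal.ofReal (Ψ (relDelta E F)) :=
        ENNReal.ofReal_le_ofReal (hZ.anti h4 (lt_of_lt_of_le h4 h3) h3)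
    _ ≤ ModFam μ Q (curvesJoining E F) :=
        hZ.loewner.2 E F ⟨hE, hE', nt E hdE⟩ ⟨hF, hF', nt F hdF⟩ hEF
    _ ≤ _ := iInf₂_le_of_le g hg (iInf_le _ hadm)

lemma Curve.le_lineIntegral (c : Curve Z) {g : Z → ℝ≥0∞} {p q : ℝ} (hp : 0 ≤ p) (hq : q ≤ c.L)
    {b : ℝ≥0∞} (h : b ≤ ∫⁻ t in Set.Icc p q, g (c.toFun t)) : b ≤ c.lineIntegral g :=
  h.trans (lintegral_mono_set (Set.Icc_subset_Icc hp hq))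

lemma Curve.continuousOn (c : Curve Z) : ContinuousOn c.toFun (Set.Icc 0 c.L) :=
  c.lip.continuousOn

/-- First linear local connectivity condition. -/
lemma LoewnerSpace.llc (hZ : LoewnerSpace μ Q C Ψ) :
    ∃ Λ : ℝ, 1 ≤ Λ ∧ ∀ x y : Z, ∃ K : Set Z, IsCompact K ∧ IsConnected K ∧ x ∈ K ∧ y ∈ K ∧
      K ⊆ Metric.closedBall x (Λ * dist x y) := by
  have hψ := hZ.pos 4 (by norm_num)
  obtain ⟨n, hn, hcap⟩ := hZ.cap (half_pos hψ)
  have h2n : (2:ℝ) ≤ 2 ^ n := by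
    calc (2 : ℝ) = 2 ^ 1 := by norm_num
      _ ≤ 2 ^ n := pow_le_pow_right₀ (by norm_num) hn
  refine ⟨2 ^ n * 2, by linarith, fun x y => ?_⟩
  by_cases hxy : x = y
  · subst hxy
    exact ⟨{x}, isCompact_singleton, isConnected_singleton, rfl, rfl, by simp⟩
  set r := dist x y with hr
  have hr0 : 0 < r := dist_pos.2 hxy
  obtain ⟨c, hc0, hcL⟩ := hZ.loewner.1 x y
  have him : IsCompact (c.toFun '' Set.Icc 0 c.L) := isCompact_Icc.image_of_continuousOn c.continuousOn
  have him' : IsPreconnected (c.toFun '' Set.Icc 0 c.L) :=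
    isPreconnected_Icc.image _ c.continuousOn
  have hxm : x ∈ c.toFun '' Set.Icc 0 c.L := ⟨0, ⟨le_rfl, c.L_nonneg⟩, hc0⟩
  have hym : y ∈ c.toFun '' Set.Icc 0 c.L := ⟨c.L, ⟨c.L_nonneg, le_rfl⟩, hcL⟩
  obtain ⟨E, -, hE, hE', hEb, ⟨u, hu, hu0⟩, u', hu', hu1⟩ := exists_subcontinuum him him'
    (f := fun w => dist w x) (by fun_prop) (show (0:ℝ) < r / 4 by linarith)
    ⟨x, hxm, by simp⟩ ⟨y, hym, by rw [dist_comm, ← hr]; linarith⟩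
  obtain ⟨F, -, hF, hF', hFb, ⟨v, hv, hv0⟩, v', hv', hv1⟩ := exists_subcontinuum him him'
    (f := fun w => dist w y) (by fun_prop) (show (0:ℝ) < r / 4 by linarith)
    ⟨y, hym, by simp⟩ ⟨x, hxm, by rw [← hr]; linarith⟩
  rw [dist_eq_zero] at hu0 hv0
  subst hu0 hv0
  have hdis : Disjoint E F := by
    rw [Set.disjoint_left]
    intro w hw hw'
    have h1 := (hEb w hw).2
    have h2 := (hFb w hw').2
    have := dist_triangle_left u v w
    linarith
  have hdE : r / 4 ≤ Metric.diam E := hu1 ▸ Metric.dist_le_diam_of_mem hE.isBounded hu' hu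
  have hdF : r / 4 ≤ Metric.diam F := hv1 ▸ Metric.dist_le_diam_of_mem hF.isBounded hv' hv
  have hFd : ∀ w ∈ F, dist w u ≤ 2 * r := by
    intro w hw
    have h2 := (hFb w hw).2
    have := dist_triangle w v u
    rw [dist_comm v u] at this
    linarith
  obtain ⟨g, hg, hgQ, hgc⟩ := hcap u (2 * r) (by linarith)
  by_contra hcon
  push Not at hcon
  have := hZ.le_lintegral hE hE' hF hF' hdis (by linarith : 0 < r / 4) hdE hdF hu hv hr.ge hg (by
    rintro c' ⟨h0, hL⟩
    have hc1 : IsConnected (c'.toFun '' Set.Icc 0 c'.L) :=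
      (isConnected_Icc c'.L_nonneg).image _ c'.continuousOn
    have hm0 : c'.toFun 0 ∈ c'.toFun '' Set.Icc 0 c'.L := ⟨0, ⟨le_rfl, c'.L_nonneg⟩, rfl⟩
    have hmL : c'.toFun c'.L ∈ c'.toFun '' Set.Icc 0 c'.L := ⟨c'.L, ⟨c'.L_nonneg, le_rfl⟩, rfl⟩
    have hEc : IsConnected (E ∪ c'.toFun '' Set.Icc 0 c'.L) := hE'.union ⟨_, h0, hm0⟩ hc1
    have hne : ¬ (E ∪ c'.toFun '' Set.Icc 0 c'.L ∪ F ⊆ Metric.closedBall u (2 ^ n * 2 * r)) :=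
      hcon _ ((hE.union (isCompact_Icc.image_of_continuousOn c'.continuousOn)).union hF)
        (hEc.union ⟨_, Or.inr hmL, hL⟩ hF') (Or.inl (Or.inl hu)) (Or.inr hv)
    obtain ⟨w, hw, hw'⟩ := Set.not_subset.1 hne
    rw [Metric.mem_closedBall, not_le] at hw'
    have hbig : 2 * r ≤ 2 ^ n * 2 * r := by nlinarith
    rcases hw with (hw | ⟨t, ht, rfl⟩) | hw
    · exact absurd (hEb w hw).2 (by linarith)
    · refine c'.le_lineIntegral le_rfl ht.2 (hgc c'.toFun 0 t ht.1
        (c'.lip.mono (Set.Icc_subset_Icc le_rfl ht.2)) (Or.inl ⟨?_, by linarith⟩))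
      have := (hEb _ h0).2
      linarith
    · exact absurd (hFd w hw) (by linarith))
  have h5 := this.trans hgQ
  rw [show r / (r / 4) = 4 by field_simp, ENNReal.ofReal_le_ofReal_iff (by linarith)] at h5
  linarith

lemma ENNReal_rpow_add3_le {Q : ℝ} (hQ : 0 ≤ Q) (a b c : ℝ≥0∞) :
    (a + b + c) ^ Q ≤ 3 ^ Q * (a ^ Q + b ^ Q + c ^ Q) := by
  have key : ∀ x : ℝ≥0∞, a ≤ x → b ≤ x → c ≤ x → (a + b + c) ^ Q ≤ 3 ^ Q * x ^ Q := by
    intro x ha hb hc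
    rw [← ENNReal.mul_rpow_of_nonneg _ _ hQ]
    gcongr
    calc a + b + c ≤ x + x + x := by gcongr
      _ = 3 * x := by ring
  rcases le_total a b with h1 | h1
  · rcases le_total b c with h2 | h2
    · exact (key c (h1.trans h2) h2 le_rfl).trans (by gcongr; exact le_add_self)
    · exact (key b h1 le_rfl h2).trans (by
        gcongr; exact (le_add_self (a := b ^ Q) (b := a ^ Q)).trans le_self_add)
  · rcases le_total a c with h2 | h2
    · exact (key c h2 (h1.trans h2) le_rfl).trans (by gcongr; exact le_add_self)
    · exact (key a le_rfl h1 h2).trans (by gcongr; rw [add_assoc]; exact le_self_add)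

lemma CoarseAdm.mono {ω : Z → ℝ} {g : Z → ℝ≥0∞} {ε : ℝ} {E F E' F' : Set Z}
    (h : CoarseAdm ω g ε E F) (hE : E' ⊆ E) (hF : F' ⊆ F) : CoarseAdm ω g ε E' F' :=
  ⟨h.osc, fun z hz => h.left z (hE hz), fun z hz => h.right z (hF hz)⟩

/-- Lower bound for the energy of a coarse upper gradient in one annulus. -/
lemma LoewnerSpace.annulus (hZ : LoewnerSpace μ Q C Ψ) :
    ∃ Λ c : ℝ, 16 ≤ Λ ∧ 0 < c ∧ ∀ (ε s : ℝ) (z : Z) (E F : Set Z) (ω : Z → ℝ) (g : Z → ℝ≥0∞),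
      0 < ε → ε ≤ s → IsCompact E → IsConnected E → IsCompact F → IsConnected F →
      (∃ u ∈ E, dist u z ≤ s) → (∃ v ∈ E, s * Λ ≤ dist v z) →
      (∃ u ∈ F, dist u z ≤ s) → (∃ v ∈ F, s * Λ ≤ dist v z) →
      CoarseAdm ω g ε E F → Measurable g →
      ENNReal.ofReal c ≤ ∫⁻ w in {w | s ≤ dist w z ∧ dist w z < s * Λ}, g w ^ Q ∂μ := by
  have hψ := hZ.pos 10 (by norm_num)
  have hQ := hZ.two_le
  set δ := Ψ 10 / (4 * 3 ^ Q) with hδ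
  obtain ⟨n, hn, hcap⟩ := hZ.cap (show 0 < δ by positivity)
  have h2n : (2:ℝ) ≤ 2 ^ n := by
    calc (2 : ℝ) = 2 ^ 1 := by norm_num
      _ ≤ 2 ^ n := pow_le_pow_right₀ (by norm_num) hn
  refine ⟨2 ^ n * (8 * 2 ^ n), Ψ 10 / (2 * 18 ^ Q), by nlinarith, by positivity, ?_⟩
  intro ε s z E F ω g hε hεs hE hE' hF hF' ⟨e1, he1, he1'⟩ ⟨e2, he2, he2'⟩ ⟨f1, hf1, hf1'⟩
    ⟨f2, hf2, hf2'⟩ hadm hg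
  have hs : 0 < s := by linarith
  set ρ := 2 ^ n * s with hρ
  have hρs : 2 * s ≤ ρ := by nlinarith
  have hΛ : s * (2 ^ n * (8 * 2 ^ n)) = 2 ^ n * (8 * ρ) := by rw [hρ]; ring
  rw [hΛ] at he2' hf2' ⊢
  have hbig : 16 * ρ ≤ 2 ^ n * (8 * ρ) := by nlinarith
  obtain ⟨E₁, hE₁s, hE₁, hE₁', hE₁b, ⟨u, hu, hu0⟩, u', hu', hu1⟩ := exists_subcontinuum hE
    hE'.isPreconnected (f := fun w => dist w z) (by fun_prop) (show ρ < 2 * ρ by linarith)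
    ⟨e1, he1, by linarith⟩ ⟨e2, he2, by linarith⟩
  obtain ⟨F₁, hF₁s, hF₁, hF₁', hF₁b, ⟨v, hv, hv0⟩, v', hv', hv1⟩ := exists_subcontinuum hF
    hF'.isPreconnected (f := fun w => dist w z) (by fun_prop) (show 4 * ρ < 8 * ρ by linarith)
    ⟨f1, hf1, by linarith⟩ ⟨f2, hf2, by linarith⟩
  have hdis : Disjoint E₁ F₁ := by
    rw [Set.disjoint_left]
    intro w hw hw'
    have h1 := (hE₁b w hw).2
    have h2 := (hF₁b w hw').1
    linarith
  have hdE : ρ ≤ Metric.diam E₁ := by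
    have := Metric.dist_le_diam_of_mem hE₁.isBounded hu' hu
    have := dist_triangle u' u z
    linarith
  have hdF : ρ ≤ Metric.diam F₁ := by
    have := Metric.dist_le_diam_of_mem hF₁.isBounded hv' hv
    have := dist_triangle v' v z
    linarith
  obtain ⟨g1, hg1, hg1Q, hg1c⟩ := hcap z s hs
  obtain ⟨g2, hg2, hg2Q, hg2c⟩ := hcap z (8 * ρ) (by linarith)
  set A : Set Z := {w | s ≤ dist w z ∧ dist w z < 2 ^ n * (8 * ρ)} with hA
  have hd : Measurable fun w => dist w z := by fun_prop
  have hAm : MeasurableSet A :=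
    (measurableSet_le measurable_const hd).inter (measurableSet_lt hd measurable_const)
  have hm6 : Measurable (fun w => 6 * A.indicator g w) := (hg.indicator hAm).const_mul _
  have hL := hZ.le_lintegral hE₁ hE₁' hF₁ hF₁' hdis (by linarith : 0 < ρ) hdE hdF hu hv
    (D := 10 * ρ) (by have := dist_triangle_right u v z; linarith)
    (g := fun w => 6 * A.indicator g w + g1 w + g2 w) ((hm6.add hg1).add hg2) (by
    rintro c ⟨h0, hL⟩
    have b0 := hE₁b _ h0
    have bL := hF₁b _ hL
    by_cases hin : ∀ t ∈ Set.Icc 0 c.L, c.toFun t ∈ A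
    · have hlen : ε ≤ c.L - 0 := by
        have h1 := c.lip.dist_le_mul 0 ⟨le_rfl, c.L_nonneg⟩ c.L ⟨c.L_nonneg, le_rfl⟩
        rw [Real.dist_eq, zero_sub, abs_neg, abs_of_nonneg c.L_nonneg] at h1
        simp at h1
        have := dist_triangle_left (c.toFun c.L) z (c.toFun 0)
        linarith
      have h6 := (hadm.mono hE₁s hF₁s).one_le hε hlen c.lip h0 hL
      rw [← lintegral_const_mul' _ _ (by norm_num)] at h6
      refine h6.trans ?_
      unfold Curve.lineIntegral
      apply setLIntegral_mono' measurableSet_Icc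
      intro t ht
      change _ ≤ 6 * A.indicator g (c.toFun t) + g1 (c.toFun t) + g2 (c.toFun t)
      rw [Set.indicator_of_mem (hin t ht), add_assoc]
      exact le_self_add
    · push Not at hin
      obtain ⟨t, ht, htA⟩ := hin
      have hlip := c.lip.mono (Set.Icc_subset_Icc (le_refl 0) ht.2)
      by_cases h1 : s ≤ dist (c.toFun t) z
      · have h2 : 2 ^ n * (8 * ρ) ≤ dist (c.toFun t) z := by
          by_contra h; exact htA ⟨h1, not_le.1 h⟩
        refine (c.le_lineIntegral le_rfl ht.2 (hg2c c.toFun 0 t ht.1 hlip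
          (Or.inl ⟨by linarith, h2⟩))).trans ?_
        exact lintegral_mono fun t => le_add_self
      · refine (c.le_lineIntegral le_rfl ht.2 (hg1c c.toFun 0 t ht.1 hlip
          (Or.inr ⟨by linarith, b0.1⟩))).trans ?_
        exact lintegral_mono fun t => le_add_self.trans le_self_add)
  have hρ0 : ρ ≠ 0 := by linarith
  rw [mul_div_assoc, div_self hρ0, mul_one] at hL
  set X := ∫⁻ w in A, g w ^ Q ∂μ with hX
  have hind : ∫⁻ w, (6 * A.indicator g w) ^ Q ∂μ = ENNReal.ofReal (6 ^ Q) * X := by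
    rw [hX, ← lintegral_indicator hAm, ← lintegral_const_mul' _ _ ENNReal.ofReal_ne_top]
    congr 1
    ext w
    rw [ENNReal.mul_rpow_of_nonneg _ _ (by linarith), ← ENNReal.ofReal_rpow_of_pos (by norm_num)]
    by_cases hw : w ∈ A
    · rw [Set.indicator_of_mem hw, Set.indicator_of_mem hw]; simp
    · simp [hw, ENNReal.zero_rpow_of_pos (by linarith : 0 < Q)]
  have hfin : ENNReal.ofReal (Ψ 10 / 2) + ENNReal.ofReal (Ψ 10 / 2) ≤
      ENNReal.ofReal (18 ^ Q) * X + ENNReal.ofReal (Ψ 10 / 2) := by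
    calc _ = ENNReal.ofReal (Ψ 10) := by
          rw [← ENNReal.ofReal_add (by linarith) (by linarith)]; congr 1; ring
      _ ≤ ∫⁻ w, 3 ^ Q * ((6 * A.indicator g w) ^ Q + g1 w ^ Q + g2 w ^ Q) ∂μ :=
          hL.trans (lintegral_mono fun w => ENNReal_rpow_add3_le (by linarith) _ _ _)
      _ = ENNReal.ofReal (3 ^ Q) * (ENNReal.ofReal (6 ^ Q) * X + ∫⁻ w, g1 w ^ Q ∂μ
            + ∫⁻ w, g2 w ^ Q ∂μ) := by
          have hm6g : Measurable fun w => (6 * A.indicator g w) ^ Q + g1 w ^ Q :=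
            (hm6.pow_const Q).add (hg1.pow_const Q)
          rw [← hind, ← lintegral_add_left (hm6.pow_const Q), ← lintegral_add_left hm6g,
            ← lintegral_const_mul' _ _ ENNReal.ofReal_ne_top,
            ← ENNReal.ofReal_rpow_of_pos (by norm_num)]
          simp
      _ ≤ ENNReal.ofReal (3 ^ Q) * (ENNReal.ofReal (6 ^ Q) * X + ENNReal.ofReal δ
            + ENNReal.ofReal δ) := by gcongr
      _ = _ := by
          rw [add_assoc, mul_add, ← mul_assoc, ← ENNReal.ofReal_mul (by positivity),
            ← Real.mul_rpow (by norm_num) (by norm_num),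
            ← ENNReal.ofReal_add (by positivity) (by positivity),
            ← ENNReal.ofReal_mul (by positivity)]
          congr 2
          · norm_num
          · rw [hδ]; field_simp; norm_num
  have hfin' := (ENNReal.add_le_add_iff_right ENNReal.ofReal_ne_top).1 hfin
  rw [show Ψ 10 / (2 * 18 ^ Q) = (Ψ 10 / 2) / 18 ^ Q by field_simp,
    ENNReal.ofReal_div_of_pos (by positivity)]
  exact ENNReal.div_le_of_le_mul' hfin'

/-- Lower bound for the energy of a coarse upper gradient in many annuli. -/
lemma LoewnerSpace.annuli (hZ : LoewnerSpace μ Q C Ψ) :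
    ∃ Λ c : ℝ, 16 ≤ Λ ∧ 0 < c ∧ ∀ (ε r : ℝ) (N : ℕ) (z : Z) (E F : Set Z) (ω : Z → ℝ)
      (g : Z → ℝ≥0∞),
      0 < ε → ε ≤ r → IsCompact E → IsConnected E → IsCompact F → IsConnected F →
      (∃ u ∈ E, dist u z ≤ r) → (∃ v ∈ E, r * Λ ^ N ≤ dist v z) →
      (∃ u ∈ F, dist u z ≤ r) → (∃ v ∈ F, r * Λ ^ N ≤ dist v z) →
      CoarseAdm ω g ε E F → Measurable g →
      ENNReal.ofReal (N * c) ≤ ∫⁻ w in {w | r ≤ dist w z ∧ dist w z < r * Λ ^ N}, g w ^ Q ∂μ := by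
  obtain ⟨Λ, c, hΛ, hc, key⟩ := hZ.annulus
  refine ⟨Λ, c, hΛ, hc, ?_⟩
  intro ε r N z E F ω g hε hεr hE hE' hF hF' he1 he2 hf1 hf2 hadm hg
  have hr : 0 < r := by linarith
  have mon : ∀ k : ℕ, r * Λ ^ k ≤ r * Λ ^ (k + 1) := fun k => by
    gcongr
    · linarith
    · omega
  have hrk : ∀ k : ℕ, r ≤ r * Λ ^ k := fun k => by
    have : (1:ℝ) ≤ Λ ^ k := one_le_pow₀ (by linarith)
    nlinarith
  induction N with
  | zero => simp
  | succ N ih =>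
    obtain ⟨e1, he1, he1'⟩ := he1
    obtain ⟨e2, he2, he2'⟩ := he2
    obtain ⟨f1, hf1, hf1'⟩ := hf1
    obtain ⟨f2, hf2, hf2'⟩ := hf2
    have h1 := ih ⟨e2, he2, (mon N).trans he2'⟩ ⟨f2, hf2, (mon N).trans hf2'⟩
    have h2 := key ε (r * Λ ^ N) z E F ω g hε (hεr.trans (hrk N)) hE hE' hF hF'
      ⟨e1, he1, he1'.trans (hrk N)⟩ ⟨e2, he2, by rw [mul_assoc, ← pow_succ]; exact he2'⟩
      ⟨f1, hf1, hf1'.trans (hrk N)⟩ ⟨f2, hf2, by rw [mul_assoc, ← pow_succ]; exact hf2'⟩ hadm hg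
    rw [mul_assoc, ← pow_succ] at h2
    have hd : Measurable fun w => dist w z := by fun_prop
    have hm : MeasurableSet {w | r * Λ ^ N ≤ dist w z ∧ dist w z < r * Λ ^ (N + 1)} :=
      (measurableSet_le measurable_const hd).inter (measurableSet_lt hd measurable_const)
    calc ENNReal.ofReal ((N + 1 : ℕ) * c) = ENNReal.ofReal (N * c) + ENNReal.ofReal c := by
          rw [← ENNReal.ofReal_add (by positivity) hc.le]; congr 1; push_cast; ring
      _ ≤ _ := add_le_add h1 h2
      _ = ∫⁻ w in {w | r ≤ dist w z ∧ dist w z < r * Λ ^ N} ∪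
            {w | r * Λ ^ N ≤ dist w z ∧ dist w z < r * Λ ^ (N + 1)}, g w ^ Q ∂μ := by
          rw [lintegral_union hm]
          rw [Set.disjoint_left]
          intro w hw hw'
          exact absurd hw'.1 (not_le.2 hw.2)
      _ ≤ _ := by
          apply lintegral_mono_set
          rintro w (hw | hw)
          · exact ⟨hw.1, lt_of_lt_of_le hw.2 (mon N)⟩
          · exact ⟨(hrk N).trans hw.1, hw.2⟩

/-- Lower bound for the energy of a coarse upper gradient between large continua. -/
lemma LoewnerSpace.energy_lower_rel (hZ : LoewnerSpace μ Q C Ψ) {Θ : ℝ} (hΘ : 0 < Θ) :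
    ∃ c : ℝ, 0 < c ∧ ∀ (ε δ : ℝ) (E F : Set Z) (ω : Z → ℝ) (g : Z → ℝ≥0∞) (x y : Z),
      0 < ε → ε ≤ Metric.diam (Set.univ : Set Z) → IsCompact E → IsConnected E → IsCompact F →
      IsConnected F → 0 < δ → δ ≤ Metric.diam E → δ ≤ Metric.diam F → x ∈ E → y ∈ F →
      dist x y ≤ Θ * δ →
      CoarseAdm ω g ε E F → Measurable g →
      ENNReal.ofReal c ≤ ∫⁻ w, g w ^ Q ∂μ := by
  have hQ := hZ.two_le
  have hC := hZ.one_le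
  have := hZ.compact
  have hψ := hZ.pos Θ hΘ
  refine ⟨min (Ψ Θ / 6 ^ Q) (C⁻¹ / 4 ^ Q), by positivity, ?_⟩
  intro ε δ E F ω g x y hε hεD hE hE' hF hF' hδ hdE hdF hx hy hxy hadm hg
  by_cases hfar : ∀ x ∈ E, ∀ y ∈ F, 2 * ε ≤ dist x y
  · have hdis : Disjoint E F := by
      rw [Set.disjoint_left]
      intro w hw hw'
      have := hfar w hw w hw'
      rw [dist_self] at this
      linarith
    have hL := hZ.le_lintegral hE hE' hF hF' hdis hδ hdE hdF hx hy hxy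
      (g := fun w => 6 * g w) (hg.const_mul _) (by
      rintro c ⟨h0, hL⟩
      have hlen : ε ≤ c.L - 0 := by
        have h1 := c.lip.dist_le_mul 0 ⟨le_rfl, c.L_nonneg⟩ c.L ⟨c.L_nonneg, le_rfl⟩
        rw [Real.dist_eq, zero_sub, abs_neg, abs_of_nonneg c.L_nonneg] at h1
        simp at h1
        have := hfar _ h0 _ hL
        linarith
      have h6 := hadm.one_le hε hlen c.lip h0 hL
      rwa [← lintegral_const_mul' _ _ (by norm_num)] at h6)
    rw [mul_div_cancel_right₀ _ hδ.ne'] at hL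
    simp_rw [ENNReal.mul_rpow_of_nonneg _ _ (by linarith : 0 ≤ Q)] at hL
    rw [lintegral_const_mul _ (hg.pow_const _)] at hL
    refine (ENNReal.ofReal_le_ofReal (min_le_left _ _)).trans ?_
    rw [ENNReal.ofReal_div_of_pos (by positivity)]
    apply ENNReal.div_le_of_le_mul'
    rw [← ENNReal.ofReal_rpow_of_pos (by norm_num)]
    simpa using hL
  · push Not at hfar
    obtain ⟨x, hx, y, hy, hxy⟩ := hfar
    have hpt : ∀ w ∈ Metric.ball x ε, ENNReal.ofReal (1 / (4 * ε)) ≤ g w := by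
      intro w hw
      rw [Metric.mem_ball] at hw
      have h1 := hadm.left x hx w (by rw [dist_comm]; linarith)
      have h2 := hadm.right y hy w (by
        have := dist_triangle y x w
        rw [dist_comm y x, dist_comm x w] at this; linarith)
      have h3 := hadm.osc w x (by linarith)
      have h4 := hadm.osc w y (by have := dist_triangle w x y; linarith)
      rw [ENNReal.ofReal_div_of_pos (by positivity)]
      apply ENNReal.div_le_of_le_mul'
      rw [ENNReal.ofReal_mul (by norm_num)]
      calc ENNReal.ofReal 1 ≤ ENNReal.ofReal
            ((ω x + |ω w - ω x|) + (|ω w - ω y| + (1 - ω y))) := by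
            apply ENNReal.ofReal_le_ofReal
            have := le_abs_self (ω w - ω x)
            have := neg_abs_le (ω w - ω y)
            linarith
        _ ≤ (ENNReal.ofReal (ω x) + ENNReal.ofReal |ω w - ω x|) +
            (ENNReal.ofReal |ω w - ω y| + ENNReal.ofReal (1 - ω y)) :=
            ENNReal.ofReal_add_le.trans
              (add_le_add ENNReal.ofReal_add_le ENNReal.ofReal_add_le)
        _ ≤ (ENNReal.ofReal ε * g w + ENNReal.ofReal ε * g w) +
            (ENNReal.ofReal ε * g w + ENNReal.ofReal ε * g w) := by gcongr
        _ = ENNReal.ofReal 4 * ENNReal.ofReal ε * g w := by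
            rw [ENNReal.ofReal_ofNat]; ring
    calc ENNReal.ofReal (min (Ψ Θ / 6 ^ Q) (C⁻¹ / 4 ^ Q))
        ≤ ENNReal.ofReal (C⁻¹ / 4 ^ Q) := ENNReal.ofReal_le_ofReal (min_le_right _ _)
      _ = ENNReal.ofReal ((1 / (4 * ε)) ^ Q) * ENNReal.ofReal (C⁻¹ * ε ^ Q) := by
          rw [← ENNReal.ofReal_mul (by positivity)]
          congr 1
          rw [Real.div_rpow (by norm_num) (by positivity), Real.mul_rpow (by norm_num) hε.le,
            Real.one_rpow]
          have : 0 < ε ^ Q := by positivity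
          field_simp
      _ ≤ ENNReal.ofReal ((1 / (4 * ε)) ^ Q) * μ (Metric.ball x ε) := by
          gcongr; exact hZ.lower x ε hε hεD
      _ = ∫⁻ w in Metric.ball x ε, ENNReal.ofReal ((1 / (4 * ε)) ^ Q) ∂μ := by
          rw [setLIntegral_const]
      _ ≤ ∫⁻ w in Metric.ball x ε, g w ^ Q ∂μ := by
          apply setLIntegral_mono' Metric.isOpen_ball.measurableSet
          intro w hw
          rw [← ENNReal.ofReal_rpow_of_nonneg (by positivity) (by linarith)]
          gcongr
          exact hpt w hw
      _ ≤ _ := setLIntegral_le_lintegral _ _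

/-- Continua of diameter at least `δ` carry a definite amount of coarse energy. -/
lemma LoewnerSpace.energy_lower (hZ : LoewnerSpace μ Q C Ψ) {δ : ℝ} (hδ : 0 < δ) :
    ∃ c : ℝ, 0 < c ∧ ∀ (ε : ℝ) (E F : Set Z) (ω : Z → ℝ) (g : Z → ℝ≥0∞),
      0 < ε → ε ≤ Metric.diam (Set.univ : Set Z) → IsCompact E → IsConnected E → IsCompact F →
      IsConnected F → δ ≤ Metric.diam E → δ ≤ Metric.diam F →
      CoarseAdm ω g ε E F → Measurable g →
      ENNReal.ofReal c ≤ ∫⁻ w, g w ^ Q ∂μ := by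
  have := hZ.compact
  obtain ⟨c, hc, key⟩ := hZ.energy_lower_rel
    (Θ := max (Metric.diam (Set.univ : Set Z)) 1 / δ) (by positivity)
  refine ⟨c, hc, ?_⟩
  intro ε E F ω g hε hεD hE hE' hF hF' hdE hdF hadm hg
  obtain ⟨x, hx⟩ := hE'.nonempty
  obtain ⟨y, hy⟩ := hF'.nonempty
  refine key ε δ E F ω g x y hε hεD hE hE' hF hF' hδ hdE hdF hx hy ?_ hadm hg
  rw [div_mul_cancel₀ _ hδ.ne']
  exact (Metric.dist_le_diam_of_mem isCompact_univ.isBounded (Set.mem_univ _)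
    (Set.mem_univ _)).trans (le_max_left _ _)

end Loewner

/-- Existence of a potential: a functional vanishing on the kernel of `T` is represented by
`⟪T p, T ·⟫`. -/
lemma exists_inner_eq {E S : Type*} [AddCommGroup E] [Module ℝ E] [Fintype S]
    (T : E →ₗ[ℝ] EuclideanSpace ℝ S) (F : E →ₗ[ℝ] ℝ) (h : ∀ g, T g = 0 → F g = 0) :
    ∃ p, ∀ g, inner ℝ (T p) (T g) = F g := by
  obtain ⟨f, hf⟩ := LinearMap.exists_rightInverse_of_surjective T.rangeRestrict
    (LinearMap.range_rangeRestrict T)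
  have hF : ∀ g, F (f (T.rangeRestrict g)) = F g := by
    intro g
    have h1 : T (f (T.rangeRestrict g) - g) = 0 := by
      have : T (f (T.rangeRestrict g)) = T g :=
        congrArg Subtype.val (LinearMap.congr_fun hf (T.rangeRestrict g))
      rw [map_sub, this, sub_self]
    have h2 := h _ h1
    rw [map_sub] at h2
    linarith
  set ℓ : T.range →L[ℝ] ℝ := LinearMap.toContinuousLinearMap (F ∘ₗ f)
  obtain ⟨p, hp⟩ := ((InnerProductSpace.toDual ℝ T.range).symm ℓ).2
  refine ⟨p, fun g => ?_⟩
  have := InnerProductSpace.toDual_symm_apply (𝕜 := ℝ) (x := T.rangeRestrict g) (y := ℓ)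
  rw [Submodule.coe_inner, ← hp] at this
  rw [← hF g]
  exact this

lemma exists_potential {S B : Type*} (Sd : Finset S) (src tgt : S → B) (F : (B → ℝ) →ₗ[ℝ] ℝ)
    (h : ∀ g : B → ℝ, (∀ σ ∈ Sd, g (src σ) = g (tgt σ)) → F g = 0) :
    ∃ p : B → ℝ, ∀ g : B → ℝ,
      ∑ σ ∈ Sd, (p (tgt σ) - p (src σ)) * (g (tgt σ) - g (src σ)) = F g := by
  let T : (B → ℝ) →ₗ[ℝ] EuclideanSpace ℝ Sd :=
    { toFun := fun g => WithLp.toLp 2 fun σ : Sd => g (tgt σ) - g (src σ)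
      map_add' := by intro g g'; ext σ; simp; ring
      map_smul' := by intro c g; ext σ; simp; ring }
  obtain ⟨p, hp⟩ := exists_inner_eq T F (by
    intro g hg
    apply h
    intro σ hσ
    have := congrArg (fun v : EuclideanSpace ℝ Sd => v ⟨σ, hσ⟩) hg
    simp [T] at this
    linarith)
  refine ⟨p, fun g => ?_⟩
  rw [← hp g, PiLp.inner_apply, ← Finset.sum_coe_sort]
  apply Finset.sum_congr rfl
  intro σ _
  simp [T]
  ring

/-- Sides between adjacent boxes of the grid `ℤ/N × {0, …, M-1}`: the side `(false, i, j)` is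
between `(i, j)` and `(i + 1, j)`, the side `(true, i, j)` between `(i, j)` and `(i, j + 1)`. -/
abbrev Side (N : ℕ) := Bool × ZMod N × ℕ

namespace Side

variable {N : ℕ}

def src (σ : Side N) : ZMod N × ℕ := σ.2

def tgt (σ : Side N) : ZMod N × ℕ :=
  if σ.1 then (σ.2.1, σ.2.2 + 1) else (σ.2.1 + 1, σ.2.2)

end Side

/-- The sides of the grid of height `M`. -/
def sides (N : ℕ) [NeZero N] (M : ℕ) : Finset (Side N) :=
  (Finset.univ ×ˢ (Finset.univ ×ˢ Finset.range M)).filter fun σ => σ.1 = true → σ.2.2 + 1 < M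

/-- Adjacency of boxes. -/
def BoxAdj (N : ℕ) [NeZero N] (M : ℕ) (b c : ZMod N × ℕ) : Prop :=
  ∃ σ ∈ sides N M, (σ.src = b ∧ σ.tgt = c) ∨ (σ.src = c ∧ σ.tgt = b)

section Grid

variable {N : ℕ} [NeZero N]

lemma mem_sides_false {M : ℕ} {i : ZMod N} {j : ℕ} :
    ((false, i, j) : Side N) ∈ sides N M ↔ j < M := by
  simp [sides]

lemma mem_sides_true {M : ℕ} {i : ZMod N} {j : ℕ} :
    ((true, i, j) : Side N) ∈ sides N M ↔ j + 1 < M := by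
  simp [sides]
  omega

lemma sum_sides (m : ℕ) {R : Type*} [AddCommMonoid R] (f : Side N → R) :
    ∑ σ ∈ sides N (m + 1), f σ =
      (∑ i : ZMod N, ∑ j ∈ Finset.range m, f (true, i, j)) +
        ∑ i : ZMod N, ∑ j ∈ Finset.range (m + 1), f (false, i, j) := by
  unfold sides
  rw [Finset.sum_filter, Finset.sum_product, Fintype.sum_bool, Finset.sum_product,
    Finset.sum_product]
  congr 1
  · apply Finset.sum_congr rfl
    intro i _
    rw [Finset.sum_range_succ]
    simp only [forall_const, add_lt_add_iff_right, lt_self_iff_false, if_false, add_zero]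
    apply Finset.sum_congr rfl
    intro j hj
    rw [if_pos (Finset.mem_range.1 hj)]

lemma side_bounds {M : ℕ} {σ : Side N} (h : σ ∈ sides N M) : σ.src.2 < M ∧ σ.tgt.2 < M := by
  obtain ⟨b, i, j⟩ := σ
  cases b
  · rw [mem_sides_false] at h; simp [Side.src, Side.tgt, h]
  · rw [mem_sides_true] at h
    simp only [Side.src, Side.tgt, if_true]
    omega

lemma boxAdj_symm {M : ℕ} {b c : ZMod N × ℕ} (h : BoxAdj N M b c) : BoxAdj N M c b := by
  obtain ⟨σ, hσ, h⟩ := h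
  exact ⟨σ, hσ, h.symm⟩

lemma eq_of_periodic {R : Type*} {f : ℤ → R} (hf : ∀ I, f (I + N) = f I) {I J : ℤ}
    (h : (I : ZMod N) = J) : f I = f J := by
  have hp : Function.Periodic f (N : ℤ) := hf
  rw [ZMod.intCast_eq_intCast_iff_dvd_sub] at h
  obtain ⟨k, hk⟩ := h
  have := hp.int_mul k I
  rw [← this]
  congr 1
  rw [Int.cast_id]
  linarith

/-- Difference of a corner function across a side. -/
def cornerDiff {R : Type*} [Sub R] (B : ℤ → ℕ → R) (σ : Side N) : R :=
  if σ.1 then B (σ.2.1.val + 1) (σ.2.2 + 1) - B σ.2.1.val (σ.2.2 + 1)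
  else B (σ.2.1.val + 1) σ.2.2 - B (σ.2.1.val + 1) (σ.2.2 + 1)

lemma abel_vertical (m : ℕ) (w g : ℕ → ℝ) :
    ∑ j ∈ Finset.range m, w (j + 1) * (g (j + 1) - g j) =
      w (m + 1) * g m - w 0 * g 0 - ∑ j ∈ Finset.range (m + 1), (w (j + 1) - w j) * g j := by
  induction m with
  | zero => simp; ring
  | succ m ih =>
    rw [Finset.sum_range_succ, ih, Finset.sum_range_succ (n := m + 1)]
    ring

/-- Discrete Green formula: cochains coming from corner functions are divergence free. -/
lemma sum_cornerDiff (m : ℕ) {B : ℤ → ℕ → ℝ} {k : ℝ} (hB : ∀ I j, B (I + N) j = B I j + k)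
    (g : ZMod N × ℕ → ℝ) :
    ∑ σ ∈ sides N (m + 1), cornerDiff B σ * (g σ.tgt - g σ.src) =
      ∑ i : ZMod N, (B (i.val + 1) (m + 1) - B i.val (m + 1)) * g (i, m) -
      ∑ i : ZMod N, (B (i.val + 1) 0 - B i.val 0) * g (i, 0) := by
  rw [sum_sides]
  have hv : ∀ i : ZMod N, ∑ j ∈ Finset.range m, cornerDiff B (true, i, j) *
      (g (Side.tgt (true, i, j)) - g (Side.src (true, i, j))) =
      (B (i.val + 1) (m + 1) - B i.val (m + 1)) * g (i, m) -
      (B (i.val + 1) 0 - B i.val 0) * g (i, 0) -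
      ∑ j ∈ Finset.range (m + 1), ((B (i.val + 1) (j + 1) - B i.val (j + 1)) -
        (B (i.val + 1) j - B i.val j)) * g (i, j) := fun i =>
    abel_vertical m (fun j => B (i.val + 1) j - B i.val j) fun j => g (i, j)
  have hh : ∑ i : ZMod N, ∑ j ∈ Finset.range (m + 1), cornerDiff B (false, i, j) *
      (g (Side.tgt (false, i, j)) - g (Side.src (false, i, j))) =
      ∑ i : ZMod N, ∑ j ∈ Finset.range (m + 1), ((B (i.val + 1) (j + 1) - B i.val (j + 1)) -
        (B (i.val + 1) j - B i.val j)) * g (i, j) := by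
    rw [Finset.sum_comm, Finset.sum_comm (s := Finset.univ)]
    apply Finset.sum_congr rfl
    intro j _
    set u : ZMod N → ℝ := fun i => B (i.val + 1) j - B (i.val + 1) (j + 1) with hu
    have e1 : ∑ i : ZMod N, u i * g (i + 1, j) = ∑ i : ZMod N, u (i - 1) * g (i, j) := by
      rw [← Equiv.sum_comp (Equiv.addRight (1 : ZMod N)) (fun i => u (i - 1) * g (i, j))]
      simp
    have e2 : ∀ i : ZMod N, u (i - 1) = B i.val j - B i.val (j + 1) := by
      intro i
      apply eq_of_periodic (N := N) (f := fun I => B I j - B I (j + 1))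
      · intro I; rw [hB, hB]; ring
      · push_cast
        simp
    calc _ = ∑ i : ZMod N, (u i * g (i + 1, j) - u i * g (i, j)) := by
          apply Finset.sum_congr rfl
          intro i _
          simp [cornerDiff, Side.tgt, Side.src, hu]
          ring
      _ = _ := by
          rw [Finset.sum_sub_distrib, e1, ← Finset.sum_sub_distrib]
          apply Finset.sum_congr rfl
          intro i _
          rw [e2]
          simp only [hu]
          ring
  rw [Finset.sum_congr rfl fun i _ => hv i, hh, Finset.sum_sub_distrib, Finset.sum_sub_distrib]
  ring

lemma sum_row_diff {B : ℤ → ℝ} {k : ℝ} (hB : ∀ I, B (I + N) = B I + k) :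
    ∑ i : ZMod N, (B (i.val + 1) - B i.val) = k := by
  have h1 : ∑ i : ZMod N, (B (i.val + 1) - B i.val) =
      ∑ n ∈ Finset.range N, (B ((n : ℤ) + 1) - B n) := by
    obtain ⟨n, hn⟩ : ∃ n, N = n + 1 := ⟨N - 1, by have := NeZero.ne N; omega⟩
    subst hn
    exact (Finset.sum_range (fun n : ℕ => B ((n : ℤ) + 1) - B n)).symm
  rw [h1]
  have := Finset.sum_range_sub (fun n : ℕ => B n) N
  push_cast at this
  rw [this]
  have := hB 0
  rw [zero_add] at this
  rw [this]
  ring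

lemma sum_cornerDiff_of_rows (m : ℕ) {B : ℤ → ℕ → ℝ} (hB : ∀ I j, B (I + N) j = B I j + 1)
    (g : ZMod N × ℕ → ℝ) {gx gy : ℝ} (hx : ∀ i, g (i, 0) = gx) (hy : ∀ i, g (i, m) = gy) :
    ∑ σ ∈ sides N (m + 1), cornerDiff B σ * (g σ.tgt - g σ.src) = gy - gx := by
  rw [sum_cornerDiff m hB]
  simp_rw [hx, hy, ← Finset.sum_mul]
  rw [sum_row_diff (B := fun I => B I (m + 1)) (fun I => hB I _),
    sum_row_diff (B := fun I => B I 0) (fun I => hB I _)]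
  ring

/-- A divergence free flow with uniform inflow and outflow comes from a corner function. -/
lemma exists_conjugate (m : ℕ) (J : Side N → ℝ)
    (hJ : ∀ g : ZMod N × ℕ → ℝ, ∑ σ ∈ sides N (m + 1), J σ * (g σ.tgt - g σ.src) =
      ∑ i : ZMod N, (N : ℝ)⁻¹ * (g (i, m) - g (i, 0))) :
    ∃ θ : ℤ → ℕ → ℝ, (∀ I j, θ (I + N) j = θ I j + 1) ∧
      ∀ σ ∈ sides N (m + 1), cornerDiff θ σ = J σ := by
  have hN : (N : ℝ) ≠ 0 := by exact_mod_cast NeZero.ne N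
  refine ⟨fun I j => I * (N : ℝ)⁻¹ - ∑ j' ∈ Finset.range j, J (false, ((I - 1 : ℤ) : ZMod N), j'),
    ?_, ?_⟩
  · intro I j
    push_cast
    simp only [add_mul, mul_inv_cancel₀ hN]
    have : ((I : ZMod N) + (N : ZMod N) - 1) = (I : ZMod N) - 1 := by simp
    rw [this]
    ring
  · rintro ⟨b, i, j⟩ hσ
    cases b
    · rw [mem_sides_false] at hσ
      simp only [cornerDiff, Bool.false_eq_true, if_false]
      rw [Finset.sum_range_succ]
      push_cast
      simp
    · rw [mem_sides_true] at hσ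
      have h := hJ (fun b => if b.1 = i ∧ b.2 ≤ j then 1 else 0)
      rw [sum_sides] at h
      have h1 : ∑ i' : ZMod N, ∑ j' ∈ Finset.range m, J (true, i', j') *
          ((if (Side.tgt (true, i', j') : ZMod N × ℕ).1 = i ∧ (Side.tgt (true, i', j')).2 ≤ j
            then (1:ℝ) else 0) - if (Side.src (true, i', j') : ZMod N × ℕ).1 = i ∧
            (Side.src (true, i', j')).2 ≤ j then 1 else 0) = - J (true, i, j) := by
        rw [Finset.sum_eq_single i, Finset.sum_eq_single j]
        · simp [Side.tgt, Side.src]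
        · intro j' _ hne
          have : j' + 1 ≤ j ↔ j' ≤ j := by omega
          simp [Side.tgt, Side.src, this]
        · intro h; rw [Finset.mem_range] at h; omega
        · intro i' _ hne
          simp [Side.tgt, Side.src, hne]
        · simp
      have h2 : ∑ i' : ZMod N, ∑ j' ∈ Finset.range (m + 1), J (false, i', j') *
          ((if (Side.tgt (false, i', j') : ZMod N × ℕ).1 = i ∧ (Side.tgt (false, i', j')).2 ≤ j
            then (1:ℝ) else 0) - if (Side.src (false, i', j') : ZMod N × ℕ).1 = i ∧
            (Side.src (false, i', j')).2 ≤ j then 1 else 0) =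
          ∑ j' ∈ Finset.range (j + 1), J (false, i - 1, j') -
            ∑ j' ∈ Finset.range (j + 1), J (false, i, j') := by
        rw [Finset.sum_comm]
        have e : ∀ j', ∑ i' : ZMod N, J (false, i', j') *
          ((if (Side.tgt (false, i', j') : ZMod N × ℕ).1 = i ∧ (Side.tgt (false, i', j')).2 ≤ j
            then (1:ℝ) else 0) - if (Side.src (false, i', j') : ZMod N × ℕ).1 = i ∧
            (Side.src (false, i', j')).2 ≤ j then 1 else 0) =
            if j' < j + 1 then J (false, i - 1, j') - J (false, i, j') else 0 := by
          intro j'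
          simp only [Side.tgt, Side.src, Bool.false_eq_true, if_false, mul_sub, mul_ite, mul_one,
            mul_zero, Finset.sum_sub_distrib]
          by_cases hj : j' ≤ j
          · simp only [hj, and_true, Nat.lt_succ_of_le hj, if_true, ← eq_sub_iff_add_eq]
            simp
          · simp [hj, show ¬ j' < j + 1 by omega]
        rw [Finset.sum_congr rfl fun j' _ => e j', ← Finset.sum_filter, Finset.sum_sub_distrib]
        have : (Finset.range (m + 1)).filter (fun j' => j' < j + 1) = Finset.range (j + 1) := by
          ext x; simp; omega
        rw [this]
      have h3 : ∑ i' : ZMod N, (N : ℝ)⁻¹ * ((if i' = i ∧ m ≤ j then (1:ℝ) else 0) -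
          if i' = i ∧ 0 ≤ j then 1 else 0) = - (N : ℝ)⁻¹ := by
        rw [Finset.sum_eq_single i]
        · have : ¬ m ≤ j := by omega
          simp [this]
        · intro i' _ hne; simp [hne]
        · simp
      rw [h1, h2] at h
      rw [h3] at h
      simp only [cornerDiff, if_true]
      push_cast
      simp only [ZMod.natCast_val, ZMod.cast_id', id_eq, add_sub_cancel_right]
      linarith

end Grid

/-- A partition of the grid of height `m + 1` into connected pieces, with constant bottom and top
rows. -/
structure IsBoxPart {N : ℕ} [NeZero N] (m : ℕ) {V : Type*} (root : ZMod N × ℕ → V) (vx vy : V) :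
    Prop where
  ne : vx ≠ vy
  bottom : ∀ i, root (i, 0) = vx
  top : ∀ i, root (i, m) = vy
  surj : ∀ v, ∃ b, b.2 < m + 1 ∧ root b = v
  conn : ∀ b e, b.2 < m + 1 → e.2 < m + 1 → root b = root e →
    Relation.ReflTransGen (fun c d => BoxAdj N (m + 1) c d ∧ root c = root b ∧ root d = root b) b e

/-- The harmonic potential `a` of a partition, with unit resistances on one chosen side for every
pair of neighbouring pieces, and a conjugate function `θ` on corners. -/
structure BoxFlow {N : ℕ} [NeZero N] (m : ℕ) {V : Type*} (root : ZMod N × ℕ → V) (vx vy : V) where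
  chosen : Finset (Side N)
  a : V → ℝ
  p : ZMod N × ℕ → ℝ
  θ : ℤ → ℕ → ℝ
  sub : chosen ⊆ sides N (m + 1)
  ext : ∀ σ ∈ chosen, root σ.src ≠ root σ.tgt
  rep : ∀ σ ∈ sides N (m + 1), root σ.src ≠ root σ.tgt →
    ∃ σ' ∈ chosen, s(root σ'.src, root σ'.tgt) = s(root σ.src, root σ.tgt)
  inj : ∀ σ ∈ chosen, ∀ σ' ∈ chosen,
    s(root σ'.src, root σ'.tgt) = s(root σ.src, root σ.tgt) → σ' = σ
  per : ∀ I j, θ (I + N) j = θ I j + 1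
  diff_chosen : ∀ σ ∈ chosen, cornerDiff θ σ = a (root σ.tgt) - a (root σ.src)
  diff_int : ∀ σ ∈ sides N (m + 1), root σ.src = root σ.tgt →
    cornerDiff θ σ = p σ.tgt - p σ.src
  diff_zero : ∀ σ ∈ sides N (m + 1), σ ∉ chosen → root σ.src ≠ root σ.tgt → cornerDiff θ σ = 0
  unit : ∀ G : V → ℝ, ∑ σ ∈ chosen, (a (root σ.tgt) - a (root σ.src)) *
    (G (root σ.tgt) - G (root σ.src)) = G vy - G vx

section

variable {N : ℕ} [NeZero N] {m : ℕ} {V : Type*} {root : ZMod N × ℕ → V} {vx vy : V}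

lemma exists_chosen (S : Finset (Side N)) (root : ZMod N × ℕ → V) :
    ∃ T ⊆ S, (∀ σ ∈ T, root σ.src ≠ root σ.tgt) ∧
      (∀ σ ∈ S, root σ.src ≠ root σ.tgt →
        ∃ σ' ∈ T, s(root σ'.src, root σ'.tgt) = s(root σ.src, root σ.tgt)) ∧
      ∀ σ ∈ T, ∀ σ' ∈ T,
        s(root σ'.src, root σ'.tgt) = s(root σ.src, root σ.tgt) → σ' = σ := by
  classical
  let f : Side N → Sym2 V := fun σ => s(root σ.src, root σ.tgt)
  let S' := S.filter fun σ => root σ.src ≠ root σ.tgt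
  have h : ∀ q : S'.image f, ∃ σ ∈ S', f σ = q := fun q => Finset.mem_image.1 q.2
  choose r hr hfr using h
  refine ⟨Finset.univ.image r, ?_, ?_, ?_, ?_⟩
  · intro σ hσ
    obtain ⟨q, -, rfl⟩ := Finset.mem_image.1 hσ
    exact (Finset.mem_filter.1 (hr q)).1
  · intro σ hσ
    obtain ⟨q, -, rfl⟩ := Finset.mem_image.1 hσ
    exact (Finset.mem_filter.1 (hr q)).2
  · intro σ hσ hne
    have : f σ ∈ S'.image f := Finset.mem_image_of_mem _ (Finset.mem_filter.2 ⟨hσ, hne⟩)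
    exact ⟨r ⟨f σ, this⟩, Finset.mem_image_of_mem _ (Finset.mem_univ _), hfr ⟨f σ, this⟩⟩
  · intro σ hσ σ' hσ' he
    obtain ⟨q, -, rfl⟩ := Finset.mem_image.1 hσ
    obtain ⟨q', -, rfl⟩ := Finset.mem_image.1 hσ'
    have e1 := hfr q
    have e2 := hfr q'
    have : q' = q := Subtype.ext (by rw [← e1, ← e2]; exact he)
    rw [this]

lemma IsBoxPart.const (h : IsBoxPart m root vx vy) {G : V → ℝ}
    (hG : ∀ σ ∈ sides N (m + 1), G (root σ.src) = G (root σ.tgt)) : G vy = G vx := by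
  have : ∀ j, j ≤ m → G (root (0, j)) = G vx := by
    intro j
    induction j with
    | zero => intro _; rw [h.bottom]
    | succ j ih =>
      intro hj
      rw [← ih (by omega)]
      exact (hG (true, 0, j) (mem_sides_true.2 (by omega))).symm
  rw [← this m le_rfl, h.top]

lemma IsBoxPart.factor (h : IsBoxPart m root vx vy) {g : ZMod N × ℕ → ℝ}
    (hg : ∀ σ ∈ sides N (m + 1), root σ.src = root σ.tgt → g σ.src = g σ.tgt) :
    ∃ G : V → ℝ, ∀ b : ZMod N × ℕ, b.2 < m + 1 → g b = G (root b) := by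
  choose β hβ hβ' using h.surj
  refine ⟨fun v => g (β v), fun b hb => ?_⟩
  have := h.conn b (β (root b)) hb (hβ _) (hβ' _).symm
  have key : ∀ c, Relation.ReflTransGen (fun c d => BoxAdj N (m + 1) c d ∧ root c = root b ∧
      root d = root b) b c → g b = g c := by
    intro c hc
    induction hc with
    | refl => rfl
    | tail _ hcd ih =>
      obtain ⟨⟨σ, hσ, h1⟩, h2, h3⟩ := hcd
      rw [ih]
      rcases h1 with ⟨rfl, rfl⟩ | ⟨rfl, rfl⟩
      · exact hg σ hσ (h2.trans h3.symm)
      · exact (hg σ hσ (h3.trans h2.symm)).symm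
  exact key _ this

lemma IsBoxPart.exists_flow (h : IsBoxPart m root vx vy) : Nonempty (BoxFlow m root vx vy) := by
  classical
  obtain ⟨T, hTS, hText, hTrep, hTinj⟩ := exists_chosen (sides N (m + 1)) root
  obtain ⟨a, ha⟩ := exists_potential T (fun σ => root σ.src) (fun σ => root σ.tgt)
    { toFun := fun G => G vy - G vx
      map_add' := by intro G G'; simp only [Pi.add_apply]; ring
      map_smul' := by intro c G; simp only [Pi.smul_apply, smul_eq_mul, RingHom.id_apply]; ring }
    (by
      intro G hG
      have := h.const (G := G) (by
        intro σ hσ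
        by_cases hne : root σ.src = root σ.tgt
        · rw [hne]
        · obtain ⟨σ', hσ', he⟩ := hTrep σ hσ hne
          have := hG σ' hσ'
          rw [Sym2.eq_iff] at he
          rcases he with ⟨h1, h2⟩ | ⟨h1, h2⟩
          · rw [← h1, ← h2, this]
          · rw [← h1, ← h2, this])
      change G vy - G vx = 0
      rw [this, sub_self])
  have ha' : ∀ G : V → ℝ, ∑ σ ∈ T, (a (root σ.tgt) - a (root σ.src)) *
    (G (root σ.tgt) - G (root σ.src)) = G vy - G vx := fun G => ha G
  let F : (ZMod N × ℕ → ℝ) →ₗ[ℝ] ℝ :=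
    { toFun := fun g => ∑ i : ZMod N, (N : ℝ)⁻¹ * (g (i, m) - g (i, 0)) -
        ∑ σ ∈ T, (a (root σ.tgt) - a (root σ.src)) * (g σ.tgt - g σ.src)
      map_add' := by
        intro g g'
        simp only [Pi.add_apply]
        rw [sub_add_sub_comm, ← Finset.sum_add_distrib, ← Finset.sum_add_distrib]
        congr 1 <;> exact Finset.sum_congr rfl fun _ _ => by ring
      map_smul' := by
        intro c g
        simp only [Pi.smul_apply, smul_eq_mul, RingHom.id_apply]
        rw [mul_sub, Finset.mul_sum, Finset.mul_sum]
        congr 1 <;> exact Finset.sum_congr rfl fun _ _ => by ring }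
  have hN : (N : ℝ) ≠ 0 := by exact_mod_cast NeZero.ne N
  obtain ⟨p, hp⟩ := exists_potential
    ((sides N (m + 1)).filter fun σ => root σ.src = root σ.tgt) Side.src Side.tgt F (by
      intro g hg
      obtain ⟨G, hG⟩ := h.factor (g := g) (fun σ hσ he => hg σ (Finset.mem_filter.2 ⟨hσ, he⟩))
      have e1 : ∑ i : ZMod N, (N : ℝ)⁻¹ * (g (i, m) - g (i, 0)) = G vy - G vx := by
        rw [Finset.sum_congr rfl fun i _ => by
          rw [hG (i, m) (by simp), hG (i, 0) (by simp), h.bottom, h.top]]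
        rw [Finset.sum_const, Finset.card_univ, ZMod.card, nsmul_eq_mul, ← mul_assoc,
          mul_inv_cancel₀ hN, one_mul]
      have e2 : ∑ σ ∈ T, (a (root σ.tgt) - a (root σ.src)) * (g σ.tgt - g σ.src) =
          G vy - G vx := by
        rw [← ha' G]
        refine Finset.sum_congr rfl fun σ hσ => ?_
        have := side_bounds (hTS hσ)
        rw [hG _ this.1, hG _ this.2]
      change _ - _ = (0 : ℝ)
      rw [e1, e2, sub_self])
  let J : Side N → ℝ := fun σ => if σ ∈ T then a (root σ.tgt) - a (root σ.src)
    else if root σ.src = root σ.tgt then p σ.tgt - p σ.src else 0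
  obtain ⟨θ, hper, hθ⟩ := exists_conjugate m J (by
    intro g
    have hsplit : ∀ σ ∈ sides N (m + 1), J σ * (g σ.tgt - g σ.src) =
        (if σ ∈ T then (a (root σ.tgt) - a (root σ.src)) * (g σ.tgt - g σ.src) else 0) +
        if root σ.src = root σ.tgt then (p σ.tgt - p σ.src) * (g σ.tgt - g σ.src) else 0 := by
      intro σ hσ
      by_cases h1 : σ ∈ T
      · simp [J, h1, hText σ h1]
      · by_cases h2 : root σ.src = root σ.tgt
        · simp [J, h1, h2]
        · simp [J, h1, h2]
    rw [Finset.sum_congr rfl hsplit, Finset.sum_add_distrib, ← Finset.sum_filter,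
      ← Finset.sum_filter (p := fun σ : Side N => root σ.src = root σ.tgt), hp g,
      Finset.filter_mem_eq_inter, Finset.inter_eq_right.2 hTS]
    exact add_sub_cancel _ _)
  exact ⟨{ chosen := T, a := a, p := p, θ := θ, sub := hTS, ext := hText, rep := hTrep,
           inj := hTinj, per := hper, unit := ha'
           diff_chosen := by
             intro σ hσ
             rw [hθ σ (hTS hσ)]; simp [J, hσ]
           diff_int := by
             intro σ hσ he
             rw [hθ σ hσ]
             have : σ ∉ T := fun h => hText σ h he
             simp [J, this, he]
           diff_zero := by
             intro σ hσ h1 h2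
             rw [hθ σ hσ]
             simp [J, h1, h2] }⟩

namespace BoxFlow

variable (f : BoxFlow m root vx vy)

/-- Integer flows obtained by rounding the conjugate function. -/
noncomputable def B (t : ℝ) (I : ℤ) (j : ℕ) : ℤ := ⌊f.θ I j - t⌋

lemma B_per (t : ℝ) (I : ℤ) (j : ℕ) : f.B t (I + N) j = f.B t I j + 1 := by
  unfold B
  rw [f.per, ← Int.floor_add_one]
  congr 1
  ring

noncomputable def n (t : ℝ) (σ : Side N) : ℤ := cornerDiff (f.B t) σ

/-- The two corners of a side. -/
def _root_.Side.c1 (σ : Side N) : ℤ × ℕ :=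
  if σ.1 then (σ.2.1.val, σ.2.2 + 1) else (σ.2.1.val + 1, σ.2.2 + 1)

def _root_.Side.c2 (σ : Side N) : ℤ × ℕ :=
  if σ.1 then (σ.2.1.val + 1, σ.2.2 + 1) else (σ.2.1.val + 1, σ.2.2)

lemma _root_.cornerDiff_eq {R : Type*} [Sub R] (B : ℤ → ℕ → R) (σ : Side N) :
    cornerDiff B σ = B σ.c2.1 σ.c2.2 - B σ.c1.1 σ.c1.2 := by
  obtain ⟨b, i, j⟩ := σ
  cases b <;> simp [cornerDiff, Side.c1, Side.c2]

noncomputable def t1 (σ : Side N) : ℝ := f.θ σ.c1.1 σ.c1.2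

noncomputable def t2 (σ : Side N) : ℝ := f.θ σ.c2.1 σ.c2.2

lemma n_eq (t : ℝ) (σ : Side N) : f.n t σ = ⌊f.t2 σ - t⌋ - ⌊f.t1 σ - t⌋ := by
  simp [n, cornerDiff_eq, B, t1, t2]

lemma diff_eq (σ : Side N) : cornerDiff f.θ σ = f.t2 σ - f.t1 σ := cornerDiff_eq _ _

lemma n_nonneg {t : ℝ} {σ : Side N} (h : 0 ≤ f.t2 σ - f.t1 σ) : 0 ≤ f.n t σ := by
  rw [n_eq, sub_nonneg]
  exact Int.floor_le_floor (by linarith)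

lemma n_nonpos {t : ℝ} {σ : Side N} (h : f.t2 σ - f.t1 σ ≤ 0) : f.n t σ ≤ 0 := by
  rw [n_eq, sub_nonpos]
  exact Int.floor_le_floor (by linarith)

lemma n_mul_nonneg (t : ℝ) (σ : Side N) : 0 ≤ (f.n t σ : ℝ) * (f.t2 σ - f.t1 σ) := by
  rcases le_total 0 (f.t2 σ - f.t1 σ) with h | h
  · exact mul_nonneg (by exact_mod_cast f.n_nonneg h) h
  · exact mul_nonneg_of_nonpos_of_nonpos (by exact_mod_cast f.n_nonpos h) h

lemma n_eq_zero {t : ℝ} {σ : Side N} (h : f.t2 σ - f.t1 σ = 0) : f.n t σ = 0 :=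
  le_antisymm (f.n_nonpos h.le) (f.n_nonneg h.ge)

lemma sum_n (t : ℝ) (g : ZMod N × ℕ → ℝ) {gx gy : ℝ} (hx : ∀ i, g (i, 0) = gx)
    (hy : ∀ i, g (i, m) = gy) :
    ∑ σ ∈ sides N (m + 1), (f.n t σ : ℝ) * (g σ.tgt - g σ.src) = gy - gx := by
  rw [← sum_cornerDiff_of_rows m (B := fun I j => (f.B t I j : ℝ))
    (fun I j => by rw [f.B_per]; push_cast; rfl) g hx hy]
  refine Finset.sum_congr rfl fun σ _ => ?_
  rw [n, cornerDiff_eq, cornerDiff_eq]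
  push_cast
  rfl

lemma n_eq_zero_of_ext {t : ℝ} {σ : Side N} (hσ : σ ∈ sides N (m + 1)) (h : σ ∉ f.chosen)
    (hne : root σ.src ≠ root σ.tgt) : f.n t σ = 0 :=
  f.n_eq_zero (by rw [← diff_eq]; exact f.diff_zero σ hσ h hne)

lemma sum_n_chosen (hP : IsBoxPart m root vx vy) (t : ℝ) (G : V → ℝ) :
    ∑ σ ∈ f.chosen, (f.n t σ : ℝ) * (G (root σ.tgt) - G (root σ.src)) = G vy - G vx := by
  rw [← f.sum_n t (fun b => G (root b)) (fun i => by rw [hP.bottom]) (fun i => by rw [hP.top])]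
  apply Finset.sum_subset f.sub
  intro σ hσ hn
  by_cases he : root σ.src = root σ.tgt
  · rw [he, sub_self, mul_zero]
  · rw [f.n_eq_zero_of_ext hσ hn he]; simp

/-- `τ` is covered by an edge at `v`. -/
def Cov (v : V) (τ : ℝ) : Prop := ∃ σ ∈ f.chosen, (root σ.src = v ∨ root σ.tgt = v) ∧ f.n τ σ ≠ 0

lemma cov_end (hP : IsBoxPart m root vx vy) {v : V} (hv : v = vx ∨ v = vy) (τ : ℝ) :
    f.Cov v τ := by
  classical
  by_contra hcov
  have := f.sum_n_chosen hP τ (fun w => if w = v then 1 else 0)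
  rw [Finset.sum_eq_zero] at this
  · rcases hv with rfl | rfl
    · simp [hP.ne.symm] at this
    · simp [hP.ne] at this
  · intro σ hσ
    by_cases h0 : f.n τ σ = 0
    · simp [h0]
    · have h1 : root σ.src ≠ v := fun h => hcov ⟨σ, hσ, Or.inl h, h0⟩
      have h2 : root σ.tgt ≠ v := fun h => hcov ⟨σ, hσ, Or.inr h, h0⟩
      simp [h1, h2]

lemma cov_of_side (hP : IsBoxPart m root vx vy) {σ : Side N} (hσ : σ ∈ sides N (m + 1)) {τ : ℝ}
    (hn : f.n τ σ ≠ 0) {v : V} (hv : root σ.src = v ∨ root σ.tgt = v) : f.Cov v τ := by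
  classical
  by_cases hvx : v = vx ∨ v = vy
  · exact f.cov_end hP hvx τ
  by_cases hc : σ ∈ f.chosen
  · exact ⟨σ, hc, hv, hn⟩
  by_cases he : root σ.src = root σ.tgt
  swap
  · exact absurd (f.n_eq_zero_of_ext hσ hc he) hn
  by_contra hcov
  push Not at hvx
  have hs : root σ.src = v := by rcases hv with h | h <;> simp [h, he]
  set g : ZMod N × ℕ → ℝ := fun b => if root b = v then f.p b else 0 with hg
  have hsum := f.sum_n τ g (gx := 0) (gy := 0) (fun i => by simp [hg, hP.bottom, hvx.1.symm])
    (fun i => by simp [hg, hP.top, hvx.2.symm])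
  rw [sub_zero] at hsum
  have hnn : ∀ σ' ∈ sides N (m + 1), 0 ≤ (f.n τ σ' : ℝ) * (g σ'.tgt - g σ'.src) := by
    intro σ' hσ'
    by_cases he' : root σ'.src = root σ'.tgt
    · by_cases hv' : root σ'.src = v
      · simp only [hg, ← he', hv', if_true]
        rw [← f.diff_int σ' hσ' he', diff_eq]
        exact f.n_mul_nonneg τ σ'
      · simp [hg, ← he', hv']
    · by_cases hc' : σ' ∈ f.chosen
      · by_cases h0 : f.n τ σ' = 0
        · simp [h0]
        · have h1 : root σ'.src ≠ v := fun h => hcov ⟨σ', hc', Or.inl h, h0⟩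
          have h2 : root σ'.tgt ≠ v := fun h => hcov ⟨σ', hc', Or.inr h, h0⟩
          simp [hg, h1, h2]
      · simp [f.n_eq_zero_of_ext hσ' hc' he']
  have := (Finset.sum_eq_zero_iff_of_nonneg hnn).1 hsum σ hσ
  simp only [hg, ← he, hs, if_true] at this
  rw [← f.diff_int σ hσ he, diff_eq] at this
  rcases mul_eq_zero.1 this with h | h
  · exact hn (by exact_mod_cast h)
  · exact hn (f.n_eq_zero h)

end BoxFlow

end

lemma exists_int_mem_of_floor_ne {x y : ℝ} (h : ⌊x⌋ ≠ ⌊y⌋) : ∃ k : ℤ, (k : ℝ) ∈ Set.uIcc x y := by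
  wlog hxy : x ≤ y generalizing x y
  · obtain ⟨k, hk⟩ := this h.symm (le_of_not_ge hxy)
    exact ⟨k, by rwa [Set.uIcc_comm]⟩
  have : ⌊x⌋ < ⌊y⌋ := lt_of_le_of_ne (Int.floor_le_floor hxy) h
  refine ⟨⌊y⌋, ?_⟩
  rw [Set.uIcc_of_le hxy]
  exact ⟨(Int.floor_lt.1 this).le, Int.floor_le y⟩

lemma periodic_add_int {φ : ℝ → ℝ} (h : ∀ τ, φ (τ + 1) = φ τ) (τ : ℝ) (k : ℤ) :
    φ (τ + k) = φ τ := by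
  have : Function.Periodic φ 1 := h
  have := this.int_mul k τ
  rwa [mul_one] at this

namespace BoxFlow

variable {N : ℕ} [NeZero N] {m : ℕ} {V : Type*} {root : ZMod N × ℕ → V} {vx vy : V}
  (f : BoxFlow m root vx vy)

/-- The corners of the boxes of a piece. -/
def _root_.IsCornerOf (m : ℕ) (root : ZMod N × ℕ → V) (v : V) (I : ℤ) (j : ℕ) : Prop :=
  ∃ b : ZMod N × ℕ, b.2 < m + 1 ∧ root b = v ∧ ((I : ZMod N) = b.1 ∨ (I : ZMod N) = b.1 + 1) ∧
    (j = b.2 ∨ j = b.2 + 1)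

/-- Two values are linked if the segment between them is covered up to a null set. -/
def _root_.NullLink (U : Set ℝ) (x y : ℝ) : Prop := volume (Set.uIcc x y \ U) = 0

lemma _root_.NullLink.symm {U : Set ℝ} {x y : ℝ} (h : NullLink U x y) : NullLink U y x := by
  rwa [NullLink, Set.uIcc_comm]

lemma _root_.NullLink.trans {U : Set ℝ} {x y z : ℝ} (h : NullLink U x y) (h' : NullLink U y z) :
    NullLink U x z := by
  refine measure_mono_null ?_ (measure_union_null h h')
  rintro w ⟨hw, hU⟩
  rcases Set.uIcc_subset_uIcc_union_uIcc (b := y) hw with h | h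
  exacts [Or.inl ⟨h, hU⟩, Or.inr ⟨h, hU⟩]

lemma _root_.NullLink.refl (U : Set ℝ) (x : ℝ) : NullLink U x x := by
  rw [NullLink, Set.uIcc_self]
  exact measure_mono_null Set.sdiff_subset (by simp)

section hull

variable {φ : ℝ → ℝ} (hφ : Continuous φ) (hper : ∀ τ, φ (τ + 1) = φ τ)

include hφ

lemma link_of_cov {U : Set ℝ} {c c' : ℝ}
    (h : ∀ τ, min c c' < τ → τ ≤ max c c' → φ τ ∈ U) : NullLink U (φ c) (φ c') := by
  refine measure_mono_null (t := {φ (min c c')}) ?_ (by simp)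
  rintro y ⟨hy, hU⟩
  obtain ⟨τ, hτ, rfl⟩ := intermediate_value_uIcc hφ.continuousOn hy
  rcases eq_or_lt_of_le hτ.1 with h1 | h1
  · rw [Set.mem_singleton_iff]
    exact congrArg φ h1.symm
  · exact absurd (h τ h1 hτ.2) hU

include hper

lemma mem_of_cov {U : Set ℝ} {v : V}
    (hU : ∀ σ ∈ f.chosen, (root σ.src = v ∨ root σ.tgt = v) →
      φ '' Set.uIcc (f.t1 σ) (f.t2 σ) ⊆ U) {τ : ℝ} (h : f.Cov v τ) : φ τ ∈ U := by
  obtain ⟨σ, hσ, hv, hn⟩ := h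
  rw [n_eq, sub_ne_zero] at hn
  obtain ⟨k, hk⟩ := exists_int_mem_of_floor_ne hn
  refine hU σ hσ hv ⟨τ + k, ?_, periodic_add_int hper τ k⟩
  rw [Set.uIcc_comm]
  rw [Set.mem_uIcc] at hk ⊢
  rcases hk with h | h
  · left; constructor <;> linarith [h.1, h.2]
  · right; constructor <;> linarith [h.1, h.2]

lemma link_side (hP : IsBoxPart m root vx vy) {U : Set ℝ} {v : V}
    (hU : ∀ σ ∈ f.chosen, (root σ.src = v ∨ root σ.tgt = v) →
      φ '' Set.uIcc (f.t1 σ) (f.t2 σ) ⊆ U) {σ : Side N} (hσ : σ ∈ sides N (m + 1))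
    (hv : root σ.src = v ∨ root σ.tgt = v) : NullLink U (φ (f.t1 σ)) (φ (f.t2 σ)) := by
  refine link_of_cov hφ fun τ h1 h2 => f.mem_of_cov hφ hper hU (f.cov_of_side hP hσ ?_ hv)
  rw [n_eq, sub_ne_zero]
  rcases le_total (f.t1 σ) (f.t2 σ) with h | h
  · rw [min_eq_left h] at h1
    rw [max_eq_right h] at h2
    have e1 : ⌊f.t1 σ - τ⌋ < 0 := Int.floor_lt.2 (by push_cast; linarith)
    have e2 : 0 ≤ ⌊f.t2 σ - τ⌋ := Int.floor_nonneg.2 (by linarith)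
    omega
  · rw [min_eq_right h] at h1
    rw [max_eq_left h] at h2
    have e1 : ⌊f.t2 σ - τ⌋ < 0 := Int.floor_lt.2 (by push_cast; linarith)
    have e2 : 0 ≤ ⌊f.t1 σ - τ⌋ := Int.floor_nonneg.2 (by linarith)
    omega

omit hφ in
lemma corner_congr {I I' : ℤ} (h : (I : ZMod N) = I') (j : ℕ) :
    φ (f.θ I j) = φ (f.θ I' j) :=
  eq_of_periodic (N := N) (f := fun I => φ (f.θ I j)) (fun I => by rw [f.per, hper]) h

lemma link_corner (hP : IsBoxPart m root vx vy) {U : Set ℝ} {v : V}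
    (hU : ∀ σ ∈ f.chosen, (root σ.src = v ∨ root σ.tgt = v) →
      φ '' Set.uIcc (f.t1 σ) (f.t2 σ) ⊆ U) {b : ZMod N × ℕ} (hb : b.2 < m + 1) (hv : root b = v)
    {I : ℤ} {j : ℕ} (hI : (I : ZMod N) = b.1 ∨ (I : ZMod N) = b.1 + 1)
    (hj : j = b.2 ∨ j = b.2 + 1) :
    NullLink U (φ (f.θ b.1.val b.2)) (φ (f.θ I j)) := by
  by_cases hxy : v = vx ∨ v = vy
  · exact link_of_cov hφ fun τ _ _ => f.mem_of_cov hφ hper hU (f.cov_end hP hxy τ)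
  push Not at hxy
  obtain ⟨i, k⟩ := b
  simp only at *
  have hk0 : k ≠ 0 := by rintro rfl; exact hxy.1 (by rw [← hv, hP.bottom])
  have hkm : k ≠ m := by rintro rfl; exact hxy.2 (by rw [← hv, hP.top])
  obtain ⟨l, rfl⟩ : ∃ l, k = l + 1 := ⟨k - 1, by omega⟩
  have h1 := f.link_side hφ hper hP hU (σ := (true, i, l)) (mem_sides_true.2 (by omega))
    (Or.inr hv)
  have h2 := f.link_side hφ hper hP hU (σ := (true, i, l + 1)) (mem_sides_true.2 (by omega))
    (Or.inl hv)
  have h3 := f.link_side hφ hper hP hU (σ := (false, i, l + 1)) (mem_sides_false.2 (by omega))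
    (Or.inl hv)
  simp only [t1, t2, Side.c1, Side.c2, if_true, Bool.false_eq_true, if_false] at h1 h2 h3
  have e1 : ((i.val : ℤ) : ZMod N) = i := by simp
  have e2 : (((i.val : ℤ) + 1 : ℤ) : ZMod N) = i + 1 := by simp
  rcases hI with hI | hI <;> rcases hj with rfl | rfl
  · rw [f.corner_congr hper (hI.trans e1.symm)]; exact NullLink.refl _ _
  · rw [f.corner_congr hper (hI.trans e1.symm)]; exact (h1.trans h3.symm).trans h2.symm
  · rw [f.corner_congr hper (hI.trans e2.symm)]; exact h1
  · rw [f.corner_congr hper (hI.trans e2.symm)]; exact h1.trans h3.symm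

lemma hull (hP : IsBoxPart m root vx vy) {v : V} {o : Side N → ℝ} [DecidableEq V]
    (ho : ∀ σ ∈ f.chosen, (root σ.src = v ∨ root σ.tgt = v) →
      ∀ τ ∈ Set.uIcc (f.t1 σ) (f.t2 σ), ∀ τ' ∈ Set.uIcc (f.t1 σ) (f.t2 σ), |φ τ - φ τ'| ≤ o σ)
    {I I' : ℤ} {j j' : ℕ} (hc : IsCornerOf m root v I j) (hc' : IsCornerOf m root v I' j') :
    |φ (f.θ I j) - φ (f.θ I' j')| ≤
      ∑ σ ∈ f.chosen.filter (fun σ => root σ.src = v ∨ root σ.tgt = v), o σ := by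
  set S := f.chosen.filter (fun σ => root σ.src = v ∨ root σ.tgt = v) with hS
  set U : Set ℝ := ⋃ σ ∈ S, φ '' Set.uIcc (f.t1 σ) (f.t2 σ) with hUdef
  have hU : ∀ σ ∈ f.chosen, (root σ.src = v ∨ root σ.tgt = v) →
      φ '' Set.uIcc (f.t1 σ) (f.t2 σ) ⊆ U := fun σ hσ hv =>
    Set.subset_biUnion_of_mem (u := fun σ => φ '' Set.uIcc (f.t1 σ) (f.t2 σ))
      (show σ ∈ S from Finset.mem_filter.2 ⟨hσ, hv⟩)
  have ho0 : ∀ σ ∈ S, 0 ≤ o σ := fun σ hσ =>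
    le_trans (abs_nonneg _) (ho σ (Finset.mem_filter.1 hσ).1 (Finset.mem_filter.1 hσ).2 _
      Set.left_mem_uIcc _ Set.left_mem_uIcc)
  have hvol : volume U ≤ ENNReal.ofReal (∑ σ ∈ S, o σ) := by
    rw [ENNReal.ofReal_sum_of_nonneg ho0]
    refine (measure_biUnion_finset_le _ _).trans (Finset.sum_le_sum fun σ hσ => ?_)
    refine (Real.volume_le_diam _).trans (Metric.ediam_le ?_)
    rintro _ ⟨τ, hτ, rfl⟩ _ ⟨τ', hτ', rfl⟩
    rw [edist_dist, Real.dist_eq]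
    exact ENNReal.ofReal_le_ofReal
      (ho σ (Finset.mem_filter.1 hσ).1 (Finset.mem_filter.1 hσ).2 _ hτ _ hτ')
  obtain ⟨b, hb, hbv, hI, hj⟩ := hc
  obtain ⟨b', hb', hbv', hI', hj'⟩ := hc'
  have key : ∀ c, Relation.ReflTransGen (fun c d => BoxAdj N (m + 1) c d ∧ root c = root b ∧
      root d = root b) b c → NullLink U (φ (f.θ b.1.val b.2)) (φ (f.θ c.1.val c.2)) := by
    intro c hc
    induction hc with
    | refl => exact NullLink.refl _ _
    | @tail c d _ hcd ih =>
      refine ih.trans ?_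
      obtain ⟨⟨σ, hσ, h1⟩, h2, h3⟩ := hcd
      have aux : NullLink U (φ (f.θ σ.src.1.val σ.src.2)) (φ (f.θ σ.tgt.1.val σ.tgt.2)) := by
        have hsv : root σ.src = v := by
          rcases h1 with ⟨h, -⟩ | ⟨h, -⟩
          · rw [h, h2, hbv]
          · rw [h, h3, hbv]
        refine f.link_corner hφ hper hP hU (side_bounds hσ).1 hsv ?_ ?_
        · obtain ⟨β, i, k⟩ := σ
          cases β <;> simp [Side.src, Side.tgt]
        · obtain ⟨β, i, k⟩ := σ
          cases β <;> simp [Side.src, Side.tgt]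
      rcases h1 with ⟨rfl, rfl⟩ | ⟨rfl, rfl⟩
      exacts [aux, aux.symm]
  have hl : NullLink U (φ (f.θ I j)) (φ (f.θ I' j')) :=
    ((f.link_corner hφ hper hP hU hb hbv hI hj).symm.trans
      (key b' (hP.conn b b' hb hb' (hbv.trans hbv'.symm)))).trans
      (f.link_corner hφ hper hP hU hb' hbv' hI' hj')
  have h1 : volume (Set.uIcc (φ (f.θ I' j')) (φ (f.θ I j))) ≤ volume U := by
    calc _ ≤ volume (Set.uIcc (φ (f.θ I' j')) (φ (f.θ I j)) \ U ∪ U) :=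
          measure_mono fun x hx => by by_cases h : x ∈ U; exacts [Or.inr h, Or.inl ⟨hx, h⟩]
      _ ≤ 0 + volume U := (measure_union_le _ _).trans (add_le_add_left (le_of_eq hl.symm) _)
      _ = _ := zero_add _
  rw [Real.volume_interval] at h1
  exact (ENNReal.ofReal_le_ofReal_iff (Finset.sum_nonneg ho0)).1 (h1.trans hvol)

end hull

end BoxFlow

section

variable {N : ℕ} [NeZero N] {m : ℕ} {V : Type*} {root : ZMod N × ℕ → V} {vx vy : V}

/-- Class of a corner modulo `N`. -/
def cornerClass (N : ℕ) (κ : ℤ × ℕ) : ZMod N × ℕ := (κ.1, κ.2)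

lemma sides_share_corner {σ σ' : Side N} (hσ : σ ∈ sides N (m + 1)) (hσ' : σ' ∈ sides N (m + 1))
    {κ κ' : ℤ × ℕ} (hκ : κ = σ.c1 ∨ κ = σ.c2) (hκ' : κ' = σ'.c1 ∨ κ' = σ'.c2)
    (h : cornerClass N κ = cornerClass N κ') :
    ∃ b b', (b = σ.src ∨ b = σ.tgt) ∧ (b' = σ'.src ∨ b' = σ'.tgt) ∧
      (b = b' ∨ BoxAdj N (m + 1) b b') := by
  have key : ∀ i i' : ZMod N, ∀ j j' : ℕ, j + 1 < m + 1 → j' < m + 1 →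
      (i = i' ∨ i = i' + 1) → (j' = j ∨ j' = j + 1) →
      ∃ b, (b = Side.src (true, i, j) ∨ b = Side.tgt (true, i, j)) ∧
        (b = Side.src (false, i', j') ∨ b = Side.tgt (false, i', j')) := by
    intro i i' j j' _ _ hi hj
    refine ⟨(i, j'), ?_, ?_⟩
    · rcases hj with rfl | rfl <;> simp [Side.src, Side.tgt]
    · rcases hi with rfl | rfl <;> simp [Side.src, Side.tgt]
  have key2 : ∀ i i' : ZMod N, ∀ κ κ' : ℤ × ℕ, ∀ j j' : ℕ,
      (κ = Side.c1 (true, i, j) ∨ κ = Side.c2 (true, i, j)) →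
      (κ' = Side.c1 (false, i', j') ∨ κ' = Side.c2 (false, i', j')) →
      cornerClass N κ = cornerClass N κ' → (i = i' ∨ i = i' + 1) ∧ (j' = j ∨ j' = j + 1) := by
    intro i i' κ κ' j j' hκ hκ' h
    rcases hκ with rfl | rfl <;> rcases hκ' with rfl | rfl <;>
      simp [cornerClass, Side.c1, Side.c2] at h
    · exact ⟨Or.inr h.1, Or.inl h.2.symm⟩
    · exact ⟨Or.inr h.1, Or.inr h.2.symm⟩
    · exact ⟨Or.inl h.1, Or.inl h.2.symm⟩
    · exact ⟨Or.inl h.1, Or.inr h.2.symm⟩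
  have key3 : ∀ i i' : ZMod N, ∀ j : ℕ, j < m + 1 → (i = i' ∨ i = i' + 1 ∨ i' = i + 1) →
      ((i, j) : ZMod N × ℕ) = (i', j) ∨ BoxAdj N (m + 1) (i, j) (i', j) := by
    intro i i' j hj h
    rcases h with rfl | rfl | rfl
    · exact Or.inl rfl
    · exact Or.inr (boxAdj_symm ⟨(false, i', j), mem_sides_false.2 hj, Or.inl ⟨rfl, rfl⟩⟩)
    · exact Or.inr ⟨(false, i, j), mem_sides_false.2 hj, Or.inl ⟨rfl, rfl⟩⟩
  have key4 : ∀ i : ZMod N, ∀ j j' : ℕ, j < m + 1 → j' < m + 1 →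
      (j = j' ∨ j = j' + 1 ∨ j' = j + 1) →
      ((i, j) : ZMod N × ℕ) = (i, j') ∨ BoxAdj N (m + 1) (i, j) (i, j') := by
    intro i j j' hj hj' h
    rcases h with rfl | rfl | rfl
    · exact Or.inl rfl
    · exact Or.inr (boxAdj_symm ⟨(true, i, j'), mem_sides_true.2 hj, Or.inl ⟨rfl, rfl⟩⟩)
    · exact Or.inr ⟨(true, i, j), mem_sides_true.2 hj', Or.inl ⟨rfl, rfl⟩⟩
  obtain ⟨β, i, j⟩ := σ
  obtain ⟨β', i', j'⟩ := σ'
  cases β <;> cases β'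
  · rw [mem_sides_false] at hσ hσ'
    have : i = i' ∧ (j = j' ∨ j = j' + 1 ∨ j' = j + 1) := by
      rcases hκ with rfl | rfl <;> rcases hκ' with rfl | rfl <;>
        simp [cornerClass, Side.c1, Side.c2] at h <;> refine ⟨h.1, ?_⟩ <;> omega
    obtain ⟨rfl, hj⟩ := this
    exact ⟨_, _, Or.inl rfl, Or.inl rfl, key4 i j j' hσ hσ' hj⟩
  · rw [mem_sides_false] at hσ
    rw [mem_sides_true] at hσ'
    obtain ⟨h1, h2⟩ := key2 i' i κ' κ j' j hκ' hκ h.symm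
    obtain ⟨b, hb, hb'⟩ := key i' i j' j hσ' hσ h1 h2
    exact ⟨b, b, hb', hb, Or.inl rfl⟩
  · rw [mem_sides_false] at hσ'
    rw [mem_sides_true] at hσ
    obtain ⟨h1, h2⟩ := key2 i i' κ κ' j j' hκ hκ' h
    obtain ⟨b, hb, hb'⟩ := key i i' j j' hσ hσ' h1 h2
    exact ⟨b, b, hb, hb', Or.inl rfl⟩
  · rw [mem_sides_true] at hσ hσ'
    have : j = j' ∧ (i = i' ∨ i = i' + 1 ∨ i' = i + 1) := by
      rcases hκ with rfl | rfl <;> rcases hκ' with rfl | rfl <;>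
        simp [cornerClass, Side.c1, Side.c2] at h <;> refine ⟨h.2, ?_⟩
      · exact Or.inl h.1
      · exact Or.inr (Or.inl h.1)
      · exact Or.inr (Or.inr h.1.symm)
      · exact Or.inl h.1
    obtain ⟨rfl, hi⟩ := this
    exact ⟨_, _, Or.inl rfl, Or.inl rfl, key3 i i' j (by omega) hi⟩

lemma isCornerOf_side {σ : Side N} (hσ : σ ∈ sides N (m + 1)) {v : V}
    (hv : root σ.src = v ∨ root σ.tgt = v) {κ : ℤ × ℕ} (hκ : κ = σ.c1 ∨ κ = σ.c2) :
    IsCornerOf m root v κ.1 κ.2 := by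
  have hb := side_bounds hσ
  obtain ⟨β, i, j⟩ := σ
  rcases hv with hv | hv
  · refine ⟨_, hb.1, hv, ?_⟩
    cases β <;> rcases hκ with rfl | rfl <;> simp [Side.c1, Side.c2, Side.src]
  · refine ⟨_, hb.2, hv, ?_⟩
    cases β <;> rcases hκ with rfl | rfl <;> simp [Side.c1, Side.c2, Side.tgt]

namespace BoxFlow

variable (f : BoxFlow m root vx vy)

/-- A side crossing the level `s`. -/
def IsCut (s : ℝ) (σ : Side N) : Prop :=
  σ ∈ sides N (m + 1) ∧ ¬ (s < f.a (root σ.src) ↔ s < f.a (root σ.tgt))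

/-- Two cut sides are linked if they share a corner at which the two roundings differ. -/
def CutLink (s t t' : ℝ) (σ σ' : Side N) : Prop :=
  f.IsCut s σ ∧ f.IsCut s σ' ∧ ∃ κ κ', (κ = σ.c1 ∨ κ = σ.c2) ∧ (κ' = σ'.c1 ∨ κ' = σ'.c2) ∧
    cornerClass N κ = cornerClass N κ' ∧ f.B t κ'.1 κ'.2 ≠ f.B t' κ'.1 κ'.2

lemma B_sub_congr (t t' : ℝ) {κ κ' : ℤ × ℕ} (h : cornerClass N κ = cornerClass N κ') :
    f.B t κ.1 κ.2 - f.B t' κ.1 κ.2 = f.B t κ'.1 κ'.2 - f.B t' κ'.1 κ'.2 := by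
  simp only [cornerClass, Prod.mk.injEq] at h
  rw [h.2]
  exact eq_of_periodic (N := N) (f := fun I => f.B t I κ'.2 - f.B t' I κ'.2)
    (fun I => by rw [f.B_per, f.B_per]; ring) h.1

lemma cut_reach (hP : IsBoxPart m root vx vy) {s t t' : ℝ} {σ₁ σ₂ : Side N}
    (h₁ : f.IsCut s σ₁) (h₂ : f.IsCut s σ₂) (hn₁ : f.n t σ₁ ≠ 0) (hn₂ : f.n t' σ₂ ≠ 0) :
    Relation.ReflTransGen (f.CutLink s t t') σ₁ σ₂ := by
  classical
  set A : V → ℝ := fun v => if s < f.a v then 1 else 0 with hA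
  set dA : Side N → ℝ := fun σ => A (root σ.tgt) - A (root σ.src) with hdA
  set R : Side N → Prop := fun σ => Relation.ReflTransGen (f.CutLink s t t') σ₁ σ with hR
  have hdA0 : ∀ σ ∈ sides N (m + 1), ¬ f.IsCut s σ → dA σ = 0 := by
    intro σ hσ hc
    have : s < f.a (root σ.src) ↔ s < f.a (root σ.tgt) := by
      by_contra h; exact hc ⟨hσ, h⟩
    simp [hdA, hA, this]
  have hw : ∀ τ, ∀ σ ∈ sides N (m + 1), 0 ≤ (f.n τ σ : ℝ) * dA σ := by
    intro τ σ hσ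
    by_cases hi : root σ.src = root σ.tgt
    · simp [hdA, hi]
    by_cases hc : σ ∈ f.chosen
    · have hd := f.diff_chosen σ hc
      rw [diff_eq] at hd
      rcases le_total 0 (f.t2 σ - f.t1 σ) with h | h
      · refine mul_nonneg (by exact_mod_cast f.n_nonneg h) ?_
        simp only [hdA, hA]
        split_ifs <;> linarith
      · refine mul_nonneg_of_nonpos_of_nonpos (by exact_mod_cast f.n_nonpos h) ?_
        simp only [hdA, hA]
        split_ifs <;> linarith
    · simp [f.n_eq_zero_of_ext hσ hc hi]
  have hw1 : ∀ τ σ, f.IsCut s σ → f.n τ σ ≠ 0 → 1 ≤ (f.n τ σ : ℝ) * dA σ := by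
    intro τ σ hc hn
    have hnn := hw τ σ hc.1
    have h1 : (1 : ℝ) ≤ |(f.n τ σ : ℝ)| := by exact_mod_cast Int.one_le_abs hn
    have h2 : |dA σ| = 1 := by
      have := hc.2
      simp only [hdA, hA]
      by_cases ha : s < f.a (root σ.src) <;> by_cases hb : s < f.a (root σ.tgt) <;>
        simp [ha, hb] at this ⊢
    rw [← abs_of_nonneg hnn, abs_mul, h2, mul_one]
    exact h1
  have htot : ∀ τ, ∑ σ ∈ sides N (m + 1), (f.n τ σ : ℝ) * dA σ ≤ 1 := by
    intro τ
    have := f.sum_n τ (fun b => A (root b)) (gx := A vx) (gy := A vy)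
      (fun i => by rw [hP.bottom]) (fun i => by rw [hP.top])
    simp only [hdA]
    rw [this]
    simp only [hA]
    split_ifs <;> norm_num
  set D : ℤ → ℕ → ℝ := fun I j =>
    if ∃ σ κ, R σ ∧ (κ = σ.c1 ∨ κ = σ.c2) ∧ cornerClass N κ = cornerClass N (I, j) then
      (((f.B t I j - f.B t' I j : ℤ)) : ℝ) else 0 with hD
  have hDper : ∀ I j, D (I + N) j = D I j + 0 := by
    intro I j
    have e : cornerClass N (I + N, j) = cornerClass N (I, j) := by simp [cornerClass]
    have := f.B_sub_congr t t' e
    simp only at this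
    simp only [hD, e, this, add_zero]
  have hcut_of_R : ∀ σ, R σ → f.IsCut s σ := by
    intro σ h
    rcases Relation.ReflTransGen.cases_tail h with rfl | ⟨_, _, h⟩
    exacts [h₁, h.2.1]
  have hsum : ∑ σ ∈ sides N (m + 1), cornerDiff D σ * dA σ = 0 := by
    have := sum_cornerDiff m hDper (fun b => A (root b))
    simp only [hdA]
    rw [this]
    simp_rw [hP.bottom, hP.top, ← Finset.sum_mul]
    rw [sum_row_diff (B := fun I => D I (m + 1)) (fun I => hDper I _),
      sum_row_diff (B := fun I => D I 0) (fun I => hDper I _)]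
    ring
  have hterm : ∀ σ ∈ sides N (m + 1), cornerDiff D σ * dA σ =
      if R σ then (f.n t σ : ℝ) * dA σ - (f.n t' σ : ℝ) * dA σ else 0 := by
    intro σ hσ
    by_cases hc : f.IsCut s σ
    swap
    · rw [hdA0 σ hσ hc]; simp
    by_cases hRσ : R σ
    · rw [if_pos hRσ, cornerDiff_eq]
      have e1 : ∀ κ, (κ = σ.c1 ∨ κ = σ.c2) → D κ.1 κ.2 = ((f.B t κ.1 κ.2 - f.B t' κ.1 κ.2 : ℤ) : ℝ) :=
        fun κ hκ => if_pos ⟨σ, κ, hRσ, hκ, rfl⟩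
      rw [e1 _ (Or.inl rfl), e1 _ (Or.inr rfl), n, n, cornerDiff_eq, cornerDiff_eq]
      push_cast
      ring
    · rw [if_neg hRσ, cornerDiff_eq]
      have e1 : ∀ κ, (κ = σ.c1 ∨ κ = σ.c2) → D κ.1 κ.2 = 0 := by
        intro κ hκ
        simp only [hD]
        split_ifs with h
        · obtain ⟨σ', κ', hR', hκ', he⟩ := h
          by_contra hne
          apply hRσ
          refine Relation.ReflTransGen.tail hR' ⟨hcut_of_R _ hR', hc, κ', κ, hκ', hκ, he, ?_⟩
          intro h0
          exact hne (by rw [h0]; simp)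
        · rfl
      rw [e1 _ (Or.inl rfl), e1 _ (Or.inr rfl)]
      simp
  rw [Finset.sum_congr rfl hterm, ← Finset.sum_filter, Finset.sum_sub_distrib, sub_eq_zero] at hsum
  have hge : (1 : ℝ) ≤ ∑ σ ∈ (sides N (m + 1)).filter R, (f.n t σ : ℝ) * dA σ :=
    (hw1 t σ₁ h₁ hn₁).trans (Finset.single_le_sum (f := fun σ => (f.n t σ : ℝ) * dA σ)
      (fun σ hσ => hw t σ (Finset.mem_filter.1 hσ).1)
      (Finset.mem_filter.2 ⟨h₁.1, Relation.ReflTransGen.refl⟩))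
  by_contra hnot
  have h3 := Finset.sum_filter_add_sum_filter_not (sides N (m + 1)) R
    (fun σ => (f.n t' σ : ℝ) * dA σ)
  have h4 : (1 : ℝ) ≤ ∑ σ ∈ (sides N (m + 1)).filter (fun σ => ¬ R σ), (f.n t' σ : ℝ) * dA σ :=
    (hw1 t' σ₂ h₂ hn₂).trans (Finset.single_le_sum (f := fun σ => (f.n t' σ : ℝ) * dA σ)
      (fun σ hσ => hw t' σ (Finset.mem_filter.1 hσ).1) (Finset.mem_filter.2 ⟨h₂.1, hnot⟩))
  have := htot t'
  linarith

end BoxFlow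

end

/-- A square tiling of a cylinder: pieces `V`, edges `E` between pieces, a potential `a` and the
angular interval `[th1 e, th2 e]` of the square of the edge `e`. -/
structure Tiling (V E : Type) [Fintype V] [DecidableEq V] [Fintype E] where
  a : V → ℝ
  vx : V
  vy : V
  lo : E → V
  hi : E → V
  th1 : E → ℝ
  th2 : E → ℝ
  Co : V → Set ℝ
  ne : ∀ e, lo e ≠ hi e
  inj : ∀ e e', s(lo e, hi e) = s(lo e', hi e') → e = e'
  le : ∀ e, a (lo e) ≤ a (hi e)
  square : ∀ e, a (hi e) - a (lo e) = th2 e - th1 e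
  unit : ∀ G : V → ℝ, ∑ e, (a (hi e) - a (lo e)) * (G (hi e) - G (lo e)) = G vy - G vx
  unit_t : ∀ (t : ℝ) (G : V → ℝ),
    ∑ e, ((⌊th2 e - t⌋ - ⌊th1 e - t⌋ : ℤ) : ℝ) * (G (hi e) - G (lo e)) = G vy - G vx
  nonempty : ∀ v, (Co v).Nonempty
  add_int : ∀ v, ∀ c ∈ Co v, ∀ k : ℤ, c + k ∈ Co v
  mem_th1 : ∀ e v, (lo e = v ∨ hi e = v) → th1 e ∈ Co v
  mem_th2 : ∀ e v, (lo e = v ∨ hi e = v) → th2 e ∈ Co v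
  hull : ∀ (φ : ℝ → ℝ) (o : E → ℝ) (v : V), Continuous φ → (∀ τ, φ (τ + 1) = φ τ) →
    (∀ e, (lo e = v ∨ hi e = v) → ∀ τ ∈ Set.Icc (th1 e) (th2 e), ∀ τ' ∈ Set.Icc (th1 e) (th2 e),
      |φ τ - φ τ'| ≤ o e) →
    ∀ c ∈ Co v, ∀ c' ∈ Co v,
      |φ c - φ c'| ≤ ∑ e ∈ Finset.univ.filter (fun e => lo e = v ∨ hi e = v), o e
  cut : ∀ (s t t' : ℝ) (e₁ e₂ : E), t ≤ t' → a (lo e₁) ≤ s → s < a (hi e₁) → a (lo e₂) ≤ s →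
    s < a (hi e₂) → ⌊th2 e₁ - t⌋ ≠ ⌊th1 e₁ - t⌋ → ⌊th2 e₂ - t'⌋ ≠ ⌊th1 e₂ - t'⌋ →
    ∃ K : Set V, lo e₁ ∈ K ∧ hi e₁ ∈ K ∧ lo e₂ ∈ K ∧ hi e₂ ∈ K ∧
      (∀ v ∈ K, Relation.ReflTransGen (fun v w => ((∃ e, s(lo e, hi e) = s(v, w)) ∧ v ∈ K ∧ w ∈ K))
        (lo e₁) v) ∧
      ∀ v ∈ K, (∃ e, (lo e = v ∨ hi e = v) ∧ a (lo e) ≤ s ∧ s < a (hi e)) ∧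
        ((∃ c ∈ Co v, t ≤ c ∧ c ≤ t') ∨ lo e₁ = v ∨ hi e₁ = v ∨ lo e₂ = v ∨ hi e₂ = v)

/-- Adjacency of pieces. -/
def Tiling.Adj {V E : Type} [Fintype V] [DecidableEq V] [Fintype E] (T : Tiling V E) (v w : V) :
    Prop := ∃ e, s(T.lo e, T.hi e) = s(v, w)

namespace BoxFlow

variable {N : ℕ} [NeZero N] {m : ℕ} {V : Type} {root : ZMod N × ℕ → V} {vx vy : V}

def CoSet (f : BoxFlow m root vx vy) (v : V) : Set ℝ :=
  {c | ∃ I j, IsCornerOf m root v I j ∧ f.θ I j = c}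

lemma θ_add (f : BoxFlow m root vx vy) (I : ℤ) (j : ℕ) (k : ℤ) :
    f.θ (I + k * N) j = f.θ I j + k := by
  have hp : Function.Periodic (fun I : ℤ => f.θ I j - I * (N : ℝ)⁻¹) (N : ℤ) := by
    intro I
    have hN : (N : ℝ) ≠ 0 := by exact_mod_cast NeZero.ne N
    simp only
    rw [f.per]
    push_cast
    rw [add_mul, mul_inv_cancel₀ hN]
    ring
  have hN : (N : ℝ) ≠ 0 := by exact_mod_cast NeZero.ne N
  have := hp.int_mul k I
  simp only [Int.cast_id] at this
  push_cast at this
  rw [add_mul, mul_assoc, mul_inv_cancel₀ hN] at this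
  linarith

lemma CoSet_add (f : BoxFlow m root vx vy) {v : V} {c : ℝ} (hc : c ∈ f.CoSet v) (k : ℤ) :
    c + k ∈ f.CoSet v := by
  obtain ⟨I, j, ⟨b, h1, h2, h3, h4⟩, rfl⟩ := hc
  refine ⟨I + k * N, j, ⟨b, h1, h2, ?_, h4⟩, f.θ_add I j k⟩
  have : ((I + k * N : ℤ) : ZMod N) = I := by push_cast; simp
  rwa [this]

lemma adj_of_boxAdj (f : BoxFlow m root vx vy) {b b' : ZMod N × ℕ}
    (h : BoxAdj N (m + 1) b b') (hne : root b ≠ root b') :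
    ∃ σ ∈ f.chosen, s(root σ.src, root σ.tgt) = s(root b, root b') := by
  obtain ⟨σ, hσ, h⟩ := h
  rcases h with ⟨rfl, rfl⟩ | ⟨rfl, rfl⟩
  · exact f.rep σ hσ hne
  · rw [Sym2.eq_swap]
    exact f.rep σ hσ hne.symm

lemma exists_cut (f : BoxFlow m root vx vy) (hP : IsBoxPart m root vx vy) {s t t' : ℝ}
    (htt : t ≤ t') {σ₁ σ₂ : Side N}
    (h₁ : f.IsCut s σ₁) (h₂ : f.IsCut s σ₂) (hn₁ : f.n t σ₁ ≠ 0) (hn₂ : f.n t' σ₂ ≠ 0) :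
    ∃ K : Set V, root σ₁.src ∈ K ∧ root σ₁.tgt ∈ K ∧ root σ₂.src ∈ K ∧ root σ₂.tgt ∈ K ∧
      (∀ v ∈ K, Relation.ReflTransGen (fun v w =>
        ((∃ σ ∈ f.chosen, s(root σ.src, root σ.tgt) = s(v, w)) ∧ v ∈ K ∧ w ∈ K)) (root σ₁.src) v) ∧
      ∀ v ∈ K, (∃ σ ∈ f.chosen, (root σ.src = v ∨ root σ.tgt = v) ∧ f.IsCut s σ) ∧
        ((∃ c ∈ f.CoSet v, t ≤ c ∧ c ≤ t') ∨ root σ₁.src = v ∨ root σ₁.tgt = v) := by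
  have hR := f.cut_reach hP h₁ h₂ hn₁ hn₂
  set R : Side N → Prop := fun σ => Relation.ReflTransGen (f.CutLink s t t') σ₁ σ with hRdef
  set K : Set V := {v | ∃ σ, R σ ∧ (root σ.src = v ∨ root σ.tgt = v)} with hK
  have hR1 : R σ₁ := Relation.ReflTransGen.refl
  have hcut : ∀ σ, R σ → f.IsCut s σ := by
    intro σ h
    rcases Relation.ReflTransGen.cases_tail h with rfl | ⟨_, _, h⟩
    exacts [h₁, h.2.1]
  set r : V → V → Prop := fun v w =>
        ((∃ σ ∈ f.chosen, s(root σ.src, root σ.tgt) = s(v, w)) ∧ v ∈ K ∧ w ∈ K) with hr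
  have step : ∀ b b', (b = b' ∨ BoxAdj N (m + 1) b b') → root b ∈ K → root b' ∈ K →
      Relation.ReflTransGen r (root b) (root b') := by
    intro b b' h hb hb'
    by_cases hne : root b = root b'
    · rw [hne]
    · rcases h with rfl | h
      · exact absurd rfl hne
      · exact Relation.ReflTransGen.single ⟨f.adj_of_boxAdj h hne, hb, hb'⟩
  have hside : ∀ σ ∈ sides N (m + 1), ∀ b b', (b = σ.src ∨ b = σ.tgt) →
      (b' = σ.src ∨ b' = σ.tgt) → (b = b' ∨ BoxAdj N (m + 1) b b') := by
    intro σ hσ b b' hb hb'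
    rcases hb with rfl | rfl <;> rcases hb' with rfl | rfl
    · exact Or.inl rfl
    · exact Or.inr ⟨σ, hσ, Or.inl ⟨rfl, rfl⟩⟩
    · exact Or.inr ⟨σ, hσ, Or.inr ⟨rfl, rfl⟩⟩
    · exact Or.inl rfl
  have hmem : ∀ σ, R σ → ∀ b, (b = σ.src ∨ b = σ.tgt) → root b ∈ K := by
    intro σ hσ b hb
    exact ⟨σ, hσ, by rcases hb with rfl | rfl; exacts [Or.inl rfl, Or.inr rfl]⟩
  have hconn : ∀ σ, R σ → ∀ b, (b = σ.src ∨ b = σ.tgt) →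
      Relation.ReflTransGen r (root σ₁.src) (root b) := by
    intro σ hσ
    induction hσ with
    | refl =>
      intro b hb
      exact step _ _ (hside σ₁ h₁.1 _ _ (Or.inl rfl) hb) (hmem _ hR1 _ (Or.inl rfl))
        (hmem _ hR1 _ hb)
    | @tail σ σ' hσ hl ih =>
      intro b hb
      have hR' : R σ' := Relation.ReflTransGen.tail hσ hl
      obtain ⟨hc, hc', κ, κ', hκ, hκ', he, -⟩ := hl
      obtain ⟨b₁, b₂, hb₁, hb₂, h12⟩ := sides_share_corner hc.1 hc'.1 hκ hκ' he
      exact ((ih b₁ hb₁).trans (step _ _ h12 (hmem _ hσ _ hb₁) (hmem _ hR' _ hb₂))).trans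
        (step _ _ (hside σ' hc'.1 _ _ hb₂ hb) (hmem _ hR' _ hb₂) (hmem _ hR' _ hb))
  refine ⟨K, hmem _ hR1 _ (Or.inl rfl), hmem _ hR1 _ (Or.inr rfl), hmem _ hR _ (Or.inl rfl),
    hmem _ hR _ (Or.inr rfl), ?_, ?_⟩
  · rintro v ⟨σ, hσ, rfl | rfl⟩
    exacts [hconn σ hσ _ (Or.inl rfl), hconn σ hσ _ (Or.inr rfl)]
  · rintro v ⟨σ, hσ, hv⟩
    have hc := hcut σ hσ
    constructor
    · have hne : root σ.src ≠ root σ.tgt := fun h => hc.2 (by rw [h])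
      obtain ⟨σ', hσ', he⟩ := f.rep σ hc.1 hne
      refine ⟨σ', hσ', ?_, f.sub hσ', ?_⟩
      · rw [Sym2.eq_iff] at he
        rcases he with ⟨h1, h2⟩ | ⟨h1, h2⟩ <;> rw [h1, h2] <;> tauto
      · have := hc.2
        rw [Sym2.eq_iff] at he
        rcases he with ⟨h1, h2⟩ | ⟨h1, h2⟩ <;> rw [h1, h2] <;> tauto
    · rcases Relation.ReflTransGen.cases_tail hσ with rfl | ⟨σ', hσ', hl⟩
      · exact Or.inr hv
      · left
        obtain ⟨-, -, κ, κ', hκ, hκ', he, hB⟩ := hl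
        obtain ⟨k, hk⟩ := exists_int_mem_of_floor_ne hB
        rw [Set.uIcc_comm, Set.uIcc_of_le (by linarith)] at hk
        refine ⟨f.θ κ'.1 κ'.2 + ((-k : ℤ) : ℝ), f.CoSet_add ?_ _, ?_, ?_⟩
        · exact ⟨κ'.1, κ'.2, isCornerOf_side hc.1 hv hκ', rfl⟩
        · push_cast; linarith [hk.2]
        · push_cast; linarith [hk.1]

lemma exists_tiling [Fintype V] [DecidableEq V] (hP : IsBoxPart m root vx vy) :
    ∃ (E : Type) (_ : Fintype E) (T : Tiling V E), T.vx = vx ∧ T.vy = vy ∧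
      (∀ b b', BoxAdj N (m + 1) b b' → root b ≠ root b' → T.Adj (root b) (root b')) ∧
      ∀ v w, T.Adj v w → ∃ b b', BoxAdj N (m + 1) b b' ∧ root b = v ∧ root b' = w := by
  classical
  obtain ⟨f⟩ := hP.exists_flow
  set up : Side N → Prop := fun σ => f.a (root σ.src) ≤ f.a (root σ.tgt) with hup
  set lo : f.chosen → V := fun e => if up e then root e.1.src else root e.1.tgt with hlo
  set hi : f.chosen → V := fun e => if up e then root e.1.tgt else root e.1.src with hhi
  set th1 : f.chosen → ℝ := fun e => if up e then f.t1 e else f.t2 e with hth1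
  set th2 : f.chosen → ℝ := fun e => if up e then f.t2 e else f.t1 e with hth2
  have hd : ∀ e : f.chosen, f.a (root e.1.tgt) - f.a (root e.1.src) = f.t2 e - f.t1 e := fun e => by
    rw [← f.diff_chosen e.1 e.2, diff_eq]
  have hends : ∀ (e : f.chosen) v, (lo e = v ∨ hi e = v) ↔ (root e.1.src = v ∨ root e.1.tgt = v) := by
    intro e v
    simp only [hlo, hhi]
    split_ifs <;> tauto
  have hsym : ∀ e : f.chosen, s(lo e, hi e) = s(root e.1.src, root e.1.tgt) := by
    intro e
    simp only [hlo, hhi]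
    split_ifs
    · rfl
    · exact Sym2.eq_swap
  have hle : ∀ e, f.a (lo e) ≤ f.a (hi e) := by
    intro e
    simp only [hlo, hhi]
    split_ifs with h
    · exact h
    · exact (not_le.1 h).le
  have hsq : ∀ e, f.a (hi e) - f.a (lo e) = th2 e - th1 e := by
    intro e
    have := hd e
    simp only [hlo, hhi, hth1, hth2]
    split_ifs <;> linarith
  have hIcc : ∀ e : f.chosen, Set.uIcc (f.t1 e) (f.t2 e) = Set.Icc (th1 e) (th2 e) := by
    intro e
    have h1 := hle e
    have h2 := hsq e
    simp only [hth1, hth2] at h2 ⊢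
    split_ifs at h2 ⊢
    · exact Set.uIcc_of_le (by linarith)
    · exact Set.uIcc_of_ge (by linarith)
  have hcutiff : ∀ (e : f.chosen) s, f.IsCut s e ↔ f.a (lo e) ≤ s ∧ s < f.a (hi e) := by
    intro e s
    have h1 := hle e
    have hs := f.sub e.2
    simp only [IsCut, hs, true_and]
    simp only [hlo, hhi] at h1 ⊢
    split_ifs at h1 ⊢
    · constructor
      · intro h
        by_contra hcon
        apply h
        constructor
        · intro h; linarith
        · intro h; by_contra h'; exact hcon ⟨not_lt.1 h', h⟩
      · rintro ⟨h, h'⟩ hiff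
        exact absurd (hiff.2 h') (not_lt.2 h)
    · constructor
      · intro h
        by_contra hcon
        apply h
        constructor
        · intro h; by_contra h'; exact hcon ⟨not_lt.1 h', h⟩
        · intro h; linarith
      · rintro ⟨h, h'⟩ hiff
        exact absurd (hiff.1 h') (not_lt.2 h)
  have hn : ∀ (e : f.chosen) t, ⌊th2 e - t⌋ ≠ ⌊th1 e - t⌋ → f.n t e ≠ 0 := by
    intro e t h h0
    rw [n_eq] at h0
    apply h
    simp only [hth1, hth2]
    split_ifs <;> omega
  refine ⟨f.chosen, inferInstance,
    { a := f.a, vx := vx, vy := vy, lo := lo, hi := hi, th1 := th1, th2 := th2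
      Co := f.CoSet
      ne := ?_, inj := ?_, le := hle, square := hsq, unit := ?_, unit_t := ?_, nonempty := ?_
      add_int := fun v c hc k => f.CoSet_add hc k
      mem_th1 := ?_, mem_th2 := ?_, hull := ?_, cut := ?_ }, rfl, rfl, ?_, ?_⟩
  · intro e
    have := f.ext e.1 e.2
    simp only [hlo, hhi]
    split_ifs
    exacts [this, this.symm]
  · intro e e' h
    rw [hsym, hsym] at h
    exact Subtype.ext (f.inj e'.1 e'.2 e.1 e.2 h)
  · intro G
    rw [← f.unit G, ← Finset.sum_coe_sort f.chosen]
    refine Finset.sum_congr rfl fun e _ => ?_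
    simp only [hlo, hhi]
    split_ifs <;> ring
  · intro t G
    rw [← f.sum_n_chosen hP t G, ← Finset.sum_coe_sort f.chosen]
    refine Finset.sum_congr rfl fun e _ => ?_
    rw [n_eq]
    simp only [hlo, hhi, hth1, hth2]
    split_ifs <;> push_cast <;> ring
  · intro v
    obtain ⟨b, hb, hv⟩ := hP.surj v
    exact ⟨_, b.1.val, b.2, ⟨b, hb, hv, Or.inl (by simp), Or.inl rfl⟩, rfl⟩
  · intro e v hv
    have h1 := isCornerOf_side (f.sub e.2) ((hends e v).1 hv) (Or.inl rfl)
    have h2 := isCornerOf_side (f.sub e.2) ((hends e v).1 hv) (Or.inr rfl)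
    simp only [hth1]
    split_ifs
    exacts [⟨_, _, h1, rfl⟩, ⟨_, _, h2, rfl⟩]
  · intro e v hv
    have h1 := isCornerOf_side (f.sub e.2) ((hends e v).1 hv) (Or.inl rfl)
    have h2 := isCornerOf_side (f.sub e.2) ((hends e v).1 hv) (Or.inr rfl)
    simp only [hth2]
    split_ifs
    exacts [⟨_, _, h2, rfl⟩, ⟨_, _, h1, rfl⟩]
  · rintro φ o v hφ hper ho _ ⟨I, j, hc, rfl⟩ _ ⟨I', j', hc', rfl⟩
    refine (f.hull hφ hper hP (o := fun σ => if h : σ ∈ f.chosen then o ⟨σ, h⟩ else 0)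
      ?_ hc hc').trans (le_of_eq ?_)
    · intro σ hσ hv τ hτ τ' hτ'
      simp only [hσ, dif_pos]
      have e := hIcc ⟨σ, hσ⟩
      simp only at e
      rw [e] at hτ hτ'
      exact ho ⟨σ, hσ⟩ ((hends ⟨σ, hσ⟩ v).2 hv) τ hτ τ' hτ'
    · rw [Finset.sum_filter, Finset.sum_filter, ← Finset.sum_coe_sort f.chosen]
      refine Finset.sum_congr rfl fun e _ => ?_
      simp only [hends, e.2, dif_pos]
  · intro s t t' e₁ e₂ htt h1 h2 h3 h4 h5 h6
    obtain ⟨K, k1, k2, k3, k4, k5, k6⟩ := f.exists_cut hP htt ((hcutiff e₁ s).2 ⟨h1, h2⟩)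
      ((hcutiff e₂ s).2 ⟨h3, h4⟩) (hn e₁ t h5) (hn e₂ t' h6)
    have hm : ∀ e : f.chosen, root e.1.src ∈ K → root e.1.tgt ∈ K → lo e ∈ K ∧ hi e ∈ K := by
      intro e ha hb
      simp only [hlo, hhi]
      split_ifs
      exacts [⟨ha, hb⟩, ⟨hb, ha⟩]
    have hadj : ∀ v w, (∃ σ ∈ f.chosen, s(root σ.src, root σ.tgt) = s(v, w)) →
        ∃ e, s(lo e, hi e) = s(v, w) := by
      rintro v w ⟨σ, hσ, h⟩
      exact ⟨⟨σ, hσ⟩, by rw [hsym]; exact h⟩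
    refine ⟨K, (hm e₁ k1 k2).1, (hm e₁ k1 k2).2, (hm e₂ k3 k4).1, (hm e₂ k3 k4).2, ?_, ?_⟩
    · intro v hv
      have hb : Relation.ReflTransGen (fun v w => (∃ e, s(lo e, hi e) = s(v, w)) ∧ v ∈ K ∧ w ∈ K)
          (root e₁.1.src) v := by
        refine Relation.ReflTransGen.mono ?_ _ _ (k5 v hv)
        rintro v w ⟨h, hv, hw⟩
        exact ⟨hadj v w h, hv, hw⟩
      refine Relation.ReflTransGen.trans ?_ hb
      by_cases hu : up e₁
      · simp only [hlo, hu, if_true]; exact Relation.ReflTransGen.refl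
      · simp only [hlo, hu, if_false]
        refine Relation.ReflTransGen.single ⟨⟨e₁, ?_⟩, k2, k1⟩
        exact (hsym e₁).trans Sym2.eq_swap
    · intro v hv
      obtain ⟨⟨σ, hσ, hvσ, hcσ⟩, h⟩ := k6 v hv
      refine ⟨⟨⟨σ, hσ⟩, (hends ⟨σ, hσ⟩ v).2 hvσ, (hcutiff ⟨σ, hσ⟩ s).1 hcσ⟩, ?_⟩
      rcases h with h | h
      · exact Or.inl h
      · have := (hends e₁ v).2 h
        tauto
  · intro b b' h hne
    obtain ⟨σ, hσ, he⟩ := f.adj_of_boxAdj h hne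
    exact ⟨⟨σ, hσ⟩, (hsym ⟨σ, hσ⟩).trans he⟩
  · rintro v w ⟨e, he⟩
    have he' := (hsym e).symm.trans he
    rw [Sym2.eq_iff] at he'
    rcases he' with ⟨rfl, rfl⟩ | ⟨rfl, rfl⟩
    · exact ⟨_, _, ⟨e.1, f.sub e.2, Or.inl ⟨rfl, rfl⟩⟩, rfl, rfl⟩
    · exact ⟨_, _, ⟨e.1, f.sub e.2, Or.inr ⟨rfl, rfl⟩⟩, rfl, rfl⟩

end BoxFlow

/-- Greedy colouring with a prescribed independent set of colour `0`. -/
lemma exists_coloring {ι : Type*} [Fintype ι] [DecidableEq ι] (R : ι → ι → Prop)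
    (hsymm : ∀ i k, R i k → R k i)
    (D : ℕ) (hD : ∀ i, {k | R i k}.ncard ≤ D) (I₀ : Set ι) (hI₀ : ∀ i ∈ I₀, ∀ k ∈ I₀, ¬ R i k) :
    ∃ col : ι → ℕ, (∀ i, col i ≤ D + 1) ∧ (∀ i ∈ I₀, col i = 0) ∧
      ∀ i k, i ≠ k → R i k → col i ≠ col k := by
  classical
  have key : ∀ s : Finset ι, ∃ col : ι → ℕ, (∀ i, col i ≤ D) ∧
      ∀ i ∈ s, ∀ k ∈ s, i ≠ k → R i k → col i ≠ col k := by
    intro s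
    induction s using Finset.induction_on with
    | empty => exact ⟨fun _ => 0, by simp, by simp⟩
    | insert j s hj ih =>
      obtain ⟨col, h1, h2⟩ := ih
      obtain ⟨c, hc, hc'⟩ : ∃ c ∈ Finset.range (D + 1),
          c ∉ ((Finset.univ.filter fun k => R j k).image col) := by
        by_contra hcon
        push Not at hcon
        have := Finset.card_le_card hcon
        rw [Finset.card_range] at this
        have h3 := this.trans Finset.card_image_le
        have h4 := hD j
        rw [Set.ncard_eq_toFinset_card', Set.toFinset_ofPred] at h4
        have h5 : (Finset.univ.filter fun k => R j k).card ≤ D := by convert h4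
        omega
      refine ⟨Function.update col j c, ?_, ?_⟩
      · intro i
        by_cases hi : i = j
        · subst hi; simp at hc ⊢; omega
        · simp [hi, h1]
      · have hno : ∀ k, R j k → col k ≠ c := by
          intro k hk he
          exact hc' (Finset.mem_image.2 ⟨k, by simp [hk], he⟩)
        intro i hi k hk hne hR
        by_cases hij : i = j
        · subst hij
          rw [Function.update_self, Function.update_of_ne hne.symm]
          exact (hno k hR).symm
        · by_cases hkj : k = j
          · subst hkj
            rw [Function.update_self, Function.update_of_ne hne]
            exact hno i (hsymm _ _ hR)
          · rw [Function.update_of_ne hij, Function.update_of_ne hkj]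
            exact h2 i (Finset.mem_of_mem_insert_of_ne hi hij) k
              (Finset.mem_of_mem_insert_of_ne hk hkj) hne hR
  obtain ⟨col, h1, h2⟩ := key Finset.univ
  refine ⟨fun i => if i ∈ I₀ then 0 else col i + 1, ?_, ?_, ?_⟩
  · intro i
    have := h1 i
    simp only
    split_ifs <;> omega
  · intro i hi; simp [hi]
  · intro i k hne hR
    have := h2 i (Finset.mem_univ _) k (Finset.mem_univ _) hne hR
    simp only
    split_ifs with h h'
    · exact absurd hR (hI₀ i h k h')
    · omega
    · omega
    · omega

/-- A family of connected sets covering `P`, coloured so that equally coloured sets are disjoint. -/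
structure IsColoredCover {B ι : Type*} (Adj : B → B → Prop) (P : Set B) (S : ι → Set B)
    (col : ι → ℕ) : Prop where
  cover : ∀ b ∈ P, ∃ i, b ∈ S i
  conn : ∀ i, ∀ b ∈ S i, ∀ b' ∈ S i,
    Relation.ReflTransGen (fun c d => Adj c d ∧ c ∈ S i ∧ d ∈ S i) b b'
  sep : ∀ i k, col i = col k → (S i ∩ S k).Nonempty → i = k
  sub : ∀ i, S i ⊆ P

namespace IsColoredCover

variable {B ι : Type*} {Adj : B → B → Prop} {P : Set B} {S : ι → Set B} {col : ι → ℕ}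

/-- Merging the sets of a coloured cover into a partition with connected fibres. -/
lemma exists_root (h : IsColoredCover Adj P S col) (hsymm : ∀ b c, Adj b c → Adj c b)
    [Nonempty ι] : ∃ root : B → ι,
      (∀ b ∈ P, ∀ b' ∈ P, root b = root b' →
        Relation.ReflTransGen (fun c d => Adj c d ∧ root c = root b ∧ root d = root b) b b') ∧
      (∀ b ∈ P, ∀ c ∈ S (root b), root c = root b) ∧
      (∀ i, col i = 0 → ∀ b ∈ S i, root b = i) ∧
      ∀ (D : ℕ) (κ : ℝ) (ρ : B → B → ℝ), (∀ i, col i ≤ D) → 0 ≤ κ →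
        (∀ b c d, ρ b d ≤ ρ b c + ρ c d) → (∀ i, ∀ b ∈ S i, ∀ c ∈ S i, ρ b c ≤ κ) →
        ∀ b ∈ P, ∃ t ∈ S (root b), ρ b t ≤ (D + 1) * κ := by
  classical
  let rank : B → ℕ := fun b => sInf (col '' {i | b ∈ S i})
  have hidx : ∀ b, ∃ i, b ∈ P → b ∈ S i ∧ col i = rank b := by
    intro b
    by_cases hb : b ∈ P
    · obtain ⟨i, hi⟩ := h.cover b hb
      obtain ⟨k, hk, hk'⟩ := Nat.sInf_mem (s := col '' {i | b ∈ S i}) ⟨_, i, hi, rfl⟩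
      exact ⟨k, fun _ => ⟨hk, hk'⟩⟩
    · exact ⟨Classical.arbitrary ι, fun h => absurd h hb⟩
  choose idx hidx using hidx
  have hrank_le : ∀ b i, b ∈ S i → rank b ≤ col i := fun b i hi => Nat.sInf_le ⟨i, hi, rfl⟩
  have hidx_eq : ∀ b i, b ∈ S i → col i = rank b → idx b = i := fun b i hi hc => by
    have := hidx b (h.sub i hi)
    exact h.sep _ _ (this.2.trans hc.symm) ⟨b, this.1, hi⟩
  let Reach : ι → ℕ → Set B := fun i n => Nat.rec {c | c ∈ S i ∧ rank c < col i}
    (fun _ R => {c | c ∈ S i ∧ ∃ d ∈ R, Adj c d}) n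
  have hReach0 : ∀ i c, c ∈ Reach i 0 ↔ c ∈ S i ∧ rank c < col i := fun i c => Iff.rfl
  have hReachS : ∀ i n c, c ∈ Reach i (n + 1) ↔ c ∈ S i ∧ ∃ d ∈ Reach i n, Adj c d :=
    fun i n c => Iff.rfl
  have hReachSub : ∀ i n c, c ∈ Reach i n → c ∈ S i := by
    intro i n c hc
    cases n
    exacts [hc.1, hc.1]
  let δ : B → ℕ := fun b => sInf {n | b ∈ Reach (idx b) n}
  let Term : B → Prop := fun b => b ∈ P → ∀ c ∈ S (idx b), rank b ≤ rank c
  have hδ : ∀ b, ¬ Term b → b ∈ Reach (idx b) (δ b) := by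
    intro b hb
    simp only [Term] at hb
    push Not at hb
    obtain ⟨hbP, c, hc, hlt⟩ := hb
    have hbi := hidx b hbP
    refine Nat.sInf_mem (s := {n | b ∈ Reach (idx b) n}) ?_
    generalize idx b = i at hbi hc
    have := h.conn i b hbi.1 c hc
    rw [← hbi.2] at hlt
    have key : ∀ e, Relation.ReflTransGen (fun c d => Adj c d ∧ c ∈ S i ∧ d ∈ S i) e c →
        ∃ n, e ∈ Reach i n := by
      intro e he
      induction he using Relation.ReflTransGen.head_induction_on with
      | refl => exact ⟨0, hc, hlt⟩
      | head hab _ ih =>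
        obtain ⟨n, hn⟩ := ih
        exact ⟨n + 1, hab.2.1, _, hn, hab.1⟩
    exact key b this
  have hparent : ∀ b, ∃ c, ¬ Term b → Adj b c ∧ c ∈ S (idx b) ∧
      (rank c < rank b ∨ (rank c = rank b ∧ δ c < δ b)) := by
    intro b
    by_cases hb : Term b
    · exact ⟨b, fun h => absurd hb h⟩
    have hbP : b ∈ P := by by_contra hcon; exact hb fun h => absurd h hcon
    have hbi := hidx b hbP
    have h1 := hδ b hb
    cases hn : δ b with
    | zero =>
      rw [hn, hReach0] at h1
      exact absurd hbi.2 h1.2.ne'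
    | succ n =>
      rw [hn, hReachS] at h1
      obtain ⟨-, c, hc, hadj⟩ := h1
      have hcS := hReachSub _ _ _ hc
      refine ⟨c, fun _ => ⟨hadj, hcS, ?_⟩⟩
      have hle := hrank_le c _ hcS
      rw [hbi.2] at hle
      rcases hle.lt_or_eq with hlt | heq
      · exact Or.inl hlt
      · refine Or.inr ⟨heq, ?_⟩
        have : idx c = idx b := hidx_eq c _ hcS (hbi.2.trans heq.symm)
        have : δ c ≤ n := Nat.sInf_le (by rw [Set.mem_ofPred_eq, this]; exact hc)
        omega
  choose parent hparent using hparent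
  let ms : B → ℕ ×ₗ ℕ := fun b => toLex (rank b, δ b)
  have hms : ∀ b, ¬ Term b → ms (parent b) < ms b := by
    intro b hb
    have := (hparent b hb).2.2
    simp only [ms, Prod.Lex.toLex_lt_toLex]
    exact this
  have hwf : WellFounded (fun b c : B => ms b < ms c) := InvImage.wf ms wellFounded_lt
  let root : B → ι := hwf.fix fun b F => if hb : Term b then idx b else F (parent b) (hms b hb)
  have hroot_T : ∀ b, Term b → root b = idx b := fun b hb => by
    simp only [root]; rw [hwf.fix_eq, dif_pos hb]
  have hroot_N : ∀ b, ¬ Term b → root b = root (parent b) := fun b hb => by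
    conv_lhs => simp only [root]
    rw [hwf.fix_eq, dif_neg hb]
  have hparP : ∀ b, ¬ Term b → parent b ∈ P := fun b hb => h.sub _ (hparent b hb).2.1
  have hTS : ∀ b ∈ P, Term b → ∀ c ∈ S (idx b), Term c ∧ idx c = idx b := by
    intro b hb hT c hc
    have hbi := hidx b hb
    have e1 : rank c = rank b := le_antisymm (hbi.2 ▸ hrank_le c _ hc) (hT hb c hc)
    have e2 := hidx_eq c _ hc (hbi.2.trans e1.symm)
    refine ⟨fun _ d hd => ?_, e2⟩
    rw [e2] at hd
    rw [e1]
    exact hT hb d hd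
  have hterm : ∀ b ∈ P, ∃ t ∈ P, Term t ∧ idx t = root b ∧ root t = root b ∧
      Relation.ReflTransGen (fun c d => Adj c d ∧ root c = root b ∧ root d = root b) b t := by
    intro b
    induction b using hwf.induction with
    | _ b ih =>
      intro hb
      by_cases hT : Term b
      · exact ⟨b, hb, hT, (hroot_T b hT).symm, rfl, Relation.ReflTransGen.refl⟩
      · obtain ⟨t, h1, h2, h3, h4, h5⟩ := ih (parent b) (hms b hT) (hparP b hT)
        rw [← hroot_N b hT] at h3 h4 h5
        exact ⟨t, h1, h2, h3, h4, Relation.ReflTransGen.head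
          ⟨(hparent b hT).1, rfl, (hroot_N b hT).symm⟩ h5⟩
  have hrootS : ∀ b ∈ P, ∀ c ∈ S (root b), Term c ∧ root c = root b := by
    intro b hb c hc
    obtain ⟨t, h1, h2, h3, -, -⟩ := hterm b hb
    rw [← h3] at hc ⊢
    have := hTS t h1 h2 c hc
    exact ⟨this.1, (hroot_T c this.1).trans this.2⟩
  refine ⟨root, ?_, fun b hb c hc => (hrootS b hb c hc).2, ?_, ?_⟩
  · intro b hb b' hb' he
    obtain ⟨t, h1, h2, h3, h4, h5⟩ := hterm b hb
    obtain ⟨t', h1', h2', h3', h4', h5'⟩ := hterm b' hb'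
    rw [← he] at h3' h4' h5'
    refine h5.trans (Relation.ReflTransGen.trans ?_
      (Relation.ReflTransGen.mono ?_ _ _ (Relation.ReflTransGen.swap _ _ h5')))
    · refine Relation.ReflTransGen.mono ?_ _ _
        (h.conn (root b) t (h3 ▸ (hidx t h1).1) t' (h3' ▸ (hidx t' h1').1))
      rintro c d ⟨hcd, hc, hd⟩
      exact ⟨hcd, (hrootS b hb c hc).2, (hrootS b hb d hd).2⟩
    · rintro c d ⟨hcd, hc, hd⟩
      exact ⟨hsymm _ _ hcd, hd, hc⟩
  · intro i hi b hb
    have hbP := h.sub i hb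
    have h0 : rank b = 0 := Nat.le_zero.1 (hi ▸ hrank_le b i hb)
    have hT : Term b := fun _ c _ => by rw [h0]; exact Nat.zero_le _
    rw [hroot_T b hT]
    exact hidx_eq b i hb (hi.trans h0.symm)
  · intro D κ ρ hD hκ htri hdiam
    have key : ∀ b ∈ P, ∃ t ∈ S (root b), ∀ b' ∈ S (idx b), ρ b' t ≤ (rank b + 1) * κ := by
      intro b
      induction b using hwf.induction with
      | _ b ih =>
        intro hb
        by_cases hT : Term b
        · rw [hroot_T b hT]
          refine ⟨b, (hidx b hb).1, fun b' hb' => (hdiam _ b' hb' b (hidx b hb).1).trans ?_⟩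
          have : (0 : ℝ) ≤ rank b := Nat.cast_nonneg _
          nlinarith
        · obtain ⟨t, ht, h1⟩ := ih (parent b) (hms b hT) (hparP b hT)
          rw [← hroot_N b hT] at ht
          refine ⟨t, ht, fun b' hb' => ?_⟩
          obtain ⟨-, hpS, hlt | ⟨heq, -⟩⟩ := hparent b hT
          · have e1 := h1 (parent b) (hidx _ (hparP b hT)).1
            have e2 := hdiam _ b' hb' _ hpS
            have e3 := htri b' (parent b) t
            have : (rank (parent b) : ℝ) + 1 ≤ rank b := by exact_mod_cast hlt
            nlinarith
          · have : idx (parent b) = idx b := hidx_eq _ _ hpS ((hidx b hb).2.trans heq.symm)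
            rw [← heq]
            exact h1 b' (this ▸ hb')
    intro b hb
    obtain ⟨t, ht, h1⟩ := key b hb
    refine ⟨t, ht, (h1 b (hidx b hb).1).trans ?_⟩
    have : (rank b : ℝ) ≤ D := by exact_mod_cast (hidx b hb).2 ▸ hD (idx b)
    gcongr

end IsColoredCover

/-- Polar coordinates on a sphere with poles `x` and `y`. -/
structure PolarParam {Z : Type*} [TopologicalSpace Z] (x y : Z) (q : ℝ → ℝ → Z) : Prop where
  ne : x ≠ y
  cont : Continuous (fun p : ℝ × ℝ => q p.1 p.2)
  per : ∀ u v, q (u + 1) v = q u v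
  bot : ∀ u, q u 0 = x
  top : ∀ u, q u 1 = y
  surj : ∀ z, ∃ u, ∃ v ∈ Set.Icc (0 : ℝ) 1, q u v = z
  inj : ∀ u v u' v', v ∈ Set.Icc (0 : ℝ) 1 → v' ∈ Set.Icc (0 : ℝ) 1 → q u v = q u' v' →
    v = v' ∧ (v = 0 ∨ v = 1 ∨ ∃ k : ℤ, u' = u + k)

lemma exists_sphere_polarParam :
    ∃ (x y : ↥(Metric.sphere (0 : EuclideanSpace ℝ (Fin 3)) 1)) (q : ℝ → ℝ → _),
      PolarParam x y q := by
  have hmem : ∀ u v : ℝ, (!₂[Real.sin (Real.pi * v) * Real.cos (2 * Real.pi * u),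
      Real.sin (Real.pi * v) * Real.sin (2 * Real.pi * u), -Real.cos (Real.pi * v)] :
      EuclideanSpace ℝ (Fin 3)) ∈ Metric.sphere (0 : EuclideanSpace ℝ (Fin 3)) 1 := by
    intro u v
    rw [mem_sphere_zero_iff_norm, EuclideanSpace.norm_eq, Real.sqrt_eq_one, Fin.sum_univ_three]
    simp only [Real.norm_eq_abs, sq_abs]
    simp
    have h1 := Real.sin_sq_add_cos_sq (Real.pi * v)
    have h2 := Real.sin_sq_add_cos_sq (2 * Real.pi * u)
    linear_combination h1 + Real.sin (Real.pi * v) ^ 2 * h2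
  let q : ℝ → ℝ → ↥(Metric.sphere (0 : EuclideanSpace ℝ (Fin 3)) 1) := fun u v => ⟨_, hmem u v⟩
  have hq : ∀ u v u' v', q u v = q u' v' ↔
      Real.sin (Real.pi * v) * Real.cos (2 * Real.pi * u)
        = Real.sin (Real.pi * v') * Real.cos (2 * Real.pi * u') ∧
      Real.sin (Real.pi * v) * Real.sin (2 * Real.pi * u)
        = Real.sin (Real.pi * v') * Real.sin (2 * Real.pi * u') ∧
      Real.cos (Real.pi * v) = Real.cos (Real.pi * v') := by
    intro u v u' v'
    simp only [q, Subtype.mk.injEq]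
    constructor
    · intro h
      have h0 := congrArg (fun w : EuclideanSpace ℝ (Fin 3) => w 0) h
      have h1 := congrArg (fun w : EuclideanSpace ℝ (Fin 3) => w 1) h
      have h2 := congrArg (fun w : EuclideanSpace ℝ (Fin 3) => w 2) h
      simp at h0 h1 h2
      refine ⟨?_, ?_, h2⟩
      · simpa using h0
      · simpa using h1
    · rintro ⟨h0, h1, h2⟩
      rw [h0, h1, h2]
  have hpi := Real.pi_pos
  refine ⟨q 0 0, q 0 1, q, ?_, ?_, ?_, ?_, ?_, ?_, ?_⟩
  · rw [Ne, hq]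
    norm_num
  · refine Continuous.subtype_mk ?_ _
    refine (PiLp.continuous_toLp 2 _).comp (continuous_pi fun i => ?_)
    fin_cases i <;> simp <;> fun_prop
  · intro u v
    rw [hq, show 2 * Real.pi * (u + 1) = 2 * Real.pi * u + 2 * Real.pi by ring]
    simp
  · intro u; rw [hq]; simp
  · intro u; rw [hq]; simp
  · rintro ⟨w, hw⟩
    rw [mem_sphere_zero_iff_norm, EuclideanSpace.norm_eq, Real.sqrt_eq_one,
      Fin.sum_univ_three] at hw
    simp only [Real.norm_eq_abs, sq_abs] at hw
    have hw2 : -1 ≤ -w 2 ∧ -w 2 ≤ 1 := by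
      constructor <;> nlinarith [sq_nonneg (w 0), sq_nonneg (w 1)]
    set ζ : ℂ := ⟨w 0, w 1⟩ with hζ
    have hn : ‖ζ‖ = Real.sqrt (1 - (-w 2) ^ 2) := by
      rw [Complex.norm_def, Complex.normSq_apply]
      congr 1
      simp only [hζ]
      linear_combination hw
    refine ⟨Complex.arg ζ / (2 * Real.pi), Real.arccos (-w 2) / Real.pi, ⟨by
      have := Real.arccos_nonneg (-w 2); positivity, by
      rw [div_le_one hpi]; exact Real.arccos_le_pi _⟩, ?_⟩
    have e1 : Real.pi * (Real.arccos (-w 2) / Real.pi) = Real.arccos (-w 2) := by field_simp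
    have e2 : 2 * Real.pi * (Complex.arg ζ / (2 * Real.pi)) = Complex.arg ζ := by field_simp
    have e3 := Complex.norm_mul_cos_arg ζ
    have e4 := Complex.norm_mul_sin_arg ζ
    simp only [q, e1, e2, Subtype.mk.injEq, Real.sin_arccos, Real.cos_arccos hw2.1 hw2.2, ← hn, e3,
      e4]
    ext i
    fin_cases i <;> simp [hζ]
  · intro u v u' v' hv hv' h
    rw [hq] at h
    have hvv : v = v' := by
      have := Real.injOn_cos (x₁ := Real.pi * v) (x₂ := Real.pi * v')
        ⟨by have := hv.1; positivity, by nlinarith [hv.2]⟩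
        ⟨by have := hv'.1; positivity, by nlinarith [hv'.2]⟩ h.2.2
      exact mul_left_cancel₀ hpi.ne' this
    refine ⟨hvv, ?_⟩
    subst hvv
    rcases hv.1.eq_or_lt with h0 | h0
    · exact Or.inl h0.symm
    rcases hv.2.eq_or_lt with h1 | h1
    · exact Or.inr (Or.inl h1)
    right; right
    have hs : Real.sin (Real.pi * v) ≠ 0 :=
      (Real.sin_pos_of_pos_of_lt_pi (by positivity) (by nlinarith)).ne'
    have hc := mul_left_cancel₀ hs h.1
    have hsn := mul_left_cancel₀ hs h.2.1
    have hexp : Complex.exp ((2 * Real.pi * u' : ℝ) * Complex.I)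
        = Complex.exp ((2 * Real.pi * u : ℝ) * Complex.I) := by
      rw [Complex.exp_mul_I, Complex.exp_mul_I, ← Complex.ofReal_cos, ← Complex.ofReal_cos,
        ← Complex.ofReal_sin, ← Complex.ofReal_sin, hc, hsn]
    obtain ⟨k, hk⟩ := Complex.exp_eq_exp_iff_exists_int.1 hexp
    refine ⟨k, ?_⟩
    have := congrArg Complex.im hk
    simp at this
    have h2 : 2 * Real.pi * u' = 2 * Real.pi * (u + k) := by linarith
    exact mul_left_cancel₀ (by positivity) h2

lemma PolarParam.comp_homeo {X Z : Type*} [TopologicalSpace X] [TopologicalSpace Z] {x y : X}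
    {q : ℝ → ℝ → X} (h : PolarParam x y q) (e : X ≃ₜ Z) :
    PolarParam (e x) (e y) (fun u v => e (q u v)) where
  ne := fun hc => h.ne (e.injective hc)
  cont := e.continuous.comp h.cont
  per u v := by rw [h.per]
  bot u := by rw [h.bot]
  top u := by rw [h.top]
  surj z := by
    obtain ⟨u, v, hv, hq⟩ := h.surj (e.symm z)
    exact ⟨u, v, hv, by rw [hq]; simp⟩
  inj u v u' v' hv hv' he := h.inj u v u' v' hv hv' (e.injective he)

/-- The `b`-th grid box in polar coordinates. -/
def polarBox {Z : Type*} (q : ℝ → ℝ → Z) (N M : ℕ) (b : ZMod N × ℕ) : Set Z :=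
  {z | ∃ (k : ℤ) (u v : ℝ), (k : ZMod N) = b.1 ∧ k ≤ N * u ∧ N * u ≤ k + 1 ∧ b.2 ≤ M * v ∧
    M * v ≤ b.2 + 1 ∧ q u v = z}

namespace PolarParam

lemma per_int {Z : Type*} [TopologicalSpace Z] {x y : Z} {q : ℝ → ℝ → Z} (h : PolarParam x y q)
    (u v : ℝ) (k : ℤ) : q (u + k) v = q u v := by
  have hp : Function.Periodic (fun u => q u v) 1 := fun u => h.per u v
  simpa using hp.int_mul k u

section

variable {Z : Type*} [MetricSpace Z] {x y : Z} {q : ℝ → ℝ → Z} {N M : ℕ} [NeZero N]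

lemma polarBox_eq_image (h : PolarParam x y q) (b : ZMod N × ℕ) :
    polarBox q N M b = (fun p : ℝ × ℝ => q p.1 p.2) ''
      ({u | (b.1.val : ℝ) ≤ N * u ∧ N * u ≤ b.1.val + 1} ×ˢ
        {v | (b.2 : ℝ) ≤ M * v ∧ M * v ≤ b.2 + 1}) := by
  have hN : (0 : ℝ) < N := by exact_mod_cast Nat.pos_of_ne_zero (NeZero.ne N)
  ext z
  constructor
  · rintro ⟨k, u, v, hk, h1, h2, h3, h4, rfl⟩
    have hk' : (k : ZMod N) = ((b.1.val : ℤ) : ZMod N) := by rw [hk]; simp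
    rw [ZMod.intCast_eq_intCast_iff_dvd_sub] at hk'
    obtain ⟨l, hl⟩ := hk'
    have hl' : (b.1.val : ℝ) - k = N * l := by exact_mod_cast hl
    refine ⟨(u + l, v), ⟨⟨?_, ?_⟩, h3, h4⟩, h.per_int u v l⟩ <;> simp only <;> nlinarith
  · rintro ⟨⟨u, v⟩, ⟨⟨h1, h2⟩, h3, h4⟩, rfl⟩
    exact ⟨b.1.val, u, v, by simp, by exact_mod_cast h1, by exact_mod_cast h2, h3, h4, rfl⟩

lemma setOf_mul_mem_eq_Icc {c : ℝ} (hc : 0 < c) (r : ℝ) :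
    {u : ℝ | r ≤ c * u ∧ c * u ≤ r + 1} = Set.Icc (r / c) ((r + 1) / c) := by
  ext u
  rw [Set.mem_Icc, Set.mem_ofPred_eq, div_le_iff₀ hc, le_div_iff₀ hc, mul_comm c]

lemma isCompact_polarBox (h : PolarParam x y q) (hM : 0 < M) (b : ZMod N × ℕ) :
    IsCompact (polarBox q N M b) := by
  rw [h.polarBox_eq_image, setOf_mul_mem_eq_Icc, setOf_mul_mem_eq_Icc (by exact_mod_cast hM)]
  · exact (isCompact_Icc.prod isCompact_Icc).image h.cont
  · exact_mod_cast Nat.pos_of_ne_zero (NeZero.ne N)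

lemma isPreconnected_polarBox (h : PolarParam x y q) (hM : 0 < M) (b : ZMod N × ℕ) :
    IsPreconnected (polarBox q N M b) := by
  rw [h.polarBox_eq_image, setOf_mul_mem_eq_Icc, setOf_mul_mem_eq_Icc (by exact_mod_cast hM)]
  · exact (isPreconnected_Icc.prod isPreconnected_Icc).image _ h.cont.continuousOn
  · exact_mod_cast Nat.pos_of_ne_zero (NeZero.ne N)

lemma exists_mem_polarBox (h : PolarParam x y q) (hM : 0 < M) (z : Z) :
    ∃ b : ZMod N × ℕ, b.2 < M ∧ z ∈ polarBox q N M b := by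
  obtain ⟨u, v, ⟨hv0, hv1⟩, rfl⟩ := h.surj z
  have hM' : (0 : ℝ) < M := by exact_mod_cast hM
  have hu : (⌊N * u⌋ : ℝ) ≤ N * u ∧ N * u ≤ ⌊N * u⌋ + 1 :=
    ⟨Int.floor_le _, (Int.lt_floor_add_one _).le⟩
  rcases hv1.eq_or_lt with rfl | hv1
  · refine ⟨(⌊N * u⌋, M - 1), by simp only; omega, ⌊N * u⌋, u, 1, rfl, hu.1, hu.2, ?_, ?_, rfl⟩
    · simp only [mul_one]; exact_mod_cast Nat.sub_le _ _
    · simp only [mul_one]; norm_cast; omega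
  · refine ⟨(⌊N * u⌋, ⌊M * v⌋₊), ?_, ⌊N * u⌋, u, v, rfl, hu.1, hu.2, Nat.floor_le (by positivity),
      (Nat.lt_floor_add_one _).le, rfl⟩
    simp only
    rw [Nat.floor_lt (by positivity)]
    nlinarith

lemma exists_small_polarBox (h : PolarParam x y q) {ε : ℝ} (hε : 0 < ε) :
    ∃ n : ℕ, 0 < n ∧ ∀ b : ZMod (n + 1) × ℕ, b.2 < n + 1 →
      ∀ z ∈ polarBox q (n + 1) (n + 1) b, ∀ z' ∈ polarBox q (n + 1) (n + 1) b, dist z z' ≤ ε := by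
  have huc := (isCompact_Icc.prod isCompact_Icc : IsCompact
    (Set.Icc (0 : ℝ) 1 ×ˢ Set.Icc (0 : ℝ) 1)).uniformContinuousOn_of_continuous h.cont.continuousOn
  rw [Metric.uniformContinuousOn_iff] at huc
  obtain ⟨δ, hδ, huc⟩ := huc ε hε
  obtain ⟨n, hn⟩ := exists_nat_one_div_lt hδ
  refine ⟨n + 1, by omega, fun b hb z hz z' hz' => ?_⟩
  rw [h.polarBox_eq_image] at hz hz'
  obtain ⟨⟨u, v⟩, ⟨⟨h1, h2⟩, h3, h4⟩, rfl⟩ := hz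
  obtain ⟨⟨u', v'⟩, ⟨⟨h1', h2'⟩, h3', h4'⟩, rfl⟩ := hz'
  simp only at h1 h2 h3 h4 h1' h2' h3' h4'
  have hval : (b.1.val : ℝ) + 1 ≤ ((n + 1 + 1 : ℕ) : ℝ) := by exact_mod_cast ZMod.val_lt b.1
  have hval2 : (b.2 : ℝ) + 1 ≤ ((n + 1 + 1 : ℕ) : ℝ) := by exact_mod_cast hb
  have hn0 : (0 : ℝ) ≤ b.1.val := Nat.cast_nonneg _
  have hn0' : (0 : ℝ) ≤ b.2 := Nat.cast_nonneg _
  set c : ℝ := ((n + 1 + 1 : ℕ) : ℝ) with hc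
  have hcpos : 0 < c := by rw [hc]; positivity
  have hcδ : 1 < δ * c := by
    rw [div_lt_iff₀ (by positivity)] at hn
    have : c = n + 1 + 1 := by rw [hc]; push_cast; ring
    rw [this]; nlinarith
  have unit : ∀ w r : ℝ, 0 ≤ r → r + 1 ≤ c → r ≤ c * w → c * w ≤ r + 1 → w ∈ Set.Icc (0 : ℝ) 1 := by
    intro w r hr hr' hw hw'
    exact ⟨by by_contra hcon; nlinarith [mul_pos hcpos (neg_pos.2 (not_le.1 hcon))],
      le_of_mul_le_mul_left (by linarith) hcpos⟩
  have close : ∀ w w' r : ℝ, r ≤ c * w → c * w ≤ r + 1 → r ≤ c * w' → c * w' ≤ r + 1 →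
      dist w w' < δ := by
    intro w w' r h1 h2 h3 h4
    rw [Real.dist_eq, abs_lt]
    constructor
    · refine lt_of_mul_lt_mul_left ?_ hcpos.le
      nlinarith
    · refine lt_of_mul_lt_mul_left ?_ hcpos.le
      nlinarith
  exact (huc (u, v) ⟨unit u _ hn0 hval h1 h2, unit v _ hn0' hval2 h3 h4⟩
    (u', v') ⟨unit u' _ hn0 hval h1' h2', unit v' _ hn0' hval2 h3' h4'⟩
    (max_lt (close u u' _ h1 h2 h1' h2') (close v v' _ h3 h4 h3' h4'))).le

lemma boxAdj_right {i : ZMod N} {j : ℕ} (hj : j < M) : BoxAdj N M (i, j) (i + 1, j) :=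
  ⟨(false, i, j), mem_sides_false.2 hj, Or.inl ⟨rfl, rfl⟩⟩

lemma boxAdj_up {i : ZMod N} {j : ℕ} (hj : j + 1 < M) : BoxAdj N M (i, j) (i, j + 1) :=
  ⟨(true, i, j), mem_sides_true.2 hj, Or.inl ⟨rfl, rfl⟩⟩

lemma polarBox_inter_nonempty {b c : ZMod N × ℕ} (hbc : BoxAdj N M b c) (hM : 0 < M) :
    (polarBox q N M b ∩ polarBox q N M c).Nonempty := by
  have hN : (0 : ℝ) < N := by exact_mod_cast Nat.pos_of_ne_zero (NeZero.ne N)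
  have hM : (0 : ℝ) < M := by exact_mod_cast hM
  have key : ∀ σ : Side N, (polarBox q N M σ.src ∩ polarBox q N M σ.tgt).Nonempty := by
    rintro ⟨s, i, j⟩
    have e2 : (M : ℝ) * ((j + 1) / M) = j + 1 := by field_simp
    have e1 : (N : ℝ) * ((i.val + 1) / N) = i.val + 1 := by field_simp
    cases s
    · refine ⟨q ((i.val + 1) / N) ((j + 1) / M), ⟨i.val, _, _, by simp [Side.src], ?_, ?_, ?_, ?_, rfl⟩,
        ⟨i.val + 1, _, _, by simp [Side.tgt], ?_, ?_, ?_, ?_, rfl⟩⟩ <;>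
        simp only [Side.src, Side.tgt, e1, e2] <;> push_cast <;> simp
    · refine ⟨q ((i.val + 1) / N) ((j + 1) / M), ⟨i.val, _, _, by simp [Side.src], ?_, ?_, ?_, ?_, rfl⟩,
        ⟨i.val, _, _, by simp [Side.tgt], ?_, ?_, ?_, ?_, rfl⟩⟩ <;>
        simp only [Side.src, Side.tgt, e1, e2] <;> push_cast <;> simp
  obtain ⟨σ, -, ⟨rfl, rfl⟩ | ⟨rfl, rfl⟩⟩ := hbc
  · exact key σ
  · rw [Set.inter_comm]; exact key σ

lemma ring_connected {j : ℕ} (hj : j < M) {p : ZMod N × ℕ → Prop} (hp : ∀ i, p (i, j)) (i i' : ZMod N) :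
    Relation.ReflTransGen (fun c d => BoxAdj N M c d ∧ p c ∧ p d) (i, j) (i', j) := by
  have key : ∀ n : ℕ, Relation.ReflTransGen (fun c d => BoxAdj N M c d ∧ p c ∧ p d) (i, j)
      (i + n, j) := by
    intro n
    induction n with
    | zero => simpa using Relation.ReflTransGen.refl
    | succ n ih =>
      refine ih.tail ⟨?_, hp _, hp _⟩
      push_cast
      rw [← add_assoc]
      exact boxAdj_right hj
  have := key (i' - i).val
  rwa [ZMod.natCast_zmod_val, add_sub_cancel] at this

lemma polarBox_common (h : PolarParam x y q) (hM : 0 < M) {z : Z} {b b' : ZMod N × ℕ}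
    (hb : b.2 < M) (hb' : b'.2 < M) (hz : z ∈ polarBox q N M b) (hz' : z ∈ polarBox q N M b') :
    Relation.ReflTransGen (fun c d => BoxAdj N M c d ∧ z ∈ polarBox q N M c ∧ z ∈ polarBox q N M d)
      b b' := by
  obtain ⟨i, j⟩ := b
  obtain ⟨i', j'⟩ := b'
  obtain ⟨k, u, v, hk, h1, h2, h3, h4, rfl⟩ := hz
  obtain ⟨k', u', v', hk', h1', h2', h3', h4', he⟩ := hz'
  simp only at hb hb' hk hk' h3 h4 h3' h4'
  have hN : (0 : ℝ) < N := by exact_mod_cast Nat.pos_of_ne_zero (NeZero.ne N)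
  have hM' : (0 : ℝ) < M := by exact_mod_cast hM
  have hmem : ∀ w : ℝ, ∀ l : ℕ, l < M → (l : ℝ) ≤ M * w → M * w ≤ l + 1 → w ∈ Set.Icc (0 : ℝ) 1 := by
    intro w l hl h1 h2
    have hl' : (l : ℝ) + 1 ≤ M := by exact_mod_cast hl
    have : (0 : ℝ) ≤ l := Nat.cast_nonneg _
    exact ⟨by by_contra hcon; nlinarith [mul_pos hM' (neg_pos.2 (not_le.1 hcon))],
      le_of_mul_le_mul_left (by linarith) hM'⟩
  obtain ⟨rfl, hcase⟩ := h.inj u v u' v' (hmem v j hb h3 h4) (hmem v' j' hb' h3' h4') he.symm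
  have pole : ∀ (v0 : ℝ) (z : Z), (∀ u, q u v0 = z) → ∀ l : ℕ, (l : ℝ) ≤ M * v0 → M * v0 ≤ l + 1 →
      ∀ i : ZMod N, z ∈ polarBox q N M (i, l) := by
    intro v0 z hq l hl1 hl2 i
    refine ⟨i.val, i.val / N, v0, by simp, ?_, ?_, hl1, hl2, hq _⟩
    · push_cast; rw [mul_div_cancel₀ _ hN.ne']
    · push_cast; rw [mul_div_cancel₀ _ hN.ne']; linarith
  by_cases hv0 : v = 0
  · subst hv0
    have e : j = 0 := by rw [mul_zero] at h3; exact_mod_cast le_antisymm h3 (Nat.cast_nonneg _)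
    have e' : j' = 0 := by rw [mul_zero] at h3'; exact_mod_cast le_antisymm h3' (Nat.cast_nonneg _)
    subst e e'
    exact ring_connected hb (p := fun c => q u 0 ∈ polarBox q N M c)
      (pole 0 _ (fun w => by rw [h.bot, h.bot]) 0 h3 h4) i i'
  by_cases hv1 : v = 1
  · subst hv1
    have e : j + 1 = M := by
      rw [mul_one] at h4; have : M ≤ j + 1 := by exact_mod_cast h4
      omega
    have e' : j' + 1 = M := by
      rw [mul_one] at h4'; have : M ≤ j' + 1 := by exact_mod_cast h4'
      omega
    obtain rfl : j = j' := by omega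
    exact ring_connected hb (p := fun c => q u 1 ∈ polarBox q N M c)
      (pole 1 _ (fun w => by rw [h.top, h.top]) j h3 h4) i i'
  obtain ⟨l, rfl⟩ := (hcase.resolve_left hv0).resolve_left hv1
  have mem1 : q u v ∈ polarBox q N M (i, j) := ⟨k, u, v, hk, h1, h2, h3, h4, rfl⟩
  have mem2 : q u v ∈ polarBox q N M (i', j) := ⟨k', u + l, v, hk', h1', h2', h3, h4, he⟩
  have mem3 : q u v ∈ polarBox q N M (i', j') := ⟨k', u + l, v, hk', h1', h2', h3', h4', he⟩
  have hor : Relation.ReflTransGen (fun c d => BoxAdj N M c d ∧ q u v ∈ polarBox q N M c ∧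
      q u v ∈ polarBox q N M d) (i, j) (i', j) := by
    have b1 : k + N * l ≤ k' + 1 := by
      have : (k : ℝ) + N * l ≤ k' + 1 := by nlinarith
      exact_mod_cast this
    have b2 : k' ≤ k + N * l + 1 := by
      have : (k' : ℝ) ≤ k + N * l + 1 := by nlinarith
      exact_mod_cast this
    have hcast : (((k + N * l : ℤ)) : ZMod N) = i := by push_cast; simp [hk]
    obtain e | e | e : k' = k + N * l ∨ k' = k + N * l + 1 ∨ k' + 1 = k + N * l := by omega
    · have : i' = i := by rw [← hk', e, hcast]
      rw [this]
    · have : i' = i + 1 := by rw [← hk', e, Int.cast_add, hcast]; simp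
      refine Relation.ReflTransGen.single ⟨?_, mem1, mem2⟩
      rw [this]; exact boxAdj_right hb
    · have : i = i' + 1 := by rw [← hk', ← hcast, ← e]; simp
      refine Relation.ReflTransGen.single ⟨boxAdj_symm ?_, mem1, mem2⟩
      rw [this]; exact boxAdj_right hb
  refine hor.trans ?_
  have b1 : j ≤ j' + 1 := by
    have : (j : ℝ) ≤ j' + 1 := by linarith
    exact_mod_cast this
  have b2 : j' ≤ j + 1 := by
    have : (j' : ℝ) ≤ j + 1 := by linarith
    exact_mod_cast this
  obtain rfl | rfl | rfl : j' = j ∨ j' = j + 1 ∨ j = j' + 1 := by omega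
  · exact Relation.ReflTransGen.refl
  · exact Relation.ReflTransGen.single ⟨boxAdj_up hb', mem2, mem3⟩
  · exact Relation.ReflTransGen.single ⟨boxAdj_symm (boxAdj_up hb), mem2, mem3⟩

/-- The boxes meeting a connected set are connected to each other. -/
lemma polarBox_connected (h : PolarParam x y q) (hM : 0 < M) {K : Set Z}
    (hK' : IsPreconnected K) {b b' : ZMod N × ℕ} (hb : b.2 < M) (hb' : b'.2 < M)
    (hKb : (polarBox q N M b ∩ K).Nonempty) (hKb' : (polarBox q N M b' ∩ K).Nonempty) :
    Relation.ReflTransGen (fun c d => BoxAdj N M c d ∧ (polarBox q N M c ∩ K).Nonempty ∧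
      (polarBox q N M d ∩ K).Nonempty) b b' := by
  set R := Relation.ReflTransGen (fun c d => BoxAdj N M c d ∧ (polarBox q N M c ∩ K).Nonempty ∧
      (polarBox q N M d ∩ K).Nonempty) with hR
  by_contra hcon
  have hfin : ∀ s : Set (ZMod N × ℕ), s ⊆ {c | c.2 < M} →
      IsClosed (⋃ c ∈ s, polarBox q N M c) := by
    intro s hs
    refine (Set.Finite.subset ?_ hs).isClosed_biUnion fun c _ => (h.isCompact_polarBox hM c).isClosed
    have : {c : ZMod N × ℕ | c.2 < M} = Set.univ ×ˢ Set.Iio M := by ext; simp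
    rw [this]
    exact Set.finite_univ.prod (Set.finite_Iio M)
  have := isPreconnected_closed_iff.1 hK' (⋃ c ∈ {c | c.2 < M ∧ R b c}, polarBox q N M c)
    (⋃ c ∈ {c | c.2 < M ∧ ¬ R b c}, polarBox q N M c) (hfin _ fun c hc => hc.1)
    (hfin _ fun c hc => hc.1) ?_ ?_ ?_
  · obtain ⟨z, hzK, hz1, hz2⟩ := this
    rw [Set.mem_iUnion₂] at hz1 hz2
    obtain ⟨c, ⟨hc, hRc⟩, hzc⟩ := hz1
    obtain ⟨d, ⟨hd, hRd⟩, hzd⟩ := hz2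
    refine hRd (Relation.ReflTransGen.trans hRc ?_)
    refine Relation.ReflTransGen.mono ?_ _ _ (h.polarBox_common hM hc hd hzc hzd)
    rintro c d ⟨hcd, h1, h2⟩
    exact ⟨hcd, ⟨z, h1, hzK⟩, ⟨z, h2, hzK⟩⟩
  · intro z hz
    obtain ⟨c, hc, hzc⟩ := h.exists_mem_polarBox (N := N) hM z
    by_cases hRc : R b c
    · exact Or.inl (Set.mem_biUnion (show c ∈ {c | c.2 < M ∧ R b c} from ⟨hc, hRc⟩) hzc)
    · exact Or.inr (Set.mem_biUnion (show c ∈ {c | c.2 < M ∧ ¬ R b c} from ⟨hc, hRc⟩) hzc)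
  · obtain ⟨z, hz, hzK⟩ := hKb
    exact ⟨z, hzK, Set.mem_biUnion (show b ∈ {c | c.2 < M ∧ R b c} from
      ⟨hb, Relation.ReflTransGen.refl⟩) hz⟩
  · obtain ⟨z, hz, hzK⟩ := hKb'
    exact ⟨z, hzK, Set.mem_biUnion (show b' ∈ {c | c.2 < M ∧ ¬ R b c} from ⟨hb', hcon⟩) hz⟩

end

end PolarParam

/-- A discretisation of a sphere `Z` at scale `ε`: a square tiling of a cylinder whose pieces
correspond to connected subsets of `Z`. -/
structure Disc (Z : Type) [MetricSpace Z] (x y : Z) (K : ℝ) (D : ℕ) (ε : ℝ) where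
  V : Type
  E : Type
  [fV : Fintype V]
  [dV : DecidableEq V]
  [fE : Fintype E]
  T : Tiling V E
  Y : V → Set Z
  ctr : V → Z
  compact : ∀ v, IsCompact (Y v)
  connected : ∀ v, IsConnected (Y v)
  cover : ∀ z, ∃ v, z ∈ Y v
  x_mem : x ∈ Y T.vx
  y_mem : y ∈ Y T.vy
  near_ctr : ∀ v, ∀ z ∈ Y v, dist z (ctr v) ≤ K * ε
  count : ∀ z, (Finset.univ.filter fun v => dist z (ctr v) ≤ 4 * K * ε).card ≤ D
  inter : ∀ v w, T.Adj v w → (Y v ∩ Y w).Nonempty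
  near : ∀ v w z z', z ∈ Y v → z' ∈ Y w → dist z z' ≤ 4 * ε →
    Relation.ReflTransGen (fun a b => T.Adj a b ∧ dist z (ctr a) ≤ K * ε ∧ dist z (ctr b) ≤ K * ε) v w
  deg : ∀ v, (Finset.univ.filter fun e => T.lo e = v ∨ T.hi e = v).card ≤ D

attribute [instance] Disc.fV Disc.dV Disc.fE

section Net

variable {Z : Type} [MetricSpace Z] [MeasurableSpace Z] [BorelSpace Z] {μ : Measure Z}
  {Q C : ℝ} {Ψ : ℝ → ℝ}

/-- A separated set has boundedly many points in a ball of comparable radius. -/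
lemma LoewnerSpace.card_separated_le (hZ : LoewnerSpace μ Q C Ψ) (K : ℝ) (hK : 0 ≤ K) :
    ∃ D : ℕ, ∀ (ε : ℝ) (z : Z) (s : Finset Z), 0 < ε → ε ≤ Metric.diam (Set.univ : Set Z) →
      (∀ a ∈ s, ∀ b ∈ s, a ≠ b → ε ≤ dist a b) → (∀ a ∈ s, dist z a ≤ K * ε) → s.card ≤ D := by
  obtain ⟨D, hD⟩ := exists_nat_ge (C ^ 2 * (2 * (K + 1)) ^ Q)
  refine ⟨D, fun ε z s hε hεd hsep hball => ?_⟩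
  have hC := hZ.one_le
  have h1 : ∑ a ∈ s, μ (Metric.ball a (ε / 2)) ≤ μ (Metric.ball z ((K + 1) * ε)) := by
    rw [← measure_biUnion_finset]
    · refine measure_mono (Set.iUnion₂_subset fun a ha w hw => ?_)
      rw [Metric.mem_ball] at hw ⊢
      have := dist_triangle w a z
      have := hball a ha
      rw [dist_comm a z] at *
      nlinarith
    · intro a ha b hb hab
      refine Metric.ball_disjoint_ball ?_
      have := hsep a ha b hb hab
      linarith
    · exact fun a _ => Metric.isOpen_ball.measurableSet
  have h2 : (s.card : ℝ≥0∞) * ENNReal.ofReal (C⁻¹ * (ε / 2) ^ Q) ≤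
      ENNReal.ofReal (C * ((K + 1) * ε) ^ Q) := by
    refine le_trans ?_ (h1.trans (hZ.upper z _ (by positivity)))
    rw [← nsmul_eq_mul, ← Finset.sum_const]
    exact Finset.sum_le_sum fun a _ => hZ.lower a _ (by linarith) (by linarith)
  rw [← ENNReal.ofReal_natCast, ← ENNReal.ofReal_mul (Nat.cast_nonneg _),
    ENNReal.ofReal_le_ofReal_iff (by positivity)] at h2
  have h3 : ((K + 1) * ε) ^ Q = (2 * (K + 1)) ^ Q * (ε / 2) ^ Q := by
    rw [← Real.mul_rpow (by positivity) (by positivity)]; congr 1; ring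
  have hpos : 0 < C⁻¹ * (ε / 2) ^ Q := by positivity
  have h4 : (s.card : ℝ) ≤ C ^ 2 * (2 * (K + 1)) ^ Q := by
    refine le_of_mul_le_mul_right ?_ hpos
    rw [h3] at h2
    refine h2.trans (le_of_eq ?_)
    field_simp
  exact_mod_cast h4.trans hD

/-- A maximal separated set containing two given points. -/
lemma LoewnerSpace.exists_net (hZ : LoewnerSpace μ Q C Ψ) {x y : Z} {ε : ℝ} (hε : 0 < ε)
    (hxy : ε ≤ dist x y) : ∃ s : Finset Z, x ∈ s ∧ y ∈ s ∧
      (∀ a ∈ s, ∀ b ∈ s, a ≠ b → ε ≤ dist a b) ∧ ∀ z, ∃ a ∈ s, dist z a ≤ ε := by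
  classical
  have := hZ.compact
  have hbd : Bornology.IsBounded (Set.univ : Set Z) := isCompact_univ.isBounded
  have hdiam : ∀ a b : Z, dist a b ≤ Metric.diam (Set.univ : Set Z) := fun a b =>
    Metric.dist_le_diam_of_mem hbd trivial trivial
  obtain ⟨D, hD⟩ := hZ.card_separated_le (Metric.diam (Set.univ : Set Z) / ε)
    (div_nonneg Metric.diam_nonneg hε.le)
  let A : Set ℕ := {n | ∃ s : Finset Z, (x ∈ s ∧ y ∈ s ∧
      ∀ a ∈ s, ∀ b ∈ s, a ≠ b → ε ≤ dist a b) ∧ s.card = n}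
  have hA : BddAbove A := by
    refine ⟨D, ?_⟩
    rintro n ⟨s, ⟨hx, hy, hs⟩, rfl⟩
    refine hD ε x s hε (hxy.trans (hdiam _ _)) hs fun a _ => ?_
    rw [div_mul_cancel₀ _ hε.ne']
    exact hdiam _ _
  have hne : A.Nonempty := by
    refine ⟨_, {x, y}, ⟨by simp, by simp, ?_⟩, rfl⟩
    intro a ha b hb hab
    simp only [Finset.mem_insert, Finset.mem_singleton] at ha hb
    rcases ha with rfl | rfl <;> rcases hb with rfl | rfl
    · exact absurd rfl hab
    · exact hxy
    · rw [dist_comm]; exact hxy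
    · exact absurd rfl hab
  obtain ⟨s, ⟨hx, hy, hs⟩, hcard⟩ := Nat.sSup_mem hne hA
  refine ⟨s, hx, hy, hs, fun z => ?_⟩
  by_contra hcon
  push Not at hcon
  have hzs : z ∉ s := fun hz => by
    have := hcon z hz
    rw [dist_self] at this
    linarith
  have hmem : (insert z s).card ∈ A := by
    refine ⟨insert z s, ⟨Finset.mem_insert_of_mem hx, Finset.mem_insert_of_mem hy, ?_⟩, rfl⟩
    intro a ha b hb hab
    rw [Finset.mem_insert] at ha hb
    rcases ha with rfl | ha <;> rcases hb with rfl | hb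
    · exact absurd rfl hab
    · exact (hcon b hb).le
    · rw [dist_comm]; exact (hcon a ha).le
    · exact hs a ha b hb hab
  have := le_csSup hA hmem
  rw [Finset.card_insert_of_notMem hzs, ← hcard] at this
  omega

/-- A continuum between two concentric balls. -/
lemma LoewnerSpace.exists_thick (hZ : LoewnerSpace μ Q C Ψ) :
    ∃ Λ : ℝ, 1 ≤ Λ ∧ (∀ x y : Z, ∃ K : Set Z, IsCompact K ∧ IsConnected K ∧ x ∈ K ∧ y ∈ K ∧
      K ⊆ Metric.closedBall x (Λ * dist x y)) ∧
      ∀ (a : Z) (r : ℝ), 0 ≤ r → ∃ K : Set Z, IsCompact K ∧ IsConnected K ∧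
        Metric.closedBall a r ⊆ K ∧ K ⊆ Metric.closedBall a (Λ * r) := by
  have := hZ.compact
  obtain ⟨Λ, hΛ, h⟩ := hZ.llc
  refine ⟨Λ, hΛ, h, fun a r hr => ?_⟩
  choose! K hK using fun y => h a y
  refine ⟨closure (⋃ y ∈ Metric.closedBall a r, K y), isClosed_closure.isCompact, ?_, ?_, ?_⟩
  · refine IsConnected.closure ⟨⟨a, Set.mem_biUnion (Metric.mem_closedBall_self hr) (hK a).2.2.1⟩, ?_⟩
    rw [Set.biUnion_eq_iUnion]
    exact isPreconnected_iUnion ⟨a, Set.mem_iInter.2 fun y => (hK y).2.2.1⟩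
      fun y => (hK y).2.1.isPreconnected
  · exact fun y hy => subset_closure (Set.mem_biUnion hy (hK y).2.2.2.1)
  · refine closure_minimal (Set.iUnion₂_subset fun y hy => ?_) Metric.isClosed_closedBall
    refine (hK y).2.2.2.2.trans (Metric.closedBall_subset_closedBall ?_)
    rw [Metric.mem_closedBall, dist_comm] at hy
    gcongr

end Net

section DiscExists

variable {Z : Type} [MetricSpace Z] [MeasurableSpace Z] [BorelSpace Z] {μ : Measure Z}
  {Q C : ℝ} {Ψ : ℝ → ℝ}

lemma reflTransGen_of_root {B V : Type*} {R : B → B → Prop} {A : V → V → Prop} {root : B → V}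
    {b b' : B} (h : Relation.ReflTransGen R b b')
    (hA : ∀ c d, R c d → root c ≠ root d → A (root c) (root d)) :
    Relation.ReflTransGen A (root b) (root b') := by
  induction h with
  | refl => exact Relation.ReflTransGen.refl
  | tail _ hcd ih =>
    rename_i c d _
    by_cases he : root c = root d
    · rwa [← he]
    · exact ih.tail (hA _ _ hcd he)

lemma polarBox_nonempty {q : ℝ → ℝ → Z} {N M : ℕ} [NeZero N] (hM : 0 < M) (b : ZMod N × ℕ) :
    (polarBox q N M b).Nonempty := by
  have hN : (0 : ℝ) < N := by exact_mod_cast Nat.pos_of_ne_zero (NeZero.ne N)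
  have hM : (0 : ℝ) < M := by exact_mod_cast hM
  refine ⟨_, b.1.val, b.1.val / N, b.2 / M, by simp, ?_, ?_, ?_, ?_, rfl⟩
  · rw [mul_div_cancel₀ _ hN.ne']; simp
  · rw [mul_div_cancel₀ _ hN.ne']; simp
  · rw [mul_div_cancel₀ _ hM.ne']
  · rw [mul_div_cancel₀ _ hM.ne']; simp

/-- Spheres with the Loewner property have discretisations at all small scales. -/
theorem LoewnerSpace.exists_disc (hZ : LoewnerSpace μ Q C Ψ) {x y : Z} {q : ℝ → ℝ → Z}
    (hq : PolarParam x y q) : ∃ (K : ℝ) (D : ℕ) (ε₀ : ℝ), 1 ≤ K ∧ 0 < ε₀ ∧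
      ∀ ε, 0 < ε → ε ≤ ε₀ → Nonempty (Disc Z x y K D ε) := by
  classical
  have := hZ.compact
  obtain ⟨Λ, hΛ, hllc, hthick⟩ := hZ.exists_thick
  obtain ⟨D₁, hD₁⟩ := hZ.card_separated_le (5 * Λ) (by positivity)
  set K₀ : ℝ := (6 * D₁ + 16) * Λ with hK₀
  have hK₀pos : 16 ≤ K₀ := by
    have : (0 : ℝ) ≤ D₁ := Nat.cast_nonneg _
    rw [hK₀]; nlinarith
  set K : ℝ := K₀ + 5 * Λ with hK
  obtain ⟨D, hD⟩ := hZ.card_separated_le (4 * K) (by positivity)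
  have hxy : 0 < dist x y := dist_pos.2 hq.ne
  refine ⟨K, D, dist x y / (6 * Λ), by linarith, by positivity, fun ε hε hε₀ => ?_⟩
  rw [le_div_iff₀ (by positivity)] at hε₀
  have hεΛ : ε ≤ ε * Λ := by nlinarith
  have hdiam : dist x y ≤ Metric.diam (Set.univ : Set Z) :=
    Metric.dist_le_diam_of_mem isCompact_univ.isBounded trivial trivial
  obtain ⟨s, hxs, hys, hsep, hnet⟩ := hZ.exists_net hε (x := x) (y := y) (by nlinarith)
  obtain ⟨n, hn, hsmall⟩ := hq.exists_small_polarBox hε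
  have hM : 0 < n + 1 := by omega
  choose Th hTh using fun i : s => hthick i.1 (2 * ε) (by positivity)
  set bx : ZMod (n + 1) × ℕ → Set Z := polarBox q (n + 1) (n + 1) with hbx
  let P : Set (ZMod (n + 1) × ℕ) := {b | b.2 < n + 1}
  let S : s → Set (ZMod (n + 1) × ℕ) := fun i => {b | b ∈ P ∧ (bx b ∩ Th i).Nonempty}
  have hadjP : ∀ b c, BoxAdj (n + 1) (n + 1) b c → b ∈ P ∧ c ∈ P := by
    rintro b c ⟨σ, hσ, ⟨rfl, rfl⟩ | ⟨rfl, rfl⟩⟩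
    · exact side_bounds hσ
    · exact (side_bounds hσ).symm
  choose p hp using fun b => polarBox_nonempty (q := q) (N := n + 1) hM b
  have hSctr : ∀ i, ∀ b ∈ S i, ∀ z ∈ bx b, dist z i.1 ≤ ε + Λ * (2 * ε) := by
    rintro i b ⟨hb, w, hwb, hw⟩ z hz
    have h1 := hsmall b hb z hz w hwb
    have h2 := (hTh i).2.2.2 hw
    rw [Metric.mem_closedBall] at h2
    have := dist_triangle z w i.1
    linarith
  let R : s → s → Prop := fun i k => i ≠ k ∧ (S i ∩ S k).Nonempty
  have hRdist : ∀ i k, (S i ∩ S k).Nonempty → dist i.1 k.1 ≤ ε + 4 * (Λ * ε) := by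
    rintro i k ⟨b, ⟨hb, w, hwb, hw⟩, -, w', hwb', hw'⟩
    have h1 := hsmall b hb w hwb w' hwb'
    have h2 := (hTh i).2.2.2 hw
    have h3 := (hTh k).2.2.2 hw'
    rw [Metric.mem_closedBall] at h2 h3
    have h4 := dist_triangle4 i.1 w w' k.1
    rw [dist_comm i.1 w] at h4
    linarith
  have hcard : ∀ (K' : ℝ) (D' : ℕ), (∀ (ε : ℝ) (z : Z) (s : Finset Z), 0 < ε →
      ε ≤ Metric.diam (Set.univ : Set Z) → (∀ a ∈ s, ∀ b ∈ s, a ≠ b → ε ≤ dist a b) →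
      (∀ a ∈ s, dist z a ≤ K' * ε) → s.card ≤ D') → ∀ (z : Z) (t : Finset s),
      (∀ i ∈ t, dist z i.1 ≤ K' * ε) → t.card ≤ D' := by
    intro K' D' h z t ht
    rw [← Finset.card_map (Function.Embedding.subtype (· ∈ s))]
    refine h ε z _ hε (by nlinarith) ?_ ?_
    · intro a ha b hb hab
      simp only [Finset.mem_map, Function.Embedding.subtype_apply] at ha hb
      obtain ⟨i, -, rfl⟩ := ha
      obtain ⟨k, -, rfl⟩ := hb
      exact hsep _ i.2 _ k.2 hab
    · intro a ha
      simp only [Finset.mem_map, Function.Embedding.subtype_apply] at ha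
      obtain ⟨i, hi, rfl⟩ := ha
      exact ht i hi
  obtain ⟨col, hcol, hcol0, hcolR⟩ := exists_coloring R
    (fun i k h => ⟨h.1.symm, by rw [Set.inter_comm]; exact h.2⟩) D₁
    (fun i => by
      rw [Set.ncard_eq_toFinset_card']
      refine hcard _ _ hD₁ i.1 _ fun k hk => ?_
      have := hRdist i k (by simpa using (Set.mem_toFinset.1 hk).2)
      nlinarith) {⟨x, hxs⟩, ⟨y, hys⟩}
    (by
      rintro i hi k hk ⟨hne, hR⟩
      have h1 := hRdist i k hR
      have h2 : dist i.1 k.1 = dist x y := by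
        rcases hi with rfl | rfl <;> rcases hk with rfl | rfl
        · exact absurd rfl hne
        · rfl
        · exact dist_comm _ _
        · exact absurd rfl hne
      nlinarith)
  have hCC : IsColoredCover (BoxAdj (n + 1) (n + 1)) P S col := by
    refine ⟨?_, ?_, ?_, fun i b hb => hb.1⟩
    · intro b hb
      obtain ⟨a, ha, hda⟩ := hnet (p b)
      refine ⟨⟨a, ha⟩, hb, p b, hp b, (hTh ⟨a, ha⟩).2.2.1 ?_⟩
      rw [Metric.mem_closedBall]
      linarith
    · rintro i b ⟨hb, hb'⟩ c ⟨hc, hc'⟩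
      refine Relation.ReflTransGen.mono ?_ _ _
        (hq.polarBox_connected hM (hTh i).2.1.isPreconnected hb hc hb' hc')
      rintro d d' ⟨h, h1, h2⟩
      exact ⟨h, ⟨(hadjP _ _ h).1, h1⟩, (hadjP _ _ h).2, h2⟩
    · intro i k hik hne
      by_contra hcon
      exact hcolR i k hcon ⟨hcon, hne⟩ hik
  have : Nonempty s := ⟨⟨x, hxs⟩⟩
  obtain ⟨root, hconn, -, hroot0, hball⟩ := hCC.exists_root (fun _ _ => boxAdj_symm)
  replace hball := hball (D₁ + 1) (6 * Λ * ε) (fun b c => dist (p b) (p c)) hcol (by positivity)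
    (fun b c d => dist_triangle _ _ _) (fun i b hb c hc => by
      have h1 := hSctr i b hb _ (hp b)
      have h2 := hSctr i c hc _ (hp c)
      have h3 := dist_triangle_right (p b) (p c) i.1
      nlinarith)
  have hctr : ∀ b ∈ P, ∀ z ∈ bx b, dist z (root b).1 ≤ K₀ * ε := by
    intro b hb z hz
    obtain ⟨t, ht, h1⟩ := hball b hb
    have h2 := hsmall b hb z hz _ (hp b)
    have h3 := hSctr _ t ht _ (hp t)
    have h4 := dist_triangle4 z (p b) (p t) (root b).1
    push_cast at h1
    rw [hK₀]
    nlinarith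
  have hbotP : ∀ i : ZMod (n + 1), ((i, 0) : ZMod (n + 1) × ℕ) ∈ P := fun i => by
    simp [P]
  have htopP : ∀ i : ZMod (n + 1), ((i, n) : ZMod (n + 1) × ℕ) ∈ P := fun i => by
    simp [P]
  have hNpos : (0 : ℝ) < (n + 1 : ℕ) := by positivity
  have hbx0 : ∀ i, x ∈ bx (i, 0) := fun i =>
    ⟨i.val, i.val / (n + 1 : ℕ), 0, by simp, by rw [mul_div_cancel₀ _ hNpos.ne']; simp,
      by rw [mul_div_cancel₀ _ hNpos.ne']; simp, by simp, by simp, hq.bot _⟩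
  have hbx1 : ∀ i, y ∈ bx (i, n) := fun i =>
    ⟨i.val, i.val / (n + 1 : ℕ), 1, by simp, by rw [mul_div_cancel₀ _ hNpos.ne']; simp,
      by rw [mul_div_cancel₀ _ hNpos.ne']; simp, by simp, by simp, hq.top _⟩
  have hself : ∀ i : s, i.1 ∈ Th i := fun i =>
    (hTh i).2.2.1 (Metric.mem_closedBall_self (by positivity))
  have hrootx : ∀ i, root (i, 0) = ⟨x, hxs⟩ := fun i =>
    hroot0 _ (hcol0 _ (by simp)) _ ⟨hbotP i, x, hbx0 i, hself ⟨x, hxs⟩⟩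
  have hrooty : ∀ i, root (i, n) = ⟨y, hys⟩ := fun i =>
    hroot0 _ (hcol0 _ (by simp)) _ ⟨htopP i, y, hbx1 i, hself ⟨y, hys⟩⟩
  let V := {i : s // ∃ b ∈ P, root b = i}
  let vx : V := ⟨⟨x, hxs⟩, (0, 0), hbotP 0, hrootx 0⟩
  let vy : V := ⟨⟨y, hys⟩, (0, n), htopP 0, hrooty 0⟩
  let rt : ZMod (n + 1) × ℕ → V := fun b => if hb : b ∈ P then ⟨root b, b, hb, rfl⟩ else vx
  have hrt : ∀ b ∈ P, (rt b).1 = root b := fun b hb => by simp only [rt, dif_pos hb]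
  have hpart : IsBoxPart n rt vx vy := by
    refine ⟨?_, ?_, ?_, ?_, ?_⟩
    · intro he
      have := congrArg (fun v : V => v.1.1) he
      exact hq.ne this
    · exact fun i => Subtype.ext ((hrt _ (hbotP i)).trans (hrootx i))
    · exact fun i => Subtype.ext ((hrt _ (htopP i)).trans (hrooty i))
    · rintro ⟨i, b, hb, rfl⟩
      exact ⟨b, hb, Subtype.ext (hrt b hb)⟩
    · intro b b' hb hb' he
      have he' : root b = root b' := by rw [← hrt b hb, ← hrt b' hb', he]
      refine Relation.ReflTransGen.mono ?_ _ _ (hconn b hb b' hb' he')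
      rintro c d ⟨hcd, hc, hd⟩
      obtain ⟨hcP, hdP⟩ := hadjP _ _ hcd
      exact ⟨hcd, Subtype.ext (by rw [hrt c hcP, hrt b hb, hc]),
        Subtype.ext (by rw [hrt d hdP, hrt b hb, hd])⟩
  obtain ⟨E, hE, T, hTx, hTy, hTadj, hTadj'⟩ := BoxFlow.exists_tiling hpart
  let Y : V → Set Z := fun v => ⋃ b ∈ {b | b ∈ P ∧ rt b = v}, bx b
  have hPfin : P.Finite := by
    have : P = Set.univ ×ˢ Set.Iio (n + 1) := by ext; simp [P]
    rw [this]
    exact Set.finite_univ.prod (Set.finite_Iio _)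
  have hYmem : ∀ b ∈ P, ∀ z ∈ bx b, z ∈ Y (rt b) := fun b hb z hz =>
    Set.mem_biUnion (show b ∈ {c | c ∈ P ∧ rt c = rt b} from ⟨hb, rfl⟩) hz
  have hYctr : ∀ v, ∀ z ∈ Y v, dist z v.1.1 ≤ K₀ * ε := by
    intro v z hz
    obtain ⟨b, ⟨hb, rfl⟩, hz'⟩ := Set.mem_iUnion₂.1 hz
    rw [hrt b hb]
    exact hctr b hb z hz'
  have hcount : ∀ z, (Finset.univ.filter fun v : V => dist z v.1.1 ≤ 4 * K * ε).card ≤ D := by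
    intro z
    rw [← Finset.card_map (Function.Embedding.subtype (fun i : s => ∃ b ∈ P, root b = i))]
    refine hcard (4 * K) D hD z _ fun i hi => ?_
    simp only [Finset.mem_map, Finset.mem_filter, Finset.mem_univ, true_and,
      Function.Embedding.subtype_apply] at hi
    obtain ⟨v, hv, rfl⟩ := hi
    exact hv
  have hinter : ∀ v w, T.Adj v w → (Y v ∩ Y w).Nonempty := by
    intro v w hvw
    obtain ⟨b, b', hbb, rfl, rfl⟩ := hTadj' v w hvw
    obtain ⟨hb, hb'⟩ := hadjP _ _ hbb
    obtain ⟨z, hz, hz'⟩ := PolarParam.polarBox_inter_nonempty (q := q) hbb hM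
    exact ⟨z, hYmem b hb z hz, hYmem b' hb' z hz'⟩
  refine ⟨
    { V := V
      E := E
      T := T
      Y := Y
      ctr := fun v => v.1.1
      compact := ?_
      connected := ?_
      cover := ?_
      x_mem := ?_
      y_mem := ?_
      near_ctr := ?_
      count := hcount
      inter := hinter
      near := ?_
      deg := ?_ }⟩
  · exact fun v => (hPfin.subset fun b hb => hb.1).isCompact_biUnion fun b _ =>
      hq.isCompact_polarBox hM b
  · intro v
    obtain ⟨b₀, hb₀, hv⟩ := hpart.surj v
    refine ⟨⟨p b₀, ?_⟩, ?_⟩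
    · rw [← hv]; exact hYmem b₀ hb₀ _ (hp b₀)
    · refine IsPreconnected.biUnion_of_reflTransGen (fun b _ => hq.isPreconnected_polarBox hM b) ?_
      rintro b ⟨hb, hbv⟩ b' ⟨hb', hbv'⟩
      refine Relation.ReflTransGen.mono ?_ _ _ (hpart.conn b b' hb hb' (hbv.trans hbv'.symm))
      rintro c d ⟨hcd, hc, hd⟩
      exact ⟨PolarParam.polarBox_inter_nonempty hcd hM, (hadjP _ _ hcd).1, hc.trans hbv⟩
  · intro z
    obtain ⟨b, hb, hz⟩ := hq.exists_mem_polarBox (N := n + 1) hM z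
    exact ⟨rt b, hYmem b hb z hz⟩
  · rw [hTx, ← hpart.bottom 0]; exact hYmem _ (hbotP 0) _ (hbx0 0)
  · rw [hTy, ← hpart.top 0]; exact hYmem _ (htopP 0) _ (hbx1 0)
  · intro v z hz
    exact (hYctr v z hz).trans (by rw [hK]; nlinarith)
  · intro v w z z' hz hz' hzz
    obtain ⟨b, ⟨hb, rfl⟩, hzb⟩ := Set.mem_iUnion₂.1 hz
    obtain ⟨b', ⟨hb', rfl⟩, hzb'⟩ := Set.mem_iUnion₂.1 hz'
    obtain ⟨L, -, hLc, hzL, hzL', hLb⟩ := hllc z z'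
    have hnear : ∀ c ∈ P, (bx c ∩ L).Nonempty → dist z (rt c).1.1 ≤ K * ε := by
      rintro c hc ⟨w, hwc, hwL⟩
      have h1 := hYctr _ w (hYmem c hc w hwc)
      have h2 := hLb hwL
      rw [Metric.mem_closedBall, dist_comm] at h2
      have h3 := dist_triangle z w (rt c).1.1
      have h4 : Λ * dist z z' ≤ Λ * (4 * ε) := by gcongr
      rw [hK]; nlinarith
    refine reflTransGen_of_root (hq.polarBox_connected hM hLc.isPreconnected hb hb'
      ⟨z, hzb, hzL⟩ ⟨z', hzb', hzL'⟩) ?_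
    rintro c d ⟨hcd, hc, hd⟩ hne
    obtain ⟨hcP, hdP⟩ := hadjP _ _ hcd
    exact ⟨hTadj c d hcd hne, hnear c hcP hc, hnear d hdP hd⟩
  · intro v
    refine le_trans ?_ (hcount v.1.1)
    refine Finset.card_le_card_of_injOn (fun e => if T.lo e = v then T.hi e else T.lo e) ?_ ?_
    · intro e he
      simp only [Finset.coe_filter, Finset.mem_univ, true_and, Set.mem_ofPred_eq] at he ⊢
      have key : ∀ w, T.Adj v w → dist v.1.1 w.1.1 ≤ 4 * K * ε := by
        intro w hvw
        obtain ⟨z, hz, hz'⟩ := hinter v w hvw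
        have h1 := hYctr v z hz
        have h2 := hYctr w z hz'
        have h3 := dist_triangle_left v.1.1 w.1.1 z
        rw [hK]; nlinarith
      split_ifs with h
      · exact key _ ⟨e, by rw [h]⟩
      · exact key _ ⟨e, by rw [he.resolve_left h]; exact Sym2.eq_swap⟩
    · intro e he e' he' hee
      simp only [Finset.coe_filter, Finset.mem_univ, true_and, Set.mem_ofPred_eq] at he he' hee
      refine T.inj e e' ?_
      split_ifs at hee with h h' h'
      · rw [h, h', hee]
      · rw [h, he'.resolve_left h', hee]; exact Sym2.eq_swap
      · rw [he.resolve_left h, h', hee]; exact Sym2.eq_swap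
      · rw [he.resolve_left h, he'.resolve_left h', hee]

end DiscExists

section TilingFacts

variable {V E : Type} [Fintype V] [DecidableEq V] [Fintype E] (T : Tiling V E)

namespace Tiling

lemma adj_symm {v w : V} (h : T.Adj v w) : T.Adj w v := by
  obtain ⟨e, he⟩ := h
  exact ⟨e, he.trans Sym2.eq_swap⟩

lemma adj_lo_hi (e : E) : T.Adj (T.lo e) (T.hi e) := ⟨e, rfl⟩

/-- The side length of a square. -/
def len (e : E) : ℝ := T.a (T.hi e) - T.a (T.lo e)

lemma len_nonneg (e : E) : 0 ≤ T.len e := sub_nonneg.2 (T.le e)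

lemma th2_eq (e : E) : T.th2 e = T.th1 e + T.len e := by
  have := T.square e
  rw [len]; linarith

lemma th1_le (e : E) : T.th1 e ≤ T.th2 e := by
  have := T.th2_eq e
  have := T.len_nonneg e
  linarith

/-- The number of times the square `e` meets the vertical line at angle `t`. -/
noncomputable def mult (t : ℝ) (e : E) : ℤ := ⌊T.th2 e - t⌋ - ⌊T.th1 e - t⌋

lemma mult_nonneg (t : ℝ) (e : E) : 0 ≤ T.mult t e :=
  sub_nonneg.2 (Int.floor_le_floor (by linarith [T.th1_le e]))

lemma mult_pos {t : ℝ} {e : E} (h : T.mult t e ≠ 0) : 0 < T.mult t e :=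
  lt_of_le_of_ne (T.mult_nonneg t e) h.symm

lemma mult_ne_zero_iff {t : ℝ} {e : E} :
    T.mult t e ≠ 0 ↔ ∃ k : ℤ, T.th1 e < t + k ∧ t + k ≤ T.th2 e := by
  constructor
  · intro h
    have h1 := T.mult_pos h
    refine ⟨⌊T.th2 e - t⌋, ?_, ?_⟩
    · have h2 : ⌊T.th1 e - t⌋ < ⌊T.th2 e - t⌋ := by unfold mult at h1; omega
      have := Int.floor_lt.1 h2
      linarith
    · have := Int.floor_le (T.th2 e - t)
      linarith
  · rintro ⟨k, h1, h2⟩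
    have h3 : ⌊T.th1 e - t⌋ < k := Int.floor_lt.2 (by linarith)
    have h4 : k ≤ ⌊T.th2 e - t⌋ := Int.le_floor.2 (by linarith)
    unfold mult
    omega

lemma len_pos_of_mult {t : ℝ} {e : E} (h : T.mult t e ≠ 0) : 0 < T.len e := by
  obtain ⟨k, h1, h2⟩ := T.mult_ne_zero_iff.1 h
  have := T.th2_eq e
  linarith

lemma unit_len (G : V → ℝ) : ∑ e, T.len e * (G (T.hi e) - G (T.lo e)) = G T.vy - G T.vx :=
  T.unit G

lemma unit_mult (t : ℝ) (G : V → ℝ) :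
    ∑ e, (T.mult t e : ℝ) * (G (T.hi e) - G (T.lo e)) = G T.vy - G T.vx := T.unit_t t G

/-- The square `e` crosses level `s`. -/
def Crosses (s : ℝ) (e : E) : Prop := T.a (T.lo e) ≤ s ∧ s < T.a (T.hi e)

lemma len_le_one (e : E) : T.len e ≤ 1 := by
  classical
  by_contra hcon
  have h := T.unit_len (fun v => if T.a (T.lo e) < T.a v then 1 else 0)
  have h1 : T.len e * 1 ≤ ∑ e', T.len e' * ((if T.a (T.lo e) < T.a (T.hi e') then (1 : ℝ) else 0) -
      (if T.a (T.lo e) < T.a (T.lo e') then 1 else 0)) := by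
    refine le_trans (le_of_eq ?_) (Finset.single_le_sum (f := fun e' => T.len e' *
      ((if T.a (T.lo e) < T.a (T.hi e') then (1 : ℝ) else 0) -
      (if T.a (T.lo e) < T.a (T.lo e') then 1 else 0))) ?_ (Finset.mem_univ e))
    · have : T.a (T.lo e) < T.a (T.hi e) := by unfold len at hcon; linarith
      simp [this]
    · intro e' _
      refine mul_nonneg (T.len_nonneg e') (sub_nonneg.2 ?_)
      have := T.le e'
      split_ifs <;> linarith
  have h2 : (if T.a (T.lo e) < T.a T.vy then (1 : ℝ) else 0) -
      (if T.a (T.lo e) < T.a T.vx then 1 else 0) ≤ 1 := by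
    split_ifs <;> norm_num
  linarith

lemma exists_crosses {s : ℝ} (h1 : T.a T.vx ≤ s) (h2 : s < T.a T.vy) (t : ℝ) :
    ∃ e, T.Crosses s e ∧ T.mult t e ≠ 0 := by
  classical
  by_contra! hcon
  have h := T.unit_mult t (fun v => if s < T.a v then 1 else 0)
  rw [if_pos h2, if_neg h1.not_gt, Finset.sum_eq_zero] at h
  · norm_num at h
  · intro e _
    by_cases hc : T.Crosses s e
    · simp [hcon e hc]
    · have := T.le e
      unfold Crosses at hc
      push Not at hc
      by_cases h3 : T.a (T.lo e) ≤ s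
      · have := hc h3
        rw [if_neg this.not_gt, if_neg h3.not_gt]; simp
      · rw [if_pos (by linarith), if_pos (by linarith)]; simp

/-- A set of pieces that is connected for the adjacency relation. -/
def Conn (A : Set V) : Prop :=
  ∀ v ∈ A, ∀ w ∈ A, Relation.ReflTransGen (fun a b => T.Adj a b ∧ a ∈ A ∧ b ∈ A) v w

lemma conn_of_root {A : Set V} {r : V}
    (h : ∀ v ∈ A, Relation.ReflTransGen (fun a b => T.Adj a b ∧ a ∈ A ∧ b ∈ A) r v) : T.Conn A := by
  intro v hv w hw
  refine Relation.ReflTransGen.trans ?_ (h w hw)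
  refine Relation.ReflTransGen.mono ?_ _ _ (Relation.ReflTransGen.swap _ _ (h v hv))
  exact fun a b hab => ⟨T.adj_symm hab.1, hab.2.2, hab.2.1⟩

lemma conn_component (R : V → V → Prop) (hR : ∀ v w, R v w → T.Adj v w) (r : V) :
    T.Conn {w | Relation.ReflTransGen R r w} := by
  refine T.conn_of_root (r := r) fun v hv => ?_
  induction hv with
  | refl => exact .refl
  | tail h h' ih => exact ih.tail ⟨hR _ _ h', h, h.tail h'⟩

lemma conn_union {A B : Set V} (hA : T.Conn A) (hB : T.Conn B) (h : (A ∩ B).Nonempty) :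
    T.Conn (A ∪ B) := by
  obtain ⟨r, hrA, hrB⟩ := h
  refine T.conn_of_root (r := r) ?_
  rintro v (hv | hv)
  · exact Relation.ReflTransGen.mono (fun a b hab => ⟨hab.1, .inl hab.2.1, .inl hab.2.2⟩) _ _
      (hA r hrA v hv)
  · exact Relation.ReflTransGen.mono (fun a b hab => ⟨hab.1, .inr hab.2.1, .inr hab.2.2⟩) _ _
      (hB r hrB v hv)

/-- Every superlevel component reaches the top. -/
lemma exists_conn_ge (hconn : ∀ v w, Relation.ReflTransGen T.Adj v w) (v : V) :
    ∃ A, T.Conn A ∧ v ∈ A ∧ T.vy ∈ A ∧ ∀ w ∈ A, T.a v ≤ T.a w := by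
  classical
  let R : V → V → Prop := fun a b => T.Adj a b ∧ T.a v ≤ T.a a ∧ T.a v ≤ T.a b
  let A : Set V := {w | Relation.ReflTransGen R v w}
  have hA : ∀ w ∈ A, T.a v ≤ T.a w := by
    intro w hw
    rcases Relation.ReflTransGen.cases_tail hw with rfl | ⟨u, -, hu⟩
    · exact le_rfl
    · exact hu.2.2
  refine ⟨A, T.conn_component R (fun _ _ h => h.1) v, .refl, ?_, hA⟩
  by_contra hy
  have hup : ∀ a ∈ A, ∀ b, T.Adj a b → T.a v ≤ T.a b → b ∈ A := fun a ha b hab hb =>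
    Relation.ReflTransGen.tail ha ⟨hab, hA a ha, hb⟩
  have hlo : ∀ e, T.lo e ∈ A → T.hi e ∈ A := fun e he =>
    hup _ he _ (T.adj_lo_hi e) ((hA _ he).trans (T.le e))
  have hG : ∀ e, 0 ≤ T.len e * ((if T.hi e ∈ A then (1 : ℝ) else 0) -
      (if T.lo e ∈ A then (1 : ℝ) else 0)) := by
    intro e
    refine mul_nonneg (T.len_nonneg e) (sub_nonneg.2 ?_)
    have := hlo e
    split_ifs <;> simp_all
  have h := T.unit_len (fun w => if w ∈ A then 1 else 0)
  have h0 : ∑ e, T.len e * ((if T.hi e ∈ A then (1 : ℝ) else 0) -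
      (if T.lo e ∈ A then (1 : ℝ) else 0)) = 0 := by
    refine le_antisymm ?_ (Finset.sum_nonneg fun e _ => hG e)
    rw [h, if_neg hy]
    split_ifs <;> norm_num
  have h1 := (Finset.sum_eq_zero_iff_of_nonneg fun e _ => hG e).1 h0
  have hclosed : ∀ a ∈ A, ∀ b, T.Adj a b → b ∈ A := by
    rintro a ha b ⟨e, he⟩
    rcases Sym2.eq_iff.1 he with ⟨rfl, rfl⟩ | ⟨rfl, rfl⟩
    · exact hlo e ha
    · by_contra hb
      have h2 := h1 e (Finset.mem_univ _)
      rw [if_pos ha, if_neg hb, len] at h2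
      exact hb (hup _ ha _ (T.adj_symm (T.adj_lo_hi e)) (by linarith [hA _ ha]))
  have : ∀ w, Relation.ReflTransGen T.Adj v w → w ∈ A := by
    intro w hw
    induction hw with
    | refl => exact .refl
    | tail _ h' ih => exact hclosed _ ih _ h'
  exact hy (this _ (hconn v T.vy))

/-- Every sublevel component reaches the bottom. -/
lemma exists_conn_le (hconn : ∀ v w, Relation.ReflTransGen T.Adj v w) (v : V) :
    ∃ A, T.Conn A ∧ v ∈ A ∧ T.vx ∈ A ∧ ∀ w ∈ A, T.a w ≤ T.a v := by
  classical
  let R : V → V → Prop := fun a b => T.Adj a b ∧ T.a a ≤ T.a v ∧ T.a b ≤ T.a v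
  let A : Set V := {w | Relation.ReflTransGen R v w}
  have hA : ∀ w ∈ A, T.a w ≤ T.a v := by
    intro w hw
    rcases Relation.ReflTransGen.cases_tail hw with rfl | ⟨u, -, hu⟩
    · exact le_rfl
    · exact hu.2.2
  refine ⟨A, T.conn_component R (fun _ _ h => h.1) v, .refl, ?_, hA⟩
  by_contra hy
  have hup : ∀ a ∈ A, ∀ b, T.Adj a b → T.a b ≤ T.a v → b ∈ A := fun a ha b hab hb =>
    Relation.ReflTransGen.tail ha ⟨hab, hA a ha, hb⟩
  have hlo : ∀ e, T.hi e ∈ A → T.lo e ∈ A := fun e he =>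
    hup _ he _ (T.adj_symm (T.adj_lo_hi e)) ((T.le e).trans (hA _ he))
  have hG : ∀ e, 0 ≤ T.len e * ((if T.hi e ∈ A then (0 : ℝ) else 1) -
      (if T.lo e ∈ A then (0 : ℝ) else 1)) := by
    intro e
    refine mul_nonneg (T.len_nonneg e) (sub_nonneg.2 ?_)
    have := hlo e
    split_ifs <;> simp_all
  have h := T.unit_len (fun w => if w ∈ A then 0 else 1)
  have h0 : ∑ e, T.len e * ((if T.hi e ∈ A then (0 : ℝ) else 1) -
      (if T.lo e ∈ A then (0 : ℝ) else 1)) = 0 := by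
    refine le_antisymm ?_ (Finset.sum_nonneg fun e _ => hG e)
    rw [h, if_neg hy]
    split_ifs <;> norm_num
  have h1 := (Finset.sum_eq_zero_iff_of_nonneg fun e _ => hG e).1 h0
  have hclosed : ∀ a ∈ A, ∀ b, T.Adj a b → b ∈ A := by
    rintro a ha b ⟨e, he⟩
    rcases Sym2.eq_iff.1 he with ⟨rfl, rfl⟩ | ⟨rfl, rfl⟩
    · by_contra hb
      have h2 := h1 e (Finset.mem_univ _)
      rw [if_pos ha, if_neg hb, len] at h2
      exact hb (hup _ ha _ (T.adj_lo_hi e) (by linarith [hA _ ha]))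
    · exact hlo e ha
  have : ∀ w, Relation.ReflTransGen T.Adj v w → w ∈ A := by
    intro w hw
    induction hw with
    | refl => exact .refl
    | tail _ h' ih => exact hclosed _ ih _ h'
  exact hy (this _ (hconn v T.vx))

/-- The piece `v` meets the vertical line at angle `t`. -/
def Live (t : ℝ) (v : V) : Prop := ∃ e, (T.lo e = v ∨ T.hi e = v) ∧ T.mult t e ≠ 0

/-- A vertical line is connected from bottom to top. -/
lemma exists_chain {t : ℝ} {v : V} (hv : T.Live t v) :
    ∃ A, T.Conn A ∧ v ∈ A ∧ T.vx ∈ A ∧ T.vy ∈ A ∧ ∀ w ∈ A, T.Live t w := by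
  classical
  let R : V → V → Prop := fun a b => ∃ e, s(T.lo e, T.hi e) = s(a, b) ∧ T.mult t e ≠ 0
  let A : Set V := {w | Relation.ReflTransGen R v w}
  have hAL : ∀ w ∈ A, T.Live t w := by
    intro w hw
    rcases Relation.ReflTransGen.cases_tail hw with rfl | ⟨u, -, e, he, hm⟩
    · exact hv
    · refine ⟨e, ?_, hm⟩
      rcases Sym2.eq_iff.1 he with ⟨-, h⟩ | ⟨h, -⟩
      · exact .inr h
      · exact .inl h
  have hiff : ∀ e, T.mult t e ≠ 0 → (T.lo e ∈ A ↔ T.hi e ∈ A) := fun e he =>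
    ⟨fun h => Relation.ReflTransGen.tail h ⟨e, rfl, he⟩,
      fun h => Relation.ReflTransGen.tail h ⟨e, Sym2.eq_swap, he⟩⟩
  have hxy : T.vx ∈ A ↔ T.vy ∈ A := by
    have h := T.unit_mult t (fun w => if w ∈ A then 1 else 0)
    rw [Finset.sum_eq_zero] at h
    · by_cases h1 : T.vx ∈ A <;> by_cases h2 : T.vy ∈ A <;> simp_all
    · intro e _
      by_cases he : T.mult t e = 0
      · simp [he]
      · have := hiff e he
        by_cases h1 : T.lo e ∈ A <;> simp_all
  have hx : T.vx ∈ A := by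
    by_contra hx
    have hy : T.vy ∉ A := fun h => hx (hxy.2 h)
    have h := T.unit_mult t (fun w => if w ∈ A then T.a w else 0)
    rw [if_neg hx, if_neg hy, sub_zero] at h
    have hG : ∀ e, 0 ≤ (T.mult t e : ℝ) * ((if T.hi e ∈ A then T.a (T.hi e) else 0) -
        (if T.lo e ∈ A then T.a (T.lo e) else 0)) := by
      intro e
      by_cases he : T.mult t e = 0
      · simp [he]
      · have := hiff e he
        refine mul_nonneg (by exact_mod_cast T.mult_nonneg t e) ?_
        have := T.le e
        by_cases h1 : T.lo e ∈ A <;> simp_all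
    have h1 := (Finset.sum_eq_zero_iff_of_nonneg fun e _ => hG e).1 h
    obtain ⟨e, hev, he⟩ := hv
    have h2 : T.lo e ∈ A ∧ T.hi e ∈ A := by
      have := hiff e he
      have hvA : v ∈ A := .refl
      rcases hev with rfl | rfl <;> tauto
    have h3 := h1 e (Finset.mem_univ _)
    rw [if_pos h2.1, if_pos h2.2] at h3
    have h4 := T.len_pos_of_mult he
    have h5 : (T.mult t e : ℝ) ≠ 0 := by exact_mod_cast he
    unfold len at h4
    rcases mul_eq_zero.1 h3 with h | h
    · exact h5 h
    · linarith
  exact ⟨A, T.conn_component R (fun a b ⟨e, he, _⟩ => ⟨e, he⟩) v, .refl, hx, hxy.1 hx, hAL⟩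

/-- A vertical line can be followed upwards from a piece to any higher level. -/
lemma exists_upChain {t s : ℝ} {v : V} (hv : T.Live t v) (h1 : T.a v ≤ s) (h2 : s < T.a T.vy) :
    ∃ A e, T.Conn A ∧ v ∈ A ∧ T.lo e ∈ A ∧ T.Crosses s e ∧ T.mult t e ≠ 0 ∧
      ∀ w ∈ A, T.Live t w ∧ T.a v ≤ T.a w ∧ T.a w ≤ s := by
  classical
  let R : V → V → Prop := fun a b => (∃ e, s(T.lo e, T.hi e) = s(a, b) ∧ T.mult t e ≠ 0) ∧
    T.a v ≤ T.a b ∧ T.a b ≤ s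
  let A : Set V := {w | Relation.ReflTransGen R v w}
  have hAL : ∀ w ∈ A, T.Live t w ∧ T.a v ≤ T.a w ∧ T.a w ≤ s := by
    intro w hw
    rcases Relation.ReflTransGen.cases_tail hw with rfl | ⟨u, -, ⟨e, he, hm⟩, h⟩
    · exact ⟨hv, le_rfl, h1⟩
    · refine ⟨⟨e, ?_, hm⟩, h⟩
      rcases Sym2.eq_iff.1 he with ⟨-, h⟩ | ⟨h, -⟩
      · exact .inr h
      · exact .inl h
  have hy : T.vy ∉ A := fun h => by linarith [(hAL _ h).2.2]
  by_contra! hcon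
  have hup : ∀ e, T.mult t e ≠ 0 → T.lo e ∈ A → T.hi e ∈ A := by
    intro e he h
    have h3 := hAL _ h
    by_contra hhi
    refine hcon A e (T.conn_component R (fun a b ⟨⟨e, he, _⟩, _⟩ => ⟨e, he⟩) v) .refl h
      ⟨h3.2.2, ?_⟩ he |>.elim fun w hw => ?_
    · by_contra h4
      exact hhi (Relation.ReflTransGen.tail h ⟨⟨e, rfl, he⟩, h3.2.1.trans (T.le e), not_lt.1 h4⟩)
    · exact absurd (hw.2 (hAL w hw.1).1 (hAL w hw.1).2.1) (not_lt.2 (hAL w hw.1).2.2)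
  have hG : ∀ e, 0 ≤ (T.mult t e : ℝ) * ((if T.hi e ∈ A then (1 : ℝ) else 0) -
      (if T.lo e ∈ A then (1 : ℝ) else 0)) := by
    intro e
    by_cases he : T.mult t e = 0
    · simp [he]
    · have := hup e he
      refine mul_nonneg (by exact_mod_cast T.mult_nonneg t e) ?_
      by_cases h1 : T.lo e ∈ A <;> by_cases h2 : T.hi e ∈ A <;> simp_all
  have h := T.unit_mult t (fun w => if w ∈ A then 1 else 0)
  have h0 : ∑ e, (T.mult t e : ℝ) * ((if T.hi e ∈ A then (1 : ℝ) else 0) -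
      (if T.lo e ∈ A then (1 : ℝ) else 0)) = 0 := by
    refine le_antisymm ?_ (Finset.sum_nonneg fun e _ => hG e)
    rw [h, if_neg hy]
    split_ifs <;> norm_num
  have hx : T.vx ∉ A := by
    intro hx
    rw [h0, if_neg hy, if_pos hx] at h
    norm_num at h
  have h3 := (Finset.sum_eq_zero_iff_of_nonneg fun e _ => hG e).1 h0
  have hiff : ∀ e, T.mult t e ≠ 0 → (T.lo e ∈ A ↔ T.hi e ∈ A) := by
    intro e he
    refine ⟨hup e he, fun hhi => ?_⟩
    by_contra hlo
    have := h3 e (Finset.mem_univ _)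
    rw [if_pos hhi, if_neg hlo] at this
    have h5 : (T.mult t e : ℝ) ≠ 0 := by exact_mod_cast he
    simp [h5] at this
  have h := T.unit_mult t (fun w => if w ∈ A then T.a w else 0)
  rw [if_neg hx, if_neg hy, sub_zero] at h
  have hG : ∀ e, 0 ≤ (T.mult t e : ℝ) * ((if T.hi e ∈ A then T.a (T.hi e) else 0) -
      (if T.lo e ∈ A then T.a (T.lo e) else 0)) := by
    intro e
    by_cases he : T.mult t e = 0
    · simp [he]
    · have := hiff e he
      refine mul_nonneg (by exact_mod_cast T.mult_nonneg t e) ?_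
      have := T.le e
      by_cases h1 : T.lo e ∈ A <;> simp_all
  have h1 := (Finset.sum_eq_zero_iff_of_nonneg fun e _ => hG e).1 h
  obtain ⟨e, hev, he⟩ := hv
  have h2 : T.lo e ∈ A ∧ T.hi e ∈ A := by
    have := hiff e he
    have hvA : v ∈ A := .refl
    rcases hev with rfl | rfl <;> tauto
  have h3 := h1 e (Finset.mem_univ _)
  rw [if_pos h2.1, if_pos h2.2] at h3
  have h4 := T.len_pos_of_mult he
  have h5 : (T.mult t e : ℝ) ≠ 0 := by exact_mod_cast he
  unfold len at h4
  rcases mul_eq_zero.1 h3 with h | h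
  · exact h5 h
  · linarith

end Tiling

end TilingFacts

section CircleDist

/-- The distance to the nearest integer. -/
noncomputable def cd (τ : ℝ) : ℝ := ‖(τ : UnitAddCircle)‖

lemma cd_continuous : Continuous cd := continuous_norm.comp (AddCircle.continuous_mk' 1)

lemma cd_nonneg (τ : ℝ) : 0 ≤ cd τ := norm_nonneg _

lemma cd_add_int (τ : ℝ) (k : ℤ) : cd (τ + k) = cd τ := by
  unfold cd
  congr 1
  rw [AddCircle.coe_add, add_eq_left, AddCircle.coe_eq_zero_iff]
  exact ⟨k, by simp⟩

lemma cd_add_one (τ : ℝ) : cd (τ + 1) = cd τ := by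
  simpa using cd_add_int τ 1

lemma cd_le_abs (τ : ℝ) : cd τ ≤ |τ| := by
  unfold cd
  rw [UnitAddCircle.norm_eq]
  simpa using round_le τ 0

lemma exists_cd_eq (τ : ℝ) : ∃ k : ℤ, cd τ = |τ - k| :=
  ⟨round τ, by unfold cd; rw [UnitAddCircle.norm_eq]⟩

lemma cd_le_half (τ : ℝ) : cd τ ≤ 1 / 2 := by
  unfold cd; rw [UnitAddCircle.norm_eq]; exact abs_sub_round τ

lemma cd_eq_zero {τ : ℝ} (h : cd τ = 0) : ∃ k : ℤ, τ = k := by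
  obtain ⟨k, hk⟩ := exists_cd_eq τ
  rw [h] at hk
  exact ⟨k, sub_eq_zero.1 (abs_eq_zero.1 hk.symm)⟩

lemma abs_cd_sub_le (τ τ' : ℝ) : |cd τ - cd τ'| ≤ |τ - τ'| := by
  refine le_trans ?_ (cd_le_abs _)
  unfold cd; rw [AddCircle.coe_sub]; exact abs_norm_sub_norm_le _ _

end CircleDist

section TilingEnergy

variable {V E : Type} [Fintype V] [DecidableEq V] [Fintype E] (T : Tiling V E)

namespace Tiling

/-- Corners of a piece none of whose squares is nondegenerate. -/
lemma corner_of_dead {v : V} (hv : ∀ e, (T.lo e = v ∨ T.hi e = v) → T.len e = 0) {c c' : ℝ}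
    (hc : c ∈ T.Co v) (hc' : c' ∈ T.Co v) : ∃ k : ℤ, c = c' + k := by
  have h := T.hull (fun τ => cd (τ - c')) (fun _ => 0) v
    (cd_continuous.comp (by fun_prop)) (fun τ => by
      rw [show τ + 1 - c' = τ - c' + 1 by ring, cd_add_one]) ?_ c hc c' hc'
  · have h0 : cd 0 = 0 := by
      have := cd_le_abs 0
      rw [abs_zero] at this
      exact le_antisymm this (cd_nonneg 0)
    simp only [sub_self, h0, sub_zero, Finset.sum_const_zero] at h
    obtain ⟨k, hk⟩ := cd_eq_zero (abs_eq_zero.1 (le_antisymm h (abs_nonneg _)))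
    exact ⟨k, by linarith⟩
  · intro e he τ hτ τ' hτ'
    have h1 := T.th2_eq e
    rw [hv e he, add_zero] at h1
    rw [h1, Set.Icc_self] at hτ hτ'
    simp only [Set.mem_singleton_iff] at hτ hτ'
    simp [hτ', hτ]

/-- A corner of a live piece lies in one of its nondegenerate squares. -/
lemma corner_of_live {v : V} {e₀ : E} (he₀ : T.lo e₀ = v ∨ T.hi e₀ = v) (h₀ : T.len e₀ ≠ 0) {c : ℝ}
    (hc : c ∈ T.Co v) : ∃ e, (T.lo e = v ∨ T.hi e = v) ∧ 0 < T.len e ∧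
      ∃ k : ℤ, T.th1 e ≤ c + k ∧ c + k ≤ T.th2 e := by
  classical
  by_contra! hcon
  have h1 : ∀ e, ∃ ρ > 0, (T.lo e = v ∨ T.hi e = v) → T.len e ≠ 0 →
      ∀ τ ∈ Set.Icc (T.th1 e) (T.th2 e), ρ ≤ cd (τ - c) := by
    intro e
    by_cases he : (T.lo e = v ∨ T.hi e = v) ∧ T.len e ≠ 0
    · obtain ⟨τ₀, hτ₀, hmin⟩ := isCompact_Icc.exists_isMinOn (Set.nonempty_Icc.2 (T.th1_le e))
        (cd_continuous.comp (f := fun τ => τ - c) (by fun_prop)).continuousOn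
      refine ⟨cd (τ₀ - c), lt_of_le_of_ne (cd_nonneg _) fun h => ?_, fun _ _ τ hτ => hmin hτ⟩
      obtain ⟨k, hk⟩ := cd_eq_zero h.symm
      have := hcon e he.1 (lt_of_le_of_ne (T.len_nonneg e) he.2.symm) k (by linarith [hτ₀.1])
      linarith [hτ₀.2]
    · exact ⟨1, one_pos, fun h h' => absurd ⟨h, h'⟩ he⟩
  choose ρ hρ hρ' using h1
  obtain ⟨r, hr, hrρ⟩ : ∃ r > 0, ∀ e, r ≤ ρ e := by
    refine ⟨Finset.univ.inf' ⟨e₀, Finset.mem_univ _⟩ ρ, ?_, fun e => Finset.inf'_le _ (Finset.mem_univ e)⟩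
    exact (Finset.lt_inf'_iff _).2 fun e _ => hρ e
  have h := T.hull (fun τ => max 0 (1 - cd (τ - c) / r)) (fun _ => 0) v
    (by have := cd_continuous.comp (f := fun τ => τ - c) (by fun_prop)
        exact continuous_const.max (continuous_const.sub (this.div_const r)))
    (fun τ => by rw [show τ + 1 - c = τ - c + 1 by ring, cd_add_one]) ?_ c hc (T.th1 e₀)
      (T.mem_th1 e₀ v he₀)
  · have h0 : cd 0 = 0 := by
      have := cd_le_abs 0
      rw [abs_zero] at this
      exact le_antisymm this (cd_nonneg 0)
    have h2 := hρ' e₀ he₀ h₀ (T.th1 e₀) ⟨le_rfl, T.th1_le e₀⟩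
    have h3 : 1 - cd (T.th1 e₀ - c) / r ≤ 0 := by
      rw [sub_nonpos, one_le_div hr]
      exact (hrρ e₀).trans h2
    simp only [sub_self, h0, zero_div, sub_zero, Finset.sum_const_zero, max_eq_left h3] at h
    norm_num at h
  · intro e he τ hτ τ' hτ'
    by_cases hl : T.len e = 0
    · have h1 := T.th2_eq e
      rw [hl, add_zero] at h1
      rw [h1, Set.Icc_self] at hτ hτ'
      simp only [Set.mem_singleton_iff] at hτ hτ'
      simp [hτ', hτ]
    · have key : ∀ τ ∈ Set.Icc (T.th1 e) (T.th2 e), max 0 (1 - cd (τ - c) / r) = 0 := by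
        intro τ hτ
        refine max_eq_left ?_
        rw [sub_nonpos, one_le_div hr]
        exact (hrρ e).trans (hρ' e he hl τ hτ)
      simp [key τ' hτ', key τ hτ]

/-- Every piece is joined to a live one through pieces sharing a corner and the level. -/
lemma exists_live (hconn : ∀ v w, Relation.ReflTransGen T.Adj v w) (hne : T.vx ≠ T.vy) {v : V}
    {c : ℝ} (hc : c ∈ T.Co v) {ρ : ℝ} (hρ : 0 < ρ) :
    ∃ A u t, T.Conn A ∧ v ∈ A ∧ u ∈ A ∧ (∀ w ∈ A, c ∈ T.Co w ∧ T.a w = T.a v) ∧ |t - c| ≤ ρ ∧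
      T.Live t u := by
  classical
  let Dead : V → Prop := fun w => ∀ e, (T.lo e = w ∨ T.hi e = w) → T.len e = 0
  let R : V → V → Prop := fun a b => T.Adj a b ∧ Dead a
  have hA : ∀ w, Relation.ReflTransGen R v w → c ∈ T.Co w ∧ T.a w = T.a v := by
    intro w hw
    induction hw with
    | refl => exact ⟨hc, rfl⟩
    | @tail b d _ h ih =>
      obtain ⟨⟨e, he⟩, hb⟩ := h
      have heb : (T.lo e = b ∧ T.hi e = d) ∨ (T.lo e = d ∧ T.hi e = b) := Sym2.eq_iff.1 he
      have heb' : T.lo e = b ∨ T.hi e = b := by tauto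
      have hed : T.lo e = d ∨ T.hi e = d := by tauto
      have hl := hb e heb'
      obtain ⟨k, hk⟩ := T.corner_of_dead hb ih.1 (T.mem_th1 e b heb')
      refine ⟨by rw [hk]; exact T.add_int _ _ (T.mem_th1 e d hed) k, ?_⟩
      rw [← ih.2]
      unfold len at hl
      rcases heb with ⟨rfl, rfl⟩ | ⟨rfl, rfl⟩ <;> linarith
  obtain ⟨u, hu, hlive⟩ : ∃ u, Relation.ReflTransGen R v u ∧ ¬ Dead u := by
    by_contra! hcon
    have hall : ∀ w, Relation.ReflTransGen R v w := by
      intro w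
      induction hconn v w with
      | refl => exact .refl
      | tail _ h ih => exact ih.tail ⟨h, hcon _ ih⟩
    have h := T.unit_len (fun w => if w = T.vy then 1 else 0)
    rw [Finset.sum_eq_zero, if_pos rfl, if_neg hne] at h
    · norm_num at h
    · intro e _
      rw [hcon _ (hall (T.lo e)) e (.inl rfl), zero_mul]
  simp only [Dead] at hlive
  push Not at hlive
  obtain ⟨e₀, he₀, hl₀⟩ := hlive
  obtain ⟨e, he, hl, k, h1, h2⟩ := T.corner_of_live he₀ hl₀ (hA u hu).1
  have h3 := T.th2_eq e
  refine ⟨{w | Relation.ReflTransGen R v w}, u, if T.th1 e < c + k then c else c + min ρ (T.len e),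
    T.conn_component R (fun _ _ h => h.1) v, .refl, hu, hA, ?_, e, he,
    T.mult_ne_zero_iff.2 ⟨k, ?_⟩⟩
  · split_ifs
    · simpa using hρ.le
    · rw [add_sub_cancel_left, abs_of_pos (lt_min hρ hl)]; exact min_le_left _ _
  · split_ifs with h
    · exact ⟨h, h2⟩
    · have : T.th1 e = c + k := le_antisymm h1 (not_lt.1 h)
      have h4 := lt_min hρ hl
      have h5 := min_le_right ρ (T.len e)
      constructor <;> linarith

/-- The part of the interval between the ends of `e` lying between two levels. -/
def part (s₁ s₂ : ℝ) (e : E) : ℝ :=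
  max s₁ (min s₂ (T.a (T.hi e))) - max s₁ (min s₂ (T.a (T.lo e)))

lemma part_nonneg (s₁ s₂ : ℝ) (e : E) : 0 ≤ T.part s₁ s₂ e :=
  sub_nonneg.2 (max_le_max le_rfl (min_le_min le_rfl (T.le e)))

lemma part_le (s₁ s₂ : ℝ) (e : E) : T.part s₁ s₂ e ≤ T.len e := by
  have := T.le e
  unfold part len
  rcases max_cases s₁ (min s₂ (T.a (T.hi e))) with h | h <;>
  rcases max_cases s₁ (min s₂ (T.a (T.lo e))) with h' | h' <;>
  rcases min_cases s₂ (T.a (T.hi e)) with h3 | h3 <;>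
  rcases min_cases s₂ (T.a (T.lo e)) with h4 | h4 <;> linarith

lemma part_eq {s₁ s₂ : ℝ} {e : E} (h1 : s₁ ≤ T.a (T.lo e)) (h2 : T.a (T.hi e) ≤ s₂) :
    T.part s₁ s₂ e = T.len e := by
  have := T.le e
  rw [part, min_eq_right h2, min_eq_right (this.trans h2), max_eq_right h1,
    max_eq_right (h1.trans this), len]

lemma clamp_sub_le {s₁ s₂ : ℝ} (h : s₁ ≤ s₂) (a b : ℝ) :
    max s₁ (min s₂ a) - max s₁ (min s₂ b) ≤ s₂ - s₁ :=
  sub_le_sub (max_le h (min_le_left _ _)) (le_max_left _ _)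

lemma sum_part_le {s₁ s₂ : ℝ} (h : s₁ ≤ s₂) : ∑ e, T.len e * T.part s₁ s₂ e ≤ s₂ - s₁ := by
  have := T.unit_len fun v => max s₁ (min s₂ (T.a v))
  unfold part
  rw [this]
  exact clamp_sub_le h _ _

lemma sum_mult_part_le (t : ℝ) {s₁ s₂ : ℝ} (h : s₁ ≤ s₂) :
    ∑ e, (T.mult t e : ℝ) * T.part s₁ s₂ e ≤ s₂ - s₁ := by
  have := T.unit_mult t fun v => max s₁ (min s₂ (T.a v))
  unfold part
  rw [this]
  exact clamp_sub_le h _ _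

/-- The energy of the truncated height function. -/
lemma sum_part_sq_le {s₁ s₂ : ℝ} (h : s₁ ≤ s₂) : ∑ e, T.part s₁ s₂ e ^ 2 ≤ s₂ - s₁ := by
  refine le_trans (Finset.sum_le_sum fun e _ => ?_) (T.sum_part_le h)
  nlinarith [T.part_nonneg s₁ s₂ e, T.part_le s₁ s₂ e]

/-- The area of the squares meeting a horizontal band. -/
lemma sum_band_le {s₁ s₂ : ℝ} (h : s₁ ≤ s₂) (F : Finset E)
    (hF : ∀ e ∈ F, T.a (T.lo e) ≤ s₂ ∧ s₁ ≤ T.a (T.hi e)) :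
    ∑ e ∈ F, T.len e ^ 2 ≤ s₂ - s₁ + 2 := by
  have h1 := T.sum_part_le (show s₁ - 1 ≤ s₂ + 1 by linarith)
  have h2 : ∑ e ∈ F, T.len e ^ 2 ≤ ∑ e, T.len e * T.part (s₁ - 1) (s₂ + 1) e := by
    refine le_trans (Finset.sum_le_sum fun e he => ?_) (Finset.sum_le_sum_of_subset_of_nonneg
      (Finset.subset_univ F) fun e _ _ => mul_nonneg (T.len_nonneg e) (T.part_nonneg _ _ e))
    have h3 := T.len_le_one e
    have h4 := hF e he
    rw [T.part_eq (by unfold len at h3; linarith) (by unfold len at h3; linarith), sq]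
  linarith

/-- The area of the small squares meeting a box. -/
lemma sum_box_le (s₀ t₀ : ℝ) {ρ : ℝ} (hρ : 0 < ρ) (F : Finset E)
    (hF : ∀ e ∈ F, T.len e ≤ ρ ∧ T.a (T.lo e) ≤ s₀ + ρ ∧ s₀ - ρ ≤ T.a (T.hi e) ∧
      ∃ τ ∈ Set.Icc (T.th1 e) (T.th2 e), cd (τ - t₀) ≤ ρ) :
    ∑ e ∈ F, T.len e ^ 2 ≤ 16 * ρ ^ 2 := by
  choose! hF1 hF2 hF3 τ hτ hτ' using hF
  choose k hk using fun e => exists_cd_eq (τ e - t₀)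
  let J := Set.Icc (t₀ - 2 * ρ) (t₀ + 2 * ρ)
  let I : E → Set ℝ := fun e => Set.Ioc (T.th1 e - k e) (T.th2 e - k e)
  have hIJ : ∀ e ∈ F, I e ⊆ J := by
    intro e he t ht
    have h1 := hk e ▸ hτ' e he
    rw [abs_le] at h1
    have h2 := T.th2_eq e
    have h3 := hF1 e he
    have h4 := hτ e he
    have h5 := ht.1
    have h6 := ht.2
    have h7 := h4.1
    have h8 := h4.2
    constructor <;> linarith
  have h1 : ∀ t, ∑ e ∈ F, ENNReal.ofReal (T.len e) * (I e).indicator 1 t ≤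
      ENNReal.ofReal (4 * ρ) := by
    intro t
    have hp := T.sum_mult_part_le t (show s₀ - 2 * ρ ≤ s₀ + 2 * ρ by linarith)
    have : ∀ e ∈ F, ENNReal.ofReal (T.len e) * (I e).indicator 1 t ≤
        ENNReal.ofReal ((T.mult t e : ℝ) * T.part (s₀ - 2 * ρ) (s₀ + 2 * ρ) e) := by
      intro e he
      by_cases ht : t ∈ I e
      · rw [Set.indicator_of_mem ht, Pi.one_apply, mul_one]
        refine ENNReal.ofReal_le_ofReal ?_
        have h3 := hF1 e he
        rw [T.part_eq (by have := hF3 e he; unfold len at h3; linarith)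
          (by have := hF2 e he; unfold len at h3; linarith)]
        refine le_mul_of_one_le_left (T.len_nonneg e) ?_
        have h4 := T.mult_pos (T.mult_ne_zero_iff.2 ⟨k e, by linarith [ht.1], by linarith [ht.2]⟩ :
          T.mult t e ≠ 0)
        exact_mod_cast h4
      · rw [Set.indicator_of_notMem ht, mul_zero]; exact bot_le
    refine (Finset.sum_le_sum this).trans ?_
    rw [← ENNReal.ofReal_sum_of_nonneg fun e _ =>
      mul_nonneg (by exact_mod_cast T.mult_nonneg t e) (T.part_nonneg _ _ e)]
    refine ENNReal.ofReal_le_ofReal (le_trans (Finset.sum_le_sum_of_subset_of_nonneg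
      (Finset.subset_univ F) fun e _ _ =>
        mul_nonneg (by exact_mod_cast T.mult_nonneg t e) (T.part_nonneg _ _ e)) ?_)
    linarith
  have h2 : ∑ e ∈ F, ENNReal.ofReal (T.len e ^ 2) ≤ ENNReal.ofReal (16 * ρ ^ 2) := by
    calc ∑ e ∈ F, ENNReal.ofReal (T.len e ^ 2)
        = ∑ e ∈ F, ENNReal.ofReal (T.len e) * ∫⁻ t in J, (I e).indicator 1 t := by
          refine Finset.sum_congr rfl fun e he => ?_
          rw [lintegral_indicator_one measurableSet_Ioc, Measure.restrict_apply measurableSet_Ioc,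
            Set.inter_eq_left.2 (hIJ e he), Real.volume_Ioc, sq, ENNReal.ofReal_mul (T.len_nonneg e)]
          congr 2
          rw [T.th2_eq e]; ring
      _ = ∫⁻ t in J, ∑ e ∈ F, ENNReal.ofReal (T.len e) * (I e).indicator 1 t := by
          rw [lintegral_finsetSum]
          · refine Finset.sum_congr rfl fun e _ => ?_
            rw [lintegral_const_mul _ (measurable_one.indicator measurableSet_Ioc)]
          · exact fun e _ => (measurable_one.indicator measurableSet_Ioc).const_mul _
      _ ≤ ∫⁻ _ in J, ENNReal.ofReal (4 * ρ) := lintegral_mono h1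
      _ = ENNReal.ofReal (16 * ρ ^ 2) := by
          rw [setLIntegral_const, Real.volume_Icc, ← ENNReal.ofReal_mul (by positivity)]
          congr 1; ring
  rw [← ENNReal.ofReal_sum_of_nonneg fun e _ => sq_nonneg _] at h2
  exact (ENNReal.ofReal_le_ofReal_iff (by positivity)).1 h2

end Tiling

end TilingEnergy

section Coarse

namespace Tiling

variable {V E : Type} [Fintype V] [DecidableEq V] [Fintype E] (T : Tiling V E)

/-- The angle `τ` is a corner of the piece `v` or lies over one of its squares. -/
def Over (v : V) (τ : ℝ) : Prop :=
  τ ∈ T.Co v ∨ ∃ e, (T.lo e = v ∨ T.hi e = v) ∧ τ ∈ Set.Icc (T.th1 e) (T.th2 e)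

/-- The squares at the piece `v`. -/
def star (v : V) : Finset E := Finset.univ.filter fun e => T.lo e = v ∨ T.hi e = v

lemma mem_star {v : V} {e : E} : e ∈ T.star v ↔ (T.lo e = v ∨ T.hi e = v) := by
  simp [star]

/-- A test function on the cylinder whose oscillation on the square `e` is at most `o e`. -/
structure Test (φ : ℝ → ℝ → ℝ) (o : E → ℝ) : Prop where
  cont : ∀ s, Continuous (φ s)
  per : ∀ s τ, φ s (τ + 1) = φ s τ
  nonneg : ∀ e, 0 ≤ o e
  osc : ∀ e, ∀ s ∈ Set.Icc (T.a (T.lo e)) (T.a (T.hi e)),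
    ∀ s' ∈ Set.Icc (T.a (T.lo e)) (T.a (T.hi e)), ∀ τ ∈ Set.Icc (T.th1 e) (T.th2 e),
    ∀ τ' ∈ Set.Icc (T.th1 e) (T.th2 e), |φ s τ - φ s' τ'| ≤ o e

variable {T} {φ : ℝ → ℝ → ℝ} {o : E → ℝ}

lemma Test.per_int (h : T.Test φ o) (s τ : ℝ) (k : ℤ) : φ s (τ + k) = φ s τ := by
  have := Function.Periodic.int_mul (h.per s) k τ
  rwa [mul_one] at this

lemma mem_level {e : E} {v : V} (he : T.lo e = v ∨ T.hi e = v) :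
    T.a v ∈ Set.Icc (T.a (T.lo e)) (T.a (T.hi e)) := by
  have := T.le e
  rcases he with rfl | rfl
  · exact ⟨le_rfl, this⟩
  · exact ⟨this, le_rfl⟩

lemma Test.corner (h : T.Test φ o) {v : V} {τ τ' : ℝ} (hτ : T.Over v τ) (hτ' : τ' ∈ T.Co v) :
    |φ (T.a v) τ - φ (T.a v) τ'| ≤ 2 * ∑ e ∈ T.star v, o e := by
  have hull := T.hull (φ (T.a v)) o v (h.cont _) (h.per _) (fun e he τ hτ τ' hτ' =>
    h.osc e _ (mem_level he) _ (mem_level he) τ hτ τ' hτ')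
  have hs : 0 ≤ ∑ e ∈ T.star v, o e := Finset.sum_nonneg fun e _ => h.nonneg e
  rcases hτ with hτ | ⟨e, he, hτ⟩
  · have := hull τ hτ τ' hτ'
    unfold star at hs ⊢
    linarith
  · have h1 := hull _ (T.mem_th1 e v he) τ' hτ'
    have h2 := h.osc e _ (mem_level he) _ (mem_level he) τ hτ _ ⟨le_rfl, T.th1_le e⟩
    have h3 := Finset.single_le_sum (fun e _ => h.nonneg e) (T.mem_star.2 he)
    have h4 := abs_sub_le (φ (T.a v) τ) (φ (T.a v) (T.th1 e)) (φ (T.a v) τ')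
    unfold star at h3 ⊢
    linarith

/-- A corner of a piece. -/
noncomputable def corner (T : Tiling V E) (v : V) : ℝ := (T.nonempty v).some

lemma corner_mem (v : V) : T.corner v ∈ T.Co v := (T.nonempty v).some_mem

lemma Test.adj (h : T.Test φ o) {v w : V} (hvw : T.Adj v w) :
    |φ (T.a v) (T.corner v) - φ (T.a w) (T.corner w)| ≤
      3 * ∑ e ∈ T.star v, o e + 3 * ∑ e ∈ T.star w, o e := by
  obtain ⟨e, he⟩ := hvw
  have he' : (T.lo e = v ∨ T.hi e = v) ∧ (T.lo e = w ∨ T.hi e = w) := by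
    rcases Sym2.eq_iff.1 he with h | h <;> tauto
  have h1 := h.corner (.inl (T.mem_th1 e v he'.1)) (corner_mem v)
  have h2 := h.corner (.inl (T.mem_th1 e w he'.2)) (corner_mem w)
  have h3 := h.osc e _ (mem_level he'.1) _ (mem_level he'.2) _ ⟨le_rfl, T.th1_le e⟩ _
    ⟨le_rfl, T.th1_le e⟩
  have h4 := Finset.single_le_sum (fun e _ => h.nonneg e) (T.mem_star.2 he'.1)
  have h5 : 0 ≤ ∑ e ∈ T.star w, o e := Finset.sum_nonneg fun e _ => h.nonneg e
  rw [abs_le] at *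
  constructor <;> linarith

end Tiling

/-- Oscillation along a chain inside a finite set. -/
lemma abs_sub_le_sum_of_chain {V : Type*} {Adj : V → V → Prop} {w S : V → ℝ} (A : Finset V)
    (hS : ∀ v, 0 ≤ S v) (hw : ∀ u v, Adj u v → |w u - w v| ≤ S u + S v) {u v : V} (hu : u ∈ A)
    (h : Relation.ReflTransGen (fun a b => Adj a b ∧ a ∈ A ∧ b ∈ A) u v) :
    |w u - w v| ≤ ∑ a ∈ A, 2 * S a := by
  classical
  let R : V → V → Prop := fun a b => Adj a b ∧ a ∈ A ∧ b ∈ A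
  let A' : Set V := {a | Relation.ReflTransGen R u a}
  have hA' : ∀ a ∈ A', a ∈ A := by
    intro a ha
    rcases Relation.ReflTransGen.cases_tail ha with rfl | ⟨_, -, h⟩
    · exact hu
    · exact h.2.2
  let I : V → Set ℝ := fun a => Set.Icc (w a - S a) (w a + S a)
  have hself : ∀ a, w a ∈ I a := fun a => ⟨by linarith [hS a], by linarith [hS a]⟩
  have hinter : ∀ a b, Adj a b → (I a ∩ I b).Nonempty := by
    intro a b hab
    have := hw a b hab
    rw [abs_le] at this
    refine ⟨max (w a - S a) (w b - S b), ⟨le_max_left _ _, max_le (by linarith [hS a]) (by linarith)⟩,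
      le_max_right _ _, max_le (by linarith) (by linarith [hS b])⟩
  have hpc : IsPreconnected (⋃ a ∈ A', I a) := by
    refine IsPreconnected.biUnion_of_reflTransGen (fun a _ => isPreconnected_Icc) ?_
    have hroot : ∀ b ∈ A', Relation.ReflTransGen (fun i j => (I i ∩ I j).Nonempty ∧ i ∈ A') u b ∧
        Relation.ReflTransGen (fun i j => (I i ∩ I j).Nonempty ∧ i ∈ A') b u := by
      intro b hb
      induction hb with
      | refl => exact ⟨.refl, .refl⟩
      | @tail b c hb hbc ih =>
        have hc : c ∈ A' := Relation.ReflTransGen.tail hb hbc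
        exact ⟨ih.1.tail ⟨hinter _ _ hbc.1, hb⟩, Relation.ReflTransGen.head
          ⟨by rw [Set.inter_comm]; exact hinter _ _ hbc.1, hc⟩ ih.2⟩
    exact fun a ha b hb => (hroot a ha).2.trans (hroot b hb).1
  have hsub : Set.uIcc (w u) (w v) ⊆ ⋃ a ∈ A, I a := by
    refine Set.Subset.trans ?_ (Set.biUnion_subset_biUnion_left hA')
    exact hpc.ordConnected.uIcc_subset (Set.mem_biUnion (show u ∈ A' from .refl) (hself u))
      (Set.mem_biUnion (show v ∈ A' from h) (hself v))
  have hvol := (measure_mono hsub).trans (measure_biUnion_finset_le (μ := volume) A I)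
  simp only [I, Real.volume_interval, Real.volume_Icc] at hvol
  rw [← ENNReal.ofReal_sum_of_nonneg fun a _ => by linarith [hS a]] at hvol
  have h2 := (ENNReal.ofReal_le_ofReal_iff (Finset.sum_nonneg fun a _ => by linarith [hS a])).1 hvol
  rw [abs_sub_comm]
  refine h2.trans (le_of_eq (Finset.sum_congr rfl fun a _ => by ring))

variable {Z : Type} [MetricSpace Z] [MeasurableSpace Z] [BorelSpace Z] {μ : Measure Z}
  {Q C : ℝ} {Ψ : ℝ → ℝ}

/-- Discretised test functions have coarse upper gradients with controlled energy. -/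
lemma LoewnerSpace.exists_coarse (hZ : LoewnerSpace μ Q C Ψ) {K : ℝ} (hK : 1 ≤ K) (D : ℕ) :
    ∃ B : ℝ, 0 < B ∧ ∀ (x y : Z) (ε : ℝ) (d : Disc Z x y K D ε) (φ : ℝ → ℝ → ℝ) (o : d.E → ℝ),
      0 < ε → d.T.Test φ o → ∀ P R : Set Z,
      (∀ z ∈ P, ∃ v τ, z ∈ d.Y v ∧ d.T.Over v τ ∧ φ (d.T.a v) τ ≤ 0) →
      (∀ z ∈ R, ∃ v τ, z ∈ d.Y v ∧ d.T.Over v τ ∧ 1 ≤ φ (d.T.a v) τ) →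
      ∃ (ω : Z → ℝ) (g : Z → ℝ≥0∞), Measurable g ∧ CoarseAdm ω g ε P R ∧
        ∀ (A : Set Z) (F : Finset d.E), MeasurableSet A →
          (∀ e v z, (d.T.lo e = v ∨ d.T.hi e = v) → z ∈ A → dist z (d.ctr v) ≤ K * ε → e ∈ F) →
          ∫⁻ z in A, g z ^ Q ∂μ ≤ ENNReal.ofReal (B * ∑ e ∈ F, o e ^ Q) := by
  have hQ := hZ.two_le
  have hC := hZ.one_le
  have hQ0 : 0 ≤ Q := by linarith
  let B₀ : ℝ := 30 ^ Q * (D + 1) ^ (Q - 1) * (C * (2 * K) ^ Q)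
  let B₁ : ℝ := (D + 1) ^ (Q - 1) * 2
  have hB₀ : 0 < B₀ := by positivity
  have hB₁ : 0 < B₁ := by positivity
  refine ⟨B₀ * B₁, by positivity, ?_⟩
  intro x y ε d φ o hε hT P R hP hR
  choose pc hpc using d.cover
  let w : d.V → ℝ := fun v => φ (d.T.a v) (d.T.corner v)
  let S : d.V → ℝ := fun v => 3 * ∑ e ∈ d.T.star v, o e
  have hS : ∀ v, 0 ≤ S v := fun v =>
    mul_nonneg (by norm_num) (Finset.sum_nonneg fun e _ => hT.nonneg e)
  let N : Z → Finset d.V := fun z => Finset.univ.filter fun v => dist z (d.ctr v) ≤ K * ε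
  have hmemN : ∀ z v, v ∈ N z ↔ dist z (d.ctr v) ≤ K * ε := fun z v => by simp [N]
  let σ : Z → ℝ := fun z => ∑ v ∈ N z, S v
  have hσ : ∀ z, 0 ≤ σ z := fun z => Finset.sum_nonneg fun v _ => hS v
  have hosc : ∀ z z' v v', z ∈ d.Y v → z' ∈ d.Y v' → dist z z' ≤ 4 * ε →
      |w v - w v'| ≤ 2 * σ z := by
    intro z z' v v' hz hz' hzz
    have h1 := abs_sub_le_sum_of_chain (N z) hS (fun u v h => hT.adj (T := d.T) h)
      ((hmemN z v).2 (d.near_ctr v z hz)) (Relation.ReflTransGen.mono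
        (fun a b h => ⟨h.1, (hmemN z a).2 h.2.1, (hmemN z b).2 h.2.2⟩) _ _
        (d.near v v' z z' hz hz' hzz))
    rw [← Finset.mul_sum] at h1
    exact h1
  let g : Z → ℝ≥0∞ := fun z => ENNReal.ofReal (5 / ε) *
    ∑ v, (Metric.closedBall (d.ctr v) (K * ε)).indicator (fun _ => ENNReal.ofReal (S v)) z
  have hgσ : ∀ z, g z = ENNReal.ofReal (5 / ε * σ z) := by
    intro z
    rw [ENNReal.ofReal_mul (by positivity), ENNReal.ofReal_sum_of_nonneg fun v _ => hS v]
    simp only [g]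
    congr 1
    rw [Finset.sum_filter]
    refine Finset.sum_congr rfl fun v _ => ?_
    by_cases h : dist z (d.ctr v) ≤ K * ε
    · rw [if_pos h, Set.indicator_of_mem (Metric.mem_closedBall.2 h)]
    · rw [if_neg h, Set.indicator_of_notMem (fun h' => h (Metric.mem_closedBall.1 h'))]
  have hεg : ∀ z, ENNReal.ofReal ε * g z = ENNReal.ofReal (5 * σ z) := by
    intro z
    rw [hgσ, ← ENNReal.ofReal_mul hε.le]
    congr 1
    field_simp
  have hcl : ∀ v τ, d.T.Over v τ → |φ (d.T.a v) τ - w v| ≤ S v := by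
    intro v τ hτ
    refine (hT.corner hτ (d.T.corner_mem v)).trans ?_
    have : 0 ≤ ∑ e ∈ d.T.star v, o e := Finset.sum_nonneg fun e _ => hT.nonneg e
    simp only [S]; linarith
  have hSσ : ∀ z z' v v', z ∈ d.Y v → z' ∈ d.Y v' → dist z z' ≤ 4 * ε → S v' ≤ σ z := by
    intro z z' v v' hz hz' hzz
    refine Finset.single_le_sum (fun v _ => hS v) ((hmemN z v').2 ?_)
    rcases Relation.ReflTransGen.cases_tail (d.near v v' z z' hz hz' hzz) with h | ⟨u, -, h⟩
    · rw [h]; exact d.near_ctr v z hz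
    · exact h.2.2
  have hend : ∀ z v z', z ∈ d.Y v → dist z z' ≤ 4 * ε → |w (pc z) - w v| + S v ≤ 5 * σ z' := by
    intro z v z' hz hzz
    rw [dist_comm] at hzz
    have h1 := hosc z' z (pc z') (pc z) (hpc z') (hpc z) hzz
    have h2 := hosc z' z (pc z') v (hpc z') hz hzz
    have h3 := hSσ z' z (pc z') v (hpc z') hz hzz
    have h4 := abs_sub_le (w (pc z)) (w (pc z')) (w v)
    rw [abs_sub_comm (w (pc z)) (w (pc z'))] at h4
    linarith
  refine ⟨fun z => w (pc z), g, ?_, ⟨?_, ?_, ?_⟩, ?_⟩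
  · exact (Finset.measurable_sum _ fun v _ =>
      measurable_const.indicator Metric.isClosed_closedBall.measurableSet).const_mul _
  · intro z z' hzz
    rw [hεg]
    refine ENNReal.ofReal_le_ofReal ?_
    have := hosc z z' _ _ (hpc z) (hpc z') hzz
    have := hσ z
    linarith
  · intro z hz z' hzz
    rw [hεg]
    refine ENNReal.ofReal_le_ofReal ?_
    obtain ⟨v, τ, hzv, hτ, hφ⟩ := hP z hz
    have h1 := hend z v z' hzv hzz
    have h2 := hcl v τ hτ
    have h3 := le_abs_self (w (pc z) - w v)
    have h4 := neg_abs_le (φ (d.T.a v) τ - w v)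
    linarith
  · intro z hz z' hzz
    rw [hεg]
    refine ENNReal.ofReal_le_ofReal ?_
    obtain ⟨v, τ, hzv, hτ, hφ⟩ := hR z hz
    have h1 := hend z v z' hzv hzz
    have h2 := hcl v τ hτ
    have h3 := neg_abs_le (w (pc z) - w v)
    have h4 := le_abs_self (φ (d.T.a v) τ - w v)
    linarith
  · intro A F hA hF
    have hD0 : (0 : ℝ) ≤ (D + 1 : ℝ) ^ (Q - 1) := by positivity
    have hpow : ∀ (ι : Type) (t : Finset ι) (f : ι → ℝ), (∀ i, 0 ≤ f i) → t.card ≤ D →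
        (∑ i ∈ t, f i) ^ Q ≤ (D + 1) ^ (Q - 1) * ∑ i ∈ t, f i ^ Q := by
      intro ι t f hf ht
      refine (Real.rpow_sum_le_const_mul_sum_rpow_of_nonneg t (by linarith) fun i _ => hf i).trans ?_
      have h1 : 0 ≤ ∑ i ∈ t, f i ^ Q := Finset.sum_nonneg fun i _ => Real.rpow_nonneg (hf i) _
      have h2 : (t.card : ℝ) ≤ D + 1 := by
        have : (t.card : ℝ) ≤ D := by exact_mod_cast ht
        linarith
      gcongr
      linarith
    let G : Finset d.V := by
      classical
      exact Finset.univ.filter fun v => ∃ z ∈ A, dist z (d.ctr v) ≤ K * ε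
    have hG : ∀ v, v ∈ G ↔ ∃ z ∈ A, dist z (d.ctr v) ≤ K * ε := fun v => by simp [G]
    have hpt : ∀ z ∈ A, g z ^ Q ≤ ∑ v ∈ G, (Metric.closedBall (d.ctr v) (K * ε)).indicator
        (fun _ => ENNReal.ofReal ((5 / ε) ^ Q * (D + 1) ^ (Q - 1) * S v ^ Q)) z := by
      intro z hz
      rw [hgσ, ENNReal.ofReal_rpow_of_nonneg (mul_nonneg (by positivity) (hσ z)) hQ0]
      have h1 : ∑ v ∈ N z, ENNReal.ofReal ((5 / ε) ^ Q * (D + 1) ^ (Q - 1) * S v ^ Q) ≤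
          ∑ v ∈ G, (Metric.closedBall (d.ctr v) (K * ε)).indicator
            (fun _ => ENNReal.ofReal ((5 / ε) ^ Q * (D + 1) ^ (Q - 1) * S v ^ Q)) z := by
        refine le_trans (Finset.sum_le_sum fun v hv => ?_) (Finset.sum_le_sum_of_subset
          (s := N z) fun v hv => (hG v).2 ⟨z, hz, (hmemN z v).1 hv⟩)
        rw [Set.indicator_of_mem (by rw [Metric.mem_closedBall]; exact (hmemN z v).1 hv)]
      refine le_trans ?_ h1
      rw [← ENNReal.ofReal_sum_of_nonneg fun v _ => by have := hS v; positivity]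
      refine ENNReal.ofReal_le_ofReal ?_
      rw [Real.mul_rpow (by positivity) (hσ z), ← Finset.mul_sum, mul_assoc]
      refine mul_le_mul_of_nonneg_left (hpow _ _ _ hS ?_) (by positivity)
      refine le_trans (Finset.card_le_card ?_) (d.count z)
      intro v hv
      have := (hmemN z v).1 hv
      simp only [Finset.mem_filter, Finset.mem_univ, true_and]
      nlinarith
    have hball : ∀ v, μ (Metric.closedBall (d.ctr v) (K * ε)) ≤
        ENNReal.ofReal (C * (2 * K * ε) ^ Q) := fun v =>
      (measure_mono (Metric.closedBall_subset_ball (by nlinarith))).trans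
        (hZ.upper (d.ctr v) (2 * K * ε) (by positivity))
    have hsum : ∑ v ∈ G, S v ^ Q ≤ 3 ^ Q * (B₁ * ∑ e ∈ F, o e ^ Q) := by
      have h1 : ∀ v, S v ^ Q ≤ 3 ^ Q * ((D + 1) ^ (Q - 1) * ∑ e ∈ d.T.star v, o e ^ Q) := by
        intro v
        simp only [S]
        rw [Real.mul_rpow (by norm_num) (Finset.sum_nonneg fun e _ => hT.nonneg e)]
        exact mul_le_mul_of_nonneg_left (hpow _ _ _ hT.nonneg (d.deg v)) (by positivity)
      have h2 : ∑ v ∈ G, ∑ e ∈ d.T.star v, o e ^ Q ≤ 2 * ∑ e ∈ F, o e ^ Q := by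
        have h3 : ∀ v ∈ G, ∑ e ∈ d.T.star v, o e ^ Q ≤
            ∑ e ∈ F, ((if d.T.lo e = v then o e ^ Q else 0) +
              if d.T.hi e = v then o e ^ Q else 0) := by
          intro v hv
          obtain ⟨z, hz, hzv⟩ := (hG v).1 hv
          refine le_trans (Finset.sum_le_sum fun e he => ?_) (Finset.sum_le_sum_of_subset_of_nonneg
            (s := d.T.star v) (fun e he => hF e v z (d.T.mem_star.1 he) hz hzv) fun e _ _ => ?_)
          · have := Real.rpow_nonneg (hT.nonneg e) Q
            rcases d.T.mem_star.1 he with h | h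
            · rw [if_pos h]; split_ifs <;> linarith
            · rw [if_pos h]; split_ifs <;> linarith
          · have := Real.rpow_nonneg (hT.nonneg e) Q
            split_ifs <;> linarith
        refine (Finset.sum_le_sum h3).trans ?_
        rw [Finset.sum_comm, Finset.mul_sum]
        refine Finset.sum_le_sum fun e _ => ?_
        rw [Finset.sum_add_distrib, Finset.sum_ite_eq, Finset.sum_ite_eq]
        have := Real.rpow_nonneg (hT.nonneg e) Q
        split_ifs <;> linarith
      refine (Finset.sum_le_sum fun v _ => h1 v).trans ?_
      rw [← Finset.mul_sum, ← Finset.mul_sum]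
      have h5 := mul_le_mul_of_nonneg_left h2 hD0
      have : B₁ * ∑ e ∈ F, o e ^ Q = (D + 1) ^ (Q - 1) * (2 * ∑ e ∈ F, o e ^ Q) := by
        simp only [B₁]; ring
      rw [this]
      gcongr
    calc ∫⁻ z in A, g z ^ Q ∂μ
        ≤ ∫⁻ z in A, ∑ v ∈ G, (Metric.closedBall (d.ctr v) (K * ε)).indicator
          (fun _ => ENNReal.ofReal ((5 / ε) ^ Q * (D + 1) ^ (Q - 1) * S v ^ Q)) z ∂μ :=
          setLIntegral_mono' hA hpt
      _ ≤ ∫⁻ z, ∑ v ∈ G, (Metric.closedBall (d.ctr v) (K * ε)).indicator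
          (fun _ => ENNReal.ofReal ((5 / ε) ^ Q * (D + 1) ^ (Q - 1) * S v ^ Q)) z ∂μ :=
          setLIntegral_le_lintegral _ _
      _ = ∑ v ∈ G, ENNReal.ofReal ((5 / ε) ^ Q * (D + 1) ^ (Q - 1) * S v ^ Q) *
            μ (Metric.closedBall (d.ctr v) (K * ε)) := by
          rw [lintegral_finsetSum]
          · refine Finset.sum_congr rfl fun v _ => ?_
            rw [lintegral_indicator_const Metric.isClosed_closedBall.measurableSet]
          · exact fun v _ => measurable_const.indicator Metric.isClosed_closedBall.measurableSet
      _ ≤ ∑ v ∈ G, ENNReal.ofReal ((5 / ε) ^ Q * (D + 1) ^ (Q - 1) * S v ^ Q) *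
            ENNReal.ofReal (C * (2 * K * ε) ^ Q) := by
          gcongr with v _; exact hball v
      _ = ENNReal.ofReal (∑ v ∈ G, ((5 / ε) ^ Q * (D + 1) ^ (Q - 1) * S v ^ Q) *
            (C * (2 * K * ε) ^ Q)) := by
          rw [ENNReal.ofReal_sum_of_nonneg fun v _ => by have := hS v; positivity]
          refine Finset.sum_congr rfl fun v _ => ?_
          rw [← ENNReal.ofReal_mul (by have := hS v; positivity)]
      _ ≤ ENNReal.ofReal (B₀ * B₁ * ∑ e ∈ F, o e ^ Q) := by
          refine ENNReal.ofReal_le_ofReal ?_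
          rw [← Finset.sum_mul, ← Finset.mul_sum]
          have h1 : (5 / ε) ^ Q * (2 * K * ε) ^ Q = 5 ^ Q * (2 * K) ^ Q := by
            rw [← Real.mul_rpow (by positivity) (by positivity),
              ← Real.mul_rpow (by positivity) (by positivity)]
            congr 1; field_simp
          have h2 : (5 : ℝ) ^ Q * 3 ^ Q ≤ 30 ^ Q := by
            rw [← Real.mul_rpow (by positivity) (by positivity)]
            exact Real.rpow_le_rpow (by norm_num) (by norm_num) hQ0
          have h3 : 0 ≤ B₁ * ∑ e ∈ F, o e ^ Q :=
            mul_nonneg hB₁.le (Finset.sum_nonneg fun e _ => Real.rpow_nonneg (hT.nonneg e) _)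
          calc (5 / ε) ^ Q * (D + 1) ^ (Q - 1) * (∑ v ∈ G, S v ^ Q) * (C * (2 * K * ε) ^ Q)
              = ((5 / ε) ^ Q * (2 * K * ε) ^ Q) * ((D + 1) ^ (Q - 1) * C) * ∑ v ∈ G, S v ^ Q := by
                ring
            _ ≤ (5 ^ Q * (2 * K) ^ Q) * ((D + 1) ^ (Q - 1) * C) *
                (3 ^ Q * (B₁ * ∑ e ∈ F, o e ^ Q)) := by rw [h1]; gcongr
            _ = (5 ^ Q * 3 ^ Q) * ((2 * K) ^ Q * ((D + 1) ^ (Q - 1) * C) *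
                (B₁ * ∑ e ∈ F, o e ^ Q)) := by ring
            _ ≤ 30 ^ Q * ((2 * K) ^ Q * ((D + 1) ^ (Q - 1) * C) * (B₁ * ∑ e ∈ F, o e ^ Q)) := by
                gcongr
            _ = B₀ * B₁ * ∑ e ∈ F, o e ^ Q := by simp only [B₀]; ring

end Coarse

namespace Disc

variable {Z : Type} [MetricSpace Z] {x y : Z} {K : ℝ} {D : ℕ} {ε : ℝ} (d : Disc Z x y K D ε)

/-- The union of a family of pieces. -/
def union (A : Set d.V) : Set Z := ⋃ v ∈ A, d.Y v

lemma mem_union {A : Set d.V} {z : Z} : z ∈ d.union A ↔ ∃ v ∈ A, z ∈ d.Y v := by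
  simp [union]

lemma isCompact_union (A : Set d.V) : IsCompact (d.union A) :=
  A.toFinite.isCompact_biUnion fun v _ => d.compact v

lemma isConnected_union {A : Set d.V} (hA : d.T.Conn A) (hne : A.Nonempty) :
    IsConnected (d.union A) := by
  refine IsConnected.biUnion_of_reflTransGen hne (fun v _ => d.connected v) fun v hv w hw => ?_
  exact Relation.ReflTransGen.mono (fun a b hab => ⟨d.inter _ _ hab.1, hab.2.1⟩) _ _ (hA v hv w hw)

lemma reachable [PreconnectedSpace Z] (hε : 0 < ε) (v w : d.V) :
    Relation.ReflTransGen d.T.Adj v w := by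
  let A : Set d.V := {u | Relation.ReflTransGen d.T.Adj v u}
  by_contra hw
  have hpre := isPreconnected_closed_iff.1 (isPreconnected_univ (α := Z)) (d.union A) (d.union Aᶜ)
    (d.isCompact_union A).isClosed (d.isCompact_union Aᶜ).isClosed (fun z _ => by
      obtain ⟨u, hu⟩ := d.cover z
      by_cases h : u ∈ A
      · exact .inl (d.mem_union.2 ⟨u, h, hu⟩)
      · exact .inr (d.mem_union.2 ⟨u, h, hu⟩))
  obtain ⟨z, hz⟩ := (d.connected v).nonempty
  obtain ⟨z', hz'⟩ := (d.connected w).nonempty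
  obtain ⟨q, -, h1, h2⟩ := hpre ⟨z, trivial, d.mem_union.2 ⟨v, .refl, hz⟩⟩
    ⟨z', trivial, d.mem_union.2 ⟨w, hw, hz'⟩⟩
  obtain ⟨a, ha, hqa⟩ := d.mem_union.1 h1
  obtain ⟨b, hb, hqb⟩ := d.mem_union.1 h2
  refine hb (Relation.ReflTransGen.trans ha (Relation.ReflTransGen.mono (fun _ _ h => h.1) _ _
    (d.near a b q q hqa hqb ?_)))
  rw [dist_self]
  positivity

lemma dist_le_of_mem {v : d.V} {z z' : Z} (hz : z ∈ d.Y v) (hz' : z' ∈ d.Y v) :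
    dist z z' ≤ 2 * K * ε := by
  have := dist_triangle_right z z' (d.ctr v)
  have := d.near_ctr v z hz
  have := d.near_ctr v z' hz'
  linarith

lemma vx_ne_vy (h : 2 * K * ε < dist x y) : d.T.vx ≠ d.T.vy := fun h' =>
  absurd (d.dist_le_of_mem d.x_mem (h' ▸ d.y_mem)) (not_le.2 h)

end Disc

namespace Tiling

variable {V E : Type} [Fintype V] [DecidableEq V] [Fintype E] (T : Tiling V E)

lemma abs_clamp_sub_le {α β s s' l h : ℝ} (hs : s ∈ Set.Icc l h) (hs' : s' ∈ Set.Icc l h) :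
    |max α (min β s) - max α (min β s')| ≤ max α (min β h) - max α (min β l) := by
  have m : ∀ {a b : ℝ}, a ≤ b → max α (min β a) ≤ max α (min β b) := fun hab =>
    max_le_max le_rfl (min_le_min le_rfl hab)
  rw [abs_le]
  constructor
  · linarith [m hs.1, m hs'.2]
  · linarith [m hs.2, m hs'.1]

/-- The height function clipped to an interval is a test function. -/
lemma clip_test {α β : ℝ} (h : α < β) :
    T.Test (fun s _ => (max α (min β s) - α) / (β - α)) (fun e => T.part α β e / (β - α)) where
  cont s := continuous_const
  per s τ := rfl
  nonneg e := div_nonneg (T.part_nonneg _ _ _) (by linarith)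
  osc e s hs s' hs' τ _ τ' _ := by
    rw [← sub_div, abs_div, abs_of_pos (sub_pos.2 h)]
    refine div_le_div_of_nonneg_right ?_ (by linarith)
    rw [sub_sub_sub_cancel_right]
    exact abs_clamp_sub_le hs hs'

end Tiling

section Gap

variable {Z : Type} [MetricSpace Z] [MeasurableSpace Z] [BorelSpace Z] {μ : Measure Z}
  {Q C : ℝ} {Ψ : ℝ → ℝ}

/-- Two families of pieces separated in height have small energy. -/
lemma LoewnerSpace.exists_clip (hZ : LoewnerSpace μ Q C Ψ) {K : ℝ} (hK : 1 ≤ K) (D : ℕ) :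
    ∃ B : ℝ, 0 < B ∧ ∀ (x y : Z) (ε : ℝ) (d : Disc Z x y K D ε) (P R : Set d.V) (α β m : ℝ),
      0 < ε → α < β → (∀ v ∈ P, d.T.a v ≤ α) → (∀ v ∈ R, β ≤ d.T.a v) → 0 ≤ m →
      (∀ e, d.T.part α β e ≤ m) →
      ∃ (ω : Z → ℝ) (g : Z → ℝ≥0∞), Measurable g ∧ CoarseAdm ω g ε (d.union P) (d.union R) ∧
        ∫⁻ z, g z ^ Q ∂μ ≤ ENNReal.ofReal (B * (m / (β - α)) ^ (Q - 2) / (β - α)) := by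
  obtain ⟨B, hB, key⟩ := hZ.exists_coarse hK D
  have hQ := hZ.two_le
  refine ⟨B, hB, fun x y ε d P R α β m hε hαβ hP hR hm hpart => ?_⟩
  have hb : 0 < β - α := sub_pos.2 hαβ
  obtain ⟨ω, g, hg, hadm, hen⟩ := key x y ε d _ _ hε (d.T.clip_test hαβ) (d.union P) (d.union R)
    (fun z hz => by
      obtain ⟨v, hv, hzv⟩ := d.mem_union.1 hz
      refine ⟨v, d.T.corner v, hzv, .inl (Tiling.corner_mem v), ?_⟩
      rw [max_eq_left ((min_le_right _ _).trans (hP v hv)), sub_self, zero_div])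
    (fun z hz => by
      obtain ⟨v, hv, hzv⟩ := d.mem_union.1 hz
      refine ⟨v, d.T.corner v, hzv, .inl (Tiling.corner_mem v), ?_⟩
      rw [min_eq_left (hR v hv), max_eq_right hαβ.le, div_self hb.ne'])
  refine ⟨ω, g, hg, hadm, ?_⟩
  have h := hen Set.univ Finset.univ MeasurableSet.univ (fun e _ _ _ _ _ => Finset.mem_univ e)
  rw [Measure.restrict_univ] at h
  refine h.trans (ENNReal.ofReal_le_ofReal ?_)
  rw [mul_div_assoc]
  refine mul_le_mul_of_nonneg_left ?_ hB.le
  have h1 : ∀ e, (d.T.part α β e / (β - α)) ^ Q ≤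
      (m / (β - α)) ^ (Q - 2) / (β - α) ^ 2 * d.T.part α β e ^ 2 := by
    intro e
    have hp := d.T.part_nonneg α β e
    have : (d.T.part α β e / (β - α)) ^ Q =
        (d.T.part α β e / (β - α)) ^ (Q - 2) * (d.T.part α β e / (β - α)) ^ 2 := by
      rw [← Real.rpow_natCast (d.T.part α β e / (β - α)) 2]
      rw [← Real.rpow_add_of_nonneg (by positivity) (by linarith) (by norm_num)]
      congr 1
      norm_num
    rw [this, div_pow, div_mul_eq_mul_div, ← mul_div_assoc]
    gcongr
    exact hpart e
  refine (Finset.sum_le_sum fun e _ => h1 e).trans ?_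
  rw [← Finset.mul_sum]
  calc (m / (β - α)) ^ (Q - 2) / (β - α) ^ 2 * ∑ e, d.T.part α β e ^ 2
      ≤ (m / (β - α)) ^ (Q - 2) / (β - α) ^ 2 * (β - α) := by
        gcongr; exact d.T.sum_part_sq_le hαβ.le
    _ = _ := by field_simp

lemma LoewnerSpace.exists_clip' (hZ : LoewnerSpace μ Q C Ψ) {K : ℝ} (hK : 1 ≤ K) (D : ℕ) :
    ∃ B : ℝ, 0 < B ∧ ∀ (x y : Z) (ε : ℝ) (d : Disc Z x y K D ε) (P R : Set d.V) (α β : ℝ),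
      0 < ε → α < β → (∀ v ∈ P, d.T.a v ≤ α) → (∀ v ∈ R, β ≤ d.T.a v) →
      ∃ (ω : Z → ℝ) (g : Z → ℝ≥0∞), Measurable g ∧ CoarseAdm ω g ε (d.union P) (d.union R) ∧
        ∫⁻ z, g z ^ Q ∂μ ≤ ENNReal.ofReal (B / (β - α)) := by
  obtain ⟨B, hB, key⟩ := hZ.exists_clip hK D
  refine ⟨B, hB, fun x y ε d P R α β hε hαβ hP hR => ?_⟩
  obtain ⟨ω, g, hg, hadm, hen⟩ := key x y ε d P R α β (β - α) hε hαβ hP hR (by linarith)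
    (fun e => Tiling.clamp_sub_le hαβ.le _ _)
  refine ⟨ω, g, hg, hadm, ?_⟩
  rwa [div_self (sub_pos.2 hαβ).ne', Real.one_rpow, mul_one] at hen

/-- Continua of pieces joining a small ball to a large one have a small height gap. -/
lemma LoewnerSpace.gap_le (hZ : LoewnerSpace μ Q C Ψ) {K : ℝ} (hK : 1 ≤ K) (D : ℕ) {η δ : ℝ}
    (hη : 0 < η) (hδ : 0 < δ) :
    ∃ r : ℝ, 0 < r ∧ ∀ (x y : Z) (ε : ℝ) (d : Disc Z x y K D ε), 0 < ε → ε ≤ r →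
      ∀ (z : Z) (P R : Set d.V) (α β : ℝ), d.T.Conn P → d.T.Conn R → (∀ v ∈ P, d.T.a v ≤ α) →
        (∀ v ∈ R, β ≤ d.T.a v) → (∃ u ∈ d.union P, dist u z ≤ r) → (∃ u ∈ d.union P, δ ≤ dist u z) →
        (∃ u ∈ d.union R, dist u z ≤ r) → (∃ u ∈ d.union R, δ ≤ dist u z) → β - α ≤ η := by
  obtain ⟨B, hB, clip⟩ := hZ.exists_clip' hK D
  obtain ⟨Λ, c, hΛ, hc, ann⟩ := hZ.annuli
  obtain ⟨N, hN⟩ := exists_nat_gt (B / (η * c))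
  have hΛN : 0 < Λ ^ N := by positivity
  refine ⟨δ / Λ ^ N, by positivity, ?_⟩
  intro x y ε d hε hεr z P R α β hP hR hPα hRβ hP1 hP2 hR1 hR2
  by_contra! hgap
  have ne : ∀ A : Set d.V, (∃ u ∈ d.union A, dist u z ≤ δ / Λ ^ N) → A.Nonempty := by
    rintro A ⟨u, hu, -⟩
    obtain ⟨v, hv, -⟩ := d.mem_union.1 hu
    exact ⟨v, hv⟩
  obtain ⟨ω, g, hg, hadm, hen⟩ := clip x y ε d P R α β hε (by linarith) hPα hRβ
  have h := ann ε (δ / Λ ^ N) N z _ _ ω g hε hεr (d.isCompact_union P)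
    (d.isConnected_union hP (ne P hP1)) (d.isCompact_union R) (d.isConnected_union hR (ne R hR1))
    hP1 (by rwa [div_mul_cancel₀ _ hΛN.ne']) hR1 (by rwa [div_mul_cancel₀ _ hΛN.ne']) hadm hg
  have h2 := (h.trans (setLIntegral_le_lintegral _ _)).trans hen
  rw [ENNReal.ofReal_le_ofReal_iff (by have : 0 < β - α := by linarith
                                       positivity)] at h2
  have h3 : B / (β - α) ≤ B / η := by gcongr
  have h4 : B / η < N * c := by
    rw [div_lt_iff₀ (by positivity)] at hN ⊢
    linarith
  linarith

/-- Large continua at bounded relative distance have a bounded height gap. -/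
lemma LoewnerSpace.gap_le_rel (hZ : LoewnerSpace μ Q C Ψ) {K : ℝ} (hK : 1 ≤ K) (D : ℕ) {Θ : ℝ}
    (hΘ : 0 < Θ) :
    ∃ G : ℝ, 0 < G ∧ ∀ (x y : Z) (ε : ℝ) (d : Disc Z x y K D ε), 0 < ε →
      ε ≤ Metric.diam (Set.univ : Set Z) →
      ∀ (P R : Set d.V) (α β δ : ℝ) (p q : Z), d.T.Conn P → d.T.Conn R → (∀ v ∈ P, d.T.a v ≤ α) →
        (∀ v ∈ R, β ≤ d.T.a v) → 0 < δ → δ ≤ Metric.diam (d.union P) →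
        δ ≤ Metric.diam (d.union R) → p ∈ d.union P → q ∈ d.union R → dist p q ≤ Θ * δ →
        β - α ≤ G := by
  obtain ⟨B, hB, clip⟩ := hZ.exists_clip' hK D
  obtain ⟨c, hc, low⟩ := hZ.energy_lower_rel hΘ
  refine ⟨B / c, by positivity, ?_⟩
  intro x y ε d hε hεd P R α β δ p q hP hR hPα hRβ hδ hdP hdR hp hq hpq
  rcases le_or_gt β α with hle | hlt
  · have : 0 < B / c := by positivity
    linarith
  have ne : ∀ (A : Set d.V) u, u ∈ d.union A → A.Nonempty := by
    intro A u hu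
    obtain ⟨v, hv, -⟩ := d.mem_union.1 hu
    exact ⟨v, hv⟩
  have hb : 0 < β - α := by linarith
  obtain ⟨ω, g, hg, hadm, hen⟩ := clip x y ε d P R α β hε hlt hPα hRβ
  have h := low ε δ _ _ ω g p q hε hεd (d.isCompact_union P)
    (d.isConnected_union hP (ne P p hp)) (d.isCompact_union R) (d.isConnected_union hR (ne R q hq))
    hδ hdP hdR hp hq hpq hadm hg
  have h2 := h.trans hen
  rw [ENNReal.ofReal_le_ofReal_iff (by positivity)] at h2
  rw [le_div_iff₀ hb] at h2
  rw [le_div_iff₀ hc]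
  linarith

end Gap

lemma cd_half : cd (1 / 2) = 1 / 2 := by
  refine le_antisymm (cd_le_half _) ?_
  obtain ⟨k, hk⟩ := exists_cd_eq (1 / 2)
  rw [hk]
  rcases le_or_gt k 0 with h | h
  · have : (k : ℝ) ≤ 0 := by exact_mod_cast h
    rw [abs_of_nonneg (by linarith)]
    linarith
  · have : (1 : ℝ) ≤ k := by exact_mod_cast h
    rw [abs_of_nonpos (by linarith)]
    linarith

namespace Tiling

variable {V E : Type} [Fintype V] [DecidableEq V] [Fintype E] (T : Tiling V E)

lemma a_vx_lt (hne : T.vx ≠ T.vy) : T.a T.vx < T.a T.vy := by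
  by_contra! h
  have h1 := T.unit_len T.a
  have h2 : ∀ e, T.len e * (T.a (T.hi e) - T.a (T.lo e)) = T.len e ^ 2 := fun e => by
    rw [sq]; rfl
  simp_rw [h2] at h1
  have h3 : ∀ e, T.len e = 0 := by
    intro e
    have := Finset.single_le_sum (f := fun e => T.len e ^ 2) (fun e _ => sq_nonneg _)
      (Finset.mem_univ e)
    nlinarith
  have h4 := T.unit_len fun v => if v = T.vy then 1 else 0
  simp [h3, hne] at h4

/-- Each vertical line gives a chain of pieces joining the two poles. -/
lemma exists_full_chain (hne : T.vx ≠ T.vy) (t : ℝ) :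
    ∃ A, T.Conn A ∧ T.vx ∈ A ∧ T.vy ∈ A ∧ ∀ w ∈ A, T.Live t w := by
  obtain ⟨e, -, he⟩ := T.exists_crosses le_rfl (T.a_vx_lt hne) t
  obtain ⟨A, h1, -, h2⟩ := T.exists_chain ⟨e, .inl rfl, he⟩
  exact ⟨A, h1, h2⟩

lemma Live.over {T : Tiling V E} {t : ℝ} {v : V} (h : T.Live t v) : ∃ k : ℤ, T.Over v (t + k) := by
  obtain ⟨e, he, hm⟩ := h
  obtain ⟨k, h1, h2⟩ := T.mult_ne_zero_iff.1 hm
  exact ⟨k, .inr ⟨e, he, h1.le, h2⟩⟩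

lemma angle_test : T.Test (fun _ τ => 2 * cd τ) (fun e => 2 * T.len e) where
  cont s := continuous_const.mul cd_continuous
  per s τ := by rw [cd_add_one]
  nonneg e := mul_nonneg (by norm_num) (T.len_nonneg e)
  osc e s _ s' _ τ hτ τ' hτ' := by
    have h1 := abs_cd_sub_le τ τ'
    have h2 := T.th2_eq e
    have h3 : |τ - τ'| ≤ T.len e := by
      rw [abs_le]
      constructor <;> linarith [hτ.1, hτ.2, hτ'.1, hτ'.2]
    rw [← mul_sub, abs_mul, abs_two]
    linarith

end Tiling

section Poles

variable {Z : Type} [MetricSpace Z] [MeasurableSpace Z] [BorelSpace Z] {μ : Measure Z}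
  {Q C : ℝ} {Ψ : ℝ → ℝ}

/-- Near a pole the heights spread over a long interval. -/
lemma LoewnerSpace.le_band (hZ : LoewnerSpace μ Q C Ψ) {K : ℝ} (hK : 1 ≤ K) (D : ℕ) (M : ℝ) {δ : ℝ}
    (hδ : 0 < δ) :
    ∃ r ε₁ : ℝ, 0 < r ∧ r ≤ δ ∧ 0 < ε₁ ∧ ∀ (x y : Z) (ε : ℝ) (d : Disc Z x y K D ε), 0 < ε →
      ε ≤ ε₁ → δ ≤ dist x y → ∀ w s₁ s₂, (w = x ∨ w = y) → s₁ ≤ s₂ →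
      (∀ v, r ≤ dist (d.ctr v) w → dist (d.ctr v) w ≤ δ → s₁ ≤ d.T.a v ∧ d.T.a v ≤ s₂) →
      M ≤ s₂ - s₁ := by
  obtain ⟨B, hB, coarse⟩ := hZ.exists_coarse hK D
  obtain ⟨Λ, c, hΛ, hc, ann⟩ := hZ.annuli
  have hQ := hZ.two_le
  obtain ⟨N, hN⟩ := exists_nat_gt (B * (2 ^ Q * (|M| + 2)) / c)
  have hΛN : 1 ≤ Λ ^ N := one_le_pow₀ (by linarith)
  have hΛN0 : 0 < Λ ^ N := by positivity
  set r := δ / (2 * Λ ^ N) with hr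
  have hr0 : 0 < r := by positivity
  have hrΛ : r * Λ ^ N = δ / 2 := by rw [hr]; field_simp
  have hrδ : r ≤ δ / 2 := by nlinarith
  refine ⟨r / 2, r / (4 * K), by positivity, by linarith, by positivity, ?_⟩
  intro x y ε d hε hεr hxy w s₁ s₂ hw hs hband
  have hKε : K * ε ≤ r / 4 := by
    rw [le_div_iff₀ (by positivity)] at hεr
    linarith
  have hεK : ε ≤ K * ε := by nlinarith
  by_contra! hM
  have hne : d.T.vx ≠ d.T.vy := d.vx_ne_vy (by linarith)
  obtain ⟨P, hP, hPx, hPy, hPl⟩ := d.T.exists_full_chain hne 0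
  obtain ⟨R, hR, hRx, hRy, hRl⟩ := d.T.exists_full_chain hne (1 / 2)
  have hends : ∀ A : Set d.V, d.T.vx ∈ A → d.T.vy ∈ A → (∃ u ∈ d.union A, dist u w ≤ r) ∧
      ∃ u ∈ d.union A, r * Λ ^ N ≤ dist u w := by
    intro A hx hy
    have hx' : x ∈ d.union A := d.mem_union.2 ⟨_, hx, d.x_mem⟩
    have hy' : y ∈ d.union A := d.mem_union.2 ⟨_, hy, d.y_mem⟩
    rw [hrΛ]
    rcases hw with rfl | rfl
    · exact ⟨⟨w, hx', by rw [dist_self]; exact hr0.le⟩, y, hy', by rw [dist_comm]; linarith⟩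
    · exact ⟨⟨w, hy', by rw [dist_self]; exact hr0.le⟩, x, hx', by linarith⟩
  obtain ⟨ω, g, hg, hadm, hen⟩ := coarse x y ε d _ _ hε d.T.angle_test (d.union P) (d.union R)
    (fun z hz => by
      obtain ⟨v, hv, hzv⟩ := d.mem_union.1 hz
      obtain ⟨k, hk⟩ := (hPl v hv).over
      refine ⟨v, _, hzv, hk, ?_⟩
      have : cd 0 ≤ 0 := by simpa using cd_le_abs 0
      rw [cd_add_int]
      linarith)
    (fun z hz => by
      obtain ⟨v, hv, hzv⟩ := d.mem_union.1 hz
      obtain ⟨k, hk⟩ := (hRl v hv).over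
      refine ⟨v, _, hzv, hk, ?_⟩
      rw [cd_add_int, cd_half]
      norm_num)
  have hlow := ann ε r N w _ _ ω g hε (by linarith) (d.isCompact_union P)
    (d.isConnected_union hP ⟨_, hPx⟩) (d.isCompact_union R) (d.isConnected_union hR ⟨_, hRx⟩)
    (hends P hPx hPy).1 (hends P hPx hPy).2 (hends R hRx hRy).1 (hends R hRx hRy).2 hadm hg
  classical
  set F : Finset d.E := Finset.univ.filter fun e => d.T.a (d.T.lo e) ≤ s₂ ∧ s₁ ≤ d.T.a (d.T.hi e)
  have hA : MeasurableSet {z : Z | r ≤ dist z w ∧ dist z w < r * Λ ^ N} := by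
    have h1 : Measurable fun z : Z => dist z w := by fun_prop
    exact (measurableSet_le measurable_const h1).inter (measurableSet_lt h1 measurable_const)
  have hup := hen _ F hA (by
    rintro e v z he ⟨hz1, hz2⟩ hzv
    have h1 := dist_triangle z (d.ctr v) w
    have h2 := dist_triangle_left (d.ctr v) w z
    obtain ⟨h3, h4⟩ := hband v (by linarith) (by linarith)
    have := d.T.le e
    simp only [F, Finset.mem_filter, Finset.mem_univ, true_and]
    rcases he with rfl | rfl
    · exact ⟨h4, h3.trans this⟩
    · exact ⟨this.trans h4, h3⟩)
  have h := hlow.trans hup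
  have hsum : ∑ e ∈ F, (2 * d.T.len e) ^ Q ≤ 2 ^ Q * (s₂ - s₁ + 2) := by
    refine le_trans ?_ (mul_le_mul_of_nonneg_left
      (d.T.sum_band_le hs F fun e he => (Finset.mem_filter.1 he).2) (by positivity))
    rw [Finset.mul_sum]
    refine Finset.sum_le_sum fun e _ => ?_
    have h0 := d.T.len_nonneg e
    rw [Real.mul_rpow (by norm_num) h0, ← Real.rpow_natCast _ 2]
    refine mul_le_mul_of_nonneg_left ?_ (by positivity)
    refine Real.rpow_le_rpow_of_exponent_ge_of_imp h0 (d.T.len_le_one e) (by exact_mod_cast hQ) ?_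
    intro _ h'
    linarith
  rw [ENNReal.ofReal_le_ofReal_iff (mul_nonneg hB.le (Finset.sum_nonneg fun e _ =>
    Real.rpow_nonneg (mul_nonneg zero_le_two (d.T.len_nonneg e)) _))] at h
  rw [div_lt_iff₀ hc] at hN
  have h5 : B * ∑ e ∈ F, (2 * d.T.len e) ^ Q ≤ B * (2 ^ Q * (|M| + 2)) := by
    refine mul_le_mul_of_nonneg_left (hsum.trans ?_) hB.le
    gcongr
    exact hM.le.trans (le_abs_self M)
  linarith

/-- Normalised data for the discretisations with poles `x`, `y` and base point `p`. -/
structure Base (x y p : Z) : Prop where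
  xy : x ≠ y
  xp : x ≠ p
  yp : y ≠ p

variable [PreconnectedSpace Z]

lemma LoewnerSpace.gap_le_diam (hZ : LoewnerSpace μ Q C Ψ) {K : ℝ} (hK : 1 ≤ K) (D : ℕ) {δ : ℝ}
    (hδ : 0 < δ) :
    ∃ G : ℝ, 0 < G ∧ ∀ (x y : Z) (ε : ℝ) (d : Disc Z x y K D ε), 0 < ε →
      ε ≤ Metric.diam (Set.univ : Set Z) → ∀ (v w : d.V) (z z' : Z), z ∈ d.Y v → z' ∈ d.Y w →
      δ ≤ dist z x → δ ≤ dist z' y → d.T.a w - d.T.a v ≤ G := by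
  have := hZ.compact
  obtain ⟨G, hG, key⟩ := hZ.gap_le_rel hK D
    (Θ := max (Metric.diam (Set.univ : Set Z)) 1 / δ) (by positivity)
  refine ⟨G, hG, fun x y ε d hε hεd v w z z' hz hz' h1 h2 => ?_⟩
  obtain ⟨P, hP, hvP, hxP, hPa⟩ := d.T.exists_conn_le (d.reachable hε) v
  obtain ⟨R, hR, hwR, hyR, hRa⟩ := d.T.exists_conn_ge (d.reachable hε) w
  have m1 : z ∈ d.union P := d.mem_union.2 ⟨v, hvP, hz⟩
  have m2 : z' ∈ d.union R := d.mem_union.2 ⟨w, hwR, hz'⟩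
  refine key x y ε d hε hεd P R _ _ δ z z' hP hR hPa hRa hδ
    (h1.trans (Metric.dist_le_diam_of_mem (d.isCompact_union P).isBounded m1
      (d.mem_union.2 ⟨_, hxP, d.x_mem⟩)))
    (h2.trans (Metric.dist_le_diam_of_mem (d.isCompact_union R).isBounded m2
      (d.mem_union.2 ⟨_, hyR, d.y_mem⟩))) m1 m2 ?_
  rw [div_mul_cancel₀ _ hδ.ne']
  exact (Metric.dist_le_diam_of_mem isCompact_univ.isBounded (Set.mem_univ _)
    (Set.mem_univ _)).trans (le_max_left _ _)

/-- The height is very negative near the first pole and very positive near the second one. -/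
lemma LoewnerSpace.exists_pole (hZ : LoewnerSpace μ Q C Ψ) {K : ℝ} (hK : 1 ≤ K) (D : ℕ) {x y p : Z}
    (hb : Base x y p) (A : ℝ) :
    ∃ r : ℝ, 0 < r ∧ ∀ (ε : ℝ) (d : Disc Z x y K D ε), 0 < ε → ε ≤ r → ∀ v₀, p ∈ d.Y v₀ →
      ∀ v z, z ∈ d.Y v → (dist z x ≤ r → d.T.a v ≤ d.T.a v₀ - A) ∧
        (dist z y ≤ r → d.T.a v₀ + A ≤ d.T.a v) := by
  have := hZ.compact
  have hxy := dist_pos.2 hb.xy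
  have hxp := dist_pos.2 hb.xp
  have hyp := dist_pos.2 hb.yp
  set δ := min (dist x y) (min (dist x p) (dist y p)) / 4 with hδdef
  have hδ : 0 < δ := by positivity
  have hδ1 : 4 * δ ≤ dist x y := by
    rw [hδdef]; linarith [min_le_left (dist x y) (min (dist x p) (dist y p))]
  have hδ2 : 4 * δ ≤ dist x p := by
    rw [hδdef]
    linarith [min_le_right (dist x y) (min (dist x p) (dist y p)), min_le_left (dist x p) (dist y p)]
  have hδ3 : 4 * δ ≤ dist y p := by
    rw [hδdef]
    linarith [min_le_right (dist x y) (min (dist x p) (dist y p)), min_le_right (dist x p) (dist y p)]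
  obtain ⟨G, hG, gap⟩ := hZ.gap_le_diam hK D hδ
  obtain ⟨r₁, ε₁, hr₁, hr₁δ, hε₁, band⟩ := hZ.le_band hK D (G + |A| + 2) hδ
  obtain ⟨r, hr, gap'⟩ := hZ.gap_le hK D one_pos (half_pos hr₁)
  refine ⟨min (min r (r₁ / (2 * K))) ε₁, by positivity, ?_⟩
  intro ε d hε hεr v₀ hp v z hz
  have hεr1 : ε ≤ r := hεr.trans ((min_le_left _ _).trans (min_le_left _ _))
  have hεr2 : ε ≤ r₁ / (2 * K) := hεr.trans ((min_le_left _ _).trans (min_le_right _ _))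
  have hεr3 : ε ≤ ε₁ := hεr.trans (min_le_right _ _)
  have hKε : K * ε ≤ r₁ / 2 := by
    rw [le_div_iff₀ (by positivity)] at hεr2
    linarith
  have hεd : ε ≤ Metric.diam (Set.univ : Set Z) := by
    have := Metric.dist_le_diam_of_mem (isCompact_univ (X := Z)).isBounded (Set.mem_univ x)
      (Set.mem_univ y)
    nlinarith
  have hA := le_abs_self A
  have hA0 := abs_nonneg A
  have hzr : ∀ q, dist z q ≤ min (min r (r₁ / (2 * K))) ε₁ → dist z q ≤ r := fun q hq =>
    hq.trans ((min_le_left _ _).trans (min_le_left _ _))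
  have hself : ∀ q : Z, dist q q ≤ r := fun q => by rw [dist_self]; exact hr.le
  obtain ⟨Pv, hPv, hvP, hxP, hPa⟩ := d.T.exists_conn_le (d.reachable hε) v
  obtain ⟨Rv, hRv, hvR, hyR, hRa⟩ := d.T.exists_conn_ge (d.reachable hε) v
  constructor
  · intro hzx
    obtain ⟨v₁, h1, h2, h3⟩ : ∃ v₁, r₁ ≤ dist (d.ctr v₁) x ∧ dist (d.ctr v₁) x ≤ δ ∧
        d.T.a v₁ < d.T.a v₀ - |A| - 1 := by
      by_contra! hcon
      have := band x y ε d hε hεr3 (by linarith) x (d.T.a v₀ - |A| - 1) (d.T.a v₀ + G) (.inl rfl)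
        (by linarith) (fun w hw1 hw2 => ⟨hcon w hw1 hw2, by
          obtain ⟨q, hq⟩ := (d.connected w).nonempty
          have h4 := d.near_ctr w q hq
          have h5 := dist_triangle4 x (d.ctr w) q y
          rw [dist_comm x (d.ctr w), dist_comm (d.ctr w) q] at h5
          have := gap x y ε d hε hεd v₀ w p q hp hq (by rw [dist_comm]; linarith) (by linarith)
          linarith⟩)
      linarith
    obtain ⟨P, hP, hvP₁, hxP₁, hPa₁⟩ := d.T.exists_conn_le (d.reachable hε) v₁
    obtain ⟨q, hq⟩ := (d.connected v₁).nonempty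
    have h4 := d.near_ctr v₁ q hq
    have h5 := dist_triangle_left (d.ctr v₁) x q
    have := gap' x y ε d hε hεr1 x P Rv _ _ hP hRv hPa₁ hRa
      ⟨x, d.mem_union.2 ⟨_, hxP₁, d.x_mem⟩, hself x⟩
      ⟨q, d.mem_union.2 ⟨_, hvP₁, hq⟩, by linarith⟩
      ⟨z, d.mem_union.2 ⟨_, hvR, hz⟩, hzr x hzx⟩
      ⟨y, d.mem_union.2 ⟨_, hyR, d.y_mem⟩, by rw [dist_comm]; linarith⟩
    linarith
  · intro hzy
    obtain ⟨v₁, h1, h2, h3⟩ : ∃ v₁, r₁ ≤ dist (d.ctr v₁) y ∧ dist (d.ctr v₁) y ≤ δ ∧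
        d.T.a v₀ + |A| + 1 < d.T.a v₁ := by
      by_contra! hcon
      have := band x y ε d hε hεr3 (by linarith) y (d.T.a v₀ - G) (d.T.a v₀ + |A| + 1) (.inr rfl)
        (by linarith) (fun w hw1 hw2 => ⟨by
          obtain ⟨q, hq⟩ := (d.connected w).nonempty
          have h4 := d.near_ctr w q hq
          have h5 := dist_triangle4 x q (d.ctr w) y
          rw [dist_comm x q] at h5
          have := gap x y ε d hε hεd w v₀ q p hq hp (by linarith) (by rw [dist_comm]; linarith)
          linarith, hcon w hw1 hw2⟩)
      linarith
    obtain ⟨R, hR, hvR₁, hyR₁, hRa₁⟩ := d.T.exists_conn_ge (d.reachable hε) v₁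
    obtain ⟨q, hq⟩ := (d.connected v₁).nonempty
    have h4 := d.near_ctr v₁ q hq
    have h5 := dist_triangle_left (d.ctr v₁) y q
    have := gap' x y ε d hε hεr1 y Pv R _ _ hPv hR hPa hRa₁
      ⟨z, d.mem_union.2 ⟨_, hvP, hz⟩, hzr y hzy⟩
      ⟨x, d.mem_union.2 ⟨_, hxP, d.x_mem⟩, by linarith⟩
      ⟨y, d.mem_union.2 ⟨_, hyR₁, d.y_mem⟩, hself y⟩
      ⟨q, d.mem_union.2 ⟨_, hvR₁, hq⟩, by linarith⟩
    linarith

/-- The squares at bounded height are uniformly small. -/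
lemma LoewnerSpace.exists_mesh (hZ : LoewnerSpace μ Q C Ψ) {K : ℝ} (hK : 1 ≤ K) (D : ℕ) {x y p : Z}
    (hb : Base x y p) (A : ℝ) {m : ℝ} (hm : 0 < m) :
    ∃ ε₁ : ℝ, 0 < ε₁ ∧ ∀ (ε : ℝ) (d : Disc Z x y K D ε), 0 < ε → ε ≤ ε₁ → ∀ v₀, p ∈ d.Y v₀ →
      ∀ e, d.T.a (d.T.lo e) ≤ d.T.a v₀ + A → d.T.a v₀ - A ≤ d.T.a (d.T.hi e) → d.T.len e ≤ m := by
  obtain ⟨r, hr, pole⟩ := hZ.exists_pole hK D hb (A + 1)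
  obtain ⟨r', hr', gap⟩ := hZ.gap_le hK D hm hr
  refine ⟨min r r', by positivity, ?_⟩
  intro ε d hε hεr v₀ hp e h1 h2
  obtain ⟨z, hz1, hz2⟩ := d.inter _ _ (d.T.adj_lo_hi e)
  have hx : r ≤ dist z x := by
    by_contra! h
    have := (pole ε d hε (hεr.trans (min_le_left _ _)) v₀ hp _ z hz2).1 h.le
    linarith
  have hy : r ≤ dist z y := by
    by_contra! h
    have := (pole ε d hε (hεr.trans (min_le_left _ _)) v₀ hp _ z hz1).2 h.le
    linarith
  obtain ⟨P, hP, hvP, hxP, hPa⟩ := d.T.exists_conn_le (d.reachable hε) (d.T.lo e)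
  obtain ⟨R, hR, hvR, hyR, hRa⟩ := d.T.exists_conn_ge (d.reachable hε) (d.T.hi e)
  exact gap x y ε d hε (hεr.trans (min_le_right _ _)) z P R _ _ hP hR hPa hRa
    ⟨z, d.mem_union.2 ⟨_, hvP, hz1⟩, by rw [dist_self]; exact hr'.le⟩
    ⟨x, d.mem_union.2 ⟨_, hxP, d.x_mem⟩, by rwa [dist_comm]⟩
    ⟨z, d.mem_union.2 ⟨_, hvR, hz2⟩, by rw [dist_self]; exact hr'.le⟩
    ⟨y, d.mem_union.2 ⟨_, hyR, d.y_mem⟩, by rwa [dist_comm]⟩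

end Poles

lemma sq_sum_geom_le (P : ℕ → Prop) [DecidablePred P] (n : ℕ) {y : ℝ} (hy : 0 ≤ y) :
    (∑ k ∈ Finset.range n, if P k then y / 2 ^ k else 0) ^ 2 ≤
      4 * ∑ k ∈ Finset.range n, (if P k then y / 2 ^ k else 0) ^ 2 := by
  induction n generalizing P y with
  | zero => simp
  | succ n ih =>
    by_cases h0 : P 0
    · have h1 : ∑ k ∈ Finset.range (n + 1), (if P k then y / 2 ^ k else 0) ≤ 2 * y := by
        refine (Finset.sum_le_sum (g := fun k => y * (1 / 2) ^ k) fun k _ => ?_).trans ?_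
        · split_ifs
          · rw [div_eq_mul_inv, one_div, inv_pow]
          · positivity
        · rw [← Finset.mul_sum]
          have := sum_geometric_two_le (n + 1)
          nlinarith
      have h2 : 0 ≤ ∑ k ∈ Finset.range (n + 1), (if P k then y / 2 ^ k else 0) :=
        Finset.sum_nonneg fun k _ => by split_ifs <;> positivity
      have h3 := Finset.single_le_sum
        (f := fun k => (if P k then y / 2 ^ k else 0) ^ 2) (fun k _ => sq_nonneg _)
        (Finset.mem_range.2 n.succ_pos)
      simp only [h0, if_true, pow_zero, div_one] at h3
      nlinarith
    · have := ih (fun k => P (k + 1)) (y := y / 2) (by positivity)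
      rw [Finset.sum_range_succ', Finset.sum_range_succ']
      simp only [h0, if_false, add_zero, pow_succ', ← div_div] at this ⊢
      simpa using this

namespace Tiling

variable {V E : Type} [Fintype V] [DecidableEq V] [Fintype E] (T : Tiling V E)

/-- Sup distance on the cylinder from a base point. -/
noncomputable def boxDist (s₀ t₀ s τ : ℝ) : ℝ := max |s - s₀| (cd (τ - t₀))

lemma boxDist_sub_le (s₀ t₀ s τ s' τ' l : ℝ) (hs : |s - s'| ≤ l) (ht : |τ - τ'| ≤ l) :
    boxDist s₀ t₀ s τ - boxDist s₀ t₀ s' τ' ≤ l := by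
  have h1 : |s - s₀| ≤ |s' - s₀| + l := by
    have := abs_sub_le s s' s₀
    linarith
  have h2 := abs_cd_sub_le (τ - t₀) (τ' - t₀)
  rw [sub_sub_sub_cancel_right] at h2
  have h3 := (abs_le.1 (h2.trans ht)).2
  unfold boxDist
  have h4 := le_max_left |s' - s₀| (cd (τ' - t₀))
  have h5 := le_max_right |s' - s₀| (cd (τ' - t₀))
  rw [sub_le_iff_le_add]
  exact max_le (by linarith) (by linarith)

/-- A linear cutoff between `r` and `2 * r`. -/
noncomputable def ramp (r u : ℝ) : ℝ := max 0 (min 1 (u / r - 1))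

lemma ramp_eq_zero {r u : ℝ} (hr : 0 < r) (h : u ≤ r) : ramp r u = 0 := by
  have : u / r ≤ 1 := (div_le_one hr).2 h
  exact max_eq_left ((min_le_right _ _).trans (by linarith))

lemma ramp_eq_one {r u : ℝ} (hr : 0 < r) (h : 2 * r ≤ u) : ramp r u = 1 := by
  have : 2 ≤ u / r := (le_div_iff₀ hr).2 h
  rw [ramp, min_eq_left (by linarith), max_eq_right zero_le_one]

lemma ramp_sub_le {r u u' l : ℝ} (hr : 0 < r) (hl : 0 ≤ l) (h : u - u' ≤ l) :
    ramp r u - ramp r u' ≤ l / r := by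
  have h1 : u / r - 1 ≤ u' / r - 1 + l / r := by
    rw [sub_add_eq_add_sub, ← add_div]
    gcongr
    linarith
  have h2 : 0 ≤ l / r := by positivity
  unfold ramp
  rw [sub_le_iff_le_add]
  refine max_le (by linarith [le_max_left 0 (min 1 (u' / r - 1))]) ?_
  have h3 := le_max_right 0 (min 1 (u' / r - 1))
  rcases min_cases 1 (u' / r - 1) with h4 | h4
  · linarith [min_le_left 1 (u / r - 1)]
  · linarith [min_le_right 1 (u / r - 1)]

lemma ramp_continuous (r : ℝ) : Continuous (ramp r) := by unfold ramp; fun_prop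

/-- The square `e` meets the box of radius `ρ`. -/
def Meets (s₀ t₀ ρ : ℝ) (e : E) : Prop :=
  ∃ s ∈ Set.Icc (T.a (T.lo e)) (T.a (T.hi e)), ∃ τ ∈ Set.Icc (T.th1 e) (T.th2 e),
    boxDist s₀ t₀ s τ ≤ ρ

open Classical in
/-- The oscillation of the logarithmic cutoff on a square. -/
noncomputable def logOsc (s₀ t₀ r : ℝ) (n : ℕ) (e : E) : ℝ :=
  (∑ k ∈ Finset.range n, if T.Meets s₀ t₀ (r * 2 ^ (k + 1)) e then T.len e / r / 2 ^ k else 0) / n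

/-- The logarithmic cutoff between the boxes of radius `r` and `r * 2 ^ n`. -/
noncomputable def logCut (s₀ t₀ r : ℝ) (n : ℕ) (s τ : ℝ) : ℝ :=
  (∑ k ∈ Finset.range n, ramp (r * 2 ^ k) (boxDist s₀ t₀ s τ)) / n

lemma logCut_le_zero {s₀ t₀ r s τ : ℝ} (hr : 0 < r) (n : ℕ) (h : boxDist s₀ t₀ s τ ≤ r) :
    logCut s₀ t₀ r n s τ ≤ 0 := by
  rw [logCut, Finset.sum_eq_zero, zero_div]
  intro k _
  have : (1 : ℝ) ≤ 2 ^ k := one_le_pow₀ (by norm_num)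
  exact ramp_eq_zero (by positivity) (by nlinarith)

lemma one_le_logCut {s₀ t₀ r s τ : ℝ} (hr : 0 < r) {n : ℕ} (hn : 0 < n)
    (h : r * 2 ^ n ≤ boxDist s₀ t₀ s τ) : 1 ≤ logCut s₀ t₀ r n s τ := by
  have hn' : (0 : ℝ) < n := by exact_mod_cast hn
  rw [logCut, le_div_iff₀ hn', Finset.sum_eq_card_nsmul (b := 1)]
  · simp
  intro k hk
  have : (2 : ℝ) ^ (k + 1) ≤ 2 ^ n := pow_le_pow_right₀ (by norm_num) (Finset.mem_range.1 hk)
  rw [pow_succ'] at this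
  exact ramp_eq_one (by positivity) (by nlinarith)

lemma logOsc_nonneg {r : ℝ} (s₀ t₀ : ℝ) (hr : 0 < r) (n : ℕ) (e : E) :
    0 ≤ T.logOsc s₀ t₀ r n e := by
  have := T.len_nonneg e
  refine div_nonneg (Finset.sum_nonneg fun k _ => ?_) n.cast_nonneg
  split_ifs <;> positivity

lemma log_test (s₀ t₀ : ℝ) {r : ℝ} (hr : 0 < r) (n : ℕ) :
    T.Test (logCut s₀ t₀ r n) (T.logOsc s₀ t₀ r n) where
  cont s := by
    have h : Continuous fun τ => boxDist s₀ t₀ s τ := by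
      unfold boxDist
      exact continuous_const.max (cd_continuous.comp (by fun_prop))
    unfold logCut
    exact (continuous_finsetSum _ fun k _ => (ramp_continuous _).comp h).div_const _
  per s τ := by
    have : boxDist s₀ t₀ s (τ + 1) = boxDist s₀ t₀ s τ := by
      rw [boxDist, boxDist, ← sub_add_eq_add_sub, cd_add_one]
    rw [logCut, logCut, this]
  nonneg := T.logOsc_nonneg s₀ t₀ hr n
  osc e := by
    have key : ∀ s ∈ Set.Icc (T.a (T.lo e)) (T.a (T.hi e)),
        ∀ s' ∈ Set.Icc (T.a (T.lo e)) (T.a (T.hi e)), ∀ τ ∈ Set.Icc (T.th1 e) (T.th2 e),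
        ∀ τ' ∈ Set.Icc (T.th1 e) (T.th2 e),
        logCut s₀ t₀ r n s τ - logCut s₀ t₀ r n s' τ' ≤ T.logOsc s₀ t₀ r n e := by
      intro s hs s' hs' τ hτ τ' hτ'
      have hlen : T.len e = T.a (T.hi e) - T.a (T.lo e) := rfl
      have h2 := T.th2_eq e
      rw [logCut, logCut, logOsc, ← sub_div, ← Finset.sum_sub_distrib]
      gcongr with k
      have hrk : 0 < r * 2 ^ k := by positivity
      split_ifs with h
      · rw [div_div]
        refine ramp_sub_le hrk (T.len_nonneg e) (boxDist_sub_le _ _ _ _ _ _ _ ?_ ?_)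
        · rw [abs_le]; constructor <;> linarith [hs.1, hs.2, hs'.1, hs'.2]
        · rw [abs_le]; constructor <;> linarith [hτ.1, hτ.2, hτ'.1, hτ'.2]
      · have h1 : ∀ s ∈ Set.Icc (T.a (T.lo e)) (T.a (T.hi e)), ∀ τ ∈ Set.Icc (T.th1 e) (T.th2 e),
            ramp (r * 2 ^ k) (boxDist s₀ t₀ s τ) = 1 := by
          intro s hs τ hτ
          refine ramp_eq_one hrk ?_
          by_contra! h'
          exact h ⟨s, hs, τ, hτ, by rw [pow_succ']; linarith⟩
        rw [h1 s hs τ hτ, h1 s' hs' τ' hτ', sub_self]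
    intro s hs s' hs' τ hτ τ' hτ'
    exact abs_sub_le_iff.2 ⟨key s hs s' hs' τ hτ τ' hτ', key s' hs' s hs τ' hτ' τ hτ⟩

lemma sum_logOsc_le {s₀ t₀ r Q : ℝ} (hQ : 2 ≤ Q) (hr : 0 < r) {n : ℕ} (hn : 0 < n)
    (hm : ∀ e, T.Meets s₀ t₀ (r * 2 ^ n) e → T.len e ≤ r) :
    ∑ e, T.logOsc s₀ t₀ r n e ^ Q ≤ 256 / n := by
  classical
  have hn' : (0 : ℝ) < n := by exact_mod_cast hn
  have hmk : ∀ k < n, ∀ e, T.Meets s₀ t₀ (r * 2 ^ (k + 1)) e → T.len e ≤ r := by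
    rintro k hk e ⟨s, hs, τ, hτ, h⟩
    refine hm e ⟨s, hs, τ, hτ, h.trans ?_⟩
    gcongr
    · norm_num
    · omega
  have hle : ∀ e, T.logOsc s₀ t₀ r n e ≤ 1 := by
    intro e
    rw [logOsc, div_le_one hn']
    calc _ ≤ ∑ k ∈ Finset.range n, (1 : ℝ) := Finset.sum_le_sum fun k hk => ?_
      _ = n := by simp
    split_ifs with h
    · have h1 := (div_le_one hr).2 (hmk k (Finset.mem_range.1 hk) e h)
      have h2 : (1 : ℝ) ≤ 2 ^ k := one_le_pow₀ (by norm_num)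
      exact (div_le_one (by positivity)).2 (h1.trans h2)
    · exact zero_le_one
  have h1 : ∀ e, T.logOsc s₀ t₀ r n e ^ Q ≤ (4 * ∑ k ∈ Finset.range n,
      (if T.Meets s₀ t₀ (r * 2 ^ (k + 1)) e then T.len e / r / 2 ^ k else 0) ^ 2) / n ^ 2 := by
    intro e
    have h0 := T.logOsc_nonneg s₀ t₀ hr n e
    have h2 : T.logOsc s₀ t₀ r n e ^ Q ≤ T.logOsc s₀ t₀ r n e ^ 2 := by
      rw [← Real.rpow_natCast _ 2]
      refine Real.rpow_le_rpow_of_exponent_ge_of_imp h0 (hle e) (by exact_mod_cast hQ) ?_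
      intro _ h'
      linarith
    refine h2.trans ?_
    rw [logOsc, div_pow]
    gcongr
    exact sq_sum_geom_le _ n (div_nonneg (T.len_nonneg e) hr.le)
  refine (Finset.sum_le_sum fun e _ => h1 e).trans ?_
  rw [← Finset.sum_div, ← Finset.mul_sum, Finset.sum_comm]
  have h2 : ∀ k ∈ Finset.range n, ∑ e,
      (if T.Meets s₀ t₀ (r * 2 ^ (k + 1)) e then T.len e / r / 2 ^ k else 0) ^ 2 ≤ 64 := by
    intro k hk
    have h3 := T.sum_box_le s₀ t₀ (ρ := r * 2 ^ (k + 1)) (by positivity)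
      (Finset.univ.filter fun e => T.Meets s₀ t₀ (r * 2 ^ (k + 1)) e) (by
        intro e he
        have he' := (Finset.mem_filter.1 he).2
        obtain ⟨s, hs, τ, hτ, h⟩ := he'
        have h4 := (le_max_left _ _).trans h
        have h5 := (le_max_right _ _).trans h
        rw [abs_le] at h4
        have h6 := hmk k (Finset.mem_range.1 hk) e (Finset.mem_filter.1 he).2
        have h7 : (1 : ℝ) ≤ 2 ^ (k + 1) := one_le_pow₀ (by norm_num)
        exact ⟨by nlinarith, by linarith [hs.1], by linarith [hs.2], τ, hτ, h5⟩)
    have h4 : ∀ e, (if T.Meets s₀ t₀ (r * 2 ^ (k + 1)) e then T.len e / r / 2 ^ k else 0) ^ 2 =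
        (if T.Meets s₀ t₀ (r * 2 ^ (k + 1)) e then T.len e ^ 2 else 0) / (r * 2 ^ k) ^ 2 := by
      intro e
      split_ifs
      · rw [div_div, div_pow]
      · simp
    simp_rw [h4]
    rw [← Finset.sum_div, ← Finset.sum_filter, div_le_iff₀ (by positivity)]
    refine h3.trans (le_of_eq ?_)
    ring
  have h3 := Finset.sum_le_sum h2
  rw [Finset.sum_const, Finset.card_range, nsmul_eq_mul] at h3
  rw [div_le_div_iff₀ (by positivity) hn']
  nlinarith

end Tiling

namespace Tiling

variable {V E : Type} [Fintype V] [DecidableEq V] [Fintype E] (T : Tiling V E)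

lemma exists_join_live {s t t' : ℝ} {u u' : V} (htt : t ≤ t') (hu : T.Live t u) (hu' : T.Live t' u')
    (h1 : T.a u ≤ s) (h1' : T.a u' ≤ s) (h2 : s < T.a T.vy) :
    ∃ A, T.Conn A ∧ u ∈ A ∧ u' ∈ A ∧ ∀ w ∈ A,
      (∃ (τ : ℝ) (k : ℤ), T.Over w τ ∧ t ≤ τ - k ∧ τ - k ≤ t') ∧
      ((∃ e, (T.lo e = w ∨ T.hi e = w) ∧ T.Crosses s e) ∨
        (min (T.a u) (T.a u') ≤ T.a w ∧ T.a w ≤ s)) := by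
  obtain ⟨A, e, hA, huA, heA, hc, hm, hAw⟩ := T.exists_upChain hu h1 h2
  obtain ⟨A', e', hA', huA', heA', hc', hm', hAw'⟩ := T.exists_upChain hu' h1' h2
  obtain ⟨K, hk1, hk2, hk3, hk4, hKconn, hKw⟩ := T.cut s t t' e e' htt hc.1 hc.2 hc'.1 hc'.2
    (fun h => hm (by rw [mult, h, sub_self])) (fun h => hm' (by rw [mult, h, sub_self]))
  have hK : T.Conn K := T.conn_of_root (r := T.lo e) hKconn
  have live : ∀ w, T.Live t w → ∃ (τ : ℝ) (k : ℤ), T.Over w τ ∧ t ≤ τ - k ∧ τ - k ≤ t' := by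
    intro w hw
    obtain ⟨k, hk⟩ := hw.over
    exact ⟨_, k, hk, by simp, by simpa using htt⟩
  have live' : ∀ w, T.Live t' w → ∃ (τ : ℝ) (k : ℤ), T.Over w τ ∧ t ≤ τ - k ∧ τ - k ≤ t' := by
    intro w hw
    obtain ⟨k, hk⟩ := hw.over
    exact ⟨_, k, hk, by simpa using htt, by simp⟩
  refine ⟨A ∪ K ∪ A', T.conn_union (T.conn_union hA hK ⟨_, heA, hk1⟩) hA' ⟨_, .inr hk3, heA'⟩,
    .inl (.inl huA), .inr huA', ?_⟩
  rintro w ((hw | hw) | hw)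
  · obtain ⟨h3, h4, h5⟩ := hAw w hw
    exact ⟨live w h3, .inr ⟨(min_le_left _ _).trans h4, h5⟩⟩
  · obtain ⟨h3, h4⟩ := hKw w hw
    refine ⟨?_, .inl h3⟩
    rcases h4 with ⟨c, hc, h5, h6⟩ | h4 | h4 | h4 | h4
    · exact ⟨c, 0, .inl hc, by simpa using h5, by simpa using h6⟩
    · exact live w ⟨e, .inl h4, hm⟩
    · exact live w ⟨e, .inr h4, hm⟩
    · exact live' w ⟨e', .inl h4, hm'⟩
    · exact live' w ⟨e', .inr h4, hm'⟩
  · obtain ⟨h3, h4, h5⟩ := hAw' w hw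
    exact ⟨live' w h3, .inr ⟨(min_le_right _ _).trans h4, h5⟩⟩

/-- Two pieces in a small box can be joined inside a slightly larger box. -/
lemma exists_join (hconn : ∀ v w, Relation.ReflTransGen T.Adj v w) (hne : T.vx ≠ T.vy)
    {s₀ t₀ σ c c' : ℝ} (hσ : 0 < σ) {v v' : V} (hc : c ∈ T.Co v) (hc' : c' ∈ T.Co v')
    (h : boxDist s₀ t₀ (T.a v) c ≤ σ) (h' : boxDist s₀ t₀ (T.a v') c' ≤ σ)
    (hvy : s₀ + σ < T.a T.vy) (hmesh : ∀ e, T.Crosses (s₀ + σ) e → T.len e ≤ σ) :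
    ∃ A, T.Conn A ∧ v ∈ A ∧ v' ∈ A ∧ ∀ w ∈ A, ∃ τ, T.Over w τ ∧
      boxDist s₀ t₀ (T.a w) τ ≤ 2 * σ := by
  suffices H : ∀ (c c' : ℝ) (v v' : V), c ∈ T.Co v → c' ∈ T.Co v' → |T.a v - s₀| ≤ σ →
      |c - t₀| ≤ σ → |T.a v' - s₀| ≤ σ → |c' - t₀| ≤ σ →
      ∃ A, T.Conn A ∧ v ∈ A ∧ v' ∈ A ∧ ∀ w ∈ A, ∃ τ, T.Over w τ ∧
        boxDist s₀ t₀ (T.a w) τ ≤ 2 * σ by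
    have shift : ∀ {c : ℝ} {v : V}, c ∈ T.Co v → boxDist s₀ t₀ (T.a v) c ≤ σ →
        ∃ c₁ ∈ T.Co v, |T.a v - s₀| ≤ σ ∧ |c₁ - t₀| ≤ σ := by
      intro c v hc h
      obtain ⟨k, hk⟩ := exists_cd_eq (c - t₀)
      refine ⟨c + (-k : ℤ), T.add_int v c hc _, (le_max_left _ _).trans h, ?_⟩
      rw [show c + ((-k : ℤ) : ℝ) - t₀ = c - t₀ - k by push_cast; ring, ← hk]
      exact (le_max_right _ _).trans h
    obtain ⟨c₁, h1, h2, h3⟩ := shift hc h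
    obtain ⟨c₂, h4, h5, h6⟩ := shift hc' h'
    exact H c₁ c₂ v v' h1 h4 h2 h3 h5 h6
  clear h h' hc hc' c c' v v'
  intro c c' v v' hc hc' hs ht hs' ht'
  obtain ⟨A, u, t, hA, hvA, huA, hAw, htc, hu⟩ := T.exists_live hconn hne hc hσ
  obtain ⟨A', u', t', hA', hvA', huA', hAw', htc', hu'⟩ := T.exists_live hconn hne hc' hσ
  have hau := (hAw u huA).2
  have hau' := (hAw' u' huA').2
  rw [abs_le] at *
  suffices H : ∃ B, T.Conn B ∧ u ∈ B ∧ u' ∈ B ∧ ∀ w ∈ B, ∃ τ, T.Over w τ ∧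
      boxDist s₀ t₀ (T.a w) τ ≤ 2 * σ by
    obtain ⟨B, hB, hu1, hu2, hBw⟩ := H
    refine ⟨A ∪ B ∪ A', T.conn_union (T.conn_union hA hB ⟨_, huA, hu1⟩) hA' ⟨_, .inr hu2, huA'⟩,
      .inl (.inl hvA), .inr hvA', ?_⟩
    rintro w ((hw | hw) | hw)
    · obtain ⟨h1, h2⟩ := hAw w hw
      refine ⟨c, .inl h1, max_le ?_ ((cd_le_abs _).trans ?_)⟩ <;>
        rw [abs_le] <;> constructor <;> linarith
    · exact hBw w hw
    · obtain ⟨h1, h2⟩ := hAw' w hw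
      refine ⟨c', .inl h1, max_le ?_ ((cd_le_abs _).trans ?_)⟩ <;>
        rw [abs_le] <;> constructor <;> linarith
  have fin : ∀ (t t' : ℝ) (u u' w : V), s₀ - σ ≤ T.a u → s₀ - σ ≤ T.a u' →
      t₀ - 2 * σ ≤ t → t' ≤ t₀ + 2 * σ →
      (∃ (τ : ℝ) (k : ℤ), T.Over w τ ∧ t ≤ τ - k ∧ τ - k ≤ t') →
      ((∃ e, (T.lo e = w ∨ T.hi e = w) ∧ T.Crosses (s₀ + σ) e) ∨
        (min (T.a u) (T.a u') ≤ T.a w ∧ T.a w ≤ s₀ + σ)) →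
      ∃ τ, T.Over w τ ∧ boxDist s₀ t₀ (T.a w) τ ≤ 2 * σ := by
    intro t t' u u' w h1 h2 h3 h4 h5 h6
    obtain ⟨τ, k, h7, h8, h9⟩ := h5
    refine ⟨τ, h7, max_le ?_ ?_⟩
    · rcases h6 with ⟨e, he, hcr⟩ | ⟨h10, h11⟩
      · have h12 := hmesh e hcr
        have h13 := mem_level he
        have h14 : T.len e = T.a (T.hi e) - T.a (T.lo e) := rfl
        rw [abs_le]
        constructor <;> linarith [h13.1, h13.2, hcr.1, hcr.2]
      · have h12 := le_min h1 h2
        rw [abs_le]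
        constructor <;> linarith
    · rw [← cd_add_int _ (-k)]
      refine (cd_le_abs _).trans ?_
      push_cast
      rw [abs_le]
      constructor <;> linarith
  rcases le_total t t' with htt | htt
  · obtain ⟨B, hB, h1, h2, h3⟩ := T.exists_join_live (s := s₀ + σ) htt hu hu' (by linarith)
      (by linarith) hvy
    exact ⟨B, hB, h1, h2, fun w hw => fin t t' u u' w (by linarith) (by linarith) (by linarith)
      (by linarith) (h3 w hw).1 (h3 w hw).2⟩
  · obtain ⟨B, hB, h1, h2, h3⟩ := T.exists_join_live (s := s₀ + σ) htt hu' hu (by linarith)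
      (by linarith) hvy
    exact ⟨B, hB, h2, h1, fun w hw => fin t' t u' u w (by linarith) (by linarith) (by linarith)
      (by linarith) (h3 w hw).1 (h3 w hw).2⟩

end Tiling

section Box

variable {Z : Type} [MetricSpace Z] [MeasurableSpace Z] [BorelSpace Z] {μ : Measure Z}
  {Q C : ℝ} {Ψ : ℝ → ℝ}

lemma LoewnerSpace.exists_logCut (hZ : LoewnerSpace μ Q C Ψ) {K : ℝ} (hK : 1 ≤ K) (D : ℕ) :
    ∃ B : ℝ, 0 < B ∧ ∀ (x y : Z) (ε : ℝ) (d : Disc Z x y K D ε) (P R : Set d.V) (s₀ t₀ r : ℝ)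
      (n : ℕ), 0 < ε → 0 < r → 0 < n →
      (∀ v ∈ P, ∃ τ, d.T.Over v τ ∧ Tiling.boxDist s₀ t₀ (d.T.a v) τ ≤ r) →
      (∀ v ∈ R, ∃ τ, d.T.Over v τ ∧ r * 2 ^ n ≤ Tiling.boxDist s₀ t₀ (d.T.a v) τ) →
      (∀ e, d.T.Meets s₀ t₀ (r * 2 ^ n) e → d.T.len e ≤ r) →
      ∃ (ω : Z → ℝ) (g : Z → ℝ≥0∞), Measurable g ∧ CoarseAdm ω g ε (d.union P) (d.union R) ∧
        ∫⁻ z, g z ^ Q ∂μ ≤ ENNReal.ofReal (B / n) := by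
  obtain ⟨B, hB, key⟩ := hZ.exists_coarse hK D
  refine ⟨B * 256, by positivity, ?_⟩
  intro x y ε d P R s₀ t₀ r n hε hr hn hP hR hmesh
  obtain ⟨ω, g, hg, hadm, hen⟩ := key x y ε d _ _ hε (d.T.log_test s₀ t₀ hr n) (d.union P)
    (d.union R)
    (fun z hz => by
      obtain ⟨v, hv, hzv⟩ := d.mem_union.1 hz
      obtain ⟨τ, h1, h2⟩ := hP v hv
      exact ⟨v, τ, hzv, h1, Tiling.logCut_le_zero hr n h2⟩)
    (fun z hz => by
      obtain ⟨v, hv, hzv⟩ := d.mem_union.1 hz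
      obtain ⟨τ, h1, h2⟩ := hR v hv
      exact ⟨v, τ, hzv, h1, Tiling.one_le_logCut hr hn h2⟩)
  refine ⟨ω, g, hg, hadm, ?_⟩
  have h1 := hen Set.univ Finset.univ MeasurableSet.univ (fun _ _ _ _ _ _ => Finset.mem_univ _)
  rw [Measure.restrict_univ] at h1
  refine h1.trans (ENNReal.ofReal_le_ofReal ?_)
  rw [mul_div_assoc]
  exact mul_le_mul_of_nonneg_left (d.T.sum_logOsc_le hZ.two_le hr hn hmesh) hB.le

variable [PreconnectedSpace Z]

/-- A third point much closer than the second one in the cylinder would violate the lower energy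
bound. -/
lemma LoewnerSpace.exists_box (hZ : LoewnerSpace μ Q C Ψ) {K : ℝ} (hK : 1 ≤ K) (D : ℕ) {x y p : Z}
    (hb : Base x y p) {t : ℝ} (ht : 0 < t) :
    ∃ L : ℝ, 1 ≤ L ∧ ∀ A R₀ : ℝ, 0 < R₀ → ∃ ε₁ : ℝ, 0 < ε₁ ∧
      ∀ (ε : ℝ) (d : Disc Z x y K D ε), 0 < ε → ε ≤ ε₁ → ∀ v₀, p ∈ d.Y v₀ →
      ∀ (v₁ v₂ v₃ : d.V) (z₁ z₂ z₃ : Z) (c₁ c₂ c₃ : ℝ), z₁ ∈ d.Y v₁ → z₂ ∈ d.Y v₂ → z₃ ∈ d.Y v₃ →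
      c₁ ∈ d.T.Co v₁ → c₂ ∈ d.T.Co v₂ → c₃ ∈ d.T.Co v₃ → z₁ ≠ z₃ → dist z₁ z₂ ≤ t * dist z₁ z₃ →
      |d.T.a v₁ - d.T.a v₀| ≤ A → ∀ R, R₀ ≤ R → R ≤ 1 / 4 →
      Tiling.boxDist (d.T.a v₁) c₁ (d.T.a v₃) c₃ ≤ R / L →
      Tiling.boxDist (d.T.a v₁) c₁ (d.T.a v₂) c₂ < R := by
  have := hZ.compact
  have hxy := dist_pos.2 hb.xy
  set Δ := Metric.diam (Set.univ : Set Z) with hΔ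
  have hdiam : ∀ z z' : Z, dist z z' ≤ Δ := fun z z' =>
    Metric.dist_le_diam_of_mem isCompact_univ.isBounded (Set.mem_univ _) (Set.mem_univ _)
  have hΔ0 : 0 < Δ := hxy.trans_le (hdiam x y)
  set c := dist x y / Δ with hc
  have hc0 : 0 < c := by positivity
  have hc1 : c ≤ 1 := (div_le_one hΔ0).2 (hdiam x y)
  obtain ⟨b, hb0, low⟩ := hZ.energy_lower_rel (Θ := t / c) (by positivity)
  obtain ⟨B, hB, cut⟩ := hZ.exists_logCut hK D
  obtain ⟨n, hn⟩ := exists_nat_gt (B / b)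
  have hn0 : (0 : ℝ) < n := lt_trans (by positivity) hn
  have hn1 : 0 < n := by exact_mod_cast hn0
  refine ⟨2 ^ (n + 3), one_le_pow₀ (by norm_num), fun A R₀ hR₀ => ?_⟩
  obtain ⟨r₁, hr₁, pole⟩ := hZ.exists_pole hK D hb (A + 2)
  obtain ⟨ε₁, hε₁, mesh⟩ := hZ.exists_mesh hK D hb (A + 2) (m := R₀ / 2 ^ (n + 3)) (by positivity)
  refine ⟨min (min r₁ ε₁) (min Δ (dist x y / (4 * K))), by positivity, ?_⟩
  intro ε d hε hεl v₀ hpv v₁ v₂ v₃ z₁ z₂ z₃ c₁ c₂ c₃ hz₁ hz₂ hz₃ hc₁ hc₂ hc₃ h13 h12 hA R hR hR4 hu3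
  by_contra! hu2
  simp only [le_min_iff] at hεl
  obtain ⟨⟨hε1, hε2⟩, hε3, hε4⟩ := hεl
  rw [le_div_iff₀ (by positivity)] at hε4
  have hne : d.T.vx ≠ d.T.vy := d.vx_ne_vy (by nlinarith)
  have hR0 : 0 < R := hR₀.trans_le hR
  set σ := R / 2 ^ (n + 3) with hσ
  have hσ0 : 0 < σ := by positivity
  have hσn : 2 * σ * 2 ^ n = R / 4 := by
    rw [hσ, pow_add]
    field_simp
    norm_num
  have h2n : (1 : ℝ) ≤ 2 ^ n := one_le_pow₀ (by norm_num)
  have hσR : 2 * σ ≤ R / 4 := by nlinarith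
  have hR₀σ : R₀ / 2 ^ (n + 3) ≤ σ := by rw [hσ]; gcongr
  rw [abs_le] at hA
  have hvy := ((pole ε d hε hε1 v₀ hpv d.T.vy y d.y_mem).2 (by rw [dist_self]; exact hr₁.le))
  have hmesh : ∀ e, d.T.a (d.T.lo e) ≤ d.T.a v₁ + R / 4 → d.T.a v₁ - R / 4 ≤ d.T.a (d.T.hi e) →
      d.T.len e ≤ σ := fun e h1 h2 =>
    (mesh ε d hε hε2 v₀ hpv e (by linarith) (by linarith)).trans hR₀σ
  have hreach := d.reachable hε
  obtain ⟨P, hP, hP1, hP3, hPw⟩ := d.T.exists_join hreach hne (s₀ := d.T.a v₁) (t₀ := c₁) hσ0 hc₁ hc₃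
    (by
      rw [Tiling.boxDist, sub_self, sub_self]
      exact max_le (by simpa using hσ0.le) ((cd_le_abs 0).trans (by simpa using hσ0.le)))
    hu3 (by linarith) (fun e he => hmesh e (by linarith [he.1]) (by linarith [he.2]))
  obtain ⟨S, hS, hSx, hSy, hSw⟩ := d.T.exists_full_chain hne (c₁ + 1 / 2)
  have hSw' : ∀ v ∈ S, ∃ τ, d.T.Over v τ ∧
      2 * σ * 2 ^ n ≤ Tiling.boxDist (d.T.a v₁) c₁ (d.T.a v) τ := by
    intro v hv
    obtain ⟨k, hk⟩ := (hSw v hv).over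
    refine ⟨_, hk, le_trans ?_ (le_max_right _ _)⟩
    rw [show c₁ + 1 / 2 + (k : ℝ) - c₁ = 1 / 2 + k by ring, cd_add_int, cd_half]
    linarith
  obtain ⟨W, hW, hW2, hWx, hWw⟩ : ∃ W : Set d.V, d.T.Conn W ∧ v₂ ∈ W ∧ (d.T.vx ∈ W ∨ d.T.vy ∈ W) ∧
      ∀ v ∈ W, ∃ τ, d.T.Over v τ ∧
        2 * σ * 2 ^ n ≤ Tiling.boxDist (d.T.a v₁) c₁ (d.T.a v) τ := by
    rcases le_max_iff.1 hu2 with h | h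
    · rcases le_abs.1 h with h | h
      · obtain ⟨W, hW, h1, h2, h3⟩ := d.T.exists_conn_ge hreach v₂
        refine ⟨W, hW, h1, .inr h2, fun v hv => ⟨_, .inl (Tiling.corner_mem v),
          le_trans ?_ (le_max_left _ _)⟩⟩
        exact le_trans (by linarith [h3 v hv]) (le_abs_self _)
      · obtain ⟨W, hW, h1, h2, h3⟩ := d.T.exists_conn_le hreach v₂
        refine ⟨W, hW, h1, .inl h2, fun v hv => ⟨_, .inl (Tiling.corner_mem v),
          le_trans ?_ (le_max_left _ _)⟩⟩
        exact le_trans (by linarith [h3 v hv]) (neg_le_abs _)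
    · obtain ⟨G, u, t', hG, h1, h2, h3, h4, h5⟩ := d.T.exists_live hreach hne hc₂ (ρ := R / 4)
        (by linarith)
      obtain ⟨W, hW, h6, h7, -, h8⟩ := d.T.exists_chain h5
      refine ⟨G ∪ W, d.T.conn_union hG hW ⟨u, h2, h6⟩, .inl h1, .inl (.inr h7), ?_⟩
      rintro v (hv | hv)
      · exact ⟨c₂, .inl (h3 v hv).1, le_trans (by linarith) (le_max_right _ _)⟩
      · obtain ⟨k, hk⟩ := (h8 v hv).over
        refine ⟨_, hk, le_trans ?_ (le_max_right _ _)⟩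
        have h9 := abs_cd_sub_le (t' + k - c₁ + (-k : ℤ)) (c₂ - c₁)
        rw [cd_add_int] at h9
        have h10 : t' + (k : ℝ) - c₁ + ((-k : ℤ) : ℝ) - (c₂ - c₁) = t' - c₂ := by
          push_cast; ring
        rw [h10] at h9
        linarith [(abs_le.1 (h9.trans h4)).1]
  have hWS : d.T.Conn (W ∪ S) := d.T.conn_union hW hS (by
    rcases hWx with h | h
    · exact ⟨_, h, hSx⟩
    · exact ⟨_, h, hSy⟩)
  obtain ⟨ω, g, hg, hadm, hen⟩ := cut x y ε d P (W ∪ S) (d.T.a v₁) c₁ (2 * σ) n hε (by positivity) hn1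
    hPw (by
      rintro v (hv | hv)
      · exact hWw v hv
      · exact hSw' v hv)
    (by
      rintro e ⟨s, hs, τ, -, h⟩
      have h1 := (le_max_left _ _).trans h
      rw [hσn, abs_le] at h1
      exact (hmesh e (by linarith [hs.1]) (by linarith [hs.2])).trans (by linarith))
  have m1 : z₁ ∈ d.union P := d.mem_union.2 ⟨_, hP1, hz₁⟩
  have m3 : z₃ ∈ d.union P := d.mem_union.2 ⟨_, hP3, hz₃⟩
  have m2 : z₂ ∈ d.union (W ∪ S) := d.mem_union.2 ⟨_, .inl hW2, hz₂⟩
  have mx : x ∈ d.union (W ∪ S) := d.mem_union.2 ⟨_, .inr hSx, d.x_mem⟩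
  have my : y ∈ d.union (W ∪ S) := d.mem_union.2 ⟨_, .inr hSy, d.y_mem⟩
  have h13' := dist_pos.2 h13
  have hδ : c * dist z₁ z₃ ≤ dist x y := by
    rw [hc, div_mul_eq_mul_div, div_le_iff₀ hΔ0]
    exact mul_le_mul_of_nonneg_left (hdiam _ _) hxy.le
  have hlow := low ε (c * dist z₁ z₃) _ _ ω g z₁ z₂ hε hε3 (d.isCompact_union P)
    (d.isConnected_union hP ⟨_, hP1⟩) (d.isCompact_union _) (d.isConnected_union hWS ⟨_, .inl hW2⟩)
    (by positivity)
    (le_trans (by nlinarith) (Metric.dist_le_diam_of_mem (d.isCompact_union P).isBounded m1 m3))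
    (hδ.trans (Metric.dist_le_diam_of_mem (d.isCompact_union _).isBounded mx my)) m1 m2
    (by rw [← mul_assoc, div_mul_cancel₀ _ hc0.ne']; exact h12) hadm hg
  have h := hlow.trans hen
  rw [ENNReal.ofReal_le_ofReal_iff (by positivity), le_div_iff₀ hn0] at h
  rw [div_lt_iff₀ hb0] at hn
  linarith

/-- Pieces far up cannot be close together relative to pieces below the base height. -/
lemma LoewnerSpace.exists_gap_up (hZ : LoewnerSpace μ Q C Ψ) {K : ℝ} (hK : 1 ≤ K) (D : ℕ)
    {x y p : Z} (hb : Base x y p) {t : ℝ} (ht : 0 < t) :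
    ∃ G : ℝ, 0 < G ∧ ∀ (ε : ℝ) (d : Disc Z x y K D ε), 0 < ε →
      ε ≤ Metric.diam (Set.univ : Set Z) → ∀ v₀, p ∈ d.Y v₀ →
      ∀ (v₁ v₂ v₃ : d.V) (z₁ z₂ z₃ : Z) (α β : ℝ), z₁ ∈ d.Y v₁ → z₂ ∈ d.Y v₂ → z₃ ∈ d.Y v₃ →
      z₁ ≠ z₃ → dist z₁ z₂ ≤ t * dist z₁ z₃ → β ≤ d.T.a v₁ → β ≤ d.T.a v₃ → d.T.a v₂ ≤ α →
      d.T.a v₀ ≤ α → β - α ≤ G := by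
  have := hZ.compact
  have hxp := dist_pos.2 hb.xp
  set Δ := Metric.diam (Set.univ : Set Z) with hΔ
  have hdiam : ∀ z z' : Z, dist z z' ≤ Δ := fun z z' =>
    Metric.dist_le_diam_of_mem isCompact_univ.isBounded (Set.mem_univ _) (Set.mem_univ _)
  have hΔ0 : 0 < Δ := hxp.trans_le (hdiam x p)
  set c := dist x p / Δ with hc
  have hc0 : 0 < c := by positivity
  have hc1 : c ≤ 1 := (div_le_one hΔ0).2 (hdiam x p)
  obtain ⟨G, hG, key⟩ := hZ.gap_le_rel hK D (Θ := t / c) (by positivity)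
  refine ⟨G, hG, ?_⟩
  intro ε d hε hεΔ v₀ hpv v₁ v₂ v₃ z₁ z₂ z₃ α β hz₁ hz₂ hz₃ h13 h12 h1 h3 h2 h0
  have hreach := d.reachable hε
  obtain ⟨P₂, hP₂, h2P, hxP, hP₂a⟩ := d.T.exists_conn_le hreach v₂
  obtain ⟨P₀, hP₀, h0P, hxP', hP₀a⟩ := d.T.exists_conn_le hreach v₀
  obtain ⟨R₁, hR₁, h1R, hyR, hR₁a⟩ := d.T.exists_conn_ge hreach v₁
  obtain ⟨R₃, hR₃, h3R, hyR', hR₃a⟩ := d.T.exists_conn_ge hreach v₃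
  have h13' := dist_pos.2 h13
  have m1 : z₁ ∈ d.union (R₁ ∪ R₃) := d.mem_union.2 ⟨_, .inl h1R, hz₁⟩
  have m3 : z₃ ∈ d.union (R₁ ∪ R₃) := d.mem_union.2 ⟨_, .inr h3R, hz₃⟩
  have m2 : z₂ ∈ d.union (P₂ ∪ P₀) := d.mem_union.2 ⟨_, .inl h2P, hz₂⟩
  have mx : x ∈ d.union (P₂ ∪ P₀) := d.mem_union.2 ⟨_, .inl hxP, d.x_mem⟩
  have mp : p ∈ d.union (P₂ ∪ P₀) := d.mem_union.2 ⟨_, .inr h0P, hpv⟩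
  have hδ : c * dist z₁ z₃ ≤ dist x p := by
    rw [hc, div_mul_eq_mul_div, div_le_iff₀ hΔ0]
    exact mul_le_mul_of_nonneg_left (hdiam _ _) hxp.le
  refine key x y ε d hε hεΔ (P₂ ∪ P₀) (R₁ ∪ R₃) α β (c * dist z₁ z₃) z₂ z₁
    (d.T.conn_union hP₂ hP₀ ⟨_, hxP, hxP'⟩) (d.T.conn_union hR₁ hR₃ ⟨_, hyR, hyR'⟩) ?_ ?_
    (by positivity)
    (hδ.trans (Metric.dist_le_diam_of_mem (d.isCompact_union _).isBounded mx mp))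
    (le_trans (by nlinarith) (Metric.dist_le_diam_of_mem (d.isCompact_union _).isBounded m1 m3))
    m2 m1 ?_
  · rintro v (hv | hv)
    · exact (hP₂a v hv).trans h2
    · exact (hP₀a v hv).trans h0
  · rintro v (hv | hv)
    · exact h1.trans (hR₁a v hv)
    · exact h3.trans (hR₃a v hv)
  · rw [dist_comm, ← mul_assoc, div_mul_cancel₀ _ hc0.ne']
    exact h12

/-- Pieces far down cannot be close together relative to pieces above the base height. -/
lemma LoewnerSpace.exists_gap_down (hZ : LoewnerSpace μ Q C Ψ) {K : ℝ} (hK : 1 ≤ K) (D : ℕ)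
    {x y p : Z} (hb : Base x y p) {t : ℝ} (ht : 0 < t) :
    ∃ G : ℝ, 0 < G ∧ ∀ (ε : ℝ) (d : Disc Z x y K D ε), 0 < ε →
      ε ≤ Metric.diam (Set.univ : Set Z) → ∀ v₀, p ∈ d.Y v₀ →
      ∀ (v₁ v₂ v₃ : d.V) (z₁ z₂ z₃ : Z) (α β : ℝ), z₁ ∈ d.Y v₁ → z₂ ∈ d.Y v₂ → z₃ ∈ d.Y v₃ →
      z₁ ≠ z₃ → dist z₁ z₂ ≤ t * dist z₁ z₃ → d.T.a v₁ ≤ α → d.T.a v₃ ≤ α → β ≤ d.T.a v₂ →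
      β ≤ d.T.a v₀ → β - α ≤ G := by
  have := hZ.compact
  have hyp := dist_pos.2 hb.yp
  set Δ := Metric.diam (Set.univ : Set Z) with hΔ
  have hdiam : ∀ z z' : Z, dist z z' ≤ Δ := fun z z' =>
    Metric.dist_le_diam_of_mem isCompact_univ.isBounded (Set.mem_univ _) (Set.mem_univ _)
  have hΔ0 : 0 < Δ := hyp.trans_le (hdiam y p)
  set c := dist y p / Δ with hc
  have hc0 : 0 < c := by positivity
  have hc1 : c ≤ 1 := (div_le_one hΔ0).2 (hdiam y p)
  obtain ⟨G, hG, key⟩ := hZ.gap_le_rel hK D (Θ := t / c) (by positivity)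
  refine ⟨G, hG, ?_⟩
  intro ε d hε hεΔ v₀ hpv v₁ v₂ v₃ z₁ z₂ z₃ α β hz₁ hz₂ hz₃ h13 h12 h1 h3 h2 h0
  have hreach := d.reachable hε
  obtain ⟨P₂, hP₂, h2P, hyP, hP₂a⟩ := d.T.exists_conn_ge hreach v₂
  obtain ⟨P₀, hP₀, h0P, hyP', hP₀a⟩ := d.T.exists_conn_ge hreach v₀
  obtain ⟨R₁, hR₁, h1R, hxR, hR₁a⟩ := d.T.exists_conn_le hreach v₁
  obtain ⟨R₃, hR₃, h3R, hxR', hR₃a⟩ := d.T.exists_conn_le hreach v₃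
  have h13' := dist_pos.2 h13
  have m1 : z₁ ∈ d.union (R₁ ∪ R₃) := d.mem_union.2 ⟨_, .inl h1R, hz₁⟩
  have m3 : z₃ ∈ d.union (R₁ ∪ R₃) := d.mem_union.2 ⟨_, .inr h3R, hz₃⟩
  have m2 : z₂ ∈ d.union (P₂ ∪ P₀) := d.mem_union.2 ⟨_, .inl h2P, hz₂⟩
  have my : y ∈ d.union (P₂ ∪ P₀) := d.mem_union.2 ⟨_, .inl hyP, d.y_mem⟩
  have mp : p ∈ d.union (P₂ ∪ P₀) := d.mem_union.2 ⟨_, .inr h0P, hpv⟩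
  have hδ : c * dist z₁ z₃ ≤ dist y p := by
    rw [hc, div_mul_eq_mul_div, div_le_iff₀ hΔ0]
    exact mul_le_mul_of_nonneg_left (hdiam _ _) hyp.le
  refine key x y ε d hε hεΔ (R₁ ∪ R₃) (P₂ ∪ P₀) α β (c * dist z₁ z₃) z₁ z₂
    (d.T.conn_union hR₁ hR₃ ⟨_, hxR, hxR'⟩) (d.T.conn_union hP₂ hP₀ ⟨_, hyP, hyP'⟩) ?_ ?_
    (by positivity)
    (le_trans (by nlinarith) (Metric.dist_le_diam_of_mem (d.isCompact_union _).isBounded m1 m3))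
    (hδ.trans (Metric.dist_le_diam_of_mem (d.isCompact_union _).isBounded my mp))
    m1 m2 ?_
  · rintro v (hv | hv)
    · exact (hR₁a v hv).trans h1
    · exact (hR₃a v hv).trans h3
  · rintro v (hv | hv)
    · exact h2.trans (hP₂a v hv)
    · exact h0.trans (hP₀a v hv)
  · rw [← mul_assoc, div_mul_cancel₀ _ hc0.ne']
    exact h12

end Box

section SphereCoordinates

open Real

/-- The reciprocal of the hyperbolic cosine, the distance of the point at height `s` to the axis. -/
noncomputable def sechW (s : ℝ) : ℝ := (cosh (2 * π * s))⁻¹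

/-- The third coordinate of the point at height `s`. -/
noncomputable def tanhW (s : ℝ) : ℝ := sinh (2 * π * s) / cosh (2 * π * s)

/-- Mercator coordinates on the unit sphere. -/
noncomputable def sphM (s t : ℝ) : EuclideanSpace ℝ (Fin 3) :=
  !₂[sechW s * cos (2 * π * t), sechW s * sin (2 * π * t), tanhW s]

/-- The north pole. -/
noncomputable def sphN : EuclideanSpace ℝ (Fin 3) := !₂[0, 0, 1]

/-- The south pole. -/
noncomputable def sphS : EuclideanSpace ℝ (Fin 3) := !₂[0, 0, -1]

lemma sechW_pos (s : ℝ) : 0 < sechW s := inv_pos.2 (cosh_pos _)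

lemma sechW_le_one (s : ℝ) : sechW s ≤ 1 := inv_le_one_of_one_le₀ (one_le_cosh _)

lemma sechW_sq_add (s : ℝ) : sechW s ^ 2 + tanhW s ^ 2 = 1 := by
  have h := (cosh_pos (2 * π * s)).ne'
  have := cosh_sq (2 * π * s)
  unfold sechW tanhW
  field_simp
  linarith

lemma dist_sq_eq (v w : EuclideanSpace ℝ (Fin 3)) :
    dist v w ^ 2 = (v 0 - w 0) ^ 2 + (v 1 - w 1) ^ 2 + (v 2 - w 2) ^ 2 := by
  rw [EuclideanSpace.dist_eq, sq_sqrt (by positivity), Fin.sum_univ_three]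
  simp [Real.dist_eq, sq_abs]

lemma sphM_mem (s t : ℝ) : sphM s t ∈ Metric.sphere (0 : EuclideanSpace ℝ (Fin 3)) 1 := by
  rw [Metric.mem_sphere, ← sq_eq_sq₀ dist_nonneg zero_le_one, dist_sq_eq]
  have h1 := sechW_sq_add s
  have h2 := sin_sq_add_cos_sq (2 * π * t)
  simp [sphM]
  linear_combination h1 + sechW s ^ 2 * h2

lemma sphN_mem : sphN ∈ Metric.sphere (0 : EuclideanSpace ℝ (Fin 3)) 1 := by
  rw [Metric.mem_sphere, ← sq_eq_sq₀ dist_nonneg zero_le_one, dist_sq_eq]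
  simp [sphN]

lemma sphS_mem : sphS ∈ Metric.sphere (0 : EuclideanSpace ℝ (Fin 3)) 1 := by
  rw [Metric.mem_sphere, ← sq_eq_sq₀ dist_nonneg zero_le_one, dist_sq_eq]
  simp [sphS]

lemma dist_le_two {v w : EuclideanSpace ℝ (Fin 3)}
    (hv : v ∈ Metric.sphere (0 : EuclideanSpace ℝ (Fin 3)) 1)
    (hw : w ∈ Metric.sphere (0 : EuclideanSpace ℝ (Fin 3)) 1) : dist v w ≤ 2 := by
  have := dist_triangle_right v w 0
  rw [Metric.mem_sphere] at hv hw
  linarith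

lemma dist_sphM_sq' (s t s' t' : ℝ) : dist (sphM s t) (sphM s' t') ^ 2 =
    sechW s ^ 2 + sechW s' ^ 2 - 2 * sechW s * sechW s' * cos (2 * π * t - 2 * π * t') +
      (tanhW s - tanhW s') ^ 2 := by
  rw [dist_sq_eq, cos_sub]
  have h1 := sin_sq_add_cos_sq (2 * π * t)
  have h2 := sin_sq_add_cos_sq (2 * π * t')
  simp [sphM]
  linear_combination sechW s ^ 2 * h1 + sechW s' ^ 2 * h2

lemma dist_sphM_sq (s t s' t' : ℝ) : dist (sphM s t) (sphM s' t') ^ 2 =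
    4 * sechW s * sechW s' * (sinh (π * (s - s')) ^ 2 + sin (π * (t - t')) ^ 2) := by
  have h1 := sechW_sq_add s
  have h2 := sechW_sq_add s'
  have h3 : cosh (2 * π * s - 2 * π * s') = 1 + 2 * sinh (π * (s - s')) ^ 2 := by
    rw [show 2 * π * s - 2 * π * s' = 2 * (π * (s - s')) by ring, cosh_two_mul, cosh_sq]
    ring
  have h4 : cos (2 * π * t - 2 * π * t') = 1 - 2 * sin (π * (t - t')) ^ 2 := by
    rw [show 2 * π * t - 2 * π * t' = 2 * (π * (t - t')) by ring, cos_two_mul, cos_sq']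
    ring
  have h5 : sechW s * sechW s' * cosh (2 * π * s - 2 * π * s') = 1 - tanhW s * tanhW s' := by
    have h := (cosh_pos (2 * π * s)).ne'
    have h' := (cosh_pos (2 * π * s')).ne'
    rw [cosh_sub]
    unfold sechW tanhW
    field_simp
  rw [dist_sphM_sq', h4]
  rw [h3] at h5
  linear_combination h1 + h2 - 2 * h5

lemma abs_sechW_sub_le (s t s' t' : ℝ) :
    |sechW s - sechW s'| ≤ dist (sphM s t) (sphM s' t') := by
  refine abs_le_of_sq_le_sq' ?_ dist_nonneg |> abs_le.2
  rw [dist_sphM_sq']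
  have h1 := mul_pos (sechW_pos s) (sechW_pos s')
  nlinarith [cos_le_one (2 * π * t - 2 * π * t'), sq_nonneg (tanhW s - tanhW s')]

lemma one_sub_tanhW (s : ℝ) : (1 - tanhW s) * (1 + exp (4 * π * s)) = 2 := by
  have h := (cosh_pos (2 * π * s)).ne'
  have h1 : exp (4 * π * s) = exp (2 * π * s) * exp (2 * π * s) := by
    rw [← exp_add]; ring_nf
  have h2 := cosh_add_sinh (2 * π * s)
  have h3 := cosh_sub_sinh (2 * π * s)
  have h4 : exp (2 * π * s) * exp (-(2 * π * s)) = 1 := by rw [← exp_add]; simp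
  have h5 : 1 - tanhW s = exp (-(2 * π * s)) / cosh (2 * π * s) := by
    rw [← h3, tanhW]; field_simp
  rw [h5, h1, div_mul_eq_mul_div, div_eq_iff h]
  linear_combination exp (2 * π * s) * h4 - h2 - h3

lemma tanhW_neg (s : ℝ) : tanhW (-s) = -tanhW s := by
  rw [tanhW, tanhW, mul_neg, sinh_neg, cosh_neg, neg_div]

lemma dist_sphN_sq (s t : ℝ) : dist (sphM s t) sphN ^ 2 = 2 * (1 - tanhW s) := by
  rw [dist_sq_eq]
  have h1 := sin_sq_add_cos_sq (2 * π * t)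
  have h2 := sechW_sq_add s
  simp [sphM, sphN]
  linear_combination sechW s ^ 2 * h1 + h2

lemma dist_sphS_sq (s t : ℝ) : dist (sphM s t) sphS ^ 2 = 2 * (1 + tanhW s) := by
  rw [dist_sq_eq]
  have h1 := sin_sq_add_cos_sq (2 * π * t)
  have h2 := sechW_sq_add s
  simp [sphM, sphS]
  linear_combination sechW s ^ 2 * h1 + h2

lemma dist_sphN_mul (s t : ℝ) : dist (sphM s t) sphN ^ 2 * (1 + exp (4 * π * s)) = 4 := by
  rw [dist_sphN_sq]
  linear_combination 2 * one_sub_tanhW s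

lemma dist_sphS_mul (s t : ℝ) : dist (sphM s t) sphS ^ 2 * (1 + exp (4 * π * -s)) = 4 := by
  rw [dist_sphS_sq]
  have := one_sub_tanhW (-s)
  rw [tanhW_neg] at this
  linear_combination 2 * this

lemma two_cd_le_sin (t : ℝ) : (2 * cd t) ^ 2 ≤ sin (π * t) ^ 2 := by
  obtain ⟨k, hk⟩ := exists_cd_eq t
  have h1 : sin (π * t) ^ 2 = sin (π * |t - k|) ^ 2 := by
    have h2 : sin (π * t - k * π) ^ 2 = sin (π * t) ^ 2 := by
      rw [sin_sub_int_mul_pi, mul_pow, ← zpow_natCast, ← zpow_mul, mul_comm k,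
        zpow_mul]
      simp
    rw [← h2, show π * t - k * π = π * (t - k) by ring]
    rcases abs_cases (t - k) with h | h <;> rw [h.1]
    rw [mul_neg, sin_neg, neg_sq]
  rw [h1, ← hk]
  have h3 := cd_nonneg t
  have h4 := cd_le_half t
  have h5 := mul_le_sin (x := π * cd t) (by positivity) (by nlinarith [pi_pos])
  have h6 : 2 / π * (π * cd t) = 2 * cd t := by field_simp
  rw [h6] at h5
  exact pow_le_pow_left₀ (by positivity) h5 2

lemma sin_le_cd (t : ℝ) : sin (π * t) ^ 2 ≤ (π * cd t) ^ 2 := by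
  obtain ⟨k, hk⟩ := exists_cd_eq t
  have h2 : sin (π * t - k * π) ^ 2 = sin (π * t) ^ 2 := by
    rw [sin_sub_int_mul_pi, mul_pow, ← zpow_natCast, ← zpow_mul, mul_comm k, zpow_mul]
    simp
  rw [← h2, hk, mul_pow, sq_abs, ← mul_pow, show π * t - k * π = π * (t - k) by ring]
  exact sin_sq_le_sq

lemma boxDist_sq_le (s t s' t' : ℝ) : 4 * sechW s * sechW s' * Tiling.boxDist s t s' t' ^ 2 ≤
    dist (sphM s t) (sphM s' t') ^ 2 := by
  rw [dist_comm, dist_sphM_sq, mul_right_comm 4 (sechW s) (sechW s')]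
  refine mul_le_mul_of_nonneg_left ?_
    (mul_nonneg (mul_nonneg (by norm_num) (sechW_pos _).le) (sechW_pos _).le)
  have h1 : |s' - s| ^ 2 ≤ sinh (π * (s' - s)) ^ 2 := by
    rw [← sq_abs (sinh _), abs_sinh]
    refine pow_le_pow_left₀ (abs_nonneg _) ?_ 2
    refine le_trans ?_ (self_le_sinh_iff.2 (abs_nonneg _))
    rw [abs_mul, abs_of_pos pi_pos]
    nlinarith [abs_nonneg (s' - s), pi_gt_three]
  have h2 := two_cd_le_sin (t' - t)
  have h3 := cd_nonneg (t' - t)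
  unfold Tiling.boxDist
  rcases max_cases |s' - s| (cd (t' - t)) with h | h <;> rw [h.1] <;>
    nlinarith [sq_nonneg (sin (π * (t' - t))), sq_nonneg (sinh (π * (s' - s)))]

lemma sechW_le_of_abs_sub {s s' : ℝ} (h : |s' - s| ≤ 1 / 4) : sechW s' ≤ 8 * sechW s := by
  have h1 : cosh (2 * π * s) ≤ 8 * cosh (2 * π * s') := by
    have hpi := pi_lt_four
    have h0 : exp 2 ≤ 8 := by
      have := exp_one_lt_d9
      rw [show (2 : ℝ) = 1 + 1 by norm_num, exp_add]
      nlinarith [exp_pos 1]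
    have key : ∀ a b : ℝ, a - b ≤ 2 → exp a ≤ 8 * exp b := by
      intro a b hab
      have := exp_le_exp.2 hab
      rw [show a = (a - b) + b by ring, exp_add]
      nlinarith [exp_pos b]
    rw [abs_le] at h
    rw [cosh_eq, cosh_eq]
    have := key (2 * π * s) (2 * π * s')
      (by nlinarith [mul_nonneg pi_pos.le (sub_nonneg.2 h.1), mul_nonneg pi_pos.le (sub_nonneg.2 h.2)])
    have := key (-(2 * π * s)) (-(2 * π * s'))
      (by nlinarith [mul_nonneg pi_pos.le (sub_nonneg.2 h.1), mul_nonneg pi_pos.le (sub_nonneg.2 h.2)])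
    linarith
  unfold sechW
  rw [inv_le_iff_one_le_mul₀ (cosh_pos _), mul_right_comm, ← div_eq_mul_inv,
    one_le_div (cosh_pos _)]
  exact h1

lemma dist_le_boxDist {s t s' t' : ℝ} (h : |s' - s| ≤ 1 / 4) :
    dist (sphM s t) (sphM s' t') ≤ 40 * sechW s * Tiling.boxDist s t s' t' := by
  have hs := sechW_pos s
  have hu : 0 ≤ Tiling.boxDist s t s' t' := (abs_nonneg _).trans (le_max_left _ _)
  refine le_of_sq_le_sq ?_ (by positivity)
  rw [dist_comm, dist_sphM_sq]
  have h1 := sechW_le_of_abs_sub h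
  have hpi := pi_lt_d2
  have h2 : sinh (π * (s' - s)) ^ 2 ≤ (2 * (π * |s' - s|)) ^ 2 := by
    rw [← sq_abs (sinh _)]
    have h5 : |π * (s' - s)| = π * |s' - s| := by rw [abs_mul, abs_of_pos pi_pos]
    have h6 : |π * (s' - s)| ≤ 1 := by rw [h5]; nlinarith [abs_nonneg (s' - s)]
    have h3 := abs_exp_sub_one_le h6
    have h4 := abs_exp_sub_one_le (x := -(π * (s' - s))) (by rwa [abs_neg])
    rw [abs_neg] at h4
    rw [h5] at h3 h4
    refine pow_le_pow_left₀ (abs_nonneg _) ?_ 2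
    rw [sinh_eq]
    rw [abs_le] at h3 h4 ⊢
    constructor <;> linarith [h3.1, h3.2, h4.1, h4.2]
  have h3 := sin_le_cd (t' - t)
  have h4 : |s' - s| ≤ Tiling.boxDist s t s' t' := le_max_left _ _
  have h5 : cd (t' - t) ≤ Tiling.boxDist s t s' t' := le_max_right _ _
  have h6 := cd_nonneg (t' - t)
  have h7 : sinh (π * (s' - s)) ^ 2 + sin (π * (t' - t)) ^ 2 ≤
      50 * Tiling.boxDist s t s' t' ^ 2 := by
    have h8 := pow_le_pow_left₀ (abs_nonneg _) h4 2
    have h9 := pow_le_pow_left₀ h6 h5 2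
    have h10 : π ^ 2 ≤ 10 := by nlinarith [pi_pos]
    have h11 : π ^ 2 * |s' - s| ^ 2 ≤ 10 * Tiling.boxDist s t s' t' ^ 2 :=
      mul_le_mul h10 h8 (by positivity) (by norm_num)
    have h12 : π ^ 2 * cd (t' - t) ^ 2 ≤ 10 * Tiling.boxDist s t s' t' ^ 2 :=
      mul_le_mul h10 h9 (by positivity) (by norm_num)
    nlinarith
  calc 4 * sechW s' * sechW s * (sinh (π * (s' - s)) ^ 2 + sin (π * (t' - t)) ^ 2)
      ≤ 4 * (8 * sechW s) * sechW s * (50 * Tiling.boxDist s t s' t' ^ 2) := by gcongr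
    _ = (40 * sechW s * Tiling.boxDist s t s' t') ^ 2 := by ring

lemma abs_le_inv_sechW (s : ℝ) : |s| ≤ (sechW s)⁻¹ := by
  rw [sechW, inv_inv, ← cosh_abs, abs_mul, abs_of_pos (by positivity : 0 < 2 * π), cosh_eq]
  have h2 := add_one_le_exp (2 * π * |s|)
  have h5 := exp_pos (-(2 * π * |s|))
  have h6 : 3 * |s| ≤ π * |s| := mul_le_mul_of_nonneg_right pi_gt_three.le (abs_nonneg s)
  linarith [abs_nonneg s]

lemma height_gap {κ G D n₁ n₂ s₁ s₂ : ℝ} (hκ : κ ^ 2 * (25 * exp (4 * π * G)) ≤ 1) (hG : 0 < G)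
    (hD : 0 < D) (hD2 : D ≤ 2) (h1 : n₁ ^ 2 * (1 + exp (4 * π * s₁)) = 4)
    (h2 : n₂ ^ 2 * (1 + exp (4 * π * s₂)) = 4) (h0 : 0 ≤ n₁) (hn1 : n₁ ≤ 2 * κ * D)
    (hn2 : D / 2 ≤ n₂) : s₂ + G < s₁ ∧ G < s₁ := by
  have hpi := pi_pos
  have e1 := exp_pos (4 * π * s₁)
  have e2 := exp_pos (4 * π * s₂)
  have hX : 1 ≤ exp (4 * π * G) := one_le_exp (by positivity)
  have h3 : n₁ ^ 2 ≤ (2 * κ * D) ^ 2 := pow_le_pow_left₀ h0 hn1 2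
  have h4 : (D / 2) ^ 2 ≤ n₂ ^ 2 := pow_le_pow_left₀ (by positivity) hn2 2
  have h5 : 1 ≤ κ ^ 2 * D ^ 2 * (1 + exp (4 * π * s₁)) := by nlinarith
  have h6 : D ^ 2 * (1 + exp (4 * π * s₂)) ≤ 16 := by nlinarith
  constructor
  · by_contra! h
    have h7 : exp (4 * π * s₁) ≤ exp (4 * π * G) * exp (4 * π * s₂) := by
      rw [← exp_add]
      exact exp_le_exp.2 (by nlinarith)
    have h8 : 1 + exp (4 * π * s₁) ≤ exp (4 * π * G) * (1 + exp (4 * π * s₂)) := by linarith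
    have h9 : κ ^ 2 * D ^ 2 * (1 + exp (4 * π * s₁)) ≤
        κ ^ 2 * D ^ 2 * (exp (4 * π * G) * (1 + exp (4 * π * s₂))) := by gcongr
    have h10 : κ ^ 2 * exp (4 * π * G) * (D ^ 2 * (1 + exp (4 * π * s₂))) ≤
        κ ^ 2 * exp (4 * π * G) * 16 := by gcongr
    nlinarith
  · by_contra! h
    have h7 : exp (4 * π * s₁) ≤ exp (4 * π * G) := exp_le_exp.2 (by nlinarith)
    have h8 : D ^ 2 ≤ 4 := by nlinarith
    have h9 : κ ^ 2 * D ^ 2 * (1 + exp (4 * π * s₁)) ≤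
        κ ^ 2 * 4 * (2 * exp (4 * π * G)) := by gcongr; linarith
    nlinarith

set_option maxHeartbeats 1000000 in
/-- The possible positions of three points on the sphere, one of them much closer to the first
than the other. -/
lemma sphere_trichotomy {G L : ℝ} (hG : 0 < G) (hL : 1 ≤ L) :
    ∃ H : ℝ, 1 ≤ H ∧ ∀ lam : ℝ, 0 < lam → ∃ A R₀ : ℝ, 0 < R₀ ∧ ∀ s₁ t₁ s₂ t₂ s₃ t₃ : ℝ,
      lam ≤ dist (sphM s₁ t₁) (sphM s₂ t₂) →
      H * dist (sphM s₁ t₁) (sphM s₃ t₃) < dist (sphM s₁ t₁) (sphM s₂ t₂) →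
      (max s₂ 0 + G < s₁ ∧ max s₂ 0 + G < s₃) ∨ (s₁ + G < min s₂ 0 ∧ s₃ + G < min s₂ 0) ∨
      (|s₁| ≤ A ∧ ∃ R, R₀ ≤ R ∧ R ≤ 1 / 4 ∧ Tiling.boxDist s₁ t₁ s₃ t₃ ≤ R / L ∧
        R ≤ Tiling.boxDist s₁ t₁ s₂ t₂) := by
  set κ : ℝ := exp (-(2 * π * G)) / 5 with hκ
  have hκ0 : 0 < κ := by positivity
  have hκ1 : κ ≤ 1 / 5 := by
    have : exp (-(2 * π * G)) ≤ 1 := exp_le_one_iff.2 (by nlinarith [mul_pos pi_pos hG])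
    rw [hκ]; linarith
  have hκG : κ ^ 2 * (25 * exp (4 * π * G)) ≤ 1 := by
    have : exp (-(2 * π * G)) ^ 2 * exp (4 * π * G) = 1 := by
      rw [sq, ← exp_add, ← exp_add, exp_eq_one_iff]
      ring
    rw [hκ]
    linarith
  set H := 40 * L / κ with hH
  have hHκ : H * κ = 40 * L := by rw [hH]; field_simp
  have hH1 : 40 * L ≤ H := by
    rw [hH, le_div_iff₀ hκ0]
    nlinarith
  have hH0 : 0 < H := by linarith
  refine ⟨H, by linarith, fun lam hlam => ⟨2 / (κ * lam), min (1 / 4) (lam / 40), by positivity, ?_⟩⟩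
  intro s₁ t₁ s₂ t₂ s₃ t₃ hD hD3
  set D := dist (sphM s₁ t₁) (sphM s₂ t₂) with hDdef
  set D3 := dist (sphM s₁ t₁) (sphM s₃ t₃) with hD3def
  have hD0 : 0 < D := by linarith
  have hD2 : D ≤ 2 := dist_le_two (sphM_mem _ _) (sphM_mem _ _)
  have hD30 : 0 ≤ D3 := dist_nonneg
  have hD3κ : D3 ≤ κ * D := by
    have : κ * (H * D3) ≤ κ * D := by gcongr
    have : κ * (H * D3) = 40 * L * D3 := by rw [← mul_assoc, mul_comm κ, hHκ]
    nlinarith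
  have near : ∀ q : EuclideanSpace ℝ (Fin 3), dist (sphM s₁ t₁) q < κ * D →
      dist (sphM s₁ t₁) q ≤ 2 * κ * D ∧ dist (sphM s₃ t₃) q ≤ 2 * κ * D ∧
        D / 2 ≤ dist (sphM s₂ t₂) q := by
    intro q hq
    have h1 := dist_triangle_left (sphM s₃ t₃) q (sphM s₁ t₁)
    have h2 := dist_triangle_right (sphM s₁ t₁) (sphM s₂ t₂) q
    have h3 : κ * D ≤ 1 / 5 * D := by gcongr
    have h4 : 0 ≤ κ * D := by positivity
    refine ⟨?_, ?_, ?_⟩ <;> linarith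
  rcases lt_or_ge (dist (sphM s₁ t₁) sphN) (κ * D) with hN | hN
  · obtain ⟨h1, h3, h2⟩ := near _ hN
    obtain ⟨a1, a2⟩ := height_gap hκG hG hD0 hD2 (dist_sphN_mul s₁ t₁) (dist_sphN_mul s₂ t₂)
      dist_nonneg h1 h2
    obtain ⟨a3, a4⟩ := height_gap hκG hG hD0 hD2 (dist_sphN_mul s₃ t₃) (dist_sphN_mul s₂ t₂)
      dist_nonneg h3 h2
    left
    rcases max_cases s₂ 0 with h | h <;> constructor <;> linarith
  rcases lt_or_ge (dist (sphM s₁ t₁) sphS) (κ * D) with hS | hS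
  · obtain ⟨h1, h3, h2⟩ := near _ hS
    obtain ⟨a1, a2⟩ := height_gap hκG hG hD0 hD2 (dist_sphS_mul s₁ t₁) (dist_sphS_mul s₂ t₂)
      dist_nonneg h1 h2
    obtain ⟨a3, a4⟩ := height_gap hκG hG hD0 hD2 (dist_sphS_mul s₃ t₃) (dist_sphS_mul s₂ t₂)
      dist_nonneg h3 h2
    right; left
    exact ⟨lt_min (by linarith) (by linarith), lt_min (by linarith) (by linarith)⟩
  right; right
  have hs1 := sechW_pos s₁
  have hsech : κ * D / 2 ≤ sechW s₁ := by
    have h1 := dist_sphN_sq s₁ t₁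
    have h2 := dist_sphS_sq s₁ t₁
    have h3 := sechW_sq_add s₁
    have h0 : 0 < κ * D := by positivity
    have h4 := pow_le_pow_left₀ h0.le hN 2
    have h5 := pow_le_pow_left₀ h0.le hS 2
    refine le_of_sq_le_sq ?_ hs1.le
    rw [h1] at h4
    rw [h2] at h5
    have h6 : sechW s₁ ^ 2 = (1 - tanhW s₁) * (1 + tanhW s₁) := by linear_combination h3
    rw [h6]
    rcases le_total 0 (tanhW s₁) with h | h <;> nlinarith
  have hD3s : D3 * L ≤ sechW s₁ / 16 := by
    have h1 : κ * (H * D3) ≤ κ * D := by gcongr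
    have h2 : κ * (H * D3) = 40 * L * D3 := by rw [← mul_assoc, mul_comm κ, hHκ]
    linarith
  have hs3 : sechW s₁ / 2 ≤ sechW s₃ := by
    have h1 := abs_sechW_sub_le s₁ t₁ s₃ t₃
    have h2 := le_abs_self (sechW s₁ - sechW s₃)
    have : D3 ≤ D3 * L := le_mul_of_one_le_right hD30 hL
    linarith
  have hu3 : sechW s₁ * Tiling.boxDist s₁ t₁ s₃ t₃ ≤ D3 := by
    refine le_of_sq_le_sq ?_ hD30
    refine le_trans ?_ (boxDist_sq_le s₁ t₁ s₃ t₃)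
    rw [mul_pow]
    refine mul_le_mul_of_nonneg_right ?_ (sq_nonneg _)
    nlinarith
  refine ⟨?_, min (1 / 4) (D / (40 * sechW s₁)), ?_, min_le_left _ _, ?_, ?_⟩
  · have h1 : (sechW s₁)⁻¹ ≤ 2 / (κ * lam) := by
      rw [inv_le_comm₀ hs1 (by positivity), inv_div]
      refine le_trans ?_ hsech
      gcongr
    refine le_trans ?_ h1
    exact abs_le_inv_sechW s₁
  · refine min_le_min le_rfl ?_
    rw [div_le_div_iff₀ (by norm_num) (by positivity)]
    have := sechW_le_one s₁
    nlinarith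
  · rw [le_div_iff₀ (by linarith), le_min_iff]
    constructor
    · by_contra! h
      have : sechW s₁ * (1 / 4) < sechW s₁ * (Tiling.boxDist s₁ t₁ s₃ t₃ * L) := by gcongr
      nlinarith
    · rw [le_div_iff₀ (by positivity)]
      have h1 : 40 * L * D3 ≤ H * D3 := by gcongr
      have h2 : 40 * L * (sechW s₁ * Tiling.boxDist s₁ t₁ s₃ t₃) ≤ 40 * L * D3 := by gcongr
      nlinarith
  · by_contra! h
    rw [lt_min_iff] at h
    have h2 := (lt_div_iff₀ (by positivity)).1 h.2
    have h1 := dist_le_boxDist (s := s₁) (t := t₁) (s' := s₂) (t' := t₂)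
      ((le_max_left _ _).trans h.1.le)
    linarith

end SphereCoordinates

section SphereDense

open Real

lemma exists_dist_sphN_le {δ : ℝ} (hδ : 0 < δ) : ∃ s : ℝ, dist (sphM s 0) sphN ≤ δ := by
  refine ⟨4 / δ ^ 2 / (4 * π), ?_⟩
  have h := dist_sphN_mul (4 / δ ^ 2 / (4 * π)) 0
  rw [mul_div_cancel₀ _ (by positivity : 4 * π ≠ 0)] at h
  have h1 := add_one_le_exp (4 / δ ^ 2)
  refine abs_le_of_sq_le_sq' ?_ hδ.le |>.2
  have h2 : dist (sphM (4 / δ ^ 2 / (4 * π)) 0) sphN ^ 2 * (4 / δ ^ 2) ≤ 4 :=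
    (mul_le_mul_of_nonneg_left (by linarith) (sq_nonneg _)).trans h.le
  rw [mul_div_assoc', div_le_iff₀ (by positivity)] at h2
  linarith

lemma exists_dist_sphS_le {δ : ℝ} (hδ : 0 < δ) : ∃ s : ℝ, dist (sphM s 0) sphS ≤ δ := by
  obtain ⟨s, hs⟩ := exists_dist_sphN_le hδ
  refine ⟨-s, ?_⟩
  rwa [← sq_le_sq₀ dist_nonneg hδ.le, dist_sphS_sq, tanhW_neg, ← sub_eq_add_neg, ← dist_sphN_sq s 0,
    sq_le_sq₀ dist_nonneg hδ.le]

lemma exists_sphM_eq {q : EuclideanSpace ℝ (Fin 3)} (hq : q ∈ Metric.sphere 0 1) (hN : q ≠ sphN)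
    (hS : q ≠ sphS) : ∃ s t : ℝ, sphM s t = q := by
  rw [Metric.mem_sphere, ← sq_eq_sq₀ dist_nonneg zero_le_one, dist_sq_eq] at hq
  simp only [PiLp.zero_apply, sub_zero, one_pow] at hq
  have hc : q 2 ^ 2 < 1 := by
    refine lt_of_le_of_ne (by nlinarith [sq_nonneg (q 0), sq_nonneg (q 1)]) fun h => ?_
    have h0 : q 0 = 0 := by nlinarith [sq_nonneg (q 0), sq_nonneg (q 1)]
    have h1 : q 1 = 0 := by nlinarith [sq_nonneg (q 0), sq_nonneg (q 1)]
    rcases sq_eq_sq_iff_eq_or_eq_neg.1 (h.trans (one_pow 2).symm) with h2 | h2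
    · exact hN (by ext i; fin_cases i <;> simp [sphN, h0, h1, h2])
    · exact hS (by ext i; fin_cases i <;> simp [sphS, h0, h1, h2])
  obtain ⟨hc1, hc2⟩ := abs_lt.1 ((sq_lt_one_iff_abs_lt_one _).1 hc)
  have hpos : 0 < (1 + q 2) / (1 - q 2) := div_pos (by linarith) (by linarith)
  set s := log ((1 + q 2) / (1 - q 2)) / (4 * π) with hs
  have hT : tanhW s = q 2 := by
    have h := one_sub_tanhW s
    rw [hs, mul_div_cancel₀ _ (by positivity : 4 * π ≠ 0), exp_log hpos, ← hs] at h
    have h1 : 1 - q 2 ≠ 0 := by linarith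
    field_simp at h
    linarith
  have hw := sechW_sq_add s
  rw [hT] at hw
  set ζ : ℂ := ⟨q 0, q 1⟩ with hζ
  have hn : ‖ζ‖ = sechW s := by
    rw [Complex.norm_def, Complex.normSq_apply, ← sqrt_sq (sechW_pos s).le]
    congr 1
    simp only [hζ]
    linarith
  refine ⟨s, Complex.arg ζ / (2 * π), ?_⟩
  have e3 := Complex.norm_mul_cos_arg ζ
  have e4 := Complex.norm_mul_sin_arg ζ
  rw [sphM, mul_div_cancel₀ _ (by positivity : 2 * π ≠ 0), hT, ← hn, e3, e4]
  ext i
  fin_cases i <;> simp [hζ]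

/-- Mercator coordinates cover a dense subset of the sphere. -/
lemma exists_dist_sphM_le {q : EuclideanSpace ℝ (Fin 3)} (hq : q ∈ Metric.sphere 0 1) {δ : ℝ}
    (hδ : 0 < δ) : ∃ s t : ℝ, dist (sphM s t) q ≤ δ := by
  by_cases hN : q = sphN
  · exact (exists_dist_sphN_le hδ).imp fun s hs => ⟨0, hN ▸ hs⟩
  by_cases hS : q = sphS
  · exact (exists_dist_sphS_le hδ).imp fun s hs => ⟨0, hS ▸ hs⟩
  obtain ⟨s, t, h⟩ := exists_sphM_eq hq hN hS
  exact ⟨s, t, by simp [h, hδ.le]⟩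

end SphereDense

section Marks

variable {Z : Type} [MetricSpace Z] [MeasurableSpace Z] [BorelSpace Z] {μ : Measure Z}
  {Q C : ℝ} {Ψ : ℝ → ℝ} [PreconnectedSpace Z]

/-- The relation between points of the space and of the sphere given by a discretisation whose
level zero is that of the piece `v₀`. -/
def Disc.Mark {x y : Z} {K : ℝ} {D : ℕ} {ε : ℝ} (d : Disc Z x y K D ε) (v₀ : d.V) (z : Z)
    (q : EuclideanSpace ℝ (Fin 3)) : Prop :=
  ∃ v c, z ∈ d.Y v ∧ c ∈ d.T.Co v ∧ sphM (d.T.a v - d.T.a v₀) c = q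

lemma Disc.exists_mark {x y : Z} {K : ℝ} {D : ℕ} {ε : ℝ} (d : Disc Z x y K D ε) (v₀ : d.V) (z : Z) :
    ∃ q, d.Mark v₀ z q := by
  obtain ⟨v, hv⟩ := d.cover z
  obtain ⟨c, hc⟩ := d.T.nonempty v
  exact ⟨_, v, c, hv, hc, rfl⟩

lemma Disc.Mark.mem {x y : Z} {K : ℝ} {D : ℕ} {ε : ℝ} {d : Disc Z x y K D ε} {v₀ : d.V} {z : Z}
    {q : EuclideanSpace ℝ (Fin 3)} (h : d.Mark v₀ z q) : q ∈ Metric.sphere 0 1 := by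
  obtain ⟨v, c, -, -, rfl⟩ := h
  exact sphM_mem _ _

/-- Discretisations satisfy a weak quasisymmetry condition at a fixed scale of the image. -/
lemma LoewnerSpace.exists_wqs (hZ : LoewnerSpace μ Q C Ψ) {K : ℝ} (hK : 1 ≤ K) (D : ℕ)
    {x y p : Z} (hb : Base x y p) {t : ℝ} (ht : 0 < t) :
    ∃ H : ℝ, 1 ≤ H ∧ ∀ lam : ℝ, 0 < lam → ∃ ε₁ : ℝ, 0 < ε₁ ∧
      ∀ (ε : ℝ) (d : Disc Z x y K D ε), 0 < ε → ε ≤ ε₁ → ∀ v₀, p ∈ d.Y v₀ →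
      ∀ z₁ z₂ z₃ q₁ q₂ q₃, d.Mark v₀ z₁ q₁ → d.Mark v₀ z₂ q₂ → d.Mark v₀ z₃ q₃ → z₁ ≠ z₃ →
      dist z₁ z₂ ≤ t * dist z₁ z₃ → lam ≤ dist q₁ q₂ → dist q₁ q₂ ≤ H * dist q₁ q₃ := by
  have := hZ.compact
  have hΔ : 0 < Metric.diam (Set.univ : Set Z) := (dist_pos.2 hb.xy).trans_le
    (Metric.dist_le_diam_of_mem isCompact_univ.isBounded (Set.mem_univ _) (Set.mem_univ _))
  obtain ⟨G₁, hG₁, up⟩ := hZ.exists_gap_up hK D hb ht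
  obtain ⟨G₂, hG₂, down⟩ := hZ.exists_gap_down hK D hb ht
  obtain ⟨L, hL, box⟩ := hZ.exists_box hK D hb ht
  obtain ⟨H, hH, tri⟩ := sphere_trichotomy (G := max G₁ G₂) (lt_max_of_lt_left hG₁) hL
  refine ⟨H, hH, fun lam hlam => ?_⟩
  obtain ⟨A, R₀, hR₀, tri⟩ := tri lam hlam
  obtain ⟨ε₁, hε₁, box⟩ := box A R₀ hR₀
  refine ⟨min ε₁ (Metric.diam (Set.univ : Set Z)), by positivity, ?_⟩
  rintro ε d hε hεle v₀ hp z₁ z₂ z₃ _ _ _ ⟨v₁, c₁, hz₁, hc₁, rfl⟩ ⟨v₂, c₂, hz₂, hc₂, rfl⟩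
    ⟨v₃, c₃, hz₃, hc₃, rfl⟩ hne hd hlam
  have hεΔ := hεle.trans (min_le_right _ _)
  by_contra! hcon
  rcases tri _ _ _ _ _ _ hlam hcon with ⟨h1, h3⟩ | ⟨h1, h3⟩ | ⟨hA, R, hR, hR', hb3, hb2⟩
  · have h := up ε d hε hεΔ v₀ hp v₁ v₂ v₃ z₁ z₂ z₃
      (d.T.a v₀ + max (d.T.a v₂ - d.T.a v₀) 0) (min (d.T.a v₁) (d.T.a v₃)) hz₁ hz₂ hz₃ hne hd
      (min_le_left _ _) (min_le_right _ _) (by linarith [le_max_left (d.T.a v₂ - d.T.a v₀) 0])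
      (by linarith [le_max_right (d.T.a v₂ - d.T.a v₀) 0])
    have := le_max_left G₁ G₂
    rcases min_cases (d.T.a v₁) (d.T.a v₃) with h' | h' <;> rw [h'.1] at h <;> linarith
  · have h := down ε d hε hεΔ v₀ hp v₁ v₂ v₃ z₁ z₂ z₃ (max (d.T.a v₁) (d.T.a v₃))
      (d.T.a v₀ + min (d.T.a v₂ - d.T.a v₀) 0) hz₁ hz₂ hz₃ hne hd
      (le_max_left _ _) (le_max_right _ _) (by linarith [min_le_left (d.T.a v₂ - d.T.a v₀) 0])
      (by linarith [min_le_right (d.T.a v₂ - d.T.a v₀) 0])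
    have := le_max_right G₁ G₂
    rcases max_cases (d.T.a v₁) (d.T.a v₃) with h' | h' <;> rw [h'.1] at h <;> linarith
  · unfold Tiling.boxDist at hb2 hb3
    rw [sub_sub_sub_cancel_right] at hb2 hb3
    exact (box ε d hε (hεle.trans (min_le_left _ _)) v₀ hp v₁ v₂ v₃ z₁ z₂ z₃ c₁ c₂ c₃ hz₁ hz₂ hz₃
      hc₁ hc₂ hc₃ hne hd hA R hR hR' hb3).not_ge hb2

/-- The marks of a fine discretisation are dense. -/
lemma LoewnerSpace.exists_mark_near (hZ : LoewnerSpace μ Q C Ψ) {K : ℝ} (hK : 1 ≤ K) (D : ℕ)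
    {x y p : Z} (hb : Base x y p) {q : EuclideanSpace ℝ (Fin 3)} (hq : q ∈ Metric.sphere 0 1)
    {δ : ℝ} (hδ : 0 < δ) :
    ∃ ε₁ : ℝ, 0 < ε₁ ∧ ∀ (ε : ℝ) (d : Disc Z x y K D ε), 0 < ε → ε ≤ ε₁ → ∀ v₀, p ∈ d.Y v₀ →
      ∃ z q', d.Mark v₀ z q' ∧ dist q q' ≤ δ := by
  obtain ⟨s, t, hst⟩ := exists_dist_sphM_le hq (half_pos hδ)
  obtain ⟨r, hr, pole⟩ := hZ.exists_pole hK D hb (|s| + 1)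
  obtain ⟨ε₁, hε₁, mesh⟩ := hZ.exists_mesh hK D hb |s| (m := min (1 / 4) (δ / 80)) (by positivity)
  refine ⟨min r ε₁, by positivity, fun ε d hε hεle v₀ hp => ?_⟩
  have hx := (pole ε d hε (hεle.trans (min_le_left _ _)) v₀ hp _ x d.x_mem).1 (by simpa using hr.le)
  have hy := (pole ε d hε (hεle.trans (min_le_left _ _)) v₀ hp _ y d.y_mem).2 (by simpa using hr.le)
  have hs1 := neg_abs_le s
  have hs2 := le_abs_self s
  obtain ⟨e, ⟨h1, h2⟩, hm⟩ := d.T.exists_crosses (s := d.T.a v₀ + s) (by linarith) (by linarith) t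
  have hlen := mesh ε d hε (hεle.trans (min_le_right _ _)) v₀ hp e (by linarith) (by linarith)
  obtain ⟨k, hk1, hk2⟩ := d.T.mult_ne_zero_iff.1 hm
  obtain ⟨z, hz⟩ := (d.connected (d.T.lo e)).nonempty
  refine ⟨z, _, ⟨d.T.lo e, d.T.th1 e, hz, d.T.mem_th1 e _ (.inl rfl), rfl⟩, ?_⟩
  have hth := d.T.th2_eq e
  have hbox : Tiling.boxDist s t (d.T.a (d.T.lo e) - d.T.a v₀) (d.T.th1 e) ≤ d.T.len e := by
    refine max_le ?_ ?_
    · unfold Tiling.len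
      rw [abs_le]
      constructor <;> linarith
    · have h3 := cd_le_abs (d.T.th1 e - t - k)
      have h4 := cd_add_int (d.T.th1 e - t - k) k
      rw [sub_add_cancel] at h4
      rw [h4]
      refine h3.trans ?_
      rw [abs_le]
      constructor <;> linarith
  have hl1 := hbox.trans (hlen.trans (min_le_left _ _))
  have h5 := dist_le_boxDist (t := t) (t' := d.T.th1 e) ((le_max_left _ _).trans hl1)
  have h6 : 40 * sechW s * Tiling.boxDist s t (d.T.a (d.T.lo e) - d.T.a v₀) (d.T.th1 e) ≤
      40 * 1 * (δ / 80) := by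
    refine mul_le_mul ?_ (hbox.trans (hlen.trans (min_le_right _ _)))
      ((abs_nonneg _).trans (le_max_left _ _)) (by norm_num)
    linarith [sechW_le_one s]
  have h7 := dist_triangle_left q (sphM (d.T.a (d.T.lo e) - d.T.a v₀) (d.T.th1 e)) (sphM s t)
  linarith

end Marks

lemma exists_dist_eq_of_le {Z : Type} [MetricSpace Z] [PreconnectedSpace Z] (z w : Z) {r : ℝ}
    (h0 : 0 ≤ r) (h1 : r ≤ dist z w) : ∃ u, dist z u = r := by
  have hcont : Continuous fun u => dist z u := continuous_const.dist continuous_id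
  exact mem_range_of_exists_le_of_exists_ge hcont ⟨z, by simpa using h0⟩ ⟨w, h1⟩

section Dimension

variable {Z : Type} [MetricSpace Z] [MeasurableSpace Z] [BorelSpace Z] {μ : Measure Z}
  {Q C : ℝ} {Ψ : ℝ → ℝ} [PreconnectedSpace Z]

/-- A Loewner space with fine discretisations has dimension two. -/
lemma LoewnerSpace.eq_two (hZ : LoewnerSpace μ Q C Ψ) {K : ℝ} (hK : 1 ≤ K) (D : ℕ) {x y p : Z}
    (hb : Base x y p) {ε₀ : ℝ} (hε₀ : 0 < ε₀)
    (hd : ∀ ε, 0 < ε → ε ≤ ε₀ → Nonempty (Disc Z x y K D ε)) : Q = 2 := by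
  have := hZ.compact
  by_contra hne
  have hQ : 0 < Q - 2 := sub_pos.2 (lt_of_le_of_ne hZ.two_le (Ne.symm hne))
  have hxp := dist_pos.2 hb.xp
  have hyp := dist_pos.2 hb.yp
  have hΔ : 0 < Metric.diam (Set.univ : Set Z) := hxp.trans_le
    (Metric.dist_le_diam_of_mem isCompact_univ.isBounded (Set.mem_univ _) (Set.mem_univ _))
  obtain ⟨r, hr, pole⟩ := hZ.exists_pole hK D hb 1
  obtain ⟨z, hz⟩ := exists_dist_eq_of_le x p (r := min r (dist x p)) (by positivity) (min_le_right _ _)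
  obtain ⟨c, hc, low⟩ := hZ.energy_lower (δ := min (min r (dist x p)) (dist y p)) (by positivity)
  obtain ⟨B, hB, clip⟩ := hZ.exists_clip hK D
  set m := (c / (2 * B)) ^ (Q - 2)⁻¹ with hm
  have hm0 : 0 < m := by positivity
  have hmQ : m ^ (Q - 2) = c / (2 * B) := by
    rw [hm, ← Real.rpow_mul (by positivity), inv_mul_cancel₀ hQ.ne', Real.rpow_one]
  obtain ⟨ε₁, hε₁, mesh⟩ := hZ.exists_mesh hK D hb 1 hm0
  set ε := min (min ε₀ ε₁) (min r (Metric.diam (Set.univ : Set Z))) with hεdef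
  have hε : 0 < ε := by positivity
  have hεr : ε ≤ r := (min_le_right _ _).trans (min_le_left _ _)
  obtain ⟨d⟩ := hd ε hε ((min_le_left _ _).trans (min_le_left _ _))
  obtain ⟨v₀, hp⟩ := d.cover p
  obtain ⟨v, hv⟩ := d.cover z
  have hv1 := (pole ε d hε hεr v₀ hp v z hv).1 (by rw [dist_comm, hz]; exact min_le_left _ _)
  obtain ⟨P, hP, hvP, hxP, hPa⟩ := d.T.exists_conn_le (d.reachable hε) v
  obtain ⟨R, hR, hvR, hyR, hRa⟩ := d.T.exists_conn_ge (d.reachable hε) v₀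
  obtain ⟨ω, g, hg, hadm, hen⟩ := clip x y ε d P R (d.T.a v₀ - 1) (d.T.a v₀) m hε (by linarith)
    (fun w hw => (hPa w hw).trans hv1) hRa hm0.le (fun e => by
      by_cases h1 : d.T.a (d.T.lo e) ≤ d.T.a v₀ + 1 ∧ d.T.a v₀ - 1 ≤ d.T.a (d.T.hi e)
      · exact (d.T.part_le _ _ e).trans (mesh ε d hε ((min_le_left _ _).trans (min_le_right _ _)) v₀
          hp e h1.1 h1.2)
      · have hle := d.T.le e
        refine le_trans (le_of_eq ?_) hm0.le
        unfold Tiling.part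
        rw [sub_eq_zero]
        rcases not_and_or.1 h1 with h | h <;> push Not at h
        · rw [min_eq_left (by linarith), min_eq_left (by linarith)]
        · rw [max_eq_left ((min_le_right _ _).trans h.le),
            max_eq_left ((min_le_right _ _).trans (hle.trans h.le))])
  have h := (low ε _ _ ω g hε ((min_le_right _ _).trans (min_le_right _ _)) (d.isCompact_union P)
    (d.isConnected_union hP ⟨v, hvP⟩) (d.isCompact_union R) (d.isConnected_union hR ⟨v₀, hvR⟩)
    (by
      refine (min_le_left _ _).trans (hz.symm.le.trans ?_)
      exact Metric.dist_le_diam_of_mem (d.isCompact_union P).isBounded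
        (d.mem_union.2 ⟨_, hxP, d.x_mem⟩) (d.mem_union.2 ⟨v, hvP, hv⟩))
    (by
      refine (min_le_right _ _).trans ?_
      exact Metric.dist_le_diam_of_mem (d.isCompact_union R).isBounded
        (d.mem_union.2 ⟨_, hyR, d.y_mem⟩) (d.mem_union.2 ⟨v₀, hvR, hp⟩)) hadm hg).trans hen
  rw [sub_sub_cancel, div_one, div_one, hmQ, ENNReal.ofReal_le_ofReal_iff (by positivity)] at h
  have : B * (c / (2 * B)) = c / 2 := by field_simp
  linarith

end Dimension

section LimitMap

/-- A relation between sequences of points of `Z` and points of the unit sphere which arises as a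
limit of weakly quasisymmetric relations. -/
structure SphereLimit {Z : Type} [MetricSpace Z] (𝒰 : Ultrafilter ℕ)
    (A : (ℕ → Z) → EuclideanSpace ℝ (Fin 3) → Prop) : Prop where
  mem : ∀ z q, A z q → q ∈ Metric.sphere 0 1
  ex : ∀ z, ∃ q, A z q
  wqs : ∀ t : ℝ, 0 < t → ∃ H : ℝ, 1 ≤ H ∧ ∀ z₁ z₂ z₃ q₁ q₂ q₃, A z₁ q₁ → A z₂ q₂ → A z₃ q₃ →
    (∀ᶠ k in 𝒰, z₁ k ≠ z₃ k ∧ dist (z₁ k) (z₂ k) ≤ t * dist (z₁ k) (z₃ k)) →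
    dist q₁ q₂ ≤ H * dist q₁ q₃
  dense : ∀ q ∈ Metric.sphere 0 1, ∀ δ : ℝ, 0 < δ → ∃ z q', A z q' ∧ dist q q' ≤ δ

variable {Z : Type} [MetricSpace Z] [MeasurableSpace Z] [BorelSpace Z] {μ : Measure Z}
  {Q C : ℝ} {Ψ : ℝ → ℝ} [PreconnectedSpace Z]

open Filter Topology in
lemma LoewnerSpace.exists_sphereLimit (hZ : LoewnerSpace μ Q C Ψ) {K : ℝ} (hK : 1 ≤ K) (D : ℕ)
    {x y p : Z} (hb : Base x y p) {ε₀ : ℝ} (hε₀ : 0 < ε₀)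
    (hd : ∀ ε, 0 < ε → ε ≤ ε₀ → Nonempty (Disc Z x y K D ε)) :
    ∃ (𝒰 : Ultrafilter ℕ) (A : (ℕ → Z) → EuclideanSpace ℝ (Fin 3) → Prop), SphereLimit 𝒰 A := by
  let ε : ℕ → ℝ := fun k => ε₀ / (k + 1)
  have hε : ∀ k, 0 < ε k := fun k => by positivity
  have hεle : ∀ k, ε k ≤ ε₀ := fun k => div_le_self hε₀.le (by linarith [k.cast_nonneg (α := ℝ)])
  have hε1 : ∀ ε₁ : ℝ, 0 < ε₁ → ∀ᶠ k in (hyperfilter ℕ : Filter ℕ), ε k ≤ ε₁ := by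
    intro ε₁ hε₁
    have h : Tendsto ε atTop (𝓝 0) := by
      have := (tendsto_one_div_add_atTop_nhds_zero_nat (𝕜 := ℝ)).const_mul ε₀
      simpa [ε, div_eq_mul_inv] using this
    exact (h.mono_left Nat.hyperfilter_le_atTop).eventually_le_const hε₁
  let d := fun k => (hd (ε k) (hε k) (hεle k)).some
  choose v₀ hp using fun k => (d k).cover p
  refine ⟨hyperfilter ℕ, fun z q => ∃ q' : ℕ → EuclideanSpace ℝ (Fin 3),
    (∀ᶠ k in (hyperfilter ℕ : Filter ℕ), (d k).Mark (v₀ k) (z k) (q' k)) ∧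
      Tendsto q' (hyperfilter ℕ) (𝓝 q), ?_⟩
  have comp : ∀ q' : ℕ → EuclideanSpace ℝ (Fin 3),
      (∀ᶠ k in (hyperfilter ℕ : Filter ℕ), q' k ∈ Metric.sphere 0 1) →
      ∃ q, Tendsto q' (hyperfilter ℕ) (𝓝 q) := by
    intro q' h
    obtain ⟨q, -, hq⟩ := (isCompact_sphere (0 : EuclideanSpace ℝ (Fin 3)) 1).ultrafilter_le_nhds
      ((hyperfilter ℕ).map q') (le_principal_iff.2 h)
    exact ⟨q, hq⟩
  constructor
  · rintro z q ⟨q', h, hq⟩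
    exact Metric.isClosed_sphere.mem_of_tendsto hq (h.mono fun k hk => hk.mem)
  · intro z
    choose q' hq' using fun k => (d k).exists_mark (v₀ k) (z k)
    obtain ⟨q, hq⟩ := comp q' (.of_forall fun k => (hq' k).mem)
    exact ⟨q, q', .of_forall hq', hq⟩
  · intro t ht
    obtain ⟨H, hH, key⟩ := hZ.exists_wqs hK D hb ht
    refine ⟨H, hH, ?_⟩
    rintro z₁ z₂ z₃ q₁ q₂ q₃ ⟨q₁', m1, h1⟩ ⟨q₂', m2, h2⟩ ⟨q₃', m3, h3⟩ hev
    rcases (dist_nonneg (x := q₁) (y := q₂)).eq_or_lt with h0 | h0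
    · rw [← h0]
      positivity
    obtain ⟨ε₁, hε₁, key⟩ := key (dist q₁ q₂ / 2) (half_pos h0)
    have h12 := h1.dist h2
    refine le_of_tendsto_of_tendsto h12 ((h1.dist h3).const_mul H) ?_
    filter_upwards [m1, m2, m3, hev, hε1 ε₁ hε₁, h12.eventually_const_le (half_lt_self h0)]
      with k a1 a2 a3 a4 a5 a6
    exact key _ (d k) (hε k) a5 _ (hp k) _ _ _ _ _ _ a1 a2 a3 a4.1 a4.2 a6
  · intro q hq δ hδ
    obtain ⟨ε₁, hε₁, key⟩ := hZ.exists_mark_near hK D hb hq hδ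
    have : ∀ k, ∃ (z : Z) (q' : EuclideanSpace ℝ (Fin 3)), ε k ≤ ε₁ →
        (d k).Mark (v₀ k) z q' ∧ dist q q' ≤ δ := by
      intro k
      by_cases h : ε k ≤ ε₁
      · obtain ⟨z, q', h'⟩ := key _ (d k) (hε k) h _ (hp k)
        exact ⟨z, q', fun _ => h'⟩
      · exact ⟨x, 0, fun h' => absurd h' h⟩
    choose z q' hzq using this
    have hev := (hε1 ε₁ hε₁).mono hzq
    obtain ⟨q₀, hq₀⟩ := comp q' (hev.mono fun k hk => hk.1.mem)
    exact ⟨z, q₀, ⟨q', hev.mono fun k hk => hk.1, hq₀⟩,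
      le_of_tendsto (tendsto_const_nhds.dist hq₀) (hev.mono fun k hk => hk.2)⟩

end LimitMap

namespace SphereLimit

variable {Z : Type} [MetricSpace Z] [PreconnectedSpace Z] {𝒰 : Ultrafilter ℕ}
  {A : (ℕ → Z) → EuclideanSpace ℝ (Fin 3) → Prop}

/-- Points relatively close in the space are relatively close on the sphere. -/
lemma exists_pow (hA : SphereLimit 𝒰 A) {δ : ℝ} (hδ : 0 < δ) :
    ∃ m : ℕ, ∀ (z₁ z₃ : Z) (z₂ : ℕ → Z) (q₁ q₂ q₃ : EuclideanSpace ℝ (Fin 3)),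
      A (fun _ => z₁) q₁ → A z₂ q₂ → A (fun _ => z₃) q₃ → z₁ ≠ z₃ →
      (∀ᶠ k in 𝒰, dist z₁ (z₂ k) ≤ (1 / 3) ^ m * dist z₁ z₃) → dist q₁ q₂ ≤ δ * dist q₁ q₃ := by
  obtain ⟨H, hH, wqs⟩ := hA.wqs 1 one_pos
  simp only [one_mul] at wqs
  obtain ⟨T, hT, hcov⟩ := Metric.totallyBounded_iff.1
    (isCompact_closedBall (0 : EuclideanSpace ℝ (Fin 3)) H).totallyBounded (δ / (2 * H ^ 2))
    (by positivity)
  refine ⟨hT.toFinset.card + 1, ?_⟩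
  set m := hT.toFinset.card + 1 with hm
  intro z₁ z₃ z₂ q₁ q₂ q₃ h1 h2 h3 hne hev
  by_contra! hcon
  have hd := dist_pos.2 hne
  have hpow : ∀ i : ℕ, (1 / 3 : ℝ) ^ i ≤ 1 := fun i => pow_le_one₀ (by norm_num) (by norm_num)
  have hρ : 0 < dist q₁ q₃ := by
    refine dist_nonneg.lt_of_ne fun h0 => ?_
    have := wqs _ _ _ _ _ _ h1 h2 h3 (hev.mono fun k hk =>
      ⟨hne, hk.trans (mul_le_of_le_one_left hd.le (hpow m))⟩)
    rw [← h0] at this hcon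
    linarith
  choose w hw using fun i : ℕ => exists_dist_eq_of_le z₁ z₃ (r := (1 / 3) ^ i * dist z₁ z₃)
    (by positivity) (mul_le_of_le_one_left hd.le (hpow i))
  choose q hq using fun i => hA.ex fun _ => w i
  have f1 : ∀ i, dist q₁ (q i) ≤ H * dist q₁ q₃ := fun i =>
    wqs _ _ _ _ _ _ h1 (hq i) h3 (.of_forall fun k =>
      ⟨hne, (hw i).le.trans (mul_le_of_le_one_left hd.le (hpow i))⟩)
  have f2 : ∀ j < m, dist q₁ q₂ ≤ H * dist q₁ (q j) := fun j hj =>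
    wqs _ _ _ _ _ _ h1 h2 (hq j) (hev.mono fun k hk => by
      refine ⟨dist_pos.1 (by rw [hw]; positivity), hk.trans ?_⟩
      rw [hw]
      exact mul_le_mul_of_nonneg_right
        (pow_le_pow_of_le_one (by norm_num) (by norm_num) hj.le) hd.le)
  have f3 : ∀ i j, i < j → dist (q j) q₁ ≤ H * dist (q j) (q i) := by
    intro i j hij
    have h5 : (1 / 3 : ℝ) ^ j ≤ (1 / 3) ^ i * (1 / 3) := by
      rw [← pow_succ]
      exact pow_le_pow_of_le_one (by norm_num) (by norm_num) hij
    have h6 : (1 / 3 : ℝ) ^ j * dist z₁ z₃ ≤ (1 / 3) ^ i * (1 / 3) * dist z₁ z₃ := by gcongr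
    have h7 := dist_triangle_right z₁ (w i) (w j)
    have h8 : 0 < (1 / 3 : ℝ) ^ j * dist z₁ z₃ := by positivity
    rw [dist_comm (w i) (w j), hw, hw] at h7
    have h9 : dist z₁ (w j) ≤ dist (w j) (w i) := by rw [hw]; linarith
    refine wqs _ _ _ _ _ _ (hq j) h1 (hq i) (.of_forall fun k => ⟨dist_pos.1 ?_, ?_⟩)
    · rw [hw] at h9
      exact h8.trans_le h9
    · rwa [dist_comm (w j) z₁]
  have hc : ∀ i, ∃ c ∈ hT.toFinset, dist ((dist q₁ q₃)⁻¹ • (q i - q₁)) c < δ / (2 * H ^ 2) := by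
    intro i
    have hmem : (dist q₁ q₃)⁻¹ • (q i - q₁) ∈ Metric.closedBall 0 H := by
      rw [mem_closedBall_zero_iff, norm_smul, norm_inv, Real.norm_of_nonneg hρ.le,
        ← dist_eq_norm, dist_comm (q i) q₁, inv_mul_le_iff₀ hρ, mul_comm]
      exact f1 i
    obtain ⟨c, hc, hc'⟩ := Set.mem_iUnion₂.1 (hcov hmem)
    exact ⟨c, hT.mem_toFinset.2 hc, hc'⟩
  choose c hcT hc using hc
  obtain ⟨i, hi, j, hj, hij, hcij⟩ := Finset.exists_ne_map_eq_of_card_lt_of_maps_to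
    (s := Finset.range m) (t := hT.toFinset) (f := c) (by simp [hm]) (fun i _ => hcT i)
  have key : ∀ i j, i < j → j < m → c i = c j → False := by
    intro i j hij hj hcij
    have h4 := dist_triangle_right ((dist q₁ q₃)⁻¹ • (q j - q₁)) ((dist q₁ q₃)⁻¹ • (q i - q₁)) (c j)
    have h5 := hc i
    rw [hcij] at h5
    have h6 : (dist q₁ q₃)⁻¹ * dist (q j) (q i) < δ / H ^ 2 := by
      rw [dist_smul₀, norm_inv, Real.norm_of_nonneg hρ.le, dist_sub_right] at h4
      have : δ / (2 * H ^ 2) = δ / H ^ 2 / 2 := by rw [div_div, mul_comm 2]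
      linarith [hc j]
    rw [inv_mul_lt_iff₀ hρ] at h6
    have h7 := f2 j hj
    have h8 := f3 i j hij
    rw [dist_comm (q j) q₁] at h8
    have h9 : dist q₁ q₂ ≤ H ^ 2 * dist (q j) (q i) := by nlinarith
    have h10 : H ^ 2 * dist (q j) (q i) < H ^ 2 * (dist q₁ q₃ * (δ / H ^ 2)) := by gcongr
    have h11 : H ^ 2 * (dist q₁ q₃ * (δ / H ^ 2)) = δ * dist q₁ q₃ := by field_simp
    linarith
  rcases lt_or_gt_of_ne hij with h | h
  · exact key i j h (Finset.mem_range.1 hj) hcij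
  · exact key j i h (Finset.mem_range.1 hi) hcij.symm

open Filter Topology in
/-- A sphere limit is a quasisymmetric homeomorphism, in terms of the moduli for bounded and for
small ratios. -/
lemma exists_homeo [CompactSpace Z] [Nontrivial Z] (hA : SphereLimit 𝒰 A) :
    ∃ f : Z ≃ₜ ↥(Metric.sphere (0 : EuclideanSpace ℝ (Fin 3)) 1),
      (∀ t : ℝ, 0 < t → ∃ H : ℝ, ∀ z₁ z₂ z₃, z₁ ≠ z₃ → dist z₁ z₂ ≤ t * dist z₁ z₃ →
        dist (f z₁) (f z₂) ≤ H * dist (f z₁) (f z₃)) ∧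
      ∀ δ : ℝ, 0 < δ → ∃ t : ℝ, 0 < t ∧ ∀ z₁ z₂ z₃, z₁ ≠ z₃ → dist z₁ z₂ ≤ t * dist z₁ z₃ →
        dist (f z₁) (f z₂) ≤ δ * dist (f z₁) (f z₃) := by
  choose g hg using fun z : Z => hA.ex fun _ => z
  have hsmall : ∀ δ : ℝ, 0 < δ → ∃ t : ℝ, 0 < t ∧ ∀ z₁ z₂ z₃, z₁ ≠ z₃ →
      dist z₁ z₂ ≤ t * dist z₁ z₃ → dist (g z₁) (g z₂) ≤ δ * dist (g z₁) (g z₃) := by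
    intro δ hδ
    obtain ⟨m, hm⟩ := hA.exists_pow hδ
    exact ⟨(1 / 3) ^ m, by positivity, fun z₁ z₂ z₃ hne h =>
      hm _ _ _ _ _ _ (hg z₁) (hg z₂) (hg z₃) hne (.of_forall fun _ => h)⟩
  have hbig : ∀ t : ℝ, 0 < t → ∃ H : ℝ, ∀ z₁ z₂ z₃, z₁ ≠ z₃ → dist z₁ z₂ ≤ t * dist z₁ z₃ →
      dist (g z₁) (g z₂) ≤ H * dist (g z₁) (g z₃) := by
    intro t ht
    obtain ⟨H, -, h⟩ := hA.wqs t ht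
    exact ⟨H, fun z₁ z₂ z₃ hne hd =>
      h _ _ _ _ _ _ (hg z₁) (hg z₂) (hg z₃) (.of_forall fun _ => ⟨hne, hd⟩)⟩
  have hlim : ∀ (z : ℕ → Z) (w : Z) (q : EuclideanSpace ℝ (Fin 3)), A z q → Tendsto z 𝒰 (𝓝 w) →
      q = g w := by
    intro z w q hz hw
    obtain ⟨w', hne⟩ := exists_ne w
    refine (dist_le_zero.1 (le_of_forall_pos_le_add fun δ hδ => ?_)).symm
    obtain ⟨m, hm⟩ := hA.exists_pow (half_pos hδ)
    have h1 := hm w w' z _ q _ (hg w) hz (hg w') hne.symm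
      (((tendsto_const_nhds (x := w)).dist hw).eventually_le_const (by
        rw [dist_self]
        have := dist_pos.2 hne.symm
        positivity))
    have h2 := dist_le_two (hA.mem _ _ (hg w)) (hA.mem _ _ (hg w'))
    nlinarith
  have hcont : Continuous g := by
    rw [Metric.continuous_iff]
    intro w δ hδ
    obtain ⟨w', hne⟩ := exists_ne w
    obtain ⟨t, ht, h⟩ := hsmall (δ / 3) (by positivity)
    refine ⟨t * dist w w', mul_pos ht (dist_pos.2 hne.symm), fun a ha => ?_⟩
    rw [dist_comm] at ha ⊢
    have h1 := h w a w' hne.symm ha.le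
    have h2 := dist_le_two (hA.mem _ _ (hg w)) (hA.mem _ _ (hg w'))
    nlinarith
  have hsurj : ∀ q ∈ Metric.sphere (0 : EuclideanSpace ℝ (Fin 3)) 1, ∃ z, g z = q := by
    intro q hq
    have hcl : IsClosed (Set.range g) := (isCompact_range hcont).isClosed
    rw [← Set.mem_range, ← hcl.closure_eq, Metric.mem_closure_iff]
    intro δ hδ
    obtain ⟨z, q', hz, hqq⟩ := hA.dense q hq (δ / 2) (half_pos hδ)
    obtain ⟨w, -, hw⟩ := isCompact_univ.ultrafilter_le_nhds (𝒰.map z)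
      (Filter.le_principal_iff.2 Filter.univ_mem)
    refine ⟨q', ⟨w, (hlim z w q' hz hw).symm⟩, by linarith⟩
  have hinj : Function.Injective g := by
    intro a b hab
    by_contra hne
    have hconst : ∀ z, g z = g a := by
      intro z
      have hd := dist_pos.2 hne
      obtain ⟨H, h⟩ := hbig (dist a z / dist a b + 1) (by positivity)
      have h1 := h a z b hne (by rw [add_mul, div_mul_cancel₀ _ hd.ne']; linarith)
      rw [hab, dist_self, mul_zero, dist_le_zero] at h1
      rw [← h1, hab]
    obtain ⟨z, hz⟩ := hsurj _ sphN_mem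
    obtain ⟨z', hz'⟩ := hsurj _ sphS_mem
    have h := hz.symm.trans ((hconst z).trans ((hconst z').symm.trans hz'))
    have h2 := congrArg (fun v : EuclideanSpace ℝ (Fin 3) => v 2) h
    simp only [sphN, sphS] at h2
    change (1 : ℝ) = -1 at h2
    norm_num at h2
  let F : Z → ↥(Metric.sphere (0 : EuclideanSpace ℝ (Fin 3)) 1) := fun z => ⟨g z, hA.mem _ _ (hg z)⟩
  have hF : Function.Bijective F := by
    refine ⟨fun a b h => hinj (congrArg Subtype.val h), ?_⟩
    rintro ⟨q, hq⟩
    obtain ⟨z, rfl⟩ := hsurj q hq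
    exact ⟨z, rfl⟩
  exact ⟨(hcont.subtype_mk _ : Continuous F).homeoOfEquivCompactToT2 (f := Equiv.ofBijective F hF),
    hbig, hsmall⟩

end SphereLimit

open Filter Topology in
/-- A monotone function vanishing at the origin is dominated by a control function. -/
lemma exists_controlFunction_ge {G : ℝ → ℝ} (hG : Monotone G) (h0 : ∀ t, 0 ≤ G t)
    (hs : ∀ δ : ℝ, 0 < δ → ∃ t : ℝ, 0 < t ∧ G t ≤ δ) :
    ∃ η, ControlFunction η ∧ ∀ t, 0 ≤ t → G t ≤ η t := by
  have hG0 : G 0 = 0 := by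
    refine le_antisymm (le_of_forall_pos_le_add fun δ hδ => ?_) (h0 0)
    obtain ⟨t, ht, h⟩ := hs δ hδ
    simpa using (hG ht.le).trans h
  have hint : ∀ t : ℝ, 0 ≤ t → IntervalIntegrable (fun s => G (t * s)) volume 1 2 := fun t ht =>
    Monotone.intervalIntegrable fun a b hab => hG (mul_le_mul_of_nonneg_left hab ht)
  set η : ℝ → ℝ := fun t => t + ∫ s in (1 : ℝ)..2, G (t * s) with hη
  have hlow : ∀ t, 0 ≤ t → G t ≤ ∫ s in (1 : ℝ)..2, G (t * s) := by
    intro t ht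
    have h := intervalIntegral.integral_mono_on (μ := volume) (a := 1) (b := 2) (f := fun _ => G t)
      (g := fun s => G (t * s)) (by norm_num) (by simp) (hint t ht)
      (fun s hs => hG (le_mul_of_one_le_right ht hs.1))
    norm_num at h
    exact h
  have hup : ∀ t, 0 ≤ t → ∫ s in (1 : ℝ)..2, G (t * s) ≤ G (t * 2) := by
    intro t ht
    have h := intervalIntegral.integral_mono_on (μ := volume) (a := 1) (b := 2)
      (f := fun s => G (t * s)) (g := fun _ => G (t * 2)) (by norm_num) (hint t ht) (by simp)
      (fun s hs => hG (mul_le_mul_of_nonneg_left hs.2 ht))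
    norm_num at h
    exact h
  have hη0 : η 0 = 0 := by simp [hη, hG0]
  have hcont : ContinuousOn η (Set.Ici 0) := by
    intro t ht
    rcases (Set.mem_Ici.1 ht).eq_or_lt with rfl | hpos
    · rw [Metric.continuousWithinAt_iff]
      intro δ hδ
      obtain ⟨t, ht, h⟩ := hs (δ / 2) (half_pos hδ)
      refine ⟨min (δ / 2) (t / 2), by positivity, fun a ha hda => ?_⟩
      have ha : 0 ≤ a := ha
      rw [Real.dist_0_eq_abs, abs_of_nonneg ha, lt_min_iff] at hda
      have h1 := hup a ha
      have h2 : G (a * 2) ≤ G t := hG (by linarith)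
      have h3 := (h0 a).trans (hlow a ha)
      rw [hη0, Real.dist_0_eq_abs, abs_of_nonneg (by simp only [hη]; linarith)]
      simp only [hη]
      linarith
    · refine ContinuousAt.continuousWithinAt ?_
      have hF : Continuous fun b => ∫ x in (0 : ℝ)..b, G x :=
        intervalIntegral.continuous_primitive (fun a b => hG.intervalIntegrable) 0
      have hc : ContinuousAt (fun t : ℝ => t + t⁻¹ * ((∫ x in (0 : ℝ)..t * 2, G x) -
          ∫ x in (0 : ℝ)..t * 1, G x)) t := by
        refine continuousAt_id.add ((continuousAt_inv₀ hpos.ne').mul (Continuous.continuousAt ?_))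
        exact (hF.comp (by fun_prop : Continuous fun t : ℝ => t * 2)).sub
          (hF.comp (by fun_prop : Continuous fun t : ℝ => t * 1))
      refine hc.congr ?_
      filter_upwards [lt_mem_nhds hpos] with a ha
      simp only [hη]
      rw [intervalIntegral.integral_comp_mul_left _ ha.ne', smul_eq_mul,
        intervalIntegral.integral_interval_sub_left hG.intervalIntegrable hG.intervalIntegrable]
  have hge : ∀ t, 0 ≤ t → t ≤ η t := fun t ht =>
    le_add_of_nonneg_right ((h0 t).trans (hlow t ht))
  refine ⟨η, ⟨hη0, fun a ha b hb hab => ?_, hcont, fun y hy => ?_⟩, fun t ht =>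
    (hlow t ht).trans (le_add_of_nonneg_left ht)⟩
  · exact add_lt_add_of_lt_of_le hab (intervalIntegral.integral_mono_on (by norm_num) (hint a ha)
      (hint b hb) fun s hs => hG (mul_le_mul_of_nonneg_right hab.le (by linarith [hs.1])))
  · have hy : 0 ≤ y := hy
    obtain ⟨t, ht, h⟩ := intermediate_value_Icc hy (hcont.mono Set.Icc_subset_Ici_self)
      ⟨by rwa [hη0], hge y hy⟩
    exact ⟨t, ht.1, h⟩

/-- A homeomorphism with moduli for bounded and for small ratios is quasisymmetric. -/
lemma exists_isQuasisymmetricWith {X Y : Type*} [MetricSpace X] [MetricSpace Y] {f : X → Y}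
    (hf : Function.Injective f)
    (hbig : ∀ t : ℝ, 0 < t → ∃ H : ℝ, ∀ z₁ z₂ z₃, z₁ ≠ z₃ → dist z₁ z₂ ≤ t * dist z₁ z₃ →
      dist (f z₁) (f z₂) ≤ H * dist (f z₁) (f z₃))
    (hsmall : ∀ δ : ℝ, 0 < δ → ∃ t : ℝ, 0 < t ∧ ∀ z₁ z₂ z₃, z₁ ≠ z₃ →
      dist z₁ z₂ ≤ t * dist z₁ z₃ → dist (f z₁) (f z₂) ≤ δ * dist (f z₁) (f z₃)) :
    ∃ η, ControlFunction η ∧ IsQuasisymmetricWith η f := by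
  let S : ℝ → Set ℝ := fun t => insert 0 {r | ∃ z₁ z₂ z₃, z₁ ≠ z₃ ∧ dist z₁ z₂ ≤ t * dist z₁ z₃ ∧
    dist (f z₁) (f z₂) / dist (f z₁) (f z₃) = r}
  have hmono : ∀ s t, s ≤ t → S s ⊆ S t := fun s t hst => Set.insert_subset_insert
    fun r ⟨z₁, z₂, z₃, hne, hd, hr⟩ =>
      ⟨z₁, z₂, z₃, hne, hd.trans (mul_le_mul_of_nonneg_right hst dist_nonneg), hr⟩
  have hle : ∀ t H : ℝ, 0 ≤ H → (∀ z₁ z₂ z₃, z₁ ≠ z₃ → dist z₁ z₂ ≤ t * dist z₁ z₃ →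
      dist (f z₁) (f z₂) ≤ H * dist (f z₁) (f z₃)) → ∀ r ∈ S t, r ≤ H := by
    rintro t H hH h r (rfl | ⟨z₁, z₂, z₃, hne, hd, rfl⟩)
    · exact hH
    · exact (div_le_iff₀ (dist_pos.2 (hf.ne hne))).2 (h _ _ _ hne hd)
  have hbdd : ∀ t, BddAbove (S t) := by
    intro t
    obtain ⟨H, hH⟩ := hbig (max t 1) (by positivity)
    refine ⟨max H 0, fun r hr => hle (max t 1) _ (le_max_right _ _) (fun z₁ z₂ z₃ hne hd =>
      (hH _ _ _ hne hd).trans (mul_le_mul_of_nonneg_right (le_max_left _ _) dist_nonneg)) r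
      (hmono _ _ (le_max_left _ _) hr)⟩
  have hne : ∀ t, (S t).Nonempty := fun t => ⟨0, Or.inl rfl⟩
  obtain ⟨η, hη, hGη⟩ := exists_controlFunction_ge (G := fun t => sSup (S t))
    (fun s t hst => csSup_le_csSup (hbdd t) (hne s) (hmono s t hst))
    (fun t => le_csSup (hbdd t) (Or.inl rfl))
    (fun δ hδ => by
      obtain ⟨t, ht, h⟩ := hsmall δ hδ
      exact ⟨t, ht, csSup_le (hne t) (hle t δ hδ.le h)⟩)
  refine ⟨η, hη, hf, fun x₁ x₂ x₃ _ h13 _ => (le_csSup (hbdd _) (Or.inr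
    ⟨x₁, x₂, x₃, h13, ?_, rfl⟩)).trans (hGη _ (by positivity))⟩
  rw [div_mul_cancel₀ _ (dist_pos.2 h13).ne']

/-- A compact Ahlfors regular space carrying a Loewner function is a Loewner space. -/
lemma AhlforsRegular.exists_loewnerSpace {Z : Type*} [MetricSpace Z] [MeasurableSpace Z]
    [BorelSpace Z] [CompactSpace Z] [Nontrivial Z] {μ : Measure Z} {Q C : ℝ} {Ψ : ℝ → ℝ}
    (hreg : AhlforsRegular μ Q C) (hQ : 2 ≤ Q) (hC : 1 ≤ C) (hΨpos : ∀ t > (0 : ℝ), 0 < Ψ t)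
    (hΨdec : AntitoneOn Ψ (Set.Ioi 0)) (hLoew : IsLoewnerWith μ Q Ψ) :
    ∃ C', LoewnerSpace μ Q C' Ψ := by
  set Δ := Metric.diam (Set.univ : Set Z) with hΔdef
  have hΔ : 0 < Δ := by
    obtain ⟨a, b, hab⟩ := exists_pair_ne Z
    exact (dist_pos.2 hab).trans_le (Metric.dist_le_diam_of_mem isCompact_univ.isBounded
      (Set.mem_univ _) (Set.mem_univ _))
  have hfin : μ Set.univ < ⊤ := isCompact_univ.measure_lt_top_of_nhdsWithin fun a _ =>
    ⟨Metric.ball a Δ, mem_nhdsWithin_of_mem_nhds (Metric.ball_mem_nhds a hΔ),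
      (hreg a Δ hΔ le_rfl).2.trans_lt ENNReal.ofReal_lt_top⟩
  refine ⟨max C ((μ Set.univ).toReal / Δ ^ Q), hQ, hC.trans (le_max_left _ _), inferInstance,
    fun a R hR => ?_, fun a R hR hRΔ => ?_, hΨpos, hΨdec, hLoew⟩
  · rcases le_total R Δ with h | h
    · refine (hreg a R hR h).2.trans (ENNReal.ofReal_le_ofReal ?_)
      gcongr
      exact le_max_left _ _
    · refine ((measure_mono (Set.subset_univ _)).trans
        (ENNReal.ofReal_toReal hfin.ne).ge).trans (ENNReal.ofReal_le_ofReal ?_)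
      calc (μ Set.univ).toReal = (μ Set.univ).toReal / Δ ^ Q * Δ ^ Q := by field_simp
        _ ≤ max C ((μ Set.univ).toReal / Δ ^ Q) * R ^ Q := by
          gcongr
          exact le_max_right _ _
  · refine (ENNReal.ofReal_le_ofReal ?_).trans (hreg a R hR hRΔ).1
    gcongr
    exact le_max_left _ _

/-- Bonk–Kleiner Theorem 1.2: if `Z` is an Ahlfors `Q`-regular metric sphere
(`Q ≥ 2`, with `Q`-dimensional Hausdorff measure) which is `Q`-Loewner, then `Q = 2`
and `Z` is quasisymmetrically homeomorphic to the standard 2-sphere `S²`. -/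
theorem stmt_18 (Q : ℝ) (hQ : 2 ≤ Q)
    (Z : Type) [MetricSpace Z] [MeasurableSpace Z] [BorelSpace Z]
    (hhomeo : Nonempty (Z ≃ₜ ↥(Metric.sphere (0 : EuclideanSpace ℝ (Fin 3)) 1)))
    (C : ℝ) (hC : 1 ≤ C)
    (hreg : AhlforsRegular (MeasureTheory.Measure.hausdorffMeasure Q : Measure Z) Q C)
    (Ψ : ℝ → ℝ) (hΨpos : ∀ t > (0:ℝ), 0 < Ψ t) (hΨdec : AntitoneOn Ψ (Set.Ioi 0))
    (hLoew : IsLoewnerWith (MeasureTheory.Measure.hausdorffMeasure Q : Measure Z) Q Ψ) :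
    Q = 2 ∧
      ∃ (f : Z ≃ₜ ↥(Metric.sphere (0 : EuclideanSpace ℝ (Fin 3)) 1)) (η : ℝ → ℝ),
        ControlFunction η ∧ IsQuasisymmetricWith η ⇑f := by
  obtain ⟨e⟩ := hhomeo
  obtain ⟨x', y', q', hq'⟩ := exists_sphere_polarParam
  have hq := hq'.comp_homeo e.symm
  have := e.symm.compactSpace
  have : Nontrivial Z := ⟨⟨_, _, hq.ne⟩⟩
  have : PreconnectedSpace Z := by
    have h : IsPreconnected (Metric.sphere (0 : EuclideanSpace ℝ (Fin 3)) 1) :=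
      isPreconnected_sphere (by simp [← Module.finrank_eq_rank]) 0 1
    have := Subtype.preconnectedSpace h
    exact e.symm.surjective.denseRange.preconnectedSpace e.symm.continuous
  obtain ⟨C', hZ⟩ := hreg.exists_loewnerSpace hQ hC hΨpos hΨdec hLoew
  obtain ⟨K, D, ε₀, hK, hε₀, hd⟩ := hZ.exists_disc hq
  have hxy := dist_pos.2 hq.ne
  obtain ⟨p, hp⟩ := exists_dist_eq_of_le (e.symm x') (e.symm y')
    (r := dist (e.symm x') (e.symm y') / 2) (by positivity) (by linarith)
  have hb : Base (e.symm x') (e.symm y') p := by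
    refine ⟨hq.ne, dist_pos.1 (by rw [hp]; positivity), ?_⟩
    rintro rfl
    linarith
  obtain ⟨𝒰, A, hA⟩ := hZ.exists_sphereLimit hK D hb hε₀ hd
  obtain ⟨f, hbig, hsmall⟩ := hA.exists_homeo
  obtain ⟨η, hη, hf⟩ := exists_isQuasisymmetricWith f.injective hbig hsmall
  exact ⟨hZ.eq_two hK D hb hε₀ hd, f, η, hη, hf⟩
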